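/- Let d ≥ 2 and assume the probability measure P on Ω = {0,1}^{Z^d} satisfies assumptions A1–A5. Then for all T > 0 and for P_0-almost every ω (where P_0 = P[·|0 ∈ S_∞]), the law on C[0,T] of the rescaled linear interpolation (B̃_n(t))_{0≤t≤T} of the lazy simple random walk on S started at 0 converges weakly, as n → ∞, to the law of a Brownian motion with zero drift and non-degenerate covariance matrix. In addition, if reflections and rotations of Z^d by π/2 preserve P, then the limiting Brownian motion is isotropic with positive diffusion constant. -/

import Mathlib

open MeasureTheory Filter
open scoped ENNReal

namespace Perco

/-- A point of the lattice `ℤ^d`. -/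
abbrev Pt (d : ℕ) := Fin d → ℤ

/-- A percolation configuration on `ℤ^d`. -/
abbrev Config (d : ℕ) := Pt d → Bool

variable {d : ℕ}

/-- The `ℓ¹`-distance on `ℤ^d`. -/
def dist1 (x y : Pt d) : ℕ := ∑ i, (x i - y i).natAbs

/-- The `ℓ^∞`-distance on `ℤ^d`. -/
def distInf (x y : Pt d) : ℕ := Finset.univ.sup fun i => (x i - y i).natAbs

/-- The closed `ℓ^∞`-ball of radius `R` around `x`. -/
def ballZ (x : Pt d) (R : ℕ) : Set (Pt d) := {y | distInf x y ≤ R}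

/-- Nearest-neighbour adjacency in `ℤ^d`. -/
def adj (x y : Pt d) : Prop := dist1 x y = 1

/-- The occupied set of a configuration. -/
def SS (ω : Config d) : Set (Pt d) := {x | ω x = true}

/-- One step of a nearest-neighbour path staying inside `T`. -/
def stepRel (T : Set (Pt d)) (x y : Pt d) : Prop := adj x y ∧ x ∈ T ∧ y ∈ T

/-- `x` and `y` are connected by a nearest-neighbour path inside `T`. -/
def connIn (T : Set (Pt d)) (x y : Pt d) : Prop :=
  x ∈ T ∧ y ∈ T ∧ Relation.ReflTransGen (stepRel T) x y

/-- The connected component (cluster) of `x` in `T`. -/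
def cluster (T : Set (Pt d)) (x : Pt d) : Set (Pt d) := {y | connIn T x y}

/-- `S_r`: vertices of `S(ω)` in connected components of `ℓ¹`-diameter at least `r`. -/
def Sr (ω : Config d) (r : ℝ) : Set (Pt d) :=
  {x | x ∈ SS ω ∧ ∃ y ∈ cluster (SS ω) x, ∃ z ∈ cluster (SS ω) x, r ≤ (dist1 y z : ℝ)}

/-- `S_∞`: vertices of `S(ω)` in infinite connected components. -/
def Sinf (ω : Config d) : Set (Pt d) := {x | x ∈ SS ω ∧ (cluster (SS ω) x).Infinite}

/-- The shift of a configuration by `x`. -/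
def shift (x : Pt d) (ω : Config d) : Config d := fun y => ω (x + y)

/-- An increasing event. -/
def IncreasingEvent (G : Set (Config d)) : Prop :=
  ∀ ω ω' : Config d, (∀ x, ω x = true → ω' x = true) → ω ∈ G → ω' ∈ G

/-- A decreasing event. -/
def DecreasingEvent (G : Set (Config d)) : Prop :=
  ∀ ω ω' : Config d, (∀ x, ω' x = true → ω x = true) → ω ∈ G → ω' ∈ G

/-- The event `G` depends only on the coordinates in `B`. -/
def DependsOn (G : Set (Config d)) (B : Set (Pt d)) : Prop :=
  ∀ ω ω' : Config d, (∀ x ∈ B, ω x = ω' x) → (ω ∈ G ↔ ω' ∈ G)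

/-- The edge boundary of `A` in `Sset`: (directed representatives of) edges of `ℤ^d`
with one endpoint in `A` and the other in `Sset \ A`. -/
def edgeBd (Sset A : Set (Pt d)) : Set (Pt d × Pt d) :=
  {p | adj p.1 p.2 ∧ p.1 ∈ A ∧ p.2 ∈ Sset \ A}

/-- The density `η(u) = P[0 ∈ S_∞]` of the infinite cluster. -/
noncomputable def eta (d : ℕ) (P : Measure (Config d)) : ℝ :=
  (P {ω | (0 : Pt d) ∈ Sinf ω}).toReal

/-- The first local-uniqueness event of axiom S1. -/
def locUniq1 (d : ℕ) (R : ℕ) : Set (Config d) :=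
  {ω | (Sr ω R ∩ ballZ (0 : Pt d) R).Nonempty}

/-- The second local-uniqueness event of axiom S1. -/
def locUniq2 (d : ℕ) (R : ℕ) : Set (Config d) :=
  {ω | ∀ x ∈ Sr ω ((R : ℝ)/10) ∩ ballZ (0 : Pt d) R,
       ∀ y ∈ Sr ω ((R : ℝ)/10) ∩ ballZ (0 : Pt d) R,
       connIn (SS ω ∩ ballZ (0 : Pt d) (2*R)) x y}


/-- The chemical (graph) distance inside `T`, with value `⊤` if there is no path. -/
noncomputable def chemDist (T : Set (Pt d)) (x y : Pt d) : ℕ∞ :=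
  sInf {n : ℕ∞ | ∃ m : ℕ, n = (m : ℕ∞) ∧ ∃ p : ℕ → Pt d, p 0 = x ∧ p m = y ∧
    (∀ k, k ≤ m → p k ∈ T) ∧ ∀ k, k < m → adj (p k) (p (k+1))}

/-- The chemical ball `B_S(x,R)` in the configuration `ω`. -/
noncomputable def chemBall (ω : Config d) (x : Pt d) (R : ℕ) : Set (Pt d) :=
  {y | chemDist (SS ω) x y ≤ (R : ℕ∞)}

/-- The degree of `y` in `S(ω)`. -/
noncomputable def degS (ω : Config d) (y : Pt d) : ℕ := {z | adj y z ∧ z ∈ SS ω}.ncard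

open scoped Classical in
/-- The transition kernel of the lazy simple random walk on `S(ω)`. -/
noncomputable def stepP (d : ℕ) (ω : Config d) (y z : Pt d) : ℝ :=
  if adj y z ∧ z ∈ SS ω then 1/(2*d)
  else if z = y then 1 - (degS ω y : ℝ)/(2*d) else 0

open scoped Classical in
/-- The `n`-step transition probabilities of the lazy simple random walk on `S(ω)`. -/
noncomputable def walkP (d : ℕ) (ω : Config d) : ℕ → Pt d → Pt d → ℝ
  | 0, x, y => if y = x then 1 else 0
  | n+1, x, y => ∑' z : Pt d, walkP d ω n x z * stepP d ω z y

/-! ### Path space, interpolated walk, and Brownian motion law -/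

/-- The path space: functions `[0,T] → ℝ^d` with the topology of uniform convergence
(on `C[0,T]` this is the supremum-norm topology). -/
abbrev PathSp (d : ℕ) (T : ℝ) := UniformFun (Set.Icc (0:ℝ) T) (Fin d → ℝ)

noncomputable instance (d : ℕ) (T : ℝ) : MeasurableSpace (PathSp d T) := borel _

/-- Extension of a finite path `p : Fin (m+1) → ℤ^d` to all times, by stopping at time `m`. -/
def extPath (m : ℕ) (p : Fin (m+1) → Pt d) (k : ℕ) : Pt d :=
  p ⟨min k m, Nat.lt_succ_of_le (min_le_right k m)⟩

/-- The diffusively rescaled linear interpolation `B̃_n` of the path `p`, as an element of the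
path space: `B̃_n(t) = n^{-1/2}(X_{⌊tn⌋} + (tn − ⌊tn⌋)(X_{⌊tn⌋+1} − X_{⌊tn⌋}))`. -/
noncomputable def interpPath (d : ℕ) (T : ℝ) (n m : ℕ) (p : Fin (m+1) → Pt d) :
    PathSp d T :=
  UniformFun.ofFun (fun t => fun i =>
    (Real.sqrt n)⁻¹ *
      ((extPath m p (⌊t.1 * n⌋.toNat) i : ℝ) +
        (t.1 * n - ⌊t.1 * n⌋) *
          ((extPath m p (⌊t.1 * n⌋.toNat + 1) i : ℝ) - (extPath m p (⌊t.1 * n⌋.toNat) i : ℝ))))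

open scoped Classical in
/-- The probability that the lazy simple random walk on `S(ω)` started at `0` follows the finite
path `p`. -/
noncomputable def pathProb (d : ℕ) (ω : Config d) (m : ℕ) (p : Fin (m+1) → Pt d) : ℝ :=
  (if p 0 = (0 : Pt d) then (1:ℝ) else 0) *
    ∏ k : Fin m, stepP d ω (p k.castSucc) (p k.succ)

/-- The expectation of `F(B̃_n)` for the lazy simple random walk on `S(ω)` started at `0`,
where only the first `⌊Tn⌋ + 2` positions of the walk are relevant. -/
noncomputable def walkExpct (d : ℕ) (ω : Config d) (T : ℝ) (n : ℕ)
    (F : PathSp d T → ℝ) : ℝ :=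
  ∑' p : Fin (⌊T * n⌋.toNat + 1 + 1) → Pt d,
    pathProb d ω (⌊T * n⌋.toNat + 1) p * F (interpPath d T n (⌊T * n⌋.toNat + 1) p)

/-- `W` is the law on `C[0,T]` of a `d`-dimensional Brownian motion with zero drift and
covariance matrix `Cov`: it is a probability measure, carried by continuous paths, whose
finite-dimensional distributions have the Gaussian characteristic functions of Brownian
motion. -/
def IsBMLaw (d : ℕ) (T : ℝ) (Cov : Matrix (Fin d) (Fin d) ℝ) (W : Measure (PathSp d T)) :
    Prop :=
  IsProbabilityMeasure W ∧
  (∀ᵐ f ∂W, Continuous (UniformFun.toFun f)) ∧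
  ∀ (n : ℕ) (t : Fin n → Set.Icc (0:ℝ) T) (θ : Fin n → Fin d → ℝ),
    ∫ f, Complex.exp (Complex.I *
        ((∑ k, ∑ i, θ k i * (UniformFun.toFun f (t k) i) : ℝ) : ℂ)) ∂W =
      Complex.exp (-(1/2 : ℂ) *
        ((∑ k, ∑ k', min (t k).1 (t k').1 *
            ∑ i, ∑ i', θ k i * Cov i i' * θ k' i' : ℝ) : ℂ))

/-- The signed permutation of `ℤ^d` given by a permutation `π` of the coordinates and signs
`ε` (these generate the group of reflections and rotations by `π/2` of `ℤ^d`). -/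
def signedPerm (π : Equiv.Perm (Fin d)) (ε : Fin d → Bool) (x : Pt d) : Pt d :=
  fun i => if ε i then -(x (π i)) else x (π i)


/-! ### The walk on a set `V` -/

/-- Directions. -/
abbrev Dir (d : ℕ) := Fin d × Bool

/-- The unit vector of a direction. -/
def vec (e : Dir d) : Pt d := Pi.single e.1 (if e.2 then 1 else -1)

/-- Opposite direction. -/
def opp (e : Dir d) : Dir d := (e.1, !e.2)

lemma opp_opp (e : Dir d) : opp (opp e) = e := by simp [opp]

lemma vec_opp (e : Dir d) : vec (opp e) = - vec e := by
  rcases e with ⟨i, b⟩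
  cases b <;> simp [vec, opp, ← Pi.single_neg]

section av
variable {E : Type*} [AddCommGroup E] [Module ℝ E]

/-- Average over directions. -/
noncomputable def av (g : Dir d → E) : E := ((2 * d : ℝ)⁻¹) • ∑ e, g e

lemma av_add (f g : Dir d → E) : av (fun e => f e + g e) = av f + av g := by
  simp [av, Finset.sum_add_distrib]

lemma av_sub (f g : Dir d → E) : av (fun e => f e - g e) = av f - av g := by
  simp [av, Finset.sum_sub_distrib, smul_sub]

lemma av_smul (c : ℝ) (g : Dir d → E) : av (fun e => c • g e) = c • av g := by
  simp only [av, ← Finset.smul_sum]; rw [smul_comm]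

lemma av_mul (c : ℝ) (g : Dir d → ℝ) : av (fun e => c * g e) = c * av g := av_smul c g

lemma av_zero : av (fun _ : Dir d => (0:E)) = 0 := by simp [av]

lemma av_const [NeZero d] (c : E) : av (fun _ : Dir d => c) = c := by
  have h : (2 * d : ℝ) ≠ 0 := by have := NeZero.ne d; positivity
  simp only [av, Finset.sum_const, Finset.card_univ, Fintype.card_prod, Fintype.card_fin,
    Fintype.card_bool]
  rw [← Nat.cast_smul_eq_nsmul ℝ, smul_smul]
  push_cast
  rw [mul_comm (d:ℝ) 2, inv_mul_cancel₀ h, one_smul]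

lemma av_sum {ι : Type*} (s : Finset ι) (g : ι → Dir d → E) :
    av (fun e => ∑ i ∈ s, g i e) = ∑ i ∈ s, av (g i) := by
  simp only [av]; rw [Finset.sum_comm, Finset.smul_sum]

lemma av_mono {f g : Dir d → ℝ} (h : ∀ e, f e ≤ g e) : av f ≤ av g := by
  simp only [av, smul_eq_mul]
  have := Finset.sum_le_sum (fun e (_ : e ∈ Finset.univ) => h e)
  gcongr

lemma av_nonneg {f : Dir d → ℝ} (h : ∀ e, 0 ≤ f e) : 0 ≤ av f := by
  have := av_mono (f := fun _ => (0:ℝ)) h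
  rwa [av_zero] at this
end av

lemma norm_av_le {E : Type*} [NormedAddCommGroup E] [NormedSpace ℝ E] (g : Dir d → E) :
    ‖av g‖ ≤ av (fun e => ‖g e‖) := by
  simp only [av, norm_smul, smul_eq_mul]
  rw [Real.norm_of_nonneg (by positivity)]
  have := norm_sum_le Finset.univ g
  gcongr

lemma abs_av_le (g : Dir d → ℝ) : |av g| ≤ av (fun e => |g e|) := norm_av_le g

open scoped Classical in
/-- The walk move from `x` in direction `e` inside `V`. -/
noncomputable def mv (V : Set (Pt d)) (x : Pt d) (e : Dir d) : Pt d :=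
  if x ∈ V ∧ x + vec e ∈ V then x + vec e else x

/-- Prepend a point to a path. -/
def consP (x : Pt d) (p : ℕ → Pt d) : ℕ → Pt d
  | 0 => x
  | k+1 => p k

@[simp] lemma consP_zero (x : Pt d) (p : ℕ → Pt d) : consP x p 0 = x := rfl
@[simp] lemma consP_succ (x : Pt d) (p : ℕ → Pt d) (k : ℕ) : consP x p (k+1) = p k := rfl

/-- A legal path of `m` steps, constant afterwards. -/
def IsPath (V : Set (Pt d)) (m : ℕ) (p : ℕ → Pt d) : Prop :=
  (∀ k, k < m → ∃ e, p (k+1) = mv V (p k) e) ∧ ∀ k, m ≤ k → p k = p m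

lemma isPath_cons {V : Set (Pt d)} {m : ℕ} {p : ℕ → Pt d} {x : Pt d} {e : Dir d}
    (h : IsPath V m p) (h0 : p 0 = mv V x e) : IsPath V (m+1) (consP x p) := by
  constructor
  · intro k hk
    cases k with
    | zero => exact ⟨e, by simpa using h0⟩
    | succ k => exact h.1 k (by omega)
  · intro k hk
    cases k with
    | zero => omega
    | succ k => simpa using h.2 k (by omega)

section EW
variable {E : Type*} [AddCommGroup E] [Module ℝ E]

/-- Expectation of a functional of the `m`-step walk on `V` from `x`. -/
noncomputable def EW (V : Set (Pt d)) : ℕ → Pt d → ((ℕ → Pt d) → E) → E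
  | 0, x, F => F (fun _ => x)
  | m+1, x, F => av fun e => EW V m (mv V x e) (fun p => F (consP x p))

lemma EW_zero (V : Set (Pt d)) (x : Pt d) (F : (ℕ → Pt d) → E) :
    EW V 0 x F = F (fun _ => x) := rfl

lemma EW_succ (V : Set (Pt d)) (m : ℕ) (x : Pt d) (F : (ℕ → Pt d) → E) :
    EW V (m+1) x F = av fun e => EW V m (mv V x e) (fun p => F (consP x p)) := rfl

lemma EW_congr {V : Set (Pt d)} {m : ℕ} {x : Pt d} {F G : (ℕ → Pt d) → E}
    (h : ∀ p, p 0 = x → IsPath V m p → F p = G p) : EW V m x F = EW V m x G := by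
  induction m generalizing x F G with
  | zero => exact h _ rfl ⟨by simp, by simp⟩
  | succ m ih =>
    rw [EW_succ, EW_succ]; congr 1; ext e
    exact ih fun p hp hp' => h _ rfl (isPath_cons hp' hp)

lemma EW_add (V : Set (Pt d)) (m : ℕ) (x : Pt d) (F G : (ℕ → Pt d) → E) :
    EW V m x (fun p => F p + G p) = EW V m x F + EW V m x G := by
  induction m generalizing x F G with
  | zero => rfl
  | succ m ih => simp only [EW_succ, ih, av_add]

lemma EW_sub (V : Set (Pt d)) (m : ℕ) (x : Pt d) (F G : (ℕ → Pt d) → E) :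
    EW V m x (fun p => F p - G p) = EW V m x F - EW V m x G := by
  induction m generalizing x F G with
  | zero => rfl
  | succ m ih => simp only [EW_succ, ih, av_sub]

lemma EW_smul (V : Set (Pt d)) (m : ℕ) (x : Pt d) (c : ℝ) (F : (ℕ → Pt d) → E) :
    EW V m x (fun p => c • F p) = c • EW V m x F := by
  induction m generalizing x F with
  | zero => rfl
  | succ m ih => simp only [EW_succ, ih, av_smul]

lemma EW_mul (V : Set (Pt d)) (m : ℕ) (x : Pt d) (c : ℝ) (F : (ℕ → Pt d) → ℝ) :
    EW V m x (fun p => c * F p) = c * EW V m x F := EW_smul V m x c F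

lemma EW_const [NeZero d] (V : Set (Pt d)) (m : ℕ) (x : Pt d) (c : E) :
    EW V m x (fun _ => c) = c := by
  induction m generalizing x with
  | zero => rfl
  | succ m ih => simp only [EW_succ, ih, av_const]

lemma EW_sum {ι : Type*} (s : Finset ι) (V : Set (Pt d)) (m : ℕ) (x : Pt d)
    (F : ι → (ℕ → Pt d) → E) :
    EW V m x (fun p => ∑ i ∈ s, F i p) = ∑ i ∈ s, EW V m x (F i) := by
  induction m generalizing x F with
  | zero => rfl
  | succ m ih => simp only [EW_succ, ih, av_sum]

lemma EW_av {E : Type*} [AddCommGroup E] [Module ℝ E] (V : Set (Pt d)) (m : ℕ) (x : Pt d)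
    (F : Dir d → (ℕ → Pt d) → E) :
    EW V m x (fun p => av fun e => F e p) = av fun e => EW V m x (F e) := by
  simp only [av]; rw [EW_smul, EW_sum]

/-- Replace the path after time `k`. -/
def glue (k : ℕ) (p q : ℕ → Pt d) : ℕ → Pt d := fun i => if i < k then p i else q (i - k)

lemma glue_zero (p q : ℕ → Pt d) : glue 0 p q = q := by ext; simp [glue]

lemma glue_succ (k : ℕ) (x : Pt d) (p q : ℕ → Pt d) :
    glue (k+1) (consP x p) q = consP x (glue k p q) := by
  funext i
  cases i with
  | zero => simp [glue]
  | succ i => simp [glue]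

lemma EW_markov (V : Set (Pt d)) (k m : ℕ) (x : Pt d) (F : (ℕ → Pt d) → E) :
    EW V (k+m) x F = EW V k x (fun p => EW V m (p k) (fun q => F (glue k p q))) := by
  induction k generalizing x F with
  | zero => simp [EW_zero, glue_zero]
  | succ k ih =>
    rw [show k + 1 + m = (k + m) + 1 by omega, EW_succ, EW_succ]
    congr 1; ext e
    rw [ih]; simp only [consP_succ, glue_succ]

lemma EW_last (V : Set (Pt d)) (m : ℕ) (x : Pt d) (F : (ℕ → Pt d) → E) :
    EW V (m+1) x F = EW V m x (fun p => av fun e =>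
      F (glue m p (consP (p m) (fun _ => mv V (p m) e)))) := by
  rw [EW_markov]; rfl

/-- Time reversal of an `m`-step path. -/
def revP (m : ℕ) (p : ℕ → Pt d) : ℕ → Pt d := fun k => p (m - k)

end EW

lemma EW_mono' {V : Set (Pt d)} {m : ℕ} {x : Pt d} {F G : (ℕ → Pt d) → ℝ}
    (h : ∀ p, p 0 = x → IsPath V m p → F p ≤ G p) : EW V m x F ≤ EW V m x G := by
  induction m generalizing x F G with
  | zero => exact h _ rfl ⟨by simp, by simp⟩
  | succ m ih =>
    rw [EW_succ, EW_succ]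
    exact av_mono fun e => ih fun p hp hp' => h _ rfl (isPath_cons hp' hp)

lemma EW_mono {V : Set (Pt d)} {m : ℕ} {x : Pt d} {F G : (ℕ → Pt d) → ℝ}
    (h : ∀ p, F p ≤ G p) : EW V m x F ≤ EW V m x G := EW_mono' fun p _ _ => h p

lemma EW_nonneg {V : Set (Pt d)} {m : ℕ} {x : Pt d} {F : (ℕ → Pt d) → ℝ}
    (h : ∀ p, 0 ≤ F p) : 0 ≤ EW V m x F := by
  induction m generalizing x F with
  | zero => exact h _
  | succ m ih => exact av_nonneg fun e => ih fun p => h _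

lemma norm_EW_le {E : Type*} [NormedAddCommGroup E] [NormedSpace ℝ E]
    (V : Set (Pt d)) (m : ℕ) (x : Pt d) (F : (ℕ → Pt d) → E) :
    ‖EW V m x F‖ ≤ EW V m x (fun p => ‖F p‖) := by
  induction m generalizing x F with
  | zero => exact le_rfl
  | succ m ih => exact (norm_av_le _).trans (av_mono fun e => ih _ _)

lemma abs_EW_le (V : Set (Pt d)) (m : ℕ) (x : Pt d) (F : (ℕ → Pt d) → ℝ) :
    |EW V m x F| ≤ EW V m x (fun p => |F p|) := norm_EW_le V m x F

/-- Jensen / Cauchy–Schwarz. -/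
lemma EW_sq_le [NeZero d] (V : Set (Pt d)) (m : ℕ) (x : Pt d) (F : (ℕ → Pt d) → ℝ) :
    (EW V m x F) ^ 2 ≤ EW V m x (fun p => F p ^ 2) := by
  set c := EW V m x F with hc
  have h : 0 ≤ EW V m x (fun p => (F p - c) ^ 2) := EW_nonneg fun p => sq_nonneg _
  have h2 : EW V m x (fun p => (F p - c) ^ 2)
      = EW V m x (fun p => F p ^ 2) - 2 * c * c + c ^ 2 := by
    have : (fun p => (F p - c) ^ 2) = fun p => (F p ^ 2 - (2 * c) * F p) + c ^ 2 := by
      ext p; ring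
    rw [this, EW_add, EW_sub, EW_mul, EW_const]
  nlinarith

/-! One-step operator -/

/-- The transition operator of the walk on `V`. -/
noncomputable def QQ {E : Type*} [AddCommGroup E] [Module ℝ E] (V : Set (Pt d))
    (u : Pt d → E) (x : Pt d) : E := av fun e => u (mv V x e)

lemma EW_pos [NeZero d] {E : Type*} [AddCommGroup E] [Module ℝ E] (V : Set (Pt d)) (m : ℕ)
    (x : Pt d) (u : Pt d → E) (k : ℕ) (hk : k ≤ m) :
    EW V m x (fun p => u (p k)) = ((QQ V)^[k] u) x := by
  induction m generalizing x k with
  | zero =>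
    obtain rfl : k = 0 := by omega
    rfl
  | succ m ih =>
    cases k with
    | zero => rw [EW_succ]; simp only [consP_zero, EW_const, av_const]; rfl
    | succ k =>
      rw [EW_succ]; simp only [consP_succ]
      rw [Function.iterate_succ_apply']
      simp only [QQ]
      congr 1; ext e
      exact ih _ _ (by omega)

/-- Detailed balance. -/
lemma balance {E : Type*} [AddCommGroup E] [Module ℝ E] (V : Set (Pt d)) (B : Finset (Pt d))
    (hB : ∀ x ∈ V, x ∈ B) (Φ : Pt d → Pt d → E) :
    ∑ x ∈ B, av (fun e => Φ x (mv V x e)) = ∑ x ∈ B, av (fun e => Φ (mv V x e) x) := by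
  classical
  simp only [av, ← Finset.smul_sum]
  congr 1
  rw [← Finset.sum_product', ← Finset.sum_product']
  let σ : Pt d × Dir d → Pt d × Dir d := fun q =>
    if q.1 ∈ V ∧ q.1 + vec q.2 ∈ V then (q.1 + vec q.2, opp q.2) else q
  have key : ∀ q, (σ q).1 = mv V q.1 q.2 ∧ mv V (σ q).1 (σ q).2 = q.1 := by
    intro q
    by_cases h : q.1 ∈ V ∧ q.1 + vec q.2 ∈ V
    · simp only [σ, mv, if_pos h]
      simp [vec_opp, h.1, h.2]
    · simp only [σ, mv, if_neg h, and_self]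
  have hinv : ∀ q, σ (σ q) = q := by
    intro q
    by_cases h : q.1 ∈ V ∧ q.1 + vec q.2 ∈ V
    · simp only [σ, if_pos h]
      simp [vec_opp, h.1, h.2, opp_opp]
    · simp only [σ, if_neg h]
  have hmem : ∀ q ∈ B ×ˢ (Finset.univ : Finset (Dir d)), σ q ∈ B ×ˢ (Finset.univ : Finset (Dir d)) := by
    intro q hq
    simp only [Finset.mem_product, Finset.mem_univ, and_true] at hq ⊢
    by_cases h : q.1 ∈ V ∧ q.1 + vec q.2 ∈ V
    · simp only [σ, if_pos h]; exact hB _ h.2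
    · simp only [σ, if_neg h]; exact hq
  refine Finset.sum_nbij' σ σ hmem hmem (fun q _ => hinv q) (fun q _ => hinv q) ?_
  intro q _
  rw [(key q).2, (key q).1]

lemma QQ_symm (V : Set (Pt d)) (B : Finset (Pt d)) (hB : ∀ x ∈ V, x ∈ B) (u v : Pt d → ℝ) :
    ∑ x ∈ B, QQ V u x * v x = ∑ x ∈ B, u x * QQ V v x := by
  have := balance V B hB (fun x y => u y * v x)
  simp only [QQ]
  rw [show (∑ x ∈ B, av (fun e => u (mv V x e)) * v x)
    = ∑ x ∈ B, av (fun e => u (mv V x e) * v x) from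
      Finset.sum_congr rfl fun x _ => by simp only [mul_comm _ (v x), av_mul]]
  rw [this]
  exact Finset.sum_congr rfl fun x _ => by simp only [av_mul]

lemma sum_QQ (V : Set (Pt d)) [NeZero d] (B : Finset (Pt d)) (hB : ∀ x ∈ V, x ∈ B) (u : Pt d → ℝ) :
    ∑ x ∈ B, QQ V u x = ∑ x ∈ B, u x := by
  have := QQ_symm V B hB u (fun _ => 1)
  simpa [QQ, av_const] using this

lemma sum_QQ_iter (V : Set (Pt d)) [NeZero d] (B : Finset (Pt d)) (hB : ∀ x ∈ V, x ∈ B)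
    (u : Pt d → ℝ) (k : ℕ) :
    ∑ x ∈ B, ((QQ V)^[k] u) x = ∑ x ∈ B, u x := by
  induction k with
  | zero => rfl
  | succ k ih => rw [← ih]; simp only [Function.iterate_succ_apply']; exact sum_QQ V B hB _

/-- Reversibility of the walk in path form. -/
lemma EW_rev {E : Type*} [AddCommGroup E] [Module ℝ E] (V : Set (Pt d)) (B : Finset (Pt d))
    (hB : ∀ x ∈ V, x ∈ B) (m : ℕ) (F : (ℕ → Pt d) → E) :
    ∑ x ∈ B, EW V m x F = ∑ x ∈ B, EW V m x (fun p => F (revP m p)) := by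
  induction m generalizing F with
  | zero => rfl
  | succ m ih =>
    have h1 := balance V B hB (fun x y => EW V m y (fun p => F (consP x p)))
    have h2 : ∀ y, av (fun e => EW V m y (fun p => F (consP (mv V y e) p)))
        = EW V m y (fun p => av fun e => F (consP (mv V (p 0) e) p)) := by
      intro y
      rw [← EW_av]
      exact EW_congr fun p hp _ => by rw [hp]
    simp only [EW_succ V m]
    rw [h1]
    simp only [h2]
    rw [ih]
    refine Finset.sum_congr rfl fun x _ => ?_
    rw [← EW_succ V m x (fun p => F (revP (m+1) p)), EW_last]
    refine EW_congr fun p hp hpp => ?_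
    congr 1; ext e
    congr 1
    funext k
    cases k with
    | zero => simp [revP, glue]
    | succ k =>
      simp only [consP_succ, revP, glue]
      rw [show m + 1 - (k+1) = m - k by omega]
      split_ifs with h
      · rfl
      · rw [show m - k = m by omega]; simp

/-- Functionals of the first `k` steps. -/
lemma EW_restrict [NeZero d] {E : Type*} [AddCommGroup E] [Module ℝ E] (V : Set (Pt d)) (k m : ℕ)
    (x : Pt d) (F : (ℕ → Pt d) → E)
    (hF : ∀ p q : ℕ → Pt d, (∀ i ≤ k, p i = q i) → F p = F q) :
    EW V (k+m) x F = EW V k x F := by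
  rw [EW_markov]
  refine EW_congr fun p _ _ => ?_
  have : EW V m (p k) (fun q => F (glue k p q)) = EW V m (p k) (fun _ => F p) := by
    refine EW_congr fun q hq _ => hF _ _ fun i hi => ?_
    simp only [glue]
    split_ifs with h
    · rfl
    · rw [show i = k by omega]; simp [hq]
  rw [this, EW_const]


/-- Additive functional along a path. -/
def SF (D : Pt d → Pt d → ℝ) (k : ℕ) (p : ℕ → Pt d) : ℝ := ∑ l ∈ Finset.range k, D (p l) (p (l+1))

lemma SF_cons (D : Pt d → Pt d → ℝ) (k : ℕ) (x : Pt d) (p : ℕ → Pt d) :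
    SF D (k+1) (consP x p) = D x (p 0) + SF D k p := by
  simp only [SF, Finset.sum_range_succ', consP_succ, consP_zero]; ring

lemma EW_SF_zero {V : Set (Pt d)} {D : Pt d → Pt d → ℝ}
    (hD : ∀ x, av (fun e => D x (mv V x e)) = 0) [NeZero d] (m : ℕ) (x : Pt d) :
    EW V m x (SF D m) = 0 := by
  induction m generalizing x with
  | zero => simp [EW_zero, SF]
  | succ m ih =>
    rw [EW_succ]
    have : ∀ e, EW V m (mv V x e) (fun p => SF D (m+1) (consP x p)) = D x (mv V x e) := by
      intro e
      rw [EW_congr (G := fun p => D x (mv V x e) + SF D m p)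
        (fun p hp _ => by rw [SF_cons, hp]), EW_add, EW_const, ih, add_zero]
    simp only [this, hD]

lemma EW_SF_sq {V : Set (Pt d)} {D : Pt d → Pt d → ℝ}
    (hD : ∀ x, av (fun e => D x (mv V x e)) = 0) [NeZero d] (m : ℕ) (x : Pt d) :
    EW V m x (fun p => SF D m p ^ 2)
      = ∑ k ∈ Finset.range m, ((QQ V)^[k] (fun x => av fun e => D x (mv V x e) ^ 2)) x := by
  induction m generalizing x with
  | zero => simp [EW_zero, SF]
  | succ m ih =>
    rw [EW_succ]
    have : ∀ e, EW V m (mv V x e) (fun p => SF D (m+1) (consP x p) ^ 2)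
        = D x (mv V x e) ^ 2 + EW V m (mv V x e) (fun p => SF D m p ^ 2) := by
      intro e
      rw [EW_congr (G := fun p => (D x (mv V x e) ^ 2 + SF D m p ^ 2) +
          (2 * D x (mv V x e)) * SF D m p)
        (fun p hp _ => by rw [SF_cons, hp]; ring), EW_add, EW_add, EW_const, EW_mul, EW_SF_zero hD]
      ring
    simp only [this, av_add, ih, av_sum]
    rw [Finset.sum_range_succ', add_comm]
    congr 1
    refine Finset.sum_congr rfl fun k _ => ?_
    rw [Function.iterate_succ_apply']; rfl

lemma av_sub_sq_le [NeZero d] (f : Dir d → ℝ) : av (fun e => (f e - av f) ^ 2) ≤ av (fun e => f e ^ 2) := by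
  set c := av f with hc
  have : (fun e => (f e - c) ^ 2) = fun e => (f e ^ 2 - (2 * c) * f e) + c ^ 2 := by ext; ring
  rw [this, av_add, av_sub, av_mul, av_const, ← hc]
  nlinarith [sq_nonneg c]

lemma av_sq_le [NeZero d] (f : Dir d → ℝ) : (av f) ^ 2 ≤ av (fun e => f e ^ 2) := by
  set c := av f with hc
  have : (fun e => (f e - c) ^ 2) = fun e => (f e ^ 2 - (2 * c) * f e) + c ^ 2 := by ext; ring
  have h := av_nonneg (fun e => sq_nonneg (f e - c))
  rw [this, av_add, av_sub, av_mul, av_const, ← hc] at h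
  nlinarith [sq_nonneg c]

/-- Drift of an edge function. -/
noncomputable def drift (V : Set (Pt d)) (F : Pt d → Pt d → ℝ) (x : Pt d) : ℝ :=
  av fun e => F x (mv V x e)

/-- Compensated edge function. -/
noncomputable def comp (V : Set (Pt d)) (F : Pt d → Pt d → ℝ) (x y : Pt d) : ℝ := F x y - drift V F x

lemma av_comp [NeZero d] (V : Set (Pt d)) (F : Pt d → Pt d → ℝ) (x : Pt d) :
    av (fun e => comp V F x (mv V x e)) = 0 := by
  simp only [comp, av_sub, av_const, drift, sub_self]

lemma LZ_identity {F : Pt d → Pt d → ℝ} (hF : ∀ x y, F x y = - F y x) (b : Pt d → ℝ)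
    (p : ℕ → Pt d) (m k : ℕ) (hk : k ≤ m) :
    SF (fun x y => F x y - b x) k p
      - (- (SF (fun x y => F x y - b x) m (revP m p)
          - SF (fun x y => F x y - b x) (m-k) (revP m p)))
      = - 2 * (∑ l ∈ Finset.range k, b (p l)) + b (p 0) - b (p k) := by
  induction k with
  | zero => simp [SF]
  | succ k ih =>
    have ih := ih (by omega)
    obtain ⟨j, rfl⟩ : ∃ j, m = k + 1 + j := ⟨m - (k+1), by omega⟩
    have e1 : SF (fun x y => F x y - b x) (k+1+j-k) (revP (k+1+j) p)
        = SF (fun x y => F x y - b x) (k+1+j-(k+1)) (revP (k+1+j) p) +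
          (F (p (k+1)) (p k) - b (p (k+1))) := by
      rw [show k+1+j-k = (k+1+j-(k+1)) + 1 by omega]
      simp only [SF]
      rw [Finset.sum_range_succ]
      simp only [revP]
      rw [show k + 1 + j - (k + 1 + j - (k + 1)) = k + 1 by omega,
        show k + 1 + j - (k + 1 + j - (k + 1) + 1) = k by omega]
    rw [e1] at ih
    have e2 : SF (fun x y => F x y - b x) (k+1) p = SF (fun x y => F x y - b x) k p
        + (F (p k) (p (k+1)) - b (p k)) := by simp only [SF, Finset.sum_range_succ]
    rw [e2, Finset.sum_range_succ]
    have := hF (p k) (p (k+1))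
    linarith

lemma sum_EW_SF_sq [NeZero d] (V : Set (Pt d)) (B : Finset (Pt d)) (hB : ∀ x ∈ V, x ∈ B)
    (F : Pt d → Pt d → ℝ) (m : ℕ) :
    ∑ x ∈ B, EW V m x (fun p => SF (comp V F) m p ^ 2)
      ≤ m * ∑ x ∈ B, av (fun e => F x (mv V x e) ^ 2) := by
  simp only [EW_SF_sq (av_comp V F)]
  rw [Finset.sum_comm]
  simp only [sum_QQ_iter V B hB]
  rw [Finset.sum_const, Finset.card_range, nsmul_eq_mul]
  have : ∑ x ∈ B, av (fun e => comp V F x (mv V x e) ^ 2)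
      ≤ ∑ x ∈ B, av (fun e => F x (mv V x e) ^ 2) :=
    Finset.sum_le_sum fun x _ => av_sub_sq_le (fun e => F x (mv V x e))
  gcongr

/-- Lyons–Zheng `ℓ²` estimate. -/
lemma LZ_L2 [NeZero d] (V : Set (Pt d)) (B : Finset (Pt d)) (hB : ∀ x ∈ V, x ∈ B)
    {F : Pt d → Pt d → ℝ} (hF : ∀ x y, F x y = - F y x) (m : ℕ) :
    ∑ x ∈ B, EW V m x (fun p => (∑ l ∈ Finset.range m, drift V F (p l)) ^ 2)
      ≤ 2 * (m + 1) * ∑ x ∈ B, av (fun e => F x (mv V x e) ^ 2) := by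
  have key : ∀ p : ℕ → Pt d, (∑ l ∈ Finset.range m, drift V F (p l)) ^ 2 ≤
      SF (comp V F) m p ^ 2 + SF (comp V F) m (revP m p) ^ 2 + drift V F (p 0) ^ 2
        + drift V F (p m) ^ 2 := by
    intro p
    have h := LZ_identity hF (drift V F) p m m le_rfl
    change SF (comp V F) m p - (- (SF (comp V F) m (revP m p) - SF (comp V F) (m-m) (revP m p))) = _ at h
    rw [Nat.sub_self, show SF (comp V F) 0 (revP m p) = 0 by simp [SF]] at h
    set a := SF (comp V F) m p
    set a' := SF (comp V F) m (revP m p)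
    set b := drift V F (p 0)
    set b' := drift V F (p m)
    have h' : (∑ l ∈ Finset.range m, drift V F (p l)) = (-a - a' + b - b') / 2 := by linarith
    rw [h']
    nlinarith [sq_nonneg (a - a'), sq_nonneg (a + b), sq_nonneg (a - b'), sq_nonneg (a' + b),
      sq_nonneg (a' - b'), sq_nonneg (b + b')]
  have h1 := sum_EW_SF_sq V B hB F m
  have h2 := EW_rev V B hB m (fun p => SF (comp V F) m p ^ 2)
  have hb : ∀ k ≤ m, ∑ x ∈ B, EW V m x (fun p => drift V F (p k) ^ 2)
      ≤ ∑ x ∈ B, av (fun e => F x (mv V x e) ^ 2) := by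
    intro k hk
    have : ∀ x, EW V m x (fun p => drift V F (p k) ^ 2)
        = ((QQ V)^[k] (fun y => drift V F y ^ 2)) x :=
      fun x => EW_pos V m x (fun y => drift V F y ^ 2) k hk
    simp only [this, sum_QQ_iter V B hB]
    exact Finset.sum_le_sum fun x _ => av_sq_le _
  have h3 := hb 0 (by omega)
  have h4 := hb m le_rfl
  calc _ ≤ ∑ x ∈ B, EW V m x (fun p => SF (comp V F) m p ^ 2 + SF (comp V F) m (revP m p) ^ 2
        + drift V F (p 0) ^ 2 + drift V F (p m) ^ 2) :=
        Finset.sum_le_sum fun x _ => EW_mono key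
    _ = ∑ x ∈ B, EW V m x (fun p => SF (comp V F) m p ^ 2)
        + ∑ x ∈ B, EW V m x (fun p => SF (comp V F) m (revP m p) ^ 2)
        + ∑ x ∈ B, EW V m x (fun p => drift V F (p 0) ^ 2)
        + ∑ x ∈ B, EW V m x (fun p => drift V F (p m) ^ 2) := by
        simp only [EW_add, Finset.sum_add_distrib]
    _ ≤ _ := by rw [← h2]; linarith

/-! Exponential maximal bound -/

open scoped Classical in
/-- Indicator of a proposition. -/
noncomputable def ind (p : Prop) : ℝ := if p then 1 else 0

lemma ind_nonneg (p : Prop) : 0 ≤ ind p := by unfold ind; split_ifs <;> norm_num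
lemma ind_le_one (p : Prop) : ind p ≤ 1 := by unfold ind; split_ifs <;> norm_num
lemma ind_pos {p : Prop} (h : p) : ind p = 1 := by simp [ind, h]
lemma ind_neg {p : Prop} (h : ¬ p) : ind p = 0 := by simp [ind, h]
lemma ind_mono {p q : Prop} (h : p → q) : ind p ≤ ind q := by
  by_cases hp : p
  · rw [ind_pos hp, ind_pos (h hp)]
  · rw [ind_neg hp]; exact ind_nonneg q
lemma ind_or_le (p q : Prop) : ind (p ∨ q) ≤ ind p + ind q := by
  by_cases hp : p
  · rw [ind_pos hp, ind_pos (Or.inl hp)]; linarith [ind_nonneg q]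
  · by_cases hq : q
    · rw [ind_pos hq, ind_pos (Or.inr hq)]; linarith [ind_nonneg p]
    · rw [ind_neg (by tauto : ¬ (p ∨ q))]; linarith [ind_nonneg q, ind_nonneg p]

lemma exp_max [NeZero d] {V : Set (Pt d)} {D : Pt d → Pt d → ℝ}
    (hD : ∀ x, av (fun e => D x (mv V x e)) = 0) (hb : ∀ x e, |D x (mv V x e)| ≤ 2)
    {α : ℝ} (hα : 0 ≤ α) (hα2 : α ≤ 1/2) (m : ℕ) (x : Pt d) (a : ℝ) :
    EW V m x (fun p => ind (∃ k ≤ m, a ≤ SF D k p)) ≤ Real.exp (- α * a) * (1 + 4 * α ^ 2) ^ m := by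
  induction m generalizing x a with
  | zero =>
    rw [EW_zero, pow_zero, mul_one]
    by_cases h : a ≤ 0
    · exact (ind_le_one _).trans (Real.one_le_exp (by nlinarith))
    · rw [ind_neg]
      · positivity
      · rintro ⟨k, hk, hk'⟩
        obtain rfl : k = 0 := by omega
        simp [SF] at hk'; exact h hk'
  | succ m ih =>
    by_cases h : a ≤ 0
    · calc _ ≤ EW V (m+1) x (fun _ => (1:ℝ)) := EW_mono fun p => ind_le_one _
        _ = 1 := EW_const _ _ _ _
        _ ≤ _ := one_le_mul_of_one_le_of_one_le (Real.one_le_exp (by nlinarith))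
            (one_le_pow₀ (by nlinarith))
    · rw [EW_succ]
      have step : ∀ e, EW V m (mv V x e) (fun p => ind (∃ k ≤ m+1, a ≤ SF D k (consP x p)))
          ≤ Real.exp (-α * a) * (1 + 4*α^2)^m * Real.exp (α * D x (mv V x e)) := by
        intro e
        calc _ ≤ EW V m (mv V x e) (fun p => ind (∃ k ≤ m, a - D x (mv V x e) ≤ SF D k p)) := by
              refine EW_mono' fun p hp _ => ind_mono ?_
              rintro ⟨k, hk, hk'⟩
              cases k with
              | zero => simp [SF] at hk'; exact absurd hk' h
              | succ k =>
                rw [SF_cons, hp] at hk'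
                exact ⟨k, by omega, by linarith⟩
          _ ≤ _ := ih _ _
          _ = _ := by
              rw [show -α * (a - D x (mv V x e)) = -α * a + α * D x (mv V x e) by ring,
                Real.exp_add]; ring
      calc _ ≤ av (fun e => Real.exp (-α * a) * (1 + 4*α^2)^m * Real.exp (α * D x (mv V x e))) :=
            av_mono step
        _ = Real.exp (-α * a) * (1 + 4*α^2)^m * av (fun e => Real.exp (α * D x (mv V x e))) := av_mul _ _
        _ ≤ Real.exp (-α * a) * (1 + 4*α^2)^m * (1 + 4 * α^2) := by
            gcongr
            calc _ ≤ av (fun e => (1 + 4 * α^2) + α * D x (mv V x e)) := by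
                  refine av_mono fun e => ?_
                  have hD2 := abs_le.1 (hb x e)
                  have : |α * D x (mv V x e)| ≤ 1 := by
                    rw [abs_mul, abs_of_nonneg hα]
                    nlinarith [hb x e, abs_nonneg (D x (mv V x e))]
                  have h3 := (abs_le.1 (Real.abs_exp_sub_one_sub_id_le this)).2
                  have h4 : D x (mv V x e) ^ 2 ≤ 4 := by nlinarith
                  nlinarith [mul_le_mul_of_nonneg_left h4 (sq_nonneg α)]
              _ = _ := by rw [av_add, av_const, av_mul, hD]; ring
        _ = _ := by ring

lemma exp_max_abs [NeZero d] {V : Set (Pt d)} {D : Pt d → Pt d → ℝ}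
    (hD : ∀ x, av (fun e => D x (mv V x e)) = 0) (hb : ∀ x e, |D x (mv V x e)| ≤ 2)
    (m : ℕ) (hm : 1 ≤ m) (x : Pt d) (a : ℝ) :
    EW V m x (fun p => ind (∃ k ≤ m, a ≤ |SF D k p|))
      ≤ 2 * Real.exp (1 - a / (2 * Real.sqrt m)) := by
  have hm' : (1:ℝ) ≤ Real.sqrt m := by
    rw [Real.one_le_sqrt]; exact_mod_cast hm
  set α : ℝ := 1 / (2 * Real.sqrt m) with hα
  have hα0 : 0 ≤ α := by positivity
  have hα2 : α ≤ 1/2 := by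
    rw [hα]; apply one_div_le_one_div_of_le <;> linarith
  have hbound : Real.exp (-α * a) * (1 + 4 * α ^ 2) ^ m ≤ Real.exp (1 - a / (2 * Real.sqrt m)) := by
    have h1 : (1 + 4 * α^2) ^ m ≤ Real.exp 1 := by
      calc _ ≤ (Real.exp (4 * α^2)) ^ m := by
            gcongr; linarith [Real.add_one_le_exp (4 * α^2)]
        _ = Real.exp 1 := by
            rw [← Real.exp_nat_mul]; congr 1
            rw [hα, div_pow, mul_pow, Real.sq_sqrt (by positivity)]
            have : (m:ℝ) ≠ 0 := by positivity
            field_simp; norm_num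
    calc _ ≤ Real.exp (-α * a) * Real.exp 1 := by gcongr
      _ = _ := by rw [← Real.exp_add]; congr 1; rw [hα]; ring
  have h1 := exp_max hD hb hα0 hα2 m x a
  have hneg : ∀ k p, SF (fun x y => - D x y) k p = - SF D k p := by
    intro k p; simp [SF]
  have h2 := exp_max (V := V) (D := fun x y => - D x y) (fun x => by
    have := av_mul (d := d) (-1) (fun e => D x (mv V x e))
    simp only [hD, mul_zero, neg_one_mul] at this; exact this)
    (fun x e => by rw [abs_neg]; exact hb x e) hα0 hα2 m x a
  calc _ ≤ EW V m x (fun p => ind (∃ k ≤ m, a ≤ SF D k p) + ind (∃ k ≤ m, a ≤ SF (fun x y => - D x y) k p)) := by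
        refine EW_mono fun p => (ind_mono ?_).trans (ind_or_le _ _)
        rintro ⟨k, hk, hk'⟩
        rcases le_abs.1 hk' with h | h
        · exact Or.inl ⟨k, hk, h⟩
        · exact Or.inr ⟨k, hk, by rw [hneg]; exact h⟩
    _ ≤ _ := by rw [EW_add]; linarith

lemma LZ_max [NeZero d] (V : Set (Pt d)) (B : Finset (Pt d)) (hB : ∀ x ∈ V, x ∈ B)
    (f : Pt d → ℝ) (hf : ∀ x e, |f (mv V x e) - f x| ≤ 1) (m : ℕ) (hm : 1 ≤ m) (lam : ℝ) :
    ∑ x ∈ B, EW V m x (fun p => ind (∃ k ≤ m, lam ≤ |f (p k) - f (p 0)|))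
      ≤ 4 * B.card * Real.exp (1 - (lam - 1) / (4 * Real.sqrt m)) := by
  have hm' : (1:ℝ) ≤ Real.sqrt m := by
    rw [Real.one_le_sqrt]; exact_mod_cast hm
  have hpos : (0:ℝ) < Real.sqrt m := by linarith
  by_cases hl : lam < 1
  · calc _ ≤ ∑ x ∈ B, (1:ℝ) := Finset.sum_le_sum fun x _ => by
          calc _ ≤ EW V m x (fun _ => (1:ℝ)) := EW_mono fun p => ind_le_one _
            _ = 1 := EW_const _ _ _ _
      _ = B.card := by simp
      _ ≤ _ := by
          have : (1:ℝ) ≤ Real.exp (1 - (lam - 1) / (4 * Real.sqrt m)) := by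
            apply Real.one_le_exp
            have : (lam - 1) / (4 * Real.sqrt m) ≤ 0 :=
              div_nonpos_of_nonpos_of_nonneg (by linarith) (by positivity)
            linarith
          nlinarith [(Nat.cast_nonneg B.card : (0:ℝ) ≤ B.card)]
  push Not at hl
  set F : Pt d → Pt d → ℝ := fun x y => f y - f x with hF
  have hF' : ∀ x y, F x y = - F y x := fun x y => by simp [hF]
  set b := drift V F with hbd
  have hb1 : ∀ x, |b x| ≤ 1 := fun x => by
    calc _ ≤ av (fun e => |F x (mv V x e)|) := abs_av_le _
      _ ≤ av (fun _ => (1:ℝ)) := av_mono fun e => hf x e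
      _ = 1 := av_const _
  have hcb : ∀ x e, |comp V F x (mv V x e)| ≤ 2 := fun x e => by
    calc _ ≤ |F x (mv V x e)| + |b x| := abs_sub _ _
      _ ≤ 2 := by linarith [hf x e, hb1 x]
  set a := (lam - 1) / 2 with ha
  set A : (ℕ → Pt d) → ℝ := fun p => ind (∃ k ≤ m, a ≤ |SF (comp V F) k p|) with hA
  have key : ∀ p : ℕ → Pt d, ind (∃ k ≤ m, lam ≤ |f (p k) - f (p 0)|) ≤ A p + A (revP m p) := by
    intro p
    refine (ind_mono ?_).trans (ind_or_le _ _)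
    rintro ⟨k, hk, hk'⟩
    by_contra hcon
    push Not at hcon
    obtain ⟨h1, h2⟩ := hcon
    have id := LZ_identity hF' b p m k hk
    have hs : SF (comp V F) k p = f (p k) - f (p 0) - ∑ l ∈ Finset.range k, b (p l) := by
      simp only [SF, comp, Finset.sum_sub_distrib, hF]
      rw [← Finset.sum_range_sub (fun l => f (p l)), Finset.sum_sub_distrib]
    change SF (comp V F) k p - (- (SF (comp V F) m (revP m p) - SF (comp V F) (m-k) (revP m p))) = _ at id
    have e1 := abs_lt.1 (h1 k hk)
    have e2 := abs_lt.1 (h2 m le_rfl)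
    have e3 := abs_lt.1 (h2 (m-k) (by omega))
    have e4 := abs_le.1 (hb1 (p 0))
    have e5 := abs_le.1 (hb1 (p k))
    have : |f (p k) - f (p 0)| < lam := by
      rw [abs_lt]; constructor <;> linarith
    linarith
  have hAb : ∀ x, EW V m x A ≤ 2 * Real.exp (1 - (lam - 1) / (4 * Real.sqrt m)) := by
    intro x
    refine (exp_max_abs (av_comp V F) hcb m hm x a).trans (le_of_eq ?_)
    congr 3; rw [ha]; field_simp; norm_num
  have h2 := EW_rev V B hB m A
  calc _ ≤ ∑ x ∈ B, (EW V m x A + EW V m x (fun p => A (revP m p))) :=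
        Finset.sum_le_sum fun x _ => by rw [← EW_add]; exact EW_mono key
    _ = 2 * ∑ x ∈ B, EW V m x A := by rw [Finset.sum_add_distrib, ← h2]; ring
    _ ≤ 2 * ∑ x ∈ B, 2 * Real.exp (1 - (lam - 1) / (4 * Real.sqrt m)) := by
        gcongr with x _; exact hAb x
    _ = _ := by rw [Finset.sum_const, nsmul_eq_mul]; ring


/-- Boxes of `ℤ^d` as finsets. -/
noncomputable def Box (d : ℕ) (R : ℕ) : Finset (Pt d) := Fintype.piFinset fun _ => Finset.Icc (-(R:ℤ)) R

lemma mem_Box {R : ℕ} {x : Pt d} : x ∈ Box d R ↔ ∀ i, |x i| ≤ R := by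
  simp [Box, Fintype.mem_piFinset, abs_le]

lemma card_Box (R : ℕ) : (Box d R).card = (2*R+1)^d := by
  simp only [Box, Fintype.card_piFinset, Int.card_Icc, Finset.prod_const, Finset.card_univ,
    Fintype.card_fin]
  congr 1; omega

lemma Box_mono {R L : ℕ} (h : R ≤ L) : Box d R ⊆ Box d L := by
  intro x hx; rw [mem_Box] at *
  intro i; exact (hx i).trans (by exact_mod_cast h)

lemma vec_abs_le (e : Dir d) (i : Fin d) : |vec e i| ≤ 1 := by
  rcases e with ⟨j, b⟩
  simp only [vec, Pi.single_apply]
  split_ifs <;> simp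

lemma mv_coord (V : Set (Pt d)) (x : Pt d) (e : Dir d) (i : Fin d) :
    |((mv V x e i : ℤ) : ℝ) - x i| ≤ 1 := by
  have h := vec_abs_le e i
  unfold mv
  split_ifs
  · simp only [Pi.add_apply, Int.cast_add, add_sub_cancel_left]; exact_mod_cast h
  · simp

/-- Comparison of the walk on `V` with the walk reflected in a box. -/
lemma reflect [NeZero d] (V : Set (Pt d)) (L m : ℕ) (x : Pt d) {F G : (ℕ → Pt d) → ℝ}
    (hF : ∀ p, F p ≤ 1) (hG : ∀ p, 0 ≤ G p)
    (h : ∀ p : ℕ → Pt d, (∀ k ≤ m, p k ∈ Box d L) → F p ≤ G p) :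
    EW V m x F ≤ EW (V ∩ Box d (L+1)) m x G
      + EW (V ∩ Box d (L+1)) m x (fun p => ind (∃ k ≤ m, p k ∉ Box d L)) := by
  induction m generalizing x F G with
  | zero =>
    simp only [EW_zero]
    by_cases hx : x ∈ Box d L
    · have := h (fun _ => x) (fun _ _ => hx)
      linarith [ind_nonneg (∃ k ≤ 0, (fun _ : ℕ => x) k ∉ Box d L)]
    · rw [ind_pos ⟨0, le_rfl, hx⟩]; linarith [hF (fun _ => x), hG (fun _ => x)]
  | succ m ih =>
    by_cases hx : x ∈ Box d L
    · simp only [EW_succ]; rw [← av_add]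
      refine av_mono fun e => ?_
      have hmv : mv (V ∩ Box d (L+1)) x e = mv V x e := by
        have h1 : x ∈ Box d (L+1) := Box_mono (by omega) hx
        have h2 : x + vec e ∈ Box d (L+1) := by
          rw [mem_Box] at *
          intro i
          have := vec_abs_le e i
          have := hx i
          have := abs_add_le (x i) (vec e i)
          simp only [Pi.add_apply]; push_cast; linarith
        have hiff : (x ∈ V ∩ Box d (L+1) ∧ x + vec e ∈ V ∩ Box d (L+1)) ↔
            (x ∈ V ∧ x + vec e ∈ V) := by
          simp only [Set.mem_inter_iff, Finset.mem_coe, h1, h2, and_true]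
        unfold mv
        by_cases hh : x ∈ V ∧ x + vec e ∈ V
        · rw [if_pos hh, if_pos (hiff.2 hh)]
        · rw [if_neg hh, if_neg (fun hc => hh (hiff.1 hc))]
      rw [hmv]
      refine (ih (mv V x e) (fun p => hF _) (fun p => hG _) (fun p hp => h _ ?_)).trans ?_
      · intro k hk
        cases k with
        | zero => exact hx
        | succ k => exact hp k (by omega)
      · gcongr
        refine EW_mono fun p => ind_mono ?_
        rintro ⟨k, hk, hk'⟩
        exact ⟨k+1, by omega, hk'⟩
    · have h1 : EW V (m+1) x F ≤ 1 := by
        rw [← EW_const V (m+1) x (1:ℝ)]; exact EW_mono hF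
      have h2 : EW (V ∩ Box d (L+1)) (m+1) x (fun p => ind (∃ k ≤ m+1, p k ∉ Box d L)) = 1 := by
        rw [← EW_const (V ∩ Box d (L+1)) (m+1) x (1:ℝ)]
        refine EW_congr fun p hp _ => ind_pos ⟨0, by omega, by rwa [hp]⟩
      rw [h2]
      linarith [EW_nonneg (V := V ∩ Box d (L+1)) (m := m+1) (x := x) hG]

/-- Error function. -/
noncomputable def errf (lam : ℝ) (m : ℕ) : ℝ := Real.exp (1 - (lam - 1) / (4 * Real.sqrt m))

lemma errf_nonneg (lam : ℝ) (m : ℕ) : 0 ≤ errf lam m := Real.exp_nonneg _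

lemma box_max [NeZero d] (V : Set (Pt d)) (L m : ℕ) (hm : 1 ≤ m) (lam : ℝ) :
    ∑ x ∈ Box d L, EW (V ∩ Box d L) m x
        (fun p => ind (∃ k ≤ m, ∃ i, lam ≤ |(p k i : ℝ) - p 0 i|))
      ≤ 4 * d * (2*L+1)^d * errf lam m := by
  have h : ∀ i : Fin d, ∑ x ∈ Box d L, EW (V ∩ Box d L) m x
      (fun p => ind (∃ k ≤ m, lam ≤ |(p k i : ℝ) - p 0 i|))
      ≤ 4 * (2*L+1)^d * errf lam m := by
    intro i
    have := LZ_max (V ∩ Box d L) (Box d L) (fun x hx => hx.2) (fun x => (x i : ℝ))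
      (fun x e => mv_coord _ x e i) m hm lam
    rw [card_Box] at this
    push_cast at this
    exact this
  calc _ ≤ ∑ x ∈ Box d L, EW (V ∩ Box d L) m x
        (fun p => ∑ i, ind (∃ k ≤ m, lam ≤ |(p k i : ℝ) - p 0 i|)) := by
        refine Finset.sum_le_sum fun x _ => EW_mono fun p => ?_
        by_cases hp : ∃ k ≤ m, ∃ i, lam ≤ |(p k i : ℝ) - p 0 i|
        · obtain ⟨k, hk, i, hi⟩ := hp
          calc _ ≤ (1:ℝ) := ind_le_one _
            _ = ind (∃ k ≤ m, lam ≤ |(p k i : ℝ) - p 0 i|) := (ind_pos ⟨k, hk, hi⟩).symm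
            _ ≤ _ := Finset.single_le_sum
                (f := fun i => ind (∃ k ≤ m, lam ≤ |(p k i : ℝ) - p 0 i|))
                (fun i _ => ind_nonneg _) (Finset.mem_univ i)
        · rw [ind_neg hp]; exact Finset.sum_nonneg fun i _ => ind_nonneg _
    _ = ∑ i, ∑ x ∈ Box d L, EW (V ∩ Box d L) m x
        (fun p => ind (∃ k ≤ m, lam ≤ |(p k i : ℝ) - p 0 i|)) := by
        simp only [EW_sum]; rw [Finset.sum_comm]
    _ ≤ ∑ _i : Fin d, 4 * (2*L+1)^d * errf lam m := Finset.sum_le_sum fun i _ => h i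
    _ = _ := by simp; ring

/-- Transfer of box averages from reflected to unreflected walk. -/
lemma box_transfer [NeZero d] (V : Set (Pt d)) (R m : ℕ) (hm : 1 ≤ m) {F G : (ℕ → Pt d) → ℝ}
    (hF : ∀ p, F p ≤ 1) (hG : ∀ p, 0 ≤ G p)
    (h : ∀ p : ℕ → Pt d, (∀ k ≤ m, p k ∈ Box d (2*R)) → F p ≤ G p) :
    ∑ x ∈ Box d R, EW V m x F ≤ ∑ x ∈ Box d (2*R+1), EW (V ∩ Box d (2*R+1)) m x G
      + 4 * d * (4*R+3)^d * errf R m := by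
  have hsub : Box d R ⊆ Box d (2*R+1) := Box_mono (by omega)
  calc _ ≤ ∑ x ∈ Box d R, (EW (V ∩ Box d (2*R+1)) m x G + EW (V ∩ Box d (2*R+1)) m x
        (fun p => ind (∃ k ≤ m, ∃ i, (R:ℝ) ≤ |(p k i : ℝ) - p 0 i|))) := by
        refine Finset.sum_le_sum fun x hx => (reflect V (2*R) m x hF hG h).trans ?_
        gcongr
        refine EW_mono' fun p hp _ => ind_mono ?_
        rintro ⟨k, hk, hk'⟩
        refine ⟨k, hk, ?_⟩
        rw [mem_Box] at hk' hx
        push Not at hk'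
        obtain ⟨i, hi⟩ := hk'
        refine ⟨i, ?_⟩
        rw [hp]
        have h1 := hx i
        have h2 := abs_sub_abs_le_abs_sub (p k i) (x i)
        push_cast at hi
        have : (R:ℤ) ≤ |p k i - x i| := by linarith
        exact_mod_cast this
    _ ≤ ∑ x ∈ Box d (2*R+1), (EW (V ∩ Box d (2*R+1)) m x G + EW (V ∩ Box d (2*R+1)) m x
        (fun p => ind (∃ k ≤ m, ∃ i, (R:ℝ) ≤ |(p k i : ℝ) - p 0 i|))) :=
        Finset.sum_le_sum_of_subset_of_nonneg hsub fun x _ _ =>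
          add_nonneg (EW_nonneg hG) (EW_nonneg fun p => ind_nonneg _)
    _ ≤ _ := by
        rw [Finset.sum_add_distrib]
        have := box_max V (2*R+1) m hm (R:ℝ)
        push_cast at this
        have e : (2 * (2 * (R:ℝ) + 1) + 1) = 4 * R + 3 := by ring
        rw [e] at this
        linarith

lemma box_max_free [NeZero d] (V : Set (Pt d)) (R m : ℕ) (hm : 1 ≤ m) (lam : ℝ) (hl : lam ≤ R) :
    ∑ x ∈ Box d R, EW V m x
        (fun p => ind (∃ k ≤ m, ∃ i, lam ≤ |(p k i : ℝ) - p 0 i|))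
      ≤ 8 * d * (4*R+3)^d * errf lam m := by
  have h := box_transfer V R m hm (F := fun p => ind (∃ k ≤ m, ∃ i, lam ≤ |(p k i : ℝ) - p 0 i|))
    (G := fun p => ind (∃ k ≤ m, ∃ i, lam ≤ |(p k i : ℝ) - p 0 i|))
    (fun p => ind_le_one _) (fun p => ind_nonneg _) (fun p _ => le_rfl)
  have h2 := box_max V (2*R+1) m hm lam
  push_cast at h2
  have e : (2 * (2 * (R:ℝ) + 1) + 1) = 4 * R + 3 := by ring
  rw [e] at h2
  have h3 : errf R m ≤ errf lam m := by
    unfold errf; gcongr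
  have : 4 * d * (4*R+3)^d * errf R m ≤ 4 * d * (4*R+3)^d * errf lam m := by gcongr
  linarith


/-- Vertex-edge boundary size of `A` for the walk on `V`. -/
noncomputable def bdry (V : Set (Pt d)) (A : Finset (Pt d)) : ℝ :=
  ∑ x ∈ A, ∑ e : Dir d, ind (mv V x e ∉ A)

/-- Coarea inequality. -/
lemma coarea (V : Set (Pt d)) (B A0 : Finset (Pt d)) (h : ℝ)
    (hiso : ∀ A ⊆ A0, A.Nonempty → h * A.card ≤ bdry V A) (hAB : A0 ⊆ B)
    (g : Pt d → ℝ) (hg : ∀ x, 0 ≤ g x) (hs : ∀ x, g x ≠ 0 → x ∈ A0) :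
    h * ∑ x ∈ B, g x ≤ ∑ x ∈ B, ∑ e : Dir d, max (g x - g (mv V x e)) 0 := by
  classical
  induction hn : (A0.filter (fun x => g x ≠ 0)).card using Nat.strong_induction_on generalizing g with
  | _ n ih =>
  set A := A0.filter (fun x => g x ≠ 0) with hA
  have memA : ∀ x, x ∈ A ↔ g x ≠ 0 := fun x => by
    simp only [hA, Finset.mem_filter]; exact ⟨fun h => h.2, fun h => ⟨hs x h, h⟩⟩
  by_cases hne : A.Nonempty
  · obtain ⟨x0, hx0, hmin⟩ := Finset.exists_min_image A g hne
    set t := g x0 with ht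
    have htpos : 0 < t := lt_of_le_of_ne (hg x0) (Ne.symm ((memA x0).1 hx0))
    set g' : Pt d → ℝ := fun x => g x - t * ind (x ∈ A) with hg'
    have g'in : ∀ x ∈ A, g' x = g x - t := fun x hx => by simp [hg', ind_pos hx]
    have gout : ∀ x, x ∉ A → g x = 0 := fun x hx => by
      by_contra h; exact hx ((memA x).2 h)
    have g'out : ∀ x, x ∉ A → g' x = 0 := fun x hx => by simp [hg', ind_neg hx, gout x hx]
    have hg'0 : ∀ x, 0 ≤ g' x := fun x => by
      by_cases hx : x ∈ A
      · rw [g'in x hx]; linarith [hmin x hx]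
      · rw [g'out x hx]
    have hs' : ∀ x, g' x ≠ 0 → x ∈ A := fun x hx => by
      by_contra h; exact hx (g'out x h)
    have hcard : (A0.filter (fun x => g' x ≠ 0)).card < n := by
      rw [← hn]
      apply Finset.card_lt_card
      refine ⟨fun x hx => ?_, fun hsub => ?_⟩
      · exact hs' x (Finset.mem_filter.1 hx).2
      · have := (Finset.mem_filter.1 (hsub hx0)).2
        rw [g'in x0 hx0] at this; simp [ht] at this
    have hA0 : A ⊆ A0 := Finset.filter_subset _ _
    have IH := ih _ hcard g' hg'0 (fun x hx => hA0 (hs' x hx)) rfl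
    have hb := hiso A hA0 hne
    have hdec : ∀ x y, max (g x - g y) 0 = max (g' x - g' y) 0 + t * (ind (x ∈ A) * ind (y ∉ A)) := by
      intro x y
      by_cases hx : x ∈ A <;> by_cases hy : y ∈ A
      · rw [g'in x hx, g'in y hy, ind_neg (p := y ∉ A) (by simpa using hy)]; simp
      · rw [g'in x hx, g'out y hy, ind_pos hx, ind_pos hy, gout y hy]
        rw [max_eq_left (by linarith [hg x]), max_eq_left (by linarith [hmin x hx])]; ring
      · rw [g'out x hx, ind_neg hx, gout x hx]
        rw [max_eq_right (by linarith [hg y]), max_eq_right (by linarith [hg'0 y])]; ring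
      · rw [g'out x hx, ind_neg hx, gout x hx]
        rw [max_eq_right (by linarith [hg y]), max_eq_right (by linarith [hg'0 y])]; ring
    have hsum : ∑ x ∈ B, g x = ∑ x ∈ B, g' x + t * A.card := by
      have : ∀ x, g x = g' x + t * ind (x ∈ A) := fun x => by simp [hg']
      rw [Finset.sum_congr rfl fun x _ => this x, Finset.sum_add_distrib, ← Finset.mul_sum]
      congr 2
      rw [← Finset.sum_subset (hA0.trans hAB) (fun x _ hx => ind_neg hx),
        Finset.sum_congr rfl fun x hx => ind_pos hx]
      simp
    have hbd : ∑ x ∈ B, ∑ e : Dir d, ind (x ∈ A) * ind (mv V x e ∉ A) = bdry V A := by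
      unfold bdry
      rw [← Finset.sum_subset (hA0.trans hAB)]
      · refine Finset.sum_congr rfl fun x hx => Finset.sum_congr rfl fun e _ => ?_
        rw [ind_pos hx, one_mul]
      · intro x _ hx
        simp [ind_neg hx]
    simp only [hdec, Finset.sum_add_distrib, ← Finset.mul_sum]
    simp only [Finset.mul_sum] at hbd ⊢
    rw [← Finset.mul_sum, hsum]
    have hbd' : ∑ x ∈ B, ∑ e : Dir d, t * (ind (x ∈ A) * ind (mv V x e ∉ A)) = t * bdry V A := by
      rw [← hbd]; simp only [Finset.mul_sum]
    rw [hbd']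
    nlinarith
  · have : ∀ x, g x = 0 := fun x => by
      by_contra hx; exact hne ⟨x, (memA x).2 hx⟩
    simp [this]

/-- Dirichlet energy. -/
noncomputable def En (V : Set (Pt d)) (B : Finset (Pt d)) (f : Pt d → ℝ) : ℝ :=
  ∑ x ∈ B, av (fun e => (f (mv V x e) - f x) ^ 2)

lemma En_eq [NeZero d] (V : Set (Pt d)) (B : Finset (Pt d)) (hB : ∀ x ∈ V, x ∈ B) (f : Pt d → ℝ) :
    En V B f = 2 * (∑ x ∈ B, f x * f x - ∑ x ∈ B, QQ V f x * f x) := by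
  have h1 : ∀ x, av (fun e => (f (mv V x e) - f x) ^ 2)
      = QQ V (fun y => f y * f y) x - 2 * (QQ V f x * f x) + f x * f x := by
    intro x
    have : (fun e => (f (mv V x e) - f x) ^ 2)
      = fun e => (f (mv V x e) * f (mv V x e) - (2 * f x) * f (mv V x e)) + f x * f x := by
      ext; ring
    rw [this, av_add, av_sub, av_mul, av_const]; simp only [QQ]; ring
  simp only [En, h1, Finset.sum_add_distrib, Finset.sum_sub_distrib, sum_QQ V B hB,
    ← Finset.mul_sum]
  ring

/-- Cheeger inequality. -/
lemma cheeger [NeZero d] (V : Set (Pt d)) (B A0 : Finset (Pt d)) (hB : ∀ x ∈ V, x ∈ B) (h : ℝ)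
    (hh : 0 ≤ h) (hiso : ∀ A ⊆ A0, A.Nonempty → h * A.card ≤ bdry V A) (hAB : A0 ⊆ B)
    (f : Pt d → ℝ) (hs : ∀ x, f x ≠ 0 → x ∈ A0) :
    h ^ 2 * ∑ x ∈ B, f x ^ 2 ≤ 16 * d ^ 2 * En V B f := by
  have hco := coarea V B A0 h hiso hAB (fun x => f x ^ 2) (fun x => sq_nonneg _)
    (fun x hx => hs x (by intro h0; simp [h0] at hx))
  set N := ∑ x ∈ B, f x ^ 2 with hN
  have hN0 : 0 ≤ N := Finset.sum_nonneg fun x _ => sq_nonneg _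
  have hEn : ∑ x ∈ B, ∑ e : Dir d, (f (mv V x e) - f x) ^ 2 = 2 * d * En V B f := by
    have hd0 : (2 * d : ℝ) ≠ 0 := by have := NeZero.ne d; positivity
    simp only [En, av, smul_eq_mul, ← Finset.mul_sum]
    rw [mul_inv_cancel_left₀ hd0]
  have hsum2 : ∑ x ∈ B, ∑ e : Dir d, (f (mv V x e) + f x) ^ 2 ≤ 8 * d * N := by
    have h1 : ∑ x ∈ B, ∑ e : Dir d, f (mv V x e) ^ 2 = 2 * d * N := by
      have := sum_QQ V B hB (fun y => f y ^ 2)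
      have hd0 : (2 * d : ℝ) ≠ 0 := by have := NeZero.ne d; positivity
      simp only [QQ, av, smul_eq_mul, ← Finset.mul_sum] at this
      rw [hN, ← this, mul_inv_cancel_left₀ hd0]
    have h2 : ∑ x ∈ B, ∑ e : Dir d, f x ^ 2 = 2 * d * N := by
      simp only [Finset.sum_const, Finset.card_univ, Fintype.card_prod, Fintype.card_fin,
        Fintype.card_bool, nsmul_eq_mul, ← Finset.mul_sum]
      push_cast; ring
    calc _ ≤ ∑ x ∈ B, ∑ e : Dir d, (2 * f (mv V x e) ^ 2 + 2 * f x ^ 2) :=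
          Finset.sum_le_sum fun x _ => Finset.sum_le_sum fun e _ => by
            nlinarith [sq_nonneg (f (mv V x e) - f x)]
      _ = _ := by
          simp only [Finset.sum_add_distrib, ← Finset.mul_sum] at h1 h2 ⊢
          rw [h1, h2]; ring
  have hCS : (∑ x ∈ B, ∑ e : Dir d, max (f x ^ 2 - f (mv V x e) ^ 2) 0) ^ 2
      ≤ (∑ x ∈ B, ∑ e : Dir d, (f (mv V x e) - f x) ^ 2) *
        ∑ x ∈ B, ∑ e : Dir d, (f (mv V x e) + f x) ^ 2 := by
    simp only [← Finset.sum_product']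
    calc _ ≤ (∑ q ∈ B ×ˢ (Finset.univ : Finset (Dir d)),
          |f (mv V q.1 q.2) - f q.1| * |f (mv V q.1 q.2) + f q.1|) ^ 2 := by
          gcongr with q _
          rw [← abs_mul]
          refine max_le ?_ (abs_nonneg _)
          rw [show (f (mv V q.1 q.2) - f q.1) * (f (mv V q.1 q.2) + f q.1)
            = - (f q.1 ^ 2 - f (mv V q.1 q.2) ^ 2) by ring, abs_neg]
          exact le_abs_self _
      _ ≤ _ := by
          refine (Finset.sum_mul_sq_le_sq_mul_sq _ _ _).trans ?_
          simp only [sq_abs]; exact le_rfl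
  have h4 : (h * N) ^ 2 ≤ (2 * d * En V B f) * (8 * d * N) := by
    calc _ ≤ (∑ x ∈ B, ∑ e : Dir d, max (f x ^ 2 - f (mv V x e) ^ 2) 0) ^ 2 := by
          apply pow_le_pow_left₀ (by positivity) hco
      _ ≤ _ := hCS
      _ ≤ _ := by
          rw [hEn]
          have : 0 ≤ 2 * d * En V B f := by
            rw [← hEn]; exact Finset.sum_nonneg fun x _ => Finset.sum_nonneg fun e _ => sq_nonneg _
          gcongr
  rcases eq_or_lt_of_le hN0 with h0 | h0
  · rw [← h0, mul_zero]
    have : 0 ≤ En V B f := Finset.sum_nonneg fun x _ => av_nonneg fun e => sq_nonneg _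
    positivity
  · have : N * (h^2 * N) ≤ N * (16 * d^2 * En V B f) := by nlinarith
    exact le_of_mul_le_mul_left this h0

/-- Faber–Krahn type inequality. -/
lemma faber [NeZero d] (V : Set (Pt d)) (B : Finset (Pt d)) (hB : ∀ x ∈ V, x ∈ B) (h : ℝ) (hh : 0 ≤ h)
    (v : Pt d → ℝ) (hv : ∀ x, 0 ≤ v x) (hsupp : ∀ x, v x ≠ 0 → x ∈ B) (h1 : ∑ x ∈ B, v x = 1)
    (hiso : ∀ A : Finset (Pt d), (∀ x ∈ A, 0 < v x) → A.Nonempty →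
      (A.card : ℝ) * ∑ x ∈ B, v x ^ 2 ≤ 4 → h * A.card ≤ bdry V A) :
    h ^ 2 * ∑ x ∈ B, v x ^ 2 ≤ 32 * d ^ 2 * En V B v := by
  classical
  set w := ∑ x ∈ B, v x ^ 2 with hw
  have hwpos : 0 < w := by
    obtain ⟨x, hx, hx'⟩ := Finset.exists_ne_zero_of_sum_ne_zero (s := B) (f := v) (by rw [h1]; norm_num)
    exact Finset.sum_pos' (fun x _ => sq_nonneg _) ⟨x, hx, by positivity⟩
  set s := w / 4 with hs
  have hspos : 0 < s := by positivity
  set f : Pt d → ℝ := fun x => max (v x - s) 0 with hf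
  set A0 := B.filter (fun x => s < v x) with hA0
  have hcard : (A0.card : ℝ) * w ≤ 4 := by
    have : (A0.card : ℝ) * s ≤ 1 := by
      rw [← h1]
      calc (A0.card : ℝ) * s = ∑ _x ∈ A0, s := by simp
        _ ≤ ∑ x ∈ A0, v x := Finset.sum_le_sum fun x hx => (Finset.mem_filter.1 hx).2.le
        _ ≤ _ := Finset.sum_le_sum_of_subset_of_nonneg (Finset.filter_subset _ _) fun x _ _ => hv x
    rw [hs] at this; linarith
  have hch := cheeger V B A0 hB h hh (fun A hA hne => by
    refine hiso A (fun x hx => hspos.trans (Finset.mem_filter.1 (hA hx)).2) hne ?_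
    have : (A.card : ℝ) ≤ A0.card := by exact_mod_cast Finset.card_le_card hA
    nlinarith) (Finset.filter_subset _ _) f (fun x hx => by
      have hlt : s < v x := by
        by_contra hc; push Not at hc
        exact hx (by simp only [hf]; exact max_eq_right (by linarith))
      exact Finset.mem_filter.2 ⟨hsupp x (by linarith [hspos] : v x > 0).ne', hlt⟩)
  have hf2 : w / 2 ≤ ∑ x ∈ B, f x ^ 2 := by
    calc w / 2 = ∑ x ∈ B, (v x ^ 2 - 2 * s * v x) := by
          rw [Finset.sum_sub_distrib, ← Finset.mul_sum, h1, ← hw, hs]; ring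
      _ ≤ _ := Finset.sum_le_sum fun x _ => by
          simp only [hf]
          rcases le_total (v x - s) 0 with hc | hc
          · rw [max_eq_right hc]; nlinarith [hv x]
          · rw [max_eq_left hc]; nlinarith
  have hEn : En V B f ≤ En V B v := by
    refine Finset.sum_le_sum fun x _ => av_mono fun e => ?_
    have := abs_max_sub_max_le_abs (v (mv V x e) - s) (v x - s) 0
    rw [sub_sub_sub_cancel_right] at this
    exact sq_le_sq.2 this
  have hd0 : (0:ℝ) ≤ 16 * d^2 := by positivity
  have h5 : h^2 * (w/2) ≤ h^2 * ∑ x ∈ B, f x ^ 2 := by gcongr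
  have h6 := mul_le_mul_of_nonneg_left hEn hd0
  linarith


lemma decay_aux (n : ℕ) (hn : 1 ≤ n) (c : ℝ) (hc : 0 < c) (hc1 : c ≤ 1) (y : ℕ → ℝ) (hy0 : 1 ≤ y 0)
    (hy : ∀ j < n, y j + c * min 1 (y j * (n:ℝ) ^ (-(2:ℝ)/3)) ≤ y (j+1)) :
    c ^ 3 / 384 * n ≤ y n := by
  have hn' : (1:ℝ) ≤ n := by exact_mod_cast hn
  have hn0 : (0:ℝ) < n := by linarith
  set β := c * (n:ℝ) ^ (-(2:ℝ)/3) with hβ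
  have hr0 : 0 < (n:ℝ) ^ (-(2:ℝ)/3) := Real.rpow_pos_of_pos hn0 _
  have hr1 : (n:ℝ) ^ (-(2:ℝ)/3) ≤ 1 := Real.rpow_le_one_of_one_le_of_nonpos hn' (by norm_num)
  have hy1 : ∀ j ≤ n, 1 ≤ y j := by
    intro j hj
    induction j with
    | zero => exact hy0
    | succ j ih =>
      have h1 := ih (by omega)
      have h2 := hy j (by omega)
      have : 0 ≤ min 1 (y j * (n:ℝ) ^ (-(2:ℝ)/3)) := le_min (by norm_num) (by positivity)
      nlinarith
  have hmono : ∀ i j, i ≤ j → j ≤ n → y i ≤ y j := by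
    intro i j hij hj
    induction j, hij using Nat.le_induction with
    | base => exact le_rfl
    | succ j hij ih =>
      have h2 := hy j (by omega)
      have h1 := hy1 j (by omega)
      have : 0 ≤ min 1 (y j * (n:ℝ) ^ (-(2:ℝ)/3)) := le_min (by norm_num) (by positivity)
      nlinarith [ih (by omega)]
  set h := (n+1)/2 with hh
  have hhn : h ≤ n := by omega
  have hc3 : c ^ 3 ≤ c := by nlinarith [pow_le_one₀ hc.le hc1 (n := 2), sq_nonneg c]
  by_cases hcase : 1 ≤ y h * (n:ℝ) ^ (-(2:ℝ)/3)
  · have lin : ∀ j, h ≤ j → j ≤ n → y h + c * (j - h) ≤ y j := by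
      intro j hij hj
      induction j, hij using Nat.le_induction with
      | base => simp
      | succ j hij ih =>
        have h2 := hy j (by omega)
        have h3 := hmono h j hij (by omega)
        rw [min_eq_left (by nlinarith)] at h2
        push_cast
        linarith [ih (by omega)]
    have h4 := lin n hhn le_rfl
    have h5 := hy1 h hhn
    have h6 : (2:ℝ) * h ≤ n + 1 := by
      have : 2 * h ≤ n + 1 := by omega
      exact_mod_cast this
    nlinarith
  · push Not at hcase
    have geo : ∀ j ≤ h, (1 + β) ^ j ≤ y j := by
      intro j hj
      induction j with
      | zero => simpa using hy0
      | succ j ih =>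
        have h2 := hy j (by omega)
        have h3 := hmono j h (by omega) hhn
        rw [min_eq_right (by nlinarith)] at h2
        calc (1 + β)^(j+1) = (1+β)^j * (1+β) := pow_succ _ _
          _ ≤ y j * (1 + β) := by
              have : 0 ≤ β := by positivity
              gcongr; exact ih (by omega)
          _ = y j + c * (y j * (n:ℝ) ^ (-(2:ℝ)/3)) := by rw [hβ]; ring
          _ ≤ _ := h2
    have hβ0 : 0 < β := by positivity
    have hβ1 : β ≤ 1 := by rw [hβ]; nlinarith
    have e1 : Real.exp (β/2) ≤ 1 + β := by
      have := (abs_le.1 (Real.abs_exp_sub_one_sub_id_le (x := β/2) (by rw [abs_of_pos] <;> linarith))).2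
      nlinarith
    have e2 : Real.exp (h * (β/2)) ≤ y h := by
      rw [Real.exp_nat_mul]
      exact (pow_le_pow_left₀ (Real.exp_nonneg _) e1 h).trans (geo h le_rfl)
    have e3 : (h * (β/2)) ^ 3 / 6 ≤ Real.exp (h * (β/2)) := by
      have := Real.pow_div_factorial_le_exp (h * (β/2)) (by positivity) 3
      simpa [Nat.factorial] using this
    have h6 : (n:ℝ) / 2 ≤ h := by
      have : n ≤ 2 * h := by omega
      have : (n:ℝ) ≤ 2 * h := by exact_mod_cast this
      linarith
    have e4 : ((n:ℝ)/2 * (β/2)) ^ 3 = c^3 / 64 * n := by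
      have : ((n:ℝ) ^ (-(2:ℝ)/3))^3 = (n:ℝ)^(-2:ℝ) := by
        rw [← Real.rpow_natCast, ← Real.rpow_mul hn0.le]; norm_num
      have h2 : (n:ℝ)^(-2:ℝ) = ((n:ℝ)^2)⁻¹ := by
        rw [Real.rpow_neg hn0.le]; norm_num
      rw [hβ]
      calc _ = c^3 / 64 * ((n:ℝ)^3 * ((n:ℝ) ^ (-(2:ℝ)/3))^3) := by ring
        _ = _ := by rw [this, h2]; field_simp
    have e5 : ((n:ℝ)/2 * (β/2)) ^ 3 ≤ (h * (β/2)) ^ 3 := by gcongr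
    have := hmono h n hhn le_rfl
    rw [e4] at e5
    linarith

lemma decay (d : ℕ) (hd : 2 ≤ d) (n : ℕ) (hn : 1 ≤ n) (c : ℝ) (hc : 0 < c) (hc1 : c ≤ 1)
    (u : ℕ → ℝ) (hu : ∀ j, 0 < u j) (hu0 : u 0 ≤ 1)
    (hdec : ∀ j < n, c * min (u j ^ ((2:ℝ)/d)) ((n:ℝ) ^ (-(2:ℝ)/3)) * u j ≤ u j - u (j+1)) :
    u n ≤ ((2/d * c) ^ 3 / 384 * n) ^ (-(d:ℝ)/2) := by
  have hd' : (2:ℝ) ≤ d := by exact_mod_cast hd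
  have hd0 : (0:ℝ) < d := by linarith
  have hn' : (1:ℝ) ≤ n := by exact_mod_cast hn
  have hn0 : (0:ℝ) < n := by linarith
  set α := (2:ℝ)/d with hα
  have hα0 : 0 < α := by positivity
  have hα1 : α ≤ 1 := by rw [hα, div_le_one hd0]; exact hd'
  set y : ℕ → ℝ := fun j => u j ^ (-α) with hy
  have hypos : ∀ j, 0 < y j := fun j => Real.rpow_pos_of_pos (hu j) _
  have hinv : ∀ j, u j ^ α = (y j)⁻¹ := fun j => by
    simp only [hy]; rw [Real.rpow_neg (hu j).le, inv_inv]
  have main := decay_aux n hn (α * c) (by positivity) (by nlinarith) y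
    (Real.one_le_rpow_of_pos_of_le_one_of_nonpos (hu 0) hu0 (by linarith)) (fun j hj => by
      have h1 := hdec j hj
      set θ := c * min (u j ^ α) ((n:ℝ) ^ (-(2:ℝ)/3)) with hθ
      have h2 : u (j+1) ≤ u j * Real.exp (-θ) := by
        have := Real.add_one_le_exp (-θ)
        nlinarith [hu j]
      have h3 : y j * Real.exp (α * θ) ≤ y (j+1) := by
        calc _ = (u j * Real.exp (-θ)) ^ (-α) := by
              rw [Real.mul_rpow (hu j).le (Real.exp_nonneg _), ← Real.exp_mul]; congr 2; ring
          _ ≤ _ := Real.rpow_le_rpow_of_nonpos (hu _) h2 (by linarith)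
      have h4 := Real.add_one_le_exp (α * θ)
      have h5 : y j * θ = c * min 1 (y j * (n:ℝ) ^ (-(2:ℝ)/3)) := by
        rw [hθ, hinv, mul_left_comm, mul_min_of_nonneg _ _ (hypos j).le, mul_inv_cancel₀ (hypos j).ne']
      nlinarith [hypos j])
  have hb : 0 < (α * c)^3 / 384 * n := by positivity
  have : u n = (y n) ^ (-(d:ℝ)/2) := by
    simp only [hy]
    rw [← Real.rpow_mul (hu n).le, hα]
    rw [show -(2/(d:ℝ)) * (-(d:ℝ)/2) = 1 by field_simp, Real.rpow_one]
  rw [this]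
  exact Real.rpow_le_rpow_of_nonpos hb main (by linarith)

/-- Heat kernel at the origin. -/
noncomputable def pk (V : Set (Pt d)) (k : ℕ) : Pt d → ℝ := (QQ V)^[k] (fun y => ind (y = 0))

lemma pk_succ (V : Set (Pt d)) (k : ℕ) (x : Pt d) : pk V (k+1) x = QQ V (pk V k) x := by
  simp only [pk, Function.iterate_succ_apply']

lemma pk_nonneg (V : Set (Pt d)) (k : ℕ) (x : Pt d) : 0 ≤ pk V k x := by
  induction k generalizing x with
  | zero => exact ind_nonneg _
  | succ k ih => rw [pk_succ]; exact av_nonneg fun e => ih _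

lemma QQ_iter_symm (V : Set (Pt d)) (B : Finset (Pt d)) (hB : ∀ x ∈ V, x ∈ B) (u v : Pt d → ℝ) (k : ℕ) :
    ∑ x ∈ B, ((QQ V)^[k] u) x * v x = ∑ x ∈ B, u x * ((QQ V)^[k] v) x := by
  induction k generalizing u with
  | zero => rfl
  | succ k ih =>
    rw [Function.iterate_succ_apply, ih, QQ_symm V B hB]
    simp only [Function.iterate_succ_apply']

lemma sum_delta (B : Finset (Pt d)) (h0 : (0 : Pt d) ∈ B) (v : Pt d → ℝ) :
    ∑ x ∈ B, ind (x = 0) * v x = v 0 := by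
  rw [Finset.sum_eq_single_of_mem 0 h0]
  · rw [ind_pos rfl, one_mul]
  · intro x _ hx; rw [ind_neg hx, zero_mul]

lemma QQ_iter_zero (V : Set (Pt d)) (B : Finset (Pt d)) (hB : ∀ x ∈ V, x ∈ B)
    (h0 : (0 : Pt d) ∈ B) (v : Pt d → ℝ) (k : ℕ) :
    ((QQ V)^[k] v) 0 = ∑ x ∈ B, pk V k x * v x := by
  rw [pk, QQ_iter_symm V B hB, sum_delta B h0]

lemma pk_inner (V : Set (Pt d)) (B : Finset (Pt d)) (hB : ∀ x ∈ V, x ∈ B)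
    (h0 : (0 : Pt d) ∈ B) (i j : ℕ) :
    ∑ x ∈ B, pk V i x * pk V j x = pk V (i+j) 0 := by
  rw [← QQ_iter_zero V B hB h0 (pk V j) i, pk, pk, ← Function.iterate_add_apply]

lemma sum_pk [NeZero d] (V : Set (Pt d)) (B : Finset (Pt d)) (hB : ∀ x ∈ V, x ∈ B)
    (h0 : (0 : Pt d) ∈ B) (k : ℕ) : ∑ x ∈ B, pk V k x = 1 := by
  rw [pk, sum_QQ_iter V B hB]
  simpa using sum_delta B h0 (fun _ => 1)

lemma pk_supp [NeZero d] (V : Set (Pt d)) (B : Finset (Pt d)) (hB : ∀ x ∈ V, x ∈ B)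
    (h0 : (0 : Pt d) ∈ B) (k : ℕ) (x : Pt d) (hx : x ∉ B) : pk V k x = 0 := by
  induction k with
  | zero => exact ind_neg (fun h => hx (h ▸ h0))
  | succ k ih =>
    rw [pk_succ]
    have : ∀ e, mv V x e = x := fun e => by
      unfold mv; rw [if_neg]; exact fun h => hx (hB _ h.1)
    simp only [QQ, this, av_const, ih]

lemma HK_fin [NeZero d] (hd : 2 ≤ d) (ι : ℝ) (hι : 0 < ι) :
    ∃ C : ℝ, 0 < C ∧ ∀ (V : Set (Pt d)) (B : Finset (Pt d)) (_ : ∀ x ∈ V, x ∈ B)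
    (_ : (0 : Pt d) ∈ B) (n : ℕ) (_ : 1 ≤ n)
    (_ : ∀ A : Finset (Pt d), A.Nonempty → (∀ x ∈ A, ∃ j ≤ n, 0 < pk V j x) →
      1 ≤ bdry V A ∧ ((n:ℝ) ^ ((1:ℝ)/3) ≤ A.card → ι * (A.card : ℝ) ^ (((d:ℝ)-1)/d) ≤ bdry V A)),
    pk V (2*n) 0 ≤ C * (n:ℝ) ^ (-(d:ℝ)/2) := by
  have hd' : (2:ℝ) ≤ d := by exact_mod_cast hd
  have hd0 : (0:ℝ) < d := by linarith
  set c := min (ι^2/8) 1 / (64 * (d:ℝ)^2) with hc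
  have hcpos : 0 < c := by
    have : 0 < min (ι^2/8) 1 := lt_min (by positivity) one_pos
    positivity
  have hc1 : c ≤ 1 := by
    rw [hc, div_le_one (by positivity)]
    refine (min_le_right _ _).trans ?_
    nlinarith
  set κ := (2/d * c) ^ 3 / 384 with hκ
  have hκ0 : 0 < κ := by positivity
  refine ⟨2 * κ ^ (-(d:ℝ)/2), by positivity, ?_⟩
  intro V B hB h0 n hn hiso
  have hn' : (1:ℝ) ≤ n := by exact_mod_cast hn
  have hn0 : (0:ℝ) < n := by linarith
  set a : ℕ → ℝ := fun k => pk V k 0 with ha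
  have ha0 : ∀ k, 0 ≤ a k := fun k => pk_nonneg V k 0
  have hpos2 : ∀ j, 0 < a (2*j) := by
    intro j
    have h1 : a (2*j) = ∑ x ∈ B, pk V j x * pk V j x := by rw [pk_inner V B hB h0, two_mul]
    rw [h1]
    obtain ⟨x, hx, hx'⟩ := Finset.exists_ne_zero_of_sum_ne_zero (s := B) (f := pk V j)
      (by rw [sum_pk V B hB h0]; norm_num)
    exact Finset.sum_pos' (fun x _ => mul_self_nonneg _) ⟨x, hx, mul_self_pos.2 hx'⟩
  set u : ℕ → ℝ := fun j => (a (2*j) + a (2*j+1))/2 with hu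
  have hupos : ∀ j, 0 < u j := fun j => by
    have := hpos2 j; have := ha0 (2*j+1); simp only [hu]; linarith
  have hle1 : ∀ k, a k ≤ 1 := fun k => by
    rw [← sum_pk V B hB h0 k]
    exact Finset.single_le_sum (f := pk V k) (fun x _ => pk_nonneg V k x) h0
  have hdec : ∀ j < n, c * min (u j ^ ((2:ℝ)/d)) ((n:ℝ) ^ (-(2:ℝ)/3)) * u j ≤ u j - u (j+1) := by
    intro j hj
    set v : Pt d → ℝ := fun x => (pk V j x + pk V (j+1) x)/2 with hv
    have hvQ : ∀ x, QQ V v x = (pk V (j+1) x + pk V (j+2) x)/2 := by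
      intro x
      rw [pk_succ V (j+1), pk_succ V j]
      simp only [QQ, hv, div_eq_inv_mul, av_add, av_mul]
    set w := ∑ x ∈ B, v x ^ 2 with hw
    have hin := pk_inner V B hB h0
    have hw' : w = (a (2*j) + 2 * a (2*j+1) + a (2*j+2))/4 := by
      have e : ∀ x, v x ^ 2 = (pk V j x * pk V j x + 2 * (pk V j x * pk V (j+1) x)
        + pk V (j+1) x * pk V (j+1) x)/4 := fun x => by simp only [hv]; ring
      rw [hw, Finset.sum_congr rfl fun x _ => e x, ← Finset.sum_div]
      simp only [Finset.sum_add_distrib, ← Finset.mul_sum, hin, ha]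
      rw [show j + j = 2*j by ring, show j + (j+1) = 2*j+1 by ring, show j+1+(j+1) = 2*j+2 by ring]
    have hEn : En V B v = u j - u (j+1) := by
      rw [En_eq V B hB]
      have e1 : ∑ x ∈ B, v x * v x = w := by rw [hw]; simp only [sq]
      have e2 : ∑ x ∈ B, QQ V v x * v x = (a (2*j+1) + 2 * 0 + a (2*j+2) + a (2*j+2) + a (2*j+3))/4 := by
        have e : ∀ x, QQ V v x * v x = (pk V (j+1) x * pk V j x + pk V (j+1) x * pk V (j+1) x
          + pk V (j+2) x * pk V j x + pk V (j+2) x * pk V (j+1) x)/4 := fun x => by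
          rw [hvQ]; simp only [hv]; ring
        rw [Finset.sum_congr rfl fun x _ => e x, ← Finset.sum_div]
        simp only [Finset.sum_add_distrib, hin, ha]
        rw [show j + 1 + j = 2*j+1 by ring, show j+1+(j+1) = 2*j+2 by ring,
          show j+2+j = 2*j+2 by ring, show j+2+(j+1) = 2*j+3 by ring]; ring
      rw [e1, e2, hw']
      simp only [hu]
      rw [show 2*(j+1) = 2*j+2 by ring]; ring_nf
    have hwu : u j / 2 ≤ w := by
      rw [hw']; simp only [hu]; linarith [ha0 (2*j+1), ha0 (2*j+2)]
    have hwpos : 0 < w := by linarith [hupos j]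
    set h := min (ι * (w/4) ^ ((1:ℝ)/d)) ((n:ℝ) ^ (-(1:ℝ)/3)) with hh
    have hh0 : 0 ≤ h := le_min (by positivity) (by positivity)
    have hfab := faber V B hB h hh0 v
      (fun x => by have := pk_nonneg V j x; have := pk_nonneg V (j+1) x; simp only [hv]; linarith)
      (fun x hx => by
        by_contra hxB
        exact hx (by simp only [hv, pk_supp V B hB h0 _ x hxB]; norm_num))
      (by
        simp only [hv, ← Finset.sum_div, Finset.sum_add_distrib, sum_pk V B hB h0]; norm_num)
      (fun A hA hne hAw => by
        obtain ⟨i1, i2⟩ := hiso A hne (fun x hx => by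
          have := hA x hx
          simp only [hv] at this
          by_cases hp : 0 < pk V j x
          · exact ⟨j, hj.le, hp⟩
          · exact ⟨j+1, hj, by linarith⟩)
        have hAc : (0:ℝ) < A.card := by exact_mod_cast hne.card_pos
        by_cases hbig : (n:ℝ) ^ ((1:ℝ)/3) ≤ A.card
        · refine le_trans ?_ (i2 hbig)
          have : (w/4) ^ ((1:ℝ)/d) ≤ ((A.card:ℝ)⁻¹) ^ ((1:ℝ)/d) := by
            apply Real.rpow_le_rpow (by positivity) _ (by positivity)
            rw [le_inv_comm₀ (by positivity) hAc, inv_div, le_div_iff₀ hwpos]; exact hAw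
          calc h * A.card ≤ ι * ((A.card:ℝ)⁻¹) ^ ((1:ℝ)/d) * A.card := by
                gcongr
                exact (min_le_left _ _).trans (by gcongr)
            _ = ι * (A.card : ℝ) ^ (((d:ℝ)-1)/d) := by
                rw [Real.inv_rpow hAc.le, ← Real.rpow_neg hAc.le, mul_assoc]
                congr 1
                conv_lhs => rw [← Real.rpow_one (A.card:ℝ), ← Real.rpow_mul hAc.le, ← Real.rpow_add hAc]
                congr 1; field_simp; ring
        · push Not at hbig
          refine le_trans ?_ i1
          calc h * A.card ≤ (n:ℝ) ^ (-(1:ℝ)/3) * (n:ℝ) ^ ((1:ℝ)/3) := by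
                gcongr; exact min_le_right _ _
            _ = 1 := by rw [← Real.rpow_add hn0]; norm_num)
    rw [hEn, ← hw] at hfab
    -- lower bound for h^2
    have hup := hupos j
    have hh2 : min (ι^2/8) 1 * min (u j ^ ((2:ℝ)/d)) ((n:ℝ) ^ (-(2:ℝ)/3)) ≤ h ^ 2 := by
      have q1 : u j ^ ((2:ℝ)/d) / 8 ≤ ((w/4) ^ ((1:ℝ)/d)) ^ 2 := by
        have : ((w/4) ^ ((1:ℝ)/d)) ^ 2 = (w/4) ^ ((2:ℝ)/d) := by
          rw [← Real.rpow_natCast, ← Real.rpow_mul (by positivity)]; congr 1; push_cast; ring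
        rw [this]
        calc _ ≤ (u j/8) ^ ((2:ℝ)/d) := by
              rw [Real.div_rpow hup.le (by norm_num)]
              gcongr
              calc (8:ℝ) ^ ((2:ℝ)/d) ≤ 8 ^ (1:ℝ) := Real.rpow_le_rpow_of_exponent_le (by norm_num)
                    (by rw [div_le_one hd0]; exact hd')
                _ = 8 := Real.rpow_one _
          _ ≤ _ := Real.rpow_le_rpow (by positivity) (by linarith) (by positivity)
      have q2 : ((n:ℝ) ^ (-(1:ℝ)/3)) ^ 2 = (n:ℝ) ^ (-(2:ℝ)/3) := by
        rw [← Real.rpow_natCast, ← Real.rpow_mul hn0.le]; norm_num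
      have hm1 : 0 ≤ min (ι^2/8) 1 := le_min (by positivity) (by norm_num)
      have hu' : 0 ≤ u j ^ ((2:ℝ)/d) := by positivity
      have hn2 : 0 ≤ (n:ℝ) ^ (-(2:ℝ)/3) := by positivity
      rw [hh]
      rcases min_choice (ι * (w/4) ^ ((1:ℝ)/d)) ((n:ℝ) ^ (-(1:ℝ)/3)) with hc | hc
      · rw [hc, mul_pow]
        calc _ ≤ (ι^2/8) * u j ^ ((2:ℝ)/d) := by
              gcongr
              · exact min_le_left _ _
              · exact min_le_left _ _
          _ = ι^2 * (u j ^ ((2:ℝ)/d)/8) := by ring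
          _ ≤ _ := by gcongr
      · rw [hc, q2]
        calc _ ≤ 1 * (n:ℝ) ^ (-(2:ℝ)/3) := by
              gcongr
              · exact min_le_right _ _
              · exact min_le_right _ _
          _ = _ := one_mul _
    rw [hc]
    set mm := min (ι^2/8) 1 * min (u j ^ ((2:ℝ)/d)) ((n:ℝ) ^ (-(2:ℝ)/3)) with hmm
    have hmm0 : 0 ≤ mm := by
      refine mul_nonneg (le_min (by positivity) (by norm_num)) (le_min ?_ (by positivity))
      positivity
    have step1 : mm * (u j / 2) ≤ h^2 * w := by
      apply mul_le_mul hh2 hwu (by positivity) (by positivity)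
    have hD : (0:ℝ) < 64 * (d:ℝ)^2 := by positivity
    calc _ = mm * u j / (64 * (d:ℝ)^2) := by rw [hmm]; ring
      _ ≤ _ := by rw [div_le_iff₀ hD]; linarith
  have hfin := decay d hd n hn c hcpos hc1 u hupos
    (by simp only [hu]; linarith [hle1 (2*0), hle1 (2*0+1)]) hdec
  rw [← hκ, Real.mul_rpow hκ0.le hn0.le] at hfin
  have : a (2*n) ≤ 2 * u n := by simp only [hu]; linarith [ha0 (2*n+1)]
  calc pk V (2*n) 0 = a (2*n) := rfl
    _ ≤ _ := this
    _ ≤ _ := by linarith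


lemma adj_iff {x y : Pt d} : adj x y ↔ ∃ e : Dir d, y = x + vec e := by
  constructor
  · intro h
    unfold adj dist1 at h
    have hex : ∃ i, (x i - y i).natAbs ≠ 0 := by
      by_contra hc
      push Not at hc
      rw [Finset.sum_eq_zero (fun i _ => hc i)] at h
      omega
    obtain ⟨i, hi⟩ := hex
    rw [← Finset.add_sum_erase _ _ (Finset.mem_univ i)] at h
    have h0 : ∑ j ∈ Finset.univ.erase i, (x j - y j).natAbs = 0 := by omega
    have h1 : (x i - y i).natAbs = 1 := by omega
    have h2 : ∀ j, j ≠ i → y j = x j := by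
      intro j hj
      have := Finset.sum_eq_zero_iff.1 h0 j (by simp [hj])
      omega
    rcases (by omega : y i = x i + 1 ∨ y i = x i + -1) with h3 | h3
    · refine ⟨(i, true), ?_⟩
      ext j
      by_cases hj : j = i
      · subst hj; simp [vec, h3]
      · simp [vec, hj, h2 j hj]
    · refine ⟨(i, false), ?_⟩
      ext j
      by_cases hj : j = i
      · subst hj; simp [vec, h3]
      · simp [vec, hj, h2 j hj]
  · rintro ⟨⟨i, b⟩, rfl⟩
    unfold adj dist1
    rw [← Finset.add_sum_erase _ _ (Finset.mem_univ i), Finset.sum_eq_zero]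
    · cases b <;> simp [vec]
    · intro j hj
      have : j ≠ i := by simpa using hj
      simp [vec, this]

lemma adj_symm {x y : Pt d} (h : adj x y) : adj y x := by
  obtain ⟨e, rfl⟩ := adj_iff.1 h
  exact adj_iff.2 ⟨opp e, by rw [vec_opp]; abel⟩

lemma conn_symm {T : Set (Pt d)} {x y : Pt d} (h : connIn T x y) : connIn T y x := by
  obtain ⟨hx, hy, h⟩ := h
  refine ⟨hy, hx, ?_⟩
  induction h with
  | refl => exact Relation.ReflTransGen.refl
  | tail h1 h2 ih => exact Relation.ReflTransGen.head ⟨adj_symm h2.1, h2.2.2, h2.2.1⟩ (ih h2.2.1)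

lemma conn_trans {T : Set (Pt d)} {x y z : Pt d} (h : connIn T x y) (h' : connIn T y z) :
    connIn T x z := ⟨h.1, h'.2.1, h.2.2.trans h'.2.2⟩

lemma Sinf_of_conn {ω : Config d} {x y : Pt d} (hx : x ∈ Sinf ω) (h : connIn (SS ω) x y) :
    y ∈ Sinf ω := by
  refine ⟨h.2.1, ?_⟩
  have : cluster (SS ω) x ⊆ cluster (SS ω) y := fun z hz => conn_trans (conn_symm h) hz
  exact hx.2.mono this

lemma Sinf_nbr {ω : Config d} {x : Pt d} (hx : x ∈ Sinf ω) {y : Pt d} (h : adj x y) (hy : y ∈ SS ω) :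
    y ∈ Sinf ω :=
  Sinf_of_conn hx ⟨hx.1, hy, Relation.ReflTransGen.single ⟨h, hx.1, hy⟩⟩

lemma mem_Box_mv {V : Set (Pt d)} {x : Pt d} {r : ℕ} (hx : x ∈ Box d r) (e : Dir d) :
    mv V x e ∈ Box d (r+1) := by
  rw [mem_Box] at *
  intro i
  have := hx i
  have h2 := vec_abs_le e i
  unfold mv
  split_ifs
  · simp only [Pi.add_apply]; push_cast
    calc _ ≤ |x i| + |vec e i| := abs_add_le _ _
      _ ≤ _ := by omega
  · push_cast; omega

lemma mv_inter {V : Set (Pt d)} {x : Pt d} {r N : ℕ} (hx : x ∈ Box d r) (h : r + 1 ≤ N) (e : Dir d) :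
    mv (V ∩ Box d N) x e = mv V x e := by
  have h1 : x ∈ Box d N := Box_mono (by omega) hx
  by_cases hc : x ∈ V ∧ x + vec e ∈ V
  · have h2 : mv V x e = x + vec e := by unfold mv; rw [if_pos hc]
    have h3 := Box_mono h (mem_Box_mv (V := V) hx e)
    rw [h2] at h3 ⊢
    unfold mv; rw [if_pos ⟨⟨hc.1, h1⟩, hc.2, h3⟩]
  · unfold mv; rw [if_neg hc, if_neg]
    rintro ⟨h2, h3⟩; exact hc ⟨h2.1, h3.1⟩

lemma QQ_inter {V : Set (Pt d)} (w : Pt d → ℝ) (N k : ℕ) : ∀ (r : ℕ) (x : Pt d), x ∈ Box d r → r + k ≤ N →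
    ((QQ (V ∩ Box d N))^[k] w) x = ((QQ V)^[k] w) x := by
  induction k with
  | zero => intros; rfl
  | succ k ih =>
    intro r x hx h
    rw [Function.iterate_succ_apply', Function.iterate_succ_apply']
    unfold QQ
    congr 1; ext e
    rw [mv_inter hx (by omega)]
    exact ih (r+1) _ (mem_Box_mv hx e) (by omega)

lemma pk_path (V : Set (Pt d)) (h0 : (0 : Pt d) ∈ V) (j : ℕ) : ∀ x, 0 < pk V j x →
    ∃ m ≤ j, ∃ p : ℕ → Pt d, p 0 = x ∧ p m = 0 ∧ (∀ k ≤ m, p k ∈ V) ∧ ∀ k < m, adj (p k) (p (k+1)) := by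
  induction j with
  | zero =>
    intro x hx
    have : x = 0 := by
      by_contra hc; simp only [pk, Function.iterate_zero, id] at hx
      rw [ind_neg hc] at hx; exact lt_irrefl _ hx
    subst this
    exact ⟨0, le_rfl, fun _ => 0, rfl, rfl, fun _ _ => h0, fun k hk => absurd hk (by omega)⟩
  | succ j ih =>
    intro x hx
    rw [pk_succ] at hx
    have : ∃ e, 0 < pk V j (mv V x e) := by
      by_contra hc; push Not at hc
      have := av_mono hc
      rw [av_zero] at this
      exact absurd hx (not_lt.2 this)
    obtain ⟨e, he⟩ := this
    obtain ⟨m, hm, p, hp0, hpm, hpV, hpa⟩ := ih _ he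
    by_cases hc : x ∈ V ∧ x + vec e ∈ V
    · refine ⟨m+1, by omega, consP x p, rfl, hpm, ?_, ?_⟩
      · intro k hk
        cases k with
        | zero => exact hc.1
        | succ k => exact hpV k (by omega)
      · intro k hk
        cases k with
        | zero =>
          simp only [consP_zero, consP_succ, hp0]
          unfold mv; rw [if_pos hc]; exact adj_iff.2 ⟨e, rfl⟩
        | succ k => exact hpa k (by omega)
    · have : mv V x e = x := by unfold mv; rw [if_neg hc]
      rw [this] at hp0
      exact ⟨m, by omega, p, hp0, hpm, hpV, hpa⟩

lemma pk_chem {ω : Config d} (h0 : (0 : Pt d) ∈ Sinf ω) {N j n : ℕ} (hj : j ≤ n) {x : Pt d}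
    (hx : 0 < pk (Sinf ω ∩ Box d N) j x) :
    x ∈ Sinf ω ∧ x ∈ chemBall ω 0 (2*n) := by
  have h00 : (0 : Pt d) ∈ Sinf ω ∩ (Box d N : Set (Pt d)) := ⟨h0, by simp [mem_Box]⟩
  obtain ⟨m, hm, p, hp0, hpm, hpV, hpa⟩ := pk_path _ h00 j x hx
  refine ⟨hp0 ▸ (hpV 0 (by omega)).1, ?_⟩
  unfold chemBall chemDist
  simp only [Set.mem_setOf_eq]
  refine (sInf_le (a := (m : ℕ∞)) ?_).trans (by exact_mod_cast (by omega : m ≤ 2*n))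
  refine ⟨m, rfl, fun k => p (m - k), by simpa using hpm, by simpa using hp0,
    fun k hk => (hpV _ (by omega)).1.1, fun k hk => ?_⟩
  have := hpa (m - (k+1)) (by omega)
  rw [show m - (k+1) + 1 = m - k by omega] at this
  exact adj_symm this

lemma pk_Box (V : Set (Pt d)) (j : ℕ) : ∀ x, 0 < pk V j x → x ∈ Box d j := by
  induction j with
  | zero =>
    intro x hx
    have : x = 0 := by
      by_contra hc; simp only [pk, Function.iterate_zero, id] at hx
      rw [ind_neg hc] at hx; exact lt_irrefl _ hx
    subst this; simp [mem_Box]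
  | succ j ih =>
    intro x hx
    rw [pk_succ] at hx
    have : ∃ e, 0 < pk V j (mv V x e) := by
      by_contra hc; push Not at hc
      have := av_mono hc
      rw [av_zero] at this
      exact absurd hx (not_lt.2 this)
    obtain ⟨e, he⟩ := this
    have h1 := ih _ he
    rw [mem_Box] at h1 ⊢
    intro i
    have h2 := h1 i
    have h3 := vec_abs_le e i
    unfold mv at h2
    split_ifs at h2
    · simp only [Pi.add_apply] at h2
      push_cast
      have := abs_le.1 h2; have := abs_le.1 h3
      rw [abs_le]; constructor <;> omega
    · push_cast; omega

lemma bdry_ge_edge {ω : Config d} {N r : ℕ} (hr : r + 1 ≤ N) (A : Finset (Pt d)) (hA : ∀ x ∈ A, x ∈ Sinf ω)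
    (hA' : A ⊆ Box d r) : ((edgeBd (SS ω) (A : Set (Pt d))).ncard : ℝ) ≤ bdry (Sinf ω ∩ Box d N) A := by
  classical
  set V := Sinf ω ∩ (Box d N : Set (Pt d)) with hV
  set S : Finset (Pt d × Dir d) := (A ×ˢ Finset.univ).filter (fun q => mv V q.1 q.2 ∉ A) with hS
  have h1 : bdry V A = S.card := by
    unfold bdry
    rw [← Finset.sum_product', hS, Finset.card_filter]
    push_cast
    refine Finset.sum_congr rfl fun q _ => ?_
    unfold ind; congr
  rw [h1]
  have h2 : edgeBd (SS ω) (A : Set (Pt d)) ⊆ (S.image (fun q => (q.1, q.1 + vec q.2)) : Finset _) := by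
    rintro ⟨x, y⟩ ⟨hadj, hx, hy, hyA⟩
    simp only at hadj hx hy hyA
    obtain ⟨e, rfl⟩ := adj_iff.1 hadj
    have hx' : x ∈ A := hx
    simp only [Finset.coe_image, Set.mem_image]
    refine ⟨(x, e), ?_, rfl⟩
    simp only [hS, Finset.coe_filter, Finset.mem_product, Finset.mem_univ, and_true, Set.mem_setOf_eq]
    refine ⟨hx', ?_⟩
    rw [mv_inter (hA' hx') hr]
    unfold mv
    rw [if_pos ⟨hA x hx', Sinf_nbr (hA x hx') hadj hy⟩]
    exact hyA
  have h3 := Set.ncard_le_ncard h2 (Finset.finite_toSet _)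
  rw [Set.ncard_coe_finset] at h3
  exact_mod_cast h3.trans Finset.card_image_le

lemma bdry_ge_one {ω : Config d} {N r : ℕ} (hr : r + 1 ≤ N) (A : Finset (Pt d)) (hA : ∀ x ∈ A, x ∈ Sinf ω)
    (hA' : A ⊆ Box d r) (hne : A.Nonempty) : 1 ≤ bdry (Sinf ω ∩ Box d N) A := by
  obtain ⟨x, hx⟩ := hne
  obtain ⟨y, hy, hyA⟩ := (hA x hx).2.exists_notMem_finset A
  have key : ∃ a ∈ A, ∃ b ∉ A, adj a b ∧ b ∈ SS ω := by
    by_contra hc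
    push Not at hc
    have : y ∈ A := by
      obtain ⟨_, _, h⟩ := hy
      clear hyA
      induction h with
      | refl => exact hx
      | tail h1 h2 ih =>
        rename_i b c _
        by_contra hcA
        exact hc b (ih h2.2.1) c hcA h2.1 h2.2.2
    exact hyA this
  obtain ⟨a, ha, b, hb, hab, hbS⟩ := key
  obtain ⟨e, rfl⟩ := adj_iff.1 hab
  have h1 : mv (Sinf ω ∩ Box d N) a e ∉ A := by
    rw [mv_inter (hA' ha) hr]
    unfold mv
    rw [if_pos ⟨hA a ha, Sinf_nbr (hA a ha) hab hbS⟩]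
    exact hb
  unfold bdry
  calc (1:ℝ) = ind (mv (Sinf ω ∩ Box d N) a e ∉ A) := (ind_pos h1).symm
    _ ≤ ∑ e : Dir d, ind (mv (Sinf ω ∩ Box d N) a e ∉ A) :=
        Finset.single_le_sum (f := fun e => ind (mv (Sinf ω ∩ Box d N) a e ∉ A))
          (fun e _ => ind_nonneg _) (Finset.mem_univ e)
    _ ≤ _ := Finset.single_le_sum (f := fun a => ∑ e : Dir d, ind (mv (Sinf ω ∩ Box d N) a e ∉ A))
          (fun a _ => Finset.sum_nonneg fun e _ => ind_nonneg _) ha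

/-- The heat kernel bound in the form used below. -/
def HKB (V : Set (Pt d)) (C : ℝ) : Prop := 0 < C ∧ ∀ n : ℕ, 1 ≤ n → ∀ (A : Finset (Pt d)) (w : Pt d → ℝ),
  (∀ x ∉ A, w x = 0) →
  ((QQ V)^[n] w) 0 ≤ C * (n:ℝ) ^ (-(d:ℝ)/4) * Real.sqrt (∑ x ∈ A, w x ^ 2)

theorem HK_main [NeZero d] (hd : 2 ≤ d) (ω : Config d) (h0 : (0 : Pt d) ∈ Sinf ω)
    (hA5 : ∃ ι > (0:ℝ), ∀ k : ℕ, 1 ≤ k →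
        ∀ A : Set (Pt d), A ⊆ Sinf ω ∩ chemBall ω (0 : Pt d) (2*k) →
          (k : ℝ) ^ ((1:ℝ)/3) ≤ (A.ncard : ℝ) →
          ι * (A.ncard : ℝ) ^ (((d:ℝ) - 1)/d) ≤ ((edgeBd (SS ω) A).ncard : ℝ)) :
    ∃ C, HKB (Sinf ω) C := by
  obtain ⟨ι, hι, hA5⟩ := hA5
  obtain ⟨C, hC, hfin⟩ := HK_fin (d := d) hd ι hι
  refine ⟨Real.sqrt C, Real.sqrt_pos.2 hC, fun n hn A w hw => ?_⟩
  set N := n + 1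
  set V := Sinf ω ∩ (Box d N : Set (Pt d)) with hV
  have hB : ∀ x ∈ V, x ∈ Box d N := fun x hx => hx.2
  have h0B : (0 : Pt d) ∈ Box d N := by simp [mem_Box]
  have hkey : pk V (2*n) 0 ≤ C * (n:ℝ) ^ (-(d:ℝ)/2) := by
    refine hfin V (Box d N) hB h0B n hn fun A hne hA => ?_
    have hA1 : ∀ x ∈ A, x ∈ Sinf ω := fun x hx => by
      obtain ⟨j, hj, h⟩ := hA x hx; exact (pk_chem h0 hj h).1
    have hA2 : A ⊆ Box d n := fun x hx => by
      obtain ⟨j, hj, h⟩ := hA x hx; exact Box_mono hj (pk_Box _ j x h)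
    refine ⟨bdry_ge_one le_rfl A hA1 hA2 hne, fun hcard => ?_⟩
    refine le_trans ?_ (bdry_ge_edge le_rfl A hA1 hA2)
    have := hA5 n hn (A : Set (Pt d)) (fun x hx => by
      obtain ⟨j, hj, h⟩ := hA x hx; exact pk_chem h0 hj h)
    rw [Set.ncard_coe_finset] at this
    exact this hcard
  have h1 : ((QQ (Sinf ω))^[n] w) 0 = ∑ x ∈ Box d N, pk V n x * w x := by
    rw [← QQ_iter_zero V (Box d N) hB h0B w n]
    exact (QQ_inter w N n 0 0 (by simp [mem_Box]) (by omega)).symm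
  rw [h1]
  refine (Real.sum_mul_le_sqrt_mul_sqrt _ _ _).trans ?_
  have h2 : ∑ x ∈ Box d N, pk V n x ^ 2 = pk V (2*n) 0 := by
    rw [two_mul, ← pk_inner V (Box d N) hB h0B]
    exact Finset.sum_congr rfl fun x _ => sq _
  have h3 : Real.sqrt (∑ x ∈ Box d N, pk V n x ^ 2) ≤ Real.sqrt C * (n:ℝ) ^ (-(d:ℝ)/4) := by
    rw [h2]
    refine (Real.sqrt_le_sqrt hkey).trans ?_
    rw [Real.sqrt_mul hC.le, Real.sqrt_eq_rpow ((n:ℝ) ^ _), ← Real.rpow_mul (by positivity)]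
    apply le_of_eq; congr 2; ring
  have h4 : ∑ x ∈ Box d N, w x ^ 2 ≤ ∑ x ∈ A, w x ^ 2 := by
    classical
    rw [← Finset.sum_filter_add_sum_filter_not (Box d N) (fun x => x ∈ A),
      Finset.sum_eq_zero (s := (Box d N).filter (fun x => x ∉ A)), add_zero]
    · refine Finset.sum_le_sum_of_subset_of_nonneg ?_ (fun _ _ _ => sq_nonneg _)
      intro x hx; exact (Finset.mem_filter.1 hx).2
    · intro x hx; rw [hw x (Finset.mem_filter.1 hx).2]; simp
  have h5 := Real.sqrt_le_sqrt h4
  gcongr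


lemma HK_func [NeZero d] {V : Set (Pt d)} {C : ℝ} (hV : HKB V C) (n m R : ℕ) (hn : 1 ≤ n)
    (G : (ℕ → Pt d) → ℝ) (hG0 : ∀ p, 0 ≤ G p) (hG1 : ∀ p, G p ≤ 1) :
    EW V (n+m) 0 (fun p => ind (p n ∈ Box d R) * G (fun k => p (n+k)))
      ≤ C * (n:ℝ) ^ (-(d:ℝ)/4) * Real.sqrt (∑ x ∈ Box d R, EW V m x G) := by
  set w : Pt d → ℝ := fun y => ind (y ∈ Box d R) * EW V m y G with hw
  have h1 : EW V (n+m) 0 (fun p => ind (p n ∈ Box d R) * G (fun k => p (n+k)))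
      = ((QQ V)^[n] w) 0 := by
    rw [← EW_pos V n 0 w n le_rfl, EW_markov]
    refine EW_congr fun p _ _ => ?_
    simp only [hw]
    rw [← EW_mul]
    refine EW_congr fun q hq _ => ?_
    simp only [glue, lt_irrefl, if_false, Nat.sub_self, hq]
    congr 2
    ext k
    simp
  rw [h1]
  refine (hV.2 n hn (Box d R) w ?_).trans ?_
  · intro x hx; simp only [hw]; rw [ind_neg hx, zero_mul]
  · have hC := hV.1
    gcongr with x hx
    simp only [hw]
    rw [ind_pos hx, one_mul]
    have h0 : 0 ≤ EW V m x G := EW_nonneg hG0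
    have h1 : EW V m x G ≤ 1 := by
      calc _ ≤ EW V m x (fun _ => (1:ℝ)) := EW_mono hG1
        _ = 1 := EW_const _ _ _ _
    nlinarith

lemma exp_bd (N : ℕ) (u : ℝ) (hu : 0 < u) : Real.exp (-u/8) ≤ (N.factorial : ℝ) * 8 ^ N / u ^ N := by
  have h := Real.pow_div_factorial_le_exp (x := u/8) (by positivity) N
  rw [show -u/8 = -(u/8) by ring, Real.exp_neg]
  rw [inv_le_comm₀ (Real.exp_pos _) (by positivity)]
  refine le_trans (le_of_eq ?_) h
  rw [div_pow]
  field_simp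

lemma rpow_cancel (x : ℝ) (hx : 0 < x) (d : ℕ) : (x^2) ^ (-(d:ℝ)/4) * Real.sqrt (x ^ d) = 1 := by
  rw [Real.sqrt_eq_rpow, ← Real.rpow_natCast x d, ← Real.rpow_natCast x 2, ← Real.rpow_mul hx.le,
    ← Real.rpow_mul hx.le, ← Real.rpow_add hx]
  rw [show ((2:ℕ):ℝ) * (-(d:ℝ)/4) + d * (1/2) = 0 by push_cast; ring, Real.rpow_zero]

lemma diff_pow [NeZero d] {V : Set (Pt d)} {C : ℝ} (hV : HKB V C) :
    ∃ K : ℝ, 0 ≤ K ∧ ∀ s : ℕ, 1 ≤ s → ∀ i l : ℕ,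
      EW V (4^i) 0 (fun p => ind (∃ k ≤ 4^i, p k ∉ Box d (s*(l+4)*2^i))) ≤ K / s^2 / (l+1) := by
  set K0 : ℝ := 8 * d * 14^d * Real.exp 2 * (((d+4).factorial : ℝ) * 8 ^ (d+4)) with hK0
  have hC := hV.1
  have hK0' : 0 ≤ K0 := by positivity
  refine ⟨C * Real.sqrt K0, by positivity, fun s hs i => ?_⟩
  set K := C * Real.sqrt K0 with hK
  have hs' : (1:ℝ) ≤ s := by exact_mod_cast hs
  have hK' : 0 ≤ K := by positivity
  induction i with
  | zero =>
    intro l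
    have : EW V (4^0) 0 (fun p => ind (∃ k ≤ 4^0, p k ∉ Box d (s*(l+4)*2^0)))
        = EW V (4^0) 0 (fun _ => (0:ℝ)) := by
      refine EW_congr fun p hp0 hp => ind_neg ?_
      rintro ⟨k, hk, h⟩
      apply h
      have h1 : p k ∈ Box d 1 := by
        rcases (by omega : k = 0 ∨ k = 1) with rfl | rfl
        · rw [hp0]; simp [mem_Box]
        · obtain ⟨e, he⟩ := hp.1 0 (by norm_num)
          rw [he, hp0]; exact mem_Box_mv (by simp [mem_Box]) e
      refine Box_mono ?_ h1
      nlinarith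
    rw [this, EW_const]
    positivity
  | succ i ih =>
    intro l
    set R := s*(l+5)*2^i with hR
    set lam := s*(l+3)*2^i with hlam
    set u : ℝ := s*(l+3) with hu
    have hu0 : 3 ≤ u := by rw [hu]; have : (0:ℝ) ≤ l := by positivity
                           nlinarith
    have hRl : s*(l+4)*2^(i+1) = R + lam := by rw [hR, hlam, pow_succ]; ring
    have h4 : 4^(i+1) = 4^i + 3*4^i := by ring
    set G : (ℕ → Pt d) → ℝ := fun p => ind (∃ k ≤ 3*4^i, ∃ a, (lam:ℝ) ≤ |(p k a : ℝ) - p 0 a|) with hG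
    rw [h4, hRl]
    have hle : ∀ p : ℕ → Pt d, ind (∃ k ≤ 4^i + 3*4^i, p k ∉ Box d (R + lam)) ≤
        ind (∃ k ≤ 4^i, p k ∉ Box d (s*(l+1+4)*2^i)) + ind (p (4^i) ∈ Box d R) * G (fun k => p (4^i+k)) := by
      intro p
      by_cases h1 : ∃ k ≤ 4^i, p k ∉ Box d (s*(l+1+4)*2^i)
      · rw [ind_pos h1]
        have := ind_le_one (∃ k ≤ 4^i + 3*4^i, p k ∉ Box d (R + lam))
        have h2 := mul_nonneg (ind_nonneg (p (4^i) ∈ Box d R)) (ind_nonneg (∃ k ≤ 3*4^i, ∃ a, (lam:ℝ) ≤ |((fun k => p (4^i+k)) k a : ℝ) - (fun k => p (4^i+k)) 0 a|))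
        simp only [hG]; linarith
      · rw [ind_neg h1, zero_add]
        push Not at h1
        have h1' : ∀ k ≤ 4^i, p k ∈ Box d R := h1
        rw [ind_pos (h1' _ le_rfl), one_mul]
        refine ind_mono ?_
        rintro ⟨k, hk, hkB⟩
        have hkk : 4^i < k := by
          by_contra hc
          exact hkB (Box_mono (by omega) (h1' k (by omega)))
        refine ⟨k - 4^i, by omega, ?_⟩
        rw [mem_Box] at hkB
        push Not at hkB
        obtain ⟨a, ha⟩ := hkB
        refine ⟨a, ?_⟩
        have h5 := mem_Box.1 (h1' _ le_rfl) a
        simp only [add_zero]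
        rw [show 4^i + (k - 4^i) = k by omega]
        have h6 : (lam:ℤ) ≤ |p k a - p (4^i) a| := by
          have := abs_sub_abs_le_abs_sub (p k a) (p (4^i) a)
          push_cast at ha
          linarith
        exact_mod_cast h6
    refine (EW_mono hle).trans ?_
    rw [EW_add, EW_restrict (hF := by
      intro p q hpq
      congr 1
      apply propext
      refine exists_congr fun k => and_congr_right fun hk => by rw [hpq k hk])]
    have hb := HK_func hV (4^i) (3*4^i) R (Nat.one_le_pow _ _ (by norm_num)) G (fun p => ind_nonneg _) (fun p => ind_le_one _)
    have hmax := box_max_free V R (3*4^i) (by have := Nat.one_le_pow i 4 (by norm_num); omega) lam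
      (by rw [hR, hlam]; push_cast; gcongr; norm_num)
    have h2i : (1:ℝ) ≤ 2^i := one_le_pow₀ (by norm_num)
    have hR7 : (4*(R:ℝ)+3) ≤ 14 * u * 2^i := by
      have : (1:ℝ) ≤ R := by
        rw [hR]; push_cast
        have : (0:ℝ) ≤ l := by positivity
        have h1 : (1:ℝ) ≤ s*(l+5) := by nlinarith
        nlinarith
      have h2 : (R:ℝ) ≤ 2 * u * 2^i := by
        rw [hR, hu]; push_cast
        have : (0:ℝ) ≤ l := by positivity
        refine mul_le_mul_of_nonneg_right ?_ (by positivity)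
        nlinarith
      linarith
    have herr : errf lam (3*4^i) ≤ Real.exp 2 * ((((d+4).factorial : ℝ) * 8 ^ (d+4)) / u ^ (d+4)) := by
      refine le_trans ?_ (mul_le_mul_of_nonneg_left (exp_bd (d+4) u (by linarith)) (Real.exp_nonneg _))
      rw [← Real.exp_add, errf]
      apply Real.exp_le_exp.2
      have hsq : Real.sqrt ((3*4^i : ℕ):ℝ) ≤ 2 * 2^i := by
        rw [Real.sqrt_le_left (by positivity)]
        push_cast
        rw [mul_pow, ← pow_mul, mul_comm i 2, pow_mul]
        norm_num
      have hsq0 : 0 < Real.sqrt ((3*4^i : ℕ):ℝ) := Real.sqrt_pos.2 (by positivity)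
      have hlam' : (lam:ℝ) = u * 2^i := by rw [hlam, hu]; push_cast; ring
      have hnum : 0 ≤ (lam:ℝ) - 1 := by rw [hlam']; nlinarith
      have : ((lam:ℝ) - 1)/(4 * (2*2^i)) ≤ ((lam:ℝ) - 1)/(4 * Real.sqrt ((3*4^i : ℕ):ℝ)) := by
        gcongr
      have h3 : u/8 - 1 ≤ ((lam:ℝ) - 1)/(4 * (2*2^i)) := by
        rw [le_div_iff₀ (by positivity), hlam']
        nlinarith
      linarith
    have hfin : C * ((4^i:ℕ):ℝ) ^ (-(d:ℝ)/4) * Real.sqrt (∑ x ∈ Box d R, EW V (3*4^i) x G) ≤ K / u^2 := by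
      have h10 : ∑ x ∈ Box d R, EW V (3*4^i) x G ≤ (K0 / (u^2)^2) * (2^i)^d := by
        refine hmax.trans ?_
        calc 8 * (d:ℝ) * (4*R+3)^d * errf lam (3*4^i)
            ≤ 8 * (d:ℝ) * (14 * u * 2^i)^d * (Real.exp 2 * ((((d+4).factorial : ℝ) * 8 ^ (d+4)) / u ^ (d+4))) := by
              have := errf_nonneg lam (3*4^i)
              gcongr
          _ = _ := by
              rw [hK0, mul_pow, mul_pow, pow_add u d 4]
              have : u ≠ 0 := by linarith
              field_simp
      have h11 := Real.sqrt_le_sqrt h10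
      rw [Real.sqrt_mul (by positivity), Real.sqrt_div hK0', Real.sqrt_sq (by positivity)] at h11
      have hr := rpow_cancel (2^i) (by positivity) d
      have h42 : ((4^i:ℕ):ℝ) = ((2:ℝ)^i)^2 := by
        push_cast; rw [← pow_mul, mul_comm i 2, pow_mul]; norm_num
      rw [h42]
      calc _ ≤ C * (((2:ℝ)^i)^2) ^ (-(d:ℝ)/4) * (Real.sqrt K0 / u^2 * Real.sqrt ((2^i)^d)) := by
            gcongr
        _ = (C * Real.sqrt K0 / u^2) * ((((2:ℝ)^i)^2) ^ (-(d:ℝ)/4) * Real.sqrt ((2^i)^d)) := by ring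
        _ = _ := by rw [hr, mul_one]
    have ih1 := ih (l+1)
    push_cast at ih1
    refine (add_le_add ih1 (hb.trans hfin)).trans ?_
    rw [hu, mul_pow, ← div_div, ← mul_one_div (K/s^2) _, ← mul_one_div (K/s^2) _,
      ← mul_one_div (K/s^2) _, ← mul_add]
    apply mul_le_mul_of_nonneg_left _ (by positivity)
    have hl : (0:ℝ) ≤ l := by positivity
    rw [div_add_div _ _ (by positivity) (by positivity), div_le_div_iff₀ (by positivity) (by positivity)]
    nlinarith

/-- Diffusivity. -/
lemma diffusive [NeZero d] {V : Set (Pt d)} {C : ℝ} (hV : HKB V C) (ε : ℝ) (hε : 0 < ε) :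
    ∃ M : ℕ, 1 ≤ M ∧ ∀ n : ℕ, 1 ≤ n →
      EW V n 0 (fun p => ind (∃ k ≤ n, ∃ a, (M:ℝ) * Real.sqrt n ≤ |(p k a:ℝ)|)) ≤ ε := by
  obtain ⟨K, hK, h⟩ := diff_pow hV
  obtain ⟨s, hs⟩ := exists_nat_gt (K/ε + 1)
  have hs1 : (1:ℝ) ≤ s := by have : 0 ≤ K/ε := by positivity
                             linarith
  refine ⟨8*s+1, by omega, fun n hn => ?_⟩
  have hn' : (1:ℝ) ≤ n := by exact_mod_cast hn
  set i := Nat.clog 4 n with hi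
  have h1 : n ≤ 4^i := Nat.le_pow_clog (by norm_num) n
  have h2 : 4^i ≤ 4*n := by
    rcases Nat.eq_zero_or_pos i with h0 | h0
    · rw [h0]; omega
    · have := Nat.pow_pred_clog_lt_self (b := 4) (x := n) (by norm_num) (by
        by_contra hc
        have : n = 1 := by omega
        rw [hi, this] at h0; simp at h0)
      rw [← hi] at this
      obtain ⟨j, hj⟩ : ∃ j, i = j+1 := ⟨i-1, by omega⟩
      rw [hj] at this ⊢
      simp only [Nat.pred_succ] at this
      rw [pow_succ]; omega
  have h3 : EW V n 0 (fun p => ind (∃ k ≤ n, ∃ a, ((8*s+1:ℕ):ℝ) * Real.sqrt n ≤ |(p k a:ℝ)|))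
      = EW V (n + (4^i - n)) 0 (fun p => ind (∃ k ≤ n, ∃ a, ((8*s+1:ℕ):ℝ) * Real.sqrt n ≤ |(p k a:ℝ)|)) := by
    symm
    refine EW_restrict (hF := ?_) ..
    intro p q hpq
    congr 1
    apply propext
    refine exists_congr fun k => and_congr_right fun hk => by rw [hpq k hk]
  rw [h3, show n + (4^i - n) = 4^i by omega]
  have h4 := h s (by exact_mod_cast hs1) i 0
  refine le_trans ?_ (h4.trans ?_)
  · refine EW_mono fun p => ind_mono ?_
    rintro ⟨k, hk, a, ha⟩
    refine ⟨k, by omega, fun hc => ?_⟩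
    have hc := mem_Box.1 hc a
    have hc' : |(p k a:ℝ)| ≤ ((s*(0+4)*2^i:ℕ):ℝ) := by exact_mod_cast hc
    have h5 : (2:ℝ)^i ≤ 2 * Real.sqrt n := by
      have : Real.sqrt ((4:ℝ)^i) ≤ Real.sqrt (4*n) := Real.sqrt_le_sqrt (by exact_mod_cast h2)
      rw [show (4:ℝ)^i = (2^i)^2 by rw [← pow_mul, mul_comm i 2, pow_mul]; norm_num,
        Real.sqrt_sq (by positivity), show (4:ℝ)*n = 2^2*n by norm_num, Real.sqrt_mul (by positivity),
        Real.sqrt_sq (by norm_num)] at this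
      exact this
    have h6 : 1 ≤ Real.sqrt n := Real.one_le_sqrt.2 hn'
    push_cast at ha hc'
    nlinarith
  · have h7 : (K / s^2 / ((0:ℕ)+1) : ℝ) = K / s^2 := by simp
    rw [h7, div_le_iff₀ (by positivity)]
    have : K < ε * (s - 1) := by
      have := (div_lt_iff₀ hε).1 (by linarith : K/ε < s - 1); linarith
    nlinarith


/-- Constant in the scaled heat kernel bound. -/
noncomputable def hkc (d : ℕ) (C δ A : ℝ) : ℝ := C * δ ^ (-(d:ℝ)/4) * Real.sqrt (A^d)

lemma hkc_nonneg {C δ A : ℝ} (hC : 0 < C) (hδ : 0 < δ) : 0 ≤ hkc d C δ A := by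
  unfold hkc; positivity

lemma HK_func' [NeZero d] {V : Set (Pt d)} {C : ℝ} (hV : HKB V C) (n t m R : ℕ) (hn : 1 ≤ n) (ht : 1 ≤ t)
    (δ A q : ℝ) (hδ : 0 < δ) (hδt : δ * n ≤ t) (hA : 0 ≤ A)
    (G : (ℕ → Pt d) → ℝ) (hG0 : ∀ p, 0 ≤ G p) (hG1 : ∀ p, G p ≤ 1)
    (hsum : ∑ x ∈ Box d R, EW V m x G ≤ (A * Real.sqrt n) ^ d * q) :
    EW V (t+m) 0 (fun p => ind (p t ∈ Box d R) * G (fun k => p (t+k))) ≤ hkc d C δ A * Real.sqrt q := by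
  have hC := hV.1
  have hn' : (0:ℝ) < n := by exact_mod_cast hn
  refine (HK_func hV t m R ht G hG0 hG1).trans ?_
  have h1 : (t:ℝ) ^ (-(d:ℝ)/4) ≤ (δ * n) ^ (-(d:ℝ)/4) :=
    Real.rpow_le_rpow_of_nonpos (by positivity) hδt (by
      have : (0:ℝ) ≤ d := by positivity
      linarith)
  have h2 := Real.sqrt_le_sqrt hsum
  rw [mul_pow, Real.sqrt_mul (by positivity), Real.sqrt_mul (by positivity)] at h2
  have h3 := rpow_cancel (Real.sqrt n) (Real.sqrt_pos.2 hn') d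
  rw [Real.sq_sqrt hn'.le] at h3
  rw [Real.mul_rpow hδ.le hn'.le] at h1
  calc _ ≤ C * (δ ^ (-(d:ℝ)/4) * (n:ℝ) ^ (-(d:ℝ)/4)) *
        (Real.sqrt (A^d) * Real.sqrt (Real.sqrt n ^ d) * Real.sqrt q) := by gcongr
    _ = C * δ ^ (-(d:ℝ)/4) * Real.sqrt (A^d) * Real.sqrt q * ((n:ℝ) ^ (-(d:ℝ)/4) * Real.sqrt (Real.sqrt n ^ d)) := by ring
    _ = _ := by rw [h3, mul_one, hkc]

lemma EW_restrict' [NeZero d] {E : Type*} [AddCommGroup E] [Module ℝ E] (V : Set (Pt d)) {k m : ℕ} (hkm : k ≤ m)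
    (x : Pt d) (F : (ℕ → Pt d) → E)
    (hF : ∀ p q : ℕ → Pt d, (∀ i ≤ k, p i = q i) → F p = F q) :
    EW V m x F = EW V k x F := by
  obtain ⟨l, rfl⟩ := Nat.exists_eq_add_of_le hkm
  exact EW_restrict V k l x F hF

lemma ind_congr {p q : Prop} (h : p ↔ q) : ind p = ind q := by rw [propext h]

lemma ind_le_sum {ι : Type*} (s : Finset ι) (p : Prop) (q : ι → Prop) (h : p → ∃ i ∈ s, q i) :
    ind p ≤ ∑ i ∈ s, ind (q i) := by
  by_cases hp : p
  · obtain ⟨i, hi, hq⟩ := h hp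
    rw [ind_pos hp, ← ind_pos hq]
    exact Finset.single_le_sum (f := fun i => ind (q i)) (fun i _ => ind_nonneg _) hi
  · rw [ind_neg hp]; exact Finset.sum_nonneg fun i _ => ind_nonneg _

set_option maxHeartbeats 2000000 in
lemma modulus [NeZero d] {V : Set (Pt d)} {C : ℝ} (hV : HKB V C) (T : ℕ) (hT : 1 ≤ T) (ρ ε : ℝ)
    (hρ : 0 < ρ) (hε : 0 < ε) :
    ∃ y : ℕ, 1 ≤ y ∧ ∃ n0 : ℕ, ∀ n ≥ n0,
      EW V ((T+1)*n) 0 (fun p => ind (∃ k l, k ≤ l ∧ l ≤ T*n ∧ (l-k)*y^2 ≤ n ∧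
        ∃ a, ρ * Real.sqrt n ≤ |(p l a : ℝ) - p k a|)) ≤ ε := by
  have hC := hV.1
  obtain ⟨M, hM1, hM⟩ := diffusive hV (ε/3) (by positivity)
  have hM1' : (1:ℝ) ≤ M := by exact_mod_cast hM1
  set δ := min 1 (ρ^2/(32*M^2)) with hδ
  have hδ0 : 0 < δ := lt_min one_pos (by positivity)
  have hδM : 2 * δ * M^2 ≤ ρ^2/16 := by
    have : δ ≤ ρ^2/(32*M^2) := min_le_right _ _
    rw [le_div_iff₀ (by positivity)] at this
    linarith
  set A0 : ℝ := M * Real.sqrt (T+1) + ρ with hA0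
  have hA0' : 0 < A0 := by positivity
  set A : ℝ := 4*A0+7 with hA
  set K : ℝ := hkc d C (δ/2) A * Real.sqrt (8*d*Real.exp 2) with hK
  have hK0 : 0 ≤ K := mul_nonneg (hkc_nonneg hC (by positivity)) (Real.sqrt_nonneg _)
  set c1 : ℝ := K * ((T+1) * ((Nat.factorial 3 : ℝ) * 8^3 * (4/ρ)^3)) with hc1
  have hc10 : 0 ≤ c1 := by positivity
  obtain ⟨y, hy⟩ := exists_nat_gt (max (3*c1/ε) (max (8/δ) 8))
  have hy1 : 3*c1/ε < y := (le_max_left _ _).trans_lt hy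
  have hy2 : 8/δ < y := ((le_max_left _ _).trans (le_max_right _ _)).trans_lt hy
  have hy3 : (8:ℝ) < y := ((le_max_right _ _).trans (le_max_right _ _)).trans_lt hy
  have hy0 : (0:ℝ) < y := by linarith
  have hyn : 1 ≤ y := by exact_mod_cast (by linarith : (1:ℝ) ≤ y)
  obtain ⟨n0, hn0⟩ := exists_nat_gt (max ((y:ℝ)^2) (1/δ))
  refine ⟨y, hyn, n0, fun n hn => ?_⟩
  have hnn : (n0:ℝ) ≤ n := by exact_mod_cast hn
  have hny : (y:ℝ)^2 ≤ n := ((le_max_left _ _).trans hn0.le).trans hnn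
  have hnδ : 1/δ ≤ n := ((le_max_right _ _).trans hn0.le).trans hnn
  have hyy : (1:ℝ) ≤ y^2 := one_le_pow₀ (by linarith)
  have hn1 : (1:ℝ) ≤ n := hyy.trans hny
  have hn1' : 1 ≤ n := by exact_mod_cast hn1
  have hs1 : 1 ≤ Real.sqrt n := Real.one_le_sqrt.2 hn1
  have hδn : 1 ≤ δ * n := by rw [div_le_iff₀ hδ0] at hnδ; linarith
  set m := ⌈(n:ℝ)/y^2⌉₊ with hm
  set h := ⌈δ * n⌉₊ with hh
  have hm1 : (n:ℝ)/y^2 ≤ m := Nat.le_ceil _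
  have hnm : 1 ≤ (n:ℝ)/y^2 := by rw [le_div_iff₀ (by positivity)]; linarith
  have hm2 : (m:ℝ) ≤ 2 * (n/y^2) := by
    have := Nat.ceil_lt_add_one (a := (n:ℝ)/y^2) (by positivity); linarith
  have hm0 : 1 ≤ m := by exact_mod_cast hnm.trans hm1
  have hh1 : δ * n ≤ h := Nat.le_ceil _
  have hh2 : (h:ℝ) ≤ 2 * (δ*n) := by
    have := Nat.ceil_lt_add_one (a := δ*n) (by positivity); linarith
  have hh0 : 1 ≤ h := by exact_mod_cast hδn.trans hh1
  have hy8 : 8 * (n/(y:ℝ)^2) ≤ δ * n := by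
    rw [mul_div_assoc', div_le_iff₀ (by positivity)]
    rw [div_lt_iff₀ hδ0] at hy2
    have : 8 ≤ δ * y^2 := by
      calc (8:ℝ) ≤ (y*δ) * 1 := by linarith
        _ ≤ (y * δ) * y := by gcongr; linarith
        _ = _ := by ring
    calc 8 * (n:ℝ) ≤ (δ * y^2) * n := by gcongr
      _ = _ := by ring
  have h4mh : 4*m ≤ h := by
    have : (4:ℝ)*m ≤ h := by linarith
    exact_mod_cast this
  have h2mn : 2*m ≤ n := by
    have h1 : (2:ℝ)*m ≤ n := by
      have h2 : δ ≤ 1 := min_le_left _ _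
      have h3 : δ * n ≤ 1 * n := mul_le_mul_of_nonneg_right h2 (by positivity)
      linarith
    exact_mod_cast h1
  have hhn : h ≤ (T+1)*n := by
    have : h ≤ 2 * n := by
      have h1 : (h:ℝ) ≤ 2*n := by
        have h2 : δ ≤ 1 := min_le_left _ _
        have h3 : δ * n ≤ 1 * n := mul_le_mul_of_nonneg_right h2 (by positivity)
        linarith
      exact_mod_cast h1
    exact this.trans (Nat.mul_le_mul_right n (by omega))
  set H := (T+1)*n with hH
  have hTH : H = T*n + n := by rw [hH]; ring
  clear_value H m h
  have hH1 : 1 ≤ H := by omega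
  set R := ⌈A0 * Real.sqrt n⌉₊ with hR
  have hR1 : A0 * Real.sqrt n ≤ R := Nat.le_ceil _
  have hR2 : (R:ℝ) ≤ A0 * Real.sqrt n + 1 := (Nat.ceil_lt_add_one (by positivity)).le
  have hMH : M * Real.sqrt H ≤ A0 * Real.sqrt n := by
    rw [hH, hA0]; push_cast
    rw [Real.sqrt_mul (by positivity), ← mul_assoc]
    refine mul_le_mul_of_nonneg_right (by linarith) (Real.sqrt_nonneg _)
  have hMh : M * Real.sqrt h ≤ ρ/4 * Real.sqrt n := by
    apply abs_le_of_sq_le_sq' _ (by positivity) |>.2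
    rw [mul_pow, mul_pow, Real.sq_sqrt (by positivity), Real.sq_sqrt (by positivity)]
    calc (M:ℝ)^2 * h ≤ M^2 * (2*(δ*n)) := by gcongr
      _ = (2 * δ * M^2) * n := by ring
      _ ≤ ρ^2/16 * n := by gcongr
      _ = _ := by ring
  set lam := ρ/2 * Real.sqrt n with hlam
  set S := (Finset.range (T*n/m+1)).filter (fun b => h < b*m+2*m) with hS
  set G : (ℕ → Pt d) → ℝ := fun p => ind (∃ k ≤ 2*m, ∃ a, lam ≤ |(p k a : ℝ) - p 0 a|) with hG
  have hincl : ∀ p : ℕ → Pt d, p 0 = 0 → ind (∃ k l, k ≤ l ∧ l ≤ T*n ∧ (l-k)*y^2 ≤ n ∧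
        ∃ a, ρ * Real.sqrt n ≤ |(p l a : ℝ) - p k a|) ≤
      ind (∃ k ≤ H, ∃ a, (M:ℝ) * Real.sqrt H ≤ |(p k a:ℝ)|) + ind (∃ k ≤ h, ∃ a, (M:ℝ) * Real.sqrt h ≤ |(p k a:ℝ)|)
      + ∑ b ∈ S, ind (p (b*m) ∈ Box d R) * G (fun k => p (b*m+k)) := by
    intro p hp0
    have hsn : 0 ≤ ∑ b ∈ S, ind (p (b*m) ∈ Box d R) * G (fun k => p (b*m+k)) :=
      Finset.sum_nonneg fun b _ => mul_nonneg (ind_nonneg _) (ind_nonneg _)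
    by_cases e1 : ∃ k ≤ H, ∃ a, (M:ℝ) * Real.sqrt H ≤ |(p k a:ℝ)|
    · rw [ind_pos e1]
      linarith [ind_le_one (∃ k l, k ≤ l ∧ l ≤ T*n ∧ (l-k)*y^2 ≤ n ∧
        ∃ a, ρ * Real.sqrt n ≤ |(p l a : ℝ) - p k a|), ind_nonneg (∃ k ≤ h, ∃ a, (M:ℝ) * Real.sqrt h ≤ |(p k a:ℝ)|)]
    by_cases e2 : ∃ k ≤ h, ∃ a, (M:ℝ) * Real.sqrt h ≤ |(p k a:ℝ)|
    · rw [ind_pos e2]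
      linarith [ind_le_one (∃ k l, k ≤ l ∧ l ≤ T*n ∧ (l-k)*y^2 ≤ n ∧
        ∃ a, ρ * Real.sqrt n ≤ |(p l a : ℝ) - p k a|), ind_nonneg (∃ k ≤ H, ∃ a, (M:ℝ) * Real.sqrt H ≤ |(p k a:ℝ)|)]
    rw [ind_neg e1, ind_neg e2, zero_add, zero_add]
    push Not at e1 e2
    have hin : ∀ k ≤ H, p k ∈ Box d R := by
      intro k hk; rw [mem_Box]; intro a
      have := e1 k hk a
      have h2 : (|p k a| : ℝ) ≤ R := by linarith
      exact_mod_cast h2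
    have hS' : ∑ b ∈ S, ind (p (b*m) ∈ Box d R) * G (fun k => p (b*m+k)) = ∑ b ∈ S, G (fun k => p (b*m+k)) := by
      refine Finset.sum_congr rfl fun b hb => ?_
      rw [ind_pos, one_mul]
      apply hin
      have := (Finset.mem_filter.1 hb).1
      have h1 : b ≤ T*n/m := by have := Finset.mem_range.1 this; omega
      have h2 := Nat.mul_le_of_le_div _ _ _ h1
      omega
    rw [hS']
    refine ind_le_sum S _ (fun b => ∃ k ≤ 2*m, ∃ a, lam ≤ |((fun k => p (b*m+k)) k a : ℝ) - (fun k => p (b*m+k)) 0 a|) ?_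
    rintro ⟨k, l, hkl, hl, hklm, a, ha⟩
    have hlk : l - k ≤ m := by
      have h1 : ((l-k:ℕ):ℝ) * y^2 ≤ n := by exact_mod_cast hklm
      have h2 : ((l-k:ℕ):ℝ) ≤ n/y^2 := by rw [le_div_iff₀ (by positivity)]; exact h1
      exact_mod_cast h2.trans hm1
    set b := k/m with hb
    have hb1 : b*m ≤ k := Nat.div_mul_le_self k m
    have hb2 : k < b*m + m := Nat.lt_div_mul_add hm0
    have hor : ∃ j ≤ 2*m, lam ≤ |(p (b*m+j) a : ℝ) - p (b*m) a| := by
      by_contra hc; push Not at hc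
      have c1 := hc (l - b*m) (by omega)
      have c2 := hc (k - b*m) (by omega)
      rw [show b*m + (l - b*m) = l by omega] at c1
      rw [show b*m + (k - b*m) = k by omega] at c2
      have := abs_sub_le (p l a : ℝ) (p (b*m) a) (p k a)
      rw [abs_sub_comm (p (b*m) a : ℝ)] at this
      simp only [hlam] at c1 c2
      linarith
    obtain ⟨j, hj, hja⟩ := hor
    refine ⟨b, ?_, j, hj, a, hja⟩
    rw [hS, Finset.mem_filter, Finset.mem_range]
    refine ⟨Nat.lt_succ_of_le (Nat.div_le_div_right (hkl.trans hl)), ?_⟩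
    by_contra hc
    have c1 := e2 (b*m+j) (by omega) a
    have c2 := e2 (b*m) (by omega) a
    have := abs_sub (p (b*m+j) a : ℝ) (p (b*m) a)
    simp only [hlam] at hja
    linarith
  have hterm : ∀ b ∈ S, EW V H 0 (fun p => ind (p (b*m) ∈ Box d R) * G (fun k => p (b*m+k))) ≤
      K * Real.exp (-(ρ * y/4)/8) := by
    intro b hb
    have hb' := Finset.mem_filter.1 hb
    have h1 : b ≤ T*n/m := by have := Finset.mem_range.1 hb'.1; omega
    have h2 := Nat.mul_le_of_le_div _ _ _ h1
    have hbm : h ≤ 2*(b*m) := by have := hb'.2; omega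
    rw [EW_restrict' V (k := b*m+2*m) (by omega) 0 _ (by
      intro p q hpq
      simp only [hG]
      rw [hpq (b*m) (by omega)]
      congr 1
      refine ind_congr (exists_congr fun k => and_congr_right fun hk => ?_)
      rw [hpq (b*m+k) (by omega), add_zero, hpq (b*m) (by omega)])]
    have hbm' : (h:ℝ) ≤ 2*((b*m:ℕ):ℝ) := by exact_mod_cast hbm
    have hbx := box_max_free V R (2*m) (by omega) lam (by
      refine le_trans ?_ hR1
      rw [hlam]; apply mul_le_mul_of_nonneg_right _ (Real.sqrt_nonneg _)
      have : 0 ≤ M * Real.sqrt (T+1) := by positivity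
      rw [hA0]; linarith)
    have hq : errf lam (2*m) ≤ Real.exp 2 * Real.exp (-(ρ * y/4)/8) ^ 2 := by
      rw [← Real.exp_nat_mul, ← Real.exp_add, errf]
      apply Real.exp_le_exp.2
      have hsq : Real.sqrt ((2*m:ℕ):ℝ) ≤ 2 * (Real.sqrt n / y) := by
        rw [Real.sqrt_le_left (by positivity), mul_pow, div_pow, Real.sq_sqrt (by positivity)]
        push_cast; linarith
      have hsq0 : 1 ≤ Real.sqrt ((2*m:ℕ):ℝ) := by
        rw [Real.one_le_sqrt]; exact_mod_cast (by omega : 1 ≤ 2*m)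
      have e1 : lam / (4 * (2 * (Real.sqrt n / y))) ≤ lam / (4 * Real.sqrt ((2*m:ℕ):ℝ)) := by
        gcongr
      have e2 : lam / (4 * (2 * (Real.sqrt n / y))) = ρ * y / 16 := by
        rw [hlam]; field_simp; ring
      have e3 : 1 / (4 * Real.sqrt ((2*m:ℕ):ℝ)) ≤ 1 := by
        rw [div_le_one (by positivity)]; linarith
      rw [sub_div]; push_cast at *; linarith
    have hAq := HK_func' hV n (b*m) (2*m) R hn1' (by omega) (δ/2) A
      (8*d*Real.exp 2 * Real.exp (-(ρ * y/4)/8) ^ 2) (by positivity) (by linarith) (by positivity) G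
      (fun p => ind_nonneg _) (fun p => ind_le_one _) (by
        refine hbx.trans ?_
        have : (4*(R:ℝ)+3) ≤ A * Real.sqrt n := by rw [hA, add_mul]; linarith
        calc 8 * (d:ℝ) * (4*R+3)^d * errf lam (2*m) ≤ 8 * (d:ℝ) * (A * Real.sqrt n)^d * (Real.exp 2 * Real.exp (-(ρ * y/4)/8) ^ 2) := by
              have := errf_nonneg lam (2*m)
              gcongr
          _ = _ := by ring)
    refine hAq.trans (le_of_eq ?_)
    rw [Real.sqrt_mul (by positivity), Real.sqrt_sq (Real.exp_nonneg _), hK]; ring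
  have hcard : (S.card : ℝ) ≤ (T+1) * y^2 := by
    have h1 : S.card ≤ T*n/m+1 := by
      refine (Finset.card_filter_le _ _).trans (by simp)
    have h2 : ((T*n/m : ℕ):ℝ) ≤ T * y^2 := by
      refine Nat.cast_div_le.trans ?_
      rw [div_le_iff₀ (by positivity)]
      push_cast
      rw [div_le_iff₀ (by positivity)] at hm1
      rw [mul_assoc, mul_comm ((y:ℝ)^2)]
      gcongr
    have h3 : (S.card : ℝ) ≤ ((T*n/m : ℕ):ℝ) + 1 := by exact_mod_cast h1
    linarith
  refine (EW_mono' fun p hp _ => hincl p hp).trans ?_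
  rw [EW_add, EW_add, EW_sum]
  have f1 := hM H hH1
  have f2 : EW V H 0 (fun p => ind (∃ k ≤ h, ∃ a, (M:ℝ) * Real.sqrt h ≤ |(p k a:ℝ)|)) ≤ ε/3 := by
    rw [EW_restrict' V hhn 0 _ (by
      intro p q hpq
      refine ind_congr (exists_congr fun k => and_congr_right fun hk => by rw [hpq k hk]))]
    exact hM h hh0
  have f3 : ∑ b ∈ S, EW V H 0 (fun p => ind (p (b*m) ∈ Box d R) * G (fun k => p (b*m+k))) ≤ ε/3 := by
    refine (Finset.sum_le_sum hterm).trans ?_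
    rw [Finset.sum_const, nsmul_eq_mul]
    have hu : 0 < ρ * y/4 := by positivity
    have hx := exp_bd 3 (ρ*y/4) hu
    calc (S.card:ℝ) * (K * Real.exp (-(ρ * y/4)/8)) ≤ ((T+1) * y^2) * (K * (((Nat.factorial 3 : ℕ):ℝ) * 8^3 / (ρ*y/4)^3)) := by
          gcongr
      _ = c1 / y := by rw [hc1]; field_simp
      _ ≤ ε/3 := by
          rw [div_le_iff₀ hy0]
          rw [div_lt_iff₀ hε] at hy1
          linarith
  linarith


lemma shift_shift (x y : Pt d) (ω : Config d) : shift y (shift x ω) = shift (x+y) ω := by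
  ext z; simp [shift, add_assoc]

lemma shift_zero (ω : Config d) : shift (0 : Pt d) ω = ω := by ext z; simp [shift]

lemma measurable_shift (x : Pt d) : Measurable (shift x : Config d → Config d) :=
  measurable_pi_lambda _ fun y => measurable_pi_apply (x + y)

lemma vec_dist (e : Dir d) : dist1 (0 : Pt d) (vec e) = 1 :=
  adj_iff.2 ⟨e, by simp⟩

lemma pt_induction {p : Pt d → Prop} (h0 : p 0) (h1 : ∀ x e, p x → p (x + vec e)) : ∀ x, p x := by
  intro x
  induction hn : dist1 0 x using Nat.strong_induction_on generalizing x with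
  | _ n ih =>
    by_cases hx : x = 0
    · rw [hx]; exact h0
    · obtain ⟨i, hi⟩ : ∃ i, x i ≠ 0 := by
        by_contra hc; push Not at hc; exact hx (funext hc)
      have key : ∀ b : Bool, (x i - (if b then 1 else -1)).natAbs + 1 = (x i).natAbs → p x := by
        intro b hb
        have h2 : x = (x - vec (i, b)) + vec (i, b) := by abel
        rw [h2]
        refine h1 _ _ (ih (dist1 0 (x - vec (i,b))) ?_ _ rfl)
        rw [← hn]
        unfold dist1
        rw [← Finset.add_sum_erase _ _ (Finset.mem_univ i),
          ← Finset.add_sum_erase Finset.univ (fun j => ((0:Pt d) j - x j).natAbs) (Finset.mem_univ i)]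
        have h3 : ∀ j ∈ Finset.univ.erase i, ((0:Pt d) j - (x - vec (i,b)) j).natAbs = ((0:Pt d) j - x j).natAbs := by
          intro j hj
          have : j ≠ i := by simpa using hj
          simp [vec, this]
        rw [Finset.sum_congr rfl h3]
        have h4 : ((0:Pt d) i - (x - vec (i,b)) i).natAbs < ((0:Pt d) i - x i).natAbs := by
          simp only [Pi.zero_apply, Pi.sub_apply, vec, Pi.single_eq_same]
          omega
        omega
      rcases lt_or_gt_of_ne hi with h | h
      · exact key false (by simp; omega)
      · exact key true (by simp; omega)

lemma shift_mp {P : Measure (Config d)} (hA1 : ∀ e : Pt d, dist1 (0 : Pt d) e = 1 → Ergodic (shift e) P)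
    (x : Pt d) : MeasurePreserving (shift x) P P := by
  refine pt_induction (p := fun x => MeasurePreserving (shift x) P P) ?_ ?_ x
  · have : (shift (0 : Pt d) : Config d → Config d) = id := by ext ω; rw [shift_zero]; rfl
    rw [this]; exact MeasurePreserving.id P
  · intro x e h
    have h1 := (hA1 (vec e) (vec_dist e)).toMeasurePreserving
    have h2 := h1.comp h
    have : (shift (vec e) ∘ shift x : Config d → Config d) = shift (x + vec e) := by
      ext ω; simp [shift_shift]
    rwa [this] at h2

lemma conn_shift {x y z : Pt d} {ω : Config d} (h : connIn (SS (shift x ω)) y z) :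
    connIn (SS ω) (x+y) (x+z) := by
  obtain ⟨hy, hz, h⟩ := h
  refine ⟨hy, hz, ?_⟩
  have key : ∀ a b, stepRel (SS (shift x ω)) a b → stepRel (SS ω) (x+a) (x+b) := by
    rintro a b ⟨hab, ha, hb⟩
    refine ⟨?_, ha, hb⟩
    obtain ⟨e, rfl⟩ := adj_iff.1 hab
    exact adj_iff.2 ⟨e, by abel⟩
  clear hy hz
  induction h with
  | refl => exact .refl
  | tail _ h2 ih => exact ih.tail (key _ _ h2)

lemma conn_shift_iff {x y z : Pt d} {ω : Config d} : connIn (SS (shift x ω)) y z ↔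
    connIn (SS ω) (x+y) (x+z) := by
  refine ⟨conn_shift, fun h => ?_⟩
  have h2 : connIn (SS (shift (-x) (shift x ω))) (x+y) (x+z) := by
    rw [shift_shift, add_neg_cancel, shift_zero]; exact h
  have := conn_shift h2
  simpa using this

lemma Sinf_shift {x y : Pt d} {ω : Config d} : y ∈ Sinf (shift x ω) ↔ x + y ∈ Sinf ω := by
  unfold Sinf
  have h1 : cluster (SS ω) (x+y) = (fun a => x + a) '' cluster (SS (shift x ω)) y := by
    ext z
    simp only [cluster, Set.mem_image]
    constructor
    · intro h
      refine ⟨-x + z, ?_, by abel⟩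
      show connIn _ _ _
      rw [conn_shift_iff]; simpa using h
    · rintro ⟨a, ha, rfl⟩
      exact conn_shift ha
  show (_ ∧ _) ↔ (_ ∧ _)
  rw [h1, Set.infinite_image_iff (add_right_injective x).injOn]
  rfl

/-- iterated step relation -/
def stepN (ω : Config d) (x : Pt d) : ℕ → Pt d → Prop
  | 0, y => y = x
  | n+1, y => ∃ z, stepN ω x n z ∧ stepRel (SS ω) z y

lemma stepN_iff (ω : Config d) (x y : Pt d) :
    Relation.ReflTransGen (stepRel (SS ω)) x y ↔ ∃ n, stepN ω x n y := by
  constructor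
  · intro h
    induction h with
    | refl => exact ⟨0, rfl⟩
    | tail _ h2 ih => obtain ⟨n, hn⟩ := ih; exact ⟨n+1, _, hn, h2⟩
  · rintro ⟨n, hn⟩
    induction n generalizing y with
    | zero => rw [show y = x from hn]
    | succ n ih => obtain ⟨z, hz, h⟩ := hn; exact (ih z hz).tail h

lemma meas_SS (x : Pt d) : MeasurableSet {ω : Config d | x ∈ SS ω} := by
  have : {ω : Config d | x ∈ SS ω} = (fun ω : Config d => ω x) ⁻¹' {true} := rfl
  rw [this]; exact measurable_pi_apply x (measurableSet_singleton _)

lemma meas_stepN (x y : Pt d) (n : ℕ) : MeasurableSet {ω : Config d | stepN ω x n y} := by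
  induction n generalizing y with
  | zero => exact MeasurableSet.const (y = x)
  | succ n ih =>
    have : {ω : Config d | stepN ω x (n+1) y} = ⋃ z, ({ω : Config d | stepN ω x n z} ∩
        ({ω : Config d | adj z y} ∩ ({ω : Config d | z ∈ SS ω} ∩ {ω : Config d | y ∈ SS ω}))) := by
      ext ω
      simp only [Set.mem_iUnion]
      rfl
    rw [this]
    exact MeasurableSet.iUnion fun z => (ih z).inter ((MeasurableSet.const _).inter ((meas_SS z).inter (meas_SS y)))

lemma meas_conn (x y : Pt d) : MeasurableSet {ω : Config d | connIn (SS ω) x y} := by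
  have : {ω : Config d | connIn (SS ω) x y} = {ω : Config d | x ∈ SS ω} ∩ ({ω : Config d | y ∈ SS ω} ∩
      ⋃ n, {ω : Config d | stepN ω x n y}) := by
    ext ω
    simp only [Set.mem_inter_iff, Set.mem_iUnion]
    show (_ ∧ _ ∧ _) ↔ _
    rw [stepN_iff]; rfl
  rw [this]
  exact (meas_SS x).inter ((meas_SS y).inter (MeasurableSet.iUnion fun n => meas_stepN x y n))

lemma meas_Sinf (x : Pt d) : MeasurableSet {ω : Config d | x ∈ Sinf ω} := by
  have : {ω : Config d | x ∈ Sinf ω} = {ω : Config d | x ∈ SS ω} ∩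
      ⋂ N : ℕ, ⋃ y : Pt d, {ω : Config d | y ∉ Box d N} ∩ {ω : Config d | connIn (SS ω) x y} := by
    ext ω
    simp only [Set.mem_inter_iff, Set.mem_iUnion, Set.mem_iInter]
    show (_ ∧ _) ↔ _
    refine and_congr_right fun _ => ?_
    constructor
    · intro h N
      obtain ⟨y, hy, hyN⟩ := h.exists_notMem_finset (Box d N)
      exact ⟨y, hyN, hy⟩
    · intro h hfin
      obtain ⟨N, hN⟩ : ∃ N : ℕ, ∀ y ∈ cluster (SS ω) x, y ∈ Box d N := by
        refine ⟨∑ y ∈ hfin.toFinset, ∑ i, (y i).natAbs, fun y hy => ?_⟩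
        rw [mem_Box]; intro i
        have h1 : (y i).natAbs ≤ ∑ i, (y i).natAbs :=
          Finset.single_le_sum (f := fun i => (y i).natAbs) (fun _ _ => Nat.zero_le _) (Finset.mem_univ i)
        have h2 : ∑ i, (y i).natAbs ≤ ∑ y ∈ hfin.toFinset, ∑ i, (y i).natAbs :=
          Finset.single_le_sum (f := fun y : Pt d => ∑ i, (y i).natAbs) (fun _ _ => Nat.zero_le _)
            (hfin.mem_toFinset.2 hy)
        rw [Int.abs_eq_natAbs]
        exact_mod_cast h1.trans h2
      obtain ⟨y, hy, hy'⟩ := h N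
      exact hy (hN y hy')
  rw [this]
  exact (meas_SS x).inter (MeasurableSet.iInter fun N => MeasurableSet.iUnion fun y =>
    (MeasurableSet.const _).inter (meas_conn x y))

lemma ae_shift {P : Measure (Config d)} (hA1 : ∀ e : Pt d, dist1 (0 : Pt d) e = 1 → Ergodic (shift e) P)
    {p : Config d → Prop} (h : ∀ᵐ ω ∂P, p ω) : ∀ᵐ ω ∂P, ∀ x, p (shift x ω) := by
  rw [ae_all_iff]
  intro x
  exact (shift_mp hA1 x).quasiMeasurePreserving.ae h

/-- Maximal inequality -/
lemma vitali_box (s : Finset (Pt d)) (r : Pt d → ℕ) (f : Pt d → ℝ≥0∞) (lam : ℝ≥0∞) (L N : ℕ)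
    (hs : s ⊆ Box d L) (hr : ∀ x ∈ s, r x ≤ N)
    (h : ∀ x ∈ s, lam * (2 * (r x : ℝ≥0∞) + 1) ^ d ≤ ∑ y ∈ Box d (r x), f (x + y)) :
    lam * s.card ≤ 4 ^ d * ∑ y ∈ Box d (L + N), f y := by
  classical
  obtain ⟨u, hus, hdisj, hcov⟩ := Vitali.exists_disjoint_subfamily_covering_enlargement_closedBall
    (s : Set (Pt d)) (fun x : Pt d => x) (fun x => (r x : ℝ)) N (fun x hx => by exact_mod_cast hr x hx) 4 (by norm_num)
  have hufin : u.Finite := s.finite_toSet.subset hus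
  set U := hufin.toFinset with hU
  have hmem : ∀ x y : Pt d, ∀ R : ℕ, y ∈ Metric.closedBall x R ↔ y - x ∈ Box d R := by
    intro x y R
    rw [Metric.mem_closedBall, dist_pi_le_iff (by positivity), mem_Box]
    refine forall_congr' fun i => ?_
    rw [Int.dist_eq, Pi.sub_apply]
    norm_cast
  have hsub : s ⊆ U.biUnion (fun x => (Box d (4 * r x)).image (fun y => x + y)) := by
    intro x hx
    obtain ⟨b, hb, hbc⟩ := hcov x hx
    rw [Finset.mem_biUnion]
    refine ⟨b, hufin.mem_toFinset.2 hb, Finset.mem_image.2 ⟨x - b, ?_, by abel⟩⟩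
    rw [← hmem]
    have := hbc (Metric.mem_closedBall_self (by positivity))
    convert this using 2
    push_cast; rfl
  have hcard : (s.card : ℝ≥0∞) ≤ ∑ x ∈ U, 4^d * (2 * (r x : ℝ≥0∞) + 1)^d := by
    have h1 : s.card ≤ ∑ x ∈ U, (Box d (4 * r x)).card :=
      (Finset.card_le_card hsub).trans (Finset.card_biUnion_le.trans
        (Finset.sum_le_sum fun x _ => Finset.card_image_le))
    have h2 : ∀ x ∈ U, (Box d (4 * r x)).card ≤ 4^d * (2 * r x + 1)^d := by
      intro x _
      rw [card_Box, ← mul_pow]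
      exact Nat.pow_le_pow_left (by omega) d
    have h3 := h1.trans (Finset.sum_le_sum h2)
    exact_mod_cast h3
  calc lam * s.card ≤ lam * ∑ x ∈ U, 4^d * (2 * (r x : ℝ≥0∞) + 1)^d := by gcongr
    _ = 4^d * ∑ x ∈ U, lam * (2 * (r x : ℝ≥0∞) + 1)^d := by
        rw [Finset.mul_sum, Finset.mul_sum]
        refine Finset.sum_congr rfl fun x _ => by ring
    _ ≤ 4^d * ∑ x ∈ U, ∑ y ∈ Box d (r x), f (x + y) := by
        gcongr with x hx
        exact h x (hus (hufin.mem_toFinset.1 hx))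
    _ = 4^d * ∑ x ∈ U, ∑ y ∈ (Box d (r x)).image (fun y => x + y), f y := by
        congr 1
        refine Finset.sum_congr rfl fun x _ => ?_
        rw [Finset.sum_image (fun a _ b _ hab => add_left_cancel hab)]
    _ = 4^d * ∑ y ∈ U.biUnion (fun x => (Box d (r x)).image (fun y => x + y)), f y := by
        rw [Finset.sum_biUnion]
        intro x hx y hy hxy
        have hd := hdisj (hufin.mem_toFinset.1 hx) (hufin.mem_toFinset.1 hy) hxy
        simp only [Function.onFun] at hd ⊢
        rw [Finset.disjoint_left]
        intro a ha hb
        obtain ⟨a1, ha1, rfl⟩ := Finset.mem_image.1 ha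
        obtain ⟨b1, hb1, hab⟩ := Finset.mem_image.1 hb
        have g1 : x + a1 ∈ Metric.closedBall x (r x : ℝ) := by rw [hmem]; simpa using ha1
        have g2 : x + a1 ∈ Metric.closedBall y (r y : ℝ) := by rw [hmem, ← hab]; simpa using hb1
        exact Set.disjoint_left.1 hd g1 g2
    _ ≤ _ := by
        gcongr
        intro y hy
        obtain ⟨x, hx, hy⟩ := Finset.mem_biUnion.1 hy
        obtain ⟨z, hz, rfl⟩ := Finset.mem_image.1 hy
        have hxs := hus (hufin.mem_toFinset.1 hx)
        have h1 := mem_Box.1 (hs hxs)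
        have h2 := mem_Box.1 hz
        rw [mem_Box]; intro i
        have := h1 i; have := h2 i
        have h5 : r x ≤ N := hr x hxs
        have := abs_add_le (x i) (z i)
        simp only [Pi.add_apply]
        push_cast
        omega

lemma max_ineq {P : Measure (Config d)} [IsProbabilityMeasure P]
    (hA1 : ∀ e : Pt d, dist1 (0 : Pt d) e = 1 → Ergodic (shift e) P)
    (f : Config d → ℝ≥0∞) (hf : Measurable f) (lam : ℝ≥0∞) :
    lam * P {ω | ∃ R : ℕ, lam * (2 * (R : ℝ≥0∞) + 1) ^ d ≤ ∑ y ∈ Box d R, f (shift y ω)}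
      ≤ 4 ^ d * ∫⁻ ω, f ω ∂P := by
  classical
  -- truncated version
  have hfm : ∀ x : Pt d, Measurable fun ω => f (shift x ω) := fun x => hf.comp (measurable_shift x)
  have hinv0 : ∀ x : Pt d, ∫⁻ ω, f (shift x ω) ∂P = ∫⁻ ω, f ω ∂P := fun x =>
    (shift_mp hA1 x).lintegral_comp hf
  set E : ℕ → Set (Config d) := fun N => {ω | ∃ R ≤ N, lam * (2 * (R : ℝ≥0∞) + 1) ^ d ≤ ∑ y ∈ Box d R, f (shift y ω)} with hE
  have hEm : ∀ N, MeasurableSet (E N) := by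
    intro N
    have : E N = ⋃ R : ℕ, ⋃ _ : R ≤ N, {ω | lam * (2 * (R : ℝ≥0∞) + 1) ^ d ≤ ∑ y ∈ Box d R, f (shift y ω)} := by
      ext ω; simp [hE]
    rw [this]
    exact MeasurableSet.iUnion fun R => MeasurableSet.iUnion fun _ =>
      measurableSet_le measurable_const (Finset.measurable_sum _ fun y _ => hfm y)
  have htr : ∀ N, lam * P (E N) ≤ 4 ^ d * ∫⁻ ω, f ω ∂P := by
    intro N
    have hL : ∀ L : ℕ, (lam * P (E N)) * (2*L+1:ℕ)^d ≤ (4 ^ d * ∫⁻ ω, f ω ∂P) * (2*(L+N)+1:ℕ)^d := by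
      intro L
      have h1 : ∀ ω : Config d, lam * ∑ x ∈ Box d L, (E N).indicator (fun _ => (1:ℝ≥0∞)) (shift x ω)
          ≤ 4^d * ∑ y ∈ Box d (L+N), f (shift y ω) := by
        intro ω
        set s := (Box d L).filter (fun x => shift x ω ∈ E N) with hs
        have h2 : ∑ x ∈ Box d L, (E N).indicator (fun _ => (1:ℝ≥0∞)) (shift x ω) = s.card := by
          rw [hs, Finset.card_filter]; push_cast
          refine Finset.sum_congr rfl fun x _ => by simp [Set.indicator_apply]
        rw [h2]
        have h3 : ∀ x : Pt d, ∃ R : ℕ, x ∈ s → R ≤ N ∧ lam * (2 * (R : ℝ≥0∞) + 1) ^ d ≤ ∑ y ∈ Box d R, f (shift (x+y) ω) := by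
          intro x
          by_cases hx : x ∈ s
          · obtain ⟨R, hR, h⟩ := (Finset.mem_filter.1 hx).2
            refine ⟨R, fun _ => ⟨hR, ?_⟩⟩
            simpa only [shift_shift] using h
          · exact ⟨0, fun h => absurd h hx⟩
        choose r hr using h3
        exact vitali_box s r (fun y => f (shift y ω)) lam L N (Finset.filter_subset _ _)
          (fun x hx => (hr x hx).1) (fun x hx => (hr x hx).2)
      have h4 := lintegral_mono (μ := P) h1
      have hm : ∀ x : Pt d, Measurable fun ω => (E N).indicator (fun _ => (1:ℝ≥0∞)) (shift x ω) :=
        fun x => (measurable_const.indicator (hEm N)).comp (measurable_shift x)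
      rw [lintegral_const_mul _ (Finset.measurable_sum _ fun x _ => hm x),
        lintegral_const_mul _ (Finset.measurable_sum _ fun y _ => hfm y),
        lintegral_finsetSum _ (fun x _ => hm x),
        lintegral_finsetSum _ (fun y _ => hfm y)] at h4
      have h5 : ∀ x : Pt d, ∫⁻ ω, (E N).indicator (fun _ => (1:ℝ≥0∞)) (shift x ω) ∂P = P (E N) := by
        intro x
        rw [(shift_mp hA1 x).lintegral_comp (measurable_const.indicator (hEm N)), lintegral_indicator_const (hEm N), one_mul]
      simp only [h5, hinv0, Finset.sum_const, card_Box, nsmul_eq_mul] at h4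
      push_cast at h4 ⊢
      calc _ = lam * ((2 * (L:ℝ≥0∞) + 1) ^ d * P (E N)) := by ring
        _ ≤ _ := h4
        _ = _ := by ring
    have hlim : Tendsto (fun L : ℕ => (4 ^ d * ∫⁻ ω, f ω ∂P) * ENNReal.ofReal ((1 + 2*N*(1/((L:ℝ)+1)))^d)) atTop
        (nhds ((4 ^ d * ∫⁻ ω, f ω ∂P) * ENNReal.ofReal ((1 + 2*N*0)^d))) := by
      refine ENNReal.Tendsto.const_mul (ENNReal.tendsto_ofReal ?_) (Or.inl (by simp))
      exact ((tendsto_one_div_add_atTop_nhds_zero_nat.const_mul _).const_add _).pow d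
    have hone : (4 ^ d * ∫⁻ ω, f ω ∂P) * ENNReal.ofReal ((1 + 2*N*0)^d) = 4 ^ d * ∫⁻ ω, f ω ∂P := by simp
    rw [hone] at hlim
    refine ge_of_tendsto' hlim fun L => ?_
    have h6 := hL L
    have hpos : ((2*L+1:ℕ):ℝ≥0∞)^d ≠ 0 := by positivity
    have hfin : ((2*L+1:ℕ):ℝ≥0∞)^d ≠ ⊤ := ENNReal.pow_ne_top (ENNReal.natCast_ne_top _)
    rw [← ENNReal.mul_le_mul_iff_left hpos hfin]
    refine h6.trans ?_
    rw [mul_assoc (4 ^ d * ∫⁻ ω, f ω ∂P)]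
    refine mul_le_mul_right ?_ _
    rw [← ENNReal.ofReal_natCast, ← ENNReal.ofReal_natCast, ← ENNReal.ofReal_pow (by positivity),
      ← ENNReal.ofReal_pow (by positivity), ← ENNReal.ofReal_mul (by positivity), ← mul_pow]
    apply ENNReal.ofReal_le_ofReal
    gcongr
    push_cast
    have hL0 : (0:ℝ) ≤ L := by positivity
    have hN0 : (0:ℝ) ≤ N := by positivity
    have : 2*(N:ℝ) ≤ 2*N*(1/((L:ℝ)+1))*(2*L+1) := by
      rw [mul_one_div, div_mul_eq_mul_div, le_div_iff₀ (by positivity)]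
      nlinarith [mul_nonneg hN0 hL0]
    nlinarith
  have hun : {ω | ∃ R : ℕ, lam * (2 * (R : ℝ≥0∞) + 1) ^ d ≤ ∑ y ∈ Box d R, f (shift y ω)} = ⋃ N, E N := by
    ext ω
    simp only [hE, Set.mem_iUnion]
    constructor
    · rintro ⟨R, hR⟩; exact ⟨R, R, le_rfl, hR⟩
    · rintro ⟨N, R, _, hR⟩; exact ⟨R, hR⟩
  rw [hun]
  have hmono : Monotone E := fun N N' h ω ⟨R, hR, hh⟩ => ⟨R, hR.trans h, hh⟩
  rw [hmono.measure_iUnion, ENNReal.mul_iSup]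
  exact iSup_le htr

lemma max_ae {P : Measure (Config d)} [IsProbabilityMeasure P]
    (hA1 : ∀ e : Pt d, dist1 (0 : Pt d) e = 1 → Ergodic (shift e) P)
    (f : ℕ → Config d → ℝ) (hf : ∀ j, Measurable (f j)) (hf0 : ∀ j ω, 0 ≤ f j ω)
    (hb : ∀ j, ∫⁻ ω, ENNReal.ofReal (f j ω) ∂P ≤ (1/4 : ℝ≥0∞) ^ j) :
    ∀ᵐ ω ∂P, ∀ᶠ j in atTop, ∀ R : ℕ, ∑ y ∈ Box d R, f j (shift y ω) ≤ (1/2:ℝ) ^ j * (2*R+1)^d := by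
  set E : ℕ → Set (Config d) := fun j => {ω | ∃ R : ℕ, ((1/2 : ℝ≥0∞)^j) * (2 * (R : ℝ≥0∞) + 1) ^ d ≤
    ∑ y ∈ Box d R, ENNReal.ofReal (f j (shift y ω))} with hE
  have h1 : ∀ j, P (E j) ≤ 4^d * (1/2 : ℝ≥0∞)^j := by
    intro j
    have h := (max_ineq hA1 (fun ω => ENNReal.ofReal (f j ω)) (hf j).ennreal_ofReal ((1/2 : ℝ≥0∞)^j)).trans
      (mul_le_mul_right (hb j) _)
    have hne0 : ((1/2 : ℝ≥0∞)^j) ≠ 0 := by simp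
    have hnet : ((1/2 : ℝ≥0∞)^j) ≠ ⊤ := ENNReal.pow_ne_top (by simp)
    rw [← ENNReal.mul_le_mul_iff_right hne0 hnet]
    refine h.trans (le_of_eq ?_)
    have : (1/4:ℝ≥0∞)^j = (1/2:ℝ≥0∞)^j * (1/2)^j := by
      rw [← mul_pow]; congr 1
      rw [one_div, one_div, ← ENNReal.mul_inv (by simp) (by simp)]; norm_num
    rw [this]; ring
  have h2 : ∑' j, P (E j) ≠ ⊤ := by
    refine ne_top_of_le_ne_top ?_ (ENNReal.tsum_le_tsum h1)
    rw [ENNReal.tsum_mul_left, ENNReal.tsum_geometric]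
    refine ENNReal.mul_ne_top (ENNReal.pow_ne_top (by simp)) ?_
    simp
  filter_upwards [ae_eventually_notMem h2] with ω hω
  filter_upwards [hω] with j hj R
  have h3 : ¬ ∃ R : ℕ, ((1/2 : ℝ≥0∞)^j) * (2 * (R : ℝ≥0∞) + 1) ^ d ≤
    ∑ y ∈ Box d R, ENNReal.ofReal (f j (shift y ω)) := hj
  push Not at h3
  have h4 := (h3 R).le
  rw [← ENNReal.ofReal_sum_of_nonneg (fun y _ => hf0 j _)] at h4
  have h5 : ((1/2 : ℝ≥0∞)^j) * (2 * (R : ℝ≥0∞) + 1) ^ d = ENNReal.ofReal ((1/2:ℝ) ^ j * (2*R+1)^d) := by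
    rw [ENNReal.ofReal_mul (by positivity), ENNReal.ofReal_pow (by positivity), ENNReal.ofReal_pow (by positivity)]
    congr 2
    · rw [ENNReal.ofReal_div_of_pos (by norm_num)]; simp
    · rw [ENNReal.ofReal_add (by positivity) (by positivity), ENNReal.ofReal_mul (by positivity)]; simp
  rw [h5] at h4
  exact (ENNReal.ofReal_le_ofReal_iff (by positivity)).1 h4


lemma big_M (d : ℕ) (T : ℕ) (hT : 1 ≤ T) (κ ε : ℝ) (hκ : 0 ≤ κ) (hε : 0 < ε) :
    ∃ M0 : ℕ, ∀ M : ℕ, M0 ≤ M → κ * Real.sqrt ((8*M+3)^d * Real.exp (2 - (M:ℝ)/(4*T))) ≤ ε := by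
  have hT' : (0:ℝ) < T := by exact_mod_cast hT
  have h1 : Tendsto (fun M : ℕ => (M:ℝ)/(4*T)) atTop atTop :=
    tendsto_natCast_atTop_atTop.atTop_div_const (by positivity)
  have h2 := (Real.tendsto_pow_mul_exp_neg_atTop_nhds_zero d).comp h1
  have h3 : Tendsto (fun M : ℕ => κ * Real.sqrt ((44*T)^d * Real.exp 2 * (((M:ℝ)/(4*T))^d * Real.exp (-((M:ℝ)/(4*T)))))) atTop
      (nhds (κ * Real.sqrt ((44*T)^d * Real.exp 2 * 0))) := (h2.const_mul _).sqrt.const_mul _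
  simp only [mul_zero, Real.sqrt_zero] at h3
  obtain ⟨M0, hM0⟩ := eventually_atTop.1 (h3.eventually (ge_mem_nhds hε))
  refine ⟨max M0 1, fun M hM => le_trans ?_ (hM0 M (le_of_max_le_left hM))⟩
  have hM1 : (1:ℝ) ≤ M := by exact_mod_cast (le_of_max_le_right hM)
  refine mul_le_mul_of_nonneg_left (Real.sqrt_le_sqrt ?_) hκ
  rw [sub_eq_add_neg, Real.exp_add]
  have h5 : (8*(M:ℝ)+3)^d ≤ (44*T)^d * ((M:ℝ)/(4*T))^d := by
    rw [← mul_pow]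
    have : 44 * (T:ℝ) * (M/(4*T)) = 11 * M := by field_simp; norm_num
    rw [this]
    gcongr; linarith
  calc _ ≤ (44*T)^d * ((M:ℝ)/(4*T))^d * (Real.exp 2 * Real.exp (-((M:ℝ)/(4*T)))) := by gcongr
    _ = _ := by ring

/-- Main transfer lemma. -/
lemma transfer [NeZero d] {V : Set (Pt d)} {C : ℝ} (hV : HKB V C) (T : ℕ) (hT : 1 ≤ T) (δ ε : ℝ)
    (hδ : 0 < δ) (hε : 0 < ε) :
    ∃ (M : ℕ) (K : ℝ), 0 ≤ K ∧ ∀ n t m : ℕ, 1 ≤ n → 1 ≤ t → δ * n ≤ t → t ≤ T * n → 1 ≤ m → m ≤ T * n →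
      ∀ (G G' : (ℕ → Pt d) → ℝ) (q : ℝ), 0 ≤ q → (∀ p, 0 ≤ G p) → (∀ p, G p ≤ 1) → (∀ p, 0 ≤ G' p) →
      (∀ p : ℕ → Pt d, (∀ k ≤ m, p k ∈ Box d (2*(M*(Nat.sqrt n+1)))) → G p ≤ G' p) →
      ∑ x ∈ Box d (2*(M*(Nat.sqrt n+1))+1), EW (V ∩ Box d (2*(M*(Nat.sqrt n+1))+1)) m x G'
        ≤ (4*(M*(Nat.sqrt n+1):ℕ)+3)^d * q →
      EW V (t+m) 0 (fun p => G (fun k => p (t+k))) ≤ ε + K * Real.sqrt q := by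
  have hC := hV.1
  have hT' : (1:ℝ) ≤ T := by exact_mod_cast hT
  obtain ⟨M1, hM1, hdiff⟩ := diffusive hV (ε/2) (by positivity)
  obtain ⟨M2, hM2⟩ := big_M d T hT (C * δ ^ (-(d:ℝ)/4) * Real.sqrt (4*d)) (ε/2) (by positivity) (by positivity)
  set M := max (M1 * T) (max M2 1) with hM
  have hMT : M1 * T ≤ M := le_max_left _ _
  have hMM2 : M2 ≤ M := (le_max_left _ _).trans (le_max_right _ _)
  have hMge1 : 1 ≤ M := (le_max_right _ _).trans (le_max_right _ _)
  have hM1' : (1:ℝ) ≤ M := by exact_mod_cast hMge1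
  refine ⟨M, hkc d C δ (8*M+3), hkc_nonneg hC hδ, ?_⟩
  intro n t m hn ht hδt htT hm hmT G G' q hq hG0 hG1 hG'0 hGG' hsum
  set R := M*(Nat.sqrt n+1) with hR
  have hn1 : (1:ℝ) ≤ n := by exact_mod_cast hn
  have hs1 : (1:ℝ) ≤ Real.sqrt n := Real.one_le_sqrt.2 hn1
  have hRlo : (M:ℝ) * Real.sqrt n ≤ R := by
    rw [hR]; push_cast
    refine mul_le_mul_of_nonneg_left ?_ (by linarith)
    exact Real.sqrt_le_iff.2 ⟨by positivity, by exact_mod_cast (Nat.lt_succ_sqrt' n).le⟩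
  have hRhi : (R:ℝ) ≤ 2 * M * Real.sqrt n := by
    rw [hR]; push_cast
    have : ((Nat.sqrt n : ℕ):ℝ) ≤ Real.sqrt n := by
      exact Real.nat_sqrt_le_real_sqrt
    calc (M:ℝ) * ((Nat.sqrt n : ℕ) + 1) ≤ M * (Real.sqrt n + Real.sqrt n) := by gcongr
      _ = _ := by ring
  -- part 1
  have hp1 : EW V (t+m) 0 (fun p => ind (p t ∉ Box d R)) ≤ ε/2 := by
    rw [EW_restrict' V (Nat.le_add_right t m) 0 _ (fun p q h => by simp only [h t le_rfl]),
      ← EW_restrict' V htT 0 _ (fun p q h => by simp only [h t le_rfl])]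
    refine le_trans (EW_mono fun p => ind_mono fun hp => ?_) (hdiff (T*n) (Nat.mul_pos hT hn))
    rw [mem_Box] at hp
    push Not at hp
    obtain ⟨a, ha⟩ := hp
    refine ⟨t, htT, a, ?_⟩
    have h1 : (R:ℝ) ≤ |(p t a : ℝ)| := by exact_mod_cast ha.le
    refine le_trans ?_ (hRlo.trans h1)
    push_cast
    rw [Real.sqrt_mul (by positivity), ← mul_assoc]
    refine mul_le_mul_of_nonneg_right ?_ (by positivity)
    calc (M1:ℝ) * Real.sqrt T ≤ M1 * T := by
          gcongr
          exact Real.sqrt_le_iff.2 ⟨by positivity, by nlinarith⟩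
      _ ≤ M := by exact_mod_cast hMT
  -- part 2
  have herr : errf R m ≤ Real.exp (2 - (M:ℝ)/(4*T)) := by
    unfold errf
    apply Real.exp_le_exp.2
    have hm0 : (1:ℝ) ≤ m := by exact_mod_cast hm
    have hsm : Real.sqrt m ≤ T * Real.sqrt n := by
      refine Real.sqrt_le_iff.2 ⟨by positivity, ?_⟩
      rw [mul_pow, Real.sq_sqrt (by positivity)]
      have : (m:ℝ) ≤ T * n := by exact_mod_cast hmT
      nlinarith
    have hsm1 : 1 ≤ Real.sqrt m := Real.one_le_sqrt.2 hm0
    have h1 : (M:ℝ)/(4*T) ≤ R/(4*Real.sqrt m) := by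
      rw [div_le_div_iff₀ (by positivity) (by positivity)]
      calc (M:ℝ) * (4 * Real.sqrt m) ≤ M * (4 * (T * Real.sqrt n)) := by gcongr
        _ = (M * Real.sqrt n) * (4*T) := by ring
        _ ≤ _ := by gcongr
    have h2 : 1/(4*Real.sqrt m) ≤ 1 := by rw [div_le_one (by positivity)]; linarith
    rw [sub_div]; linarith
  have hbt := box_transfer V R m hm hG1 hG'0 hGG'
  have hA : (4*(R:ℝ)+3) ≤ (8*M+3) * Real.sqrt n := by nlinarith
  have hq2 : ∑ x ∈ Box d R, EW V m x G ≤ ((8*M+3) * Real.sqrt n)^d * (q + 4*d*errf R m) := by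
    refine hbt.trans ((add_le_add_left hsum _).trans ?_)
    have h0 := errf_nonneg R m
    calc _ = (4*(R:ℝ)+3)^d * (q + 4*d*errf R m) := by ring
      _ ≤ _ := by gcongr
  have hp2 := HK_func' hV n t m R hn ht δ (8*M+3) (q + 4*d*errf R m) hδ hδt (by positivity) G hG0 hG1 hq2
  have hk0 : 0 ≤ hkc d C δ (8*M+3) := hkc_nonneg hC hδ
  have hp3 : hkc d C δ (8*M+3) * Real.sqrt (q + 4*d*errf R m) ≤ hkc d C δ (8*M+3) * Real.sqrt q + ε/2 := by
    have h1 : Real.sqrt (q + 4*d*errf R m) ≤ Real.sqrt q + Real.sqrt (4*d*errf R m) := by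
      have h0 : 0 ≤ 4*d*errf R m := by have := errf_nonneg R m; positivity
      refine Real.sqrt_le_iff.2 ⟨by positivity, ?_⟩
      nlinarith [Real.sq_sqrt hq, Real.sq_sqrt h0, Real.sqrt_nonneg q, Real.sqrt_nonneg (4*d*errf R m),
        mul_nonneg (Real.sqrt_nonneg q) (Real.sqrt_nonneg (4*d*errf R m))]
    have h2 : hkc d C δ (8*M+3) * Real.sqrt (4*d*errf R m) ≤ ε/2 := by
      refine le_trans ?_ (hM2 M hMM2)
      unfold hkc
      calc C * δ ^ (-(d:ℝ)/4) * Real.sqrt ((8*M+3)^d) * Real.sqrt (4*d*errf R m)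
          ≤ C * δ ^ (-(d:ℝ)/4) * Real.sqrt ((8*M+3)^d) * Real.sqrt (4*d*Real.exp (2 - (M:ℝ)/(4*T))) := by gcongr
        _ = _ := by
          rw [Real.sqrt_mul (by positivity) (Real.exp _), Real.sqrt_mul (by positivity) (Real.exp _)]; ring
    nlinarith
  have hfin : EW V (t+m) 0 (fun p => G (fun k => p (t+k))) ≤
      EW V (t+m) 0 (fun p => ind (p t ∉ Box d R)) +
      EW V (t+m) 0 (fun p => ind (p t ∈ Box d R) * G (fun k => p (t+k))) := by
    rw [← EW_add]
    refine EW_mono fun p => ?_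
    by_cases h : p t ∈ Box d R
    · rw [ind_pos h, one_mul]; linarith [ind_nonneg (p t ∉ Box d R)]
    · rw [ind_pos (show p t ∉ Box d R from h), ind_neg h, zero_mul, add_zero]; exact hG1 _
  linarith

/-- bound for additive functionals on the box -/
lemma af_bound [NeZero d] (V : Set (Pt d)) {F : Pt d → Pt d → ℝ} (hF : ∀ x y, F x y = - F y x)
    (u s : Pt d → ℝ) (hu : ∀ x, u x = drift V F x + s x) (a b : ℝ)
    (ha : ∀ R : ℕ, ∑ x ∈ Box d R, av (fun e => F x (mv V x e) ^ 2) ≤ a * (2*R+1)^d)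
    (hb : ∀ R : ℕ, ∑ x ∈ Box d R, |s x| ≤ b * (2*R+1)^d)
    (k m R : ℕ) (hk : k ≤ m) (lam η : ℝ) (hl : 0 ≤ lam) (hη : 0 < η) :
    ∃ G' : (ℕ → Pt d) → ℝ, (∀ p, 0 ≤ G' p) ∧
      (∀ p : ℕ → Pt d, (∀ k ≤ m, p k ∈ Box d (2*R)) → lam * |∑ l ∈ Finset.range k, u (p l)| ≤ G' p) ∧
      ∑ x ∈ Box d (2*R+1), EW (V ∩ Box d (2*R+1)) m x G' ≤
        (4*R+3)^d * (η + lam^2 / η * (2 * (k+1) * a) + lam * (k * b)) := by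
  set V' : Set (Pt d) := V ∩ Box d (2*R+1) with hV'
  have hB : ∀ x ∈ V', x ∈ Box d (2*R+1) := fun x hx => by exact_mod_cast hx.2
  refine ⟨fun p => η + lam^2/η * (∑ l ∈ Finset.range k, drift V' F (p l))^2 + lam * ∑ l ∈ Finset.range k, |s (p l)|,
    fun p => by positivity, fun p hp => ?_, ?_⟩
  · have h1 : ∑ l ∈ Finset.range k, u (p l) = ∑ l ∈ Finset.range k, drift V' F (p l) + ∑ l ∈ Finset.range k, s (p l) := by
      rw [← Finset.sum_add_distrib]
      refine Finset.sum_congr rfl fun l hl => ?_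
      rw [hu]; congr 1
      unfold drift; congr 1; ext e
      rw [hV', mv_inter (hp l (by have := Finset.mem_range.1 hl; omega)) le_rfl]
    rw [h1]
    have h2 := abs_add_le (∑ l ∈ Finset.range k, drift V' F (p l)) (∑ l ∈ Finset.range k, s (p l))
    have h3 := Finset.abs_sum_le_sum_abs (fun l => s (p l)) (Finset.range k)
    set X := ∑ l ∈ Finset.range k, drift V' F (p l)
    have h4 : lam * |X| ≤ η + lam^2/η * X^2 := by
      have e1 : η + lam^2/η * X^2 - lam * |X| = ((η - lam*|X|/2)^2 + 3/4*(lam*|X|)^2)/η := by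
        field_simp; rw [← sq_abs X]; ring
      have : 0 ≤ ((η - lam*|X|/2)^2 + 3/4*(lam*|X|)^2)/η := by positivity
      linarith
    calc _ ≤ lam * (|X| + ∑ l ∈ Finset.range k, |s (p l)|) := by gcongr; linarith
      _ ≤ _ := by rw [mul_add]; linarith
  · simp only [EW_add, EW_mul, EW_const, Finset.sum_add_distrib, ← Finset.mul_sum]
    have e1 : ∑ x ∈ Box d (2*R+1), EW V' m x (fun p => (∑ l ∈ Finset.range k, drift V' F (p l))^2) ≤
        2 * (k+1) * (a * (4*R+3)^d) := by
      have e2 : ∀ x, EW V' m x (fun p => (∑ l ∈ Finset.range k, drift V' F (p l))^2) =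
          EW V' k x (fun p => (∑ l ∈ Finset.range k, drift V' F (p l))^2) := by
        intro x
        refine EW_restrict' V' hk x _ fun p q h => ?_
        congr 1
        refine Finset.sum_congr rfl fun l hl => by rw [h l (Finset.mem_range.1 hl).le]
      simp only [e2]
      refine (LZ_L2 V' _ hB hF k).trans ?_
      refine mul_le_mul_of_nonneg_left ?_ (by positivity)
      have := ha (2*R+1)
      push_cast at this
      rw [show (2:ℝ)*(2*R+1)+1 = 4*R+3 by ring] at this
      refine le_trans (Finset.sum_le_sum fun x _ => av_mono fun e => ?_) this
      have hxx : ∀ x, F x x = 0 := fun x => by have := hF x x; linarith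
      by_cases hc : x ∈ V' ∧ x + vec e ∈ V'
      · have h1 : mv V' x e = x + vec e := by unfold mv; rw [if_pos hc]
        have h2 : mv V x e = x + vec e := by unfold mv; rw [if_pos ⟨hc.1.1, hc.2.1⟩]
        rw [h1, h2]
      · have h1 : mv V' x e = x := by unfold mv; rw [if_neg hc]
        rw [h1, hxx, zero_pow two_ne_zero]; positivity
    have e3 : ∑ x ∈ Box d (2*R+1), EW V' m x (fun p => ∑ l ∈ Finset.range k, |s (p l)|) ≤ k * (b * (4*R+3)^d) := by
      simp only [EW_sum]
      rw [Finset.sum_comm]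
      have : ∀ l ∈ Finset.range k, ∑ x ∈ Box d (2*R+1), EW V' m x (fun p => |s (p l)|) ≤ b * (4*R+3)^d := by
        intro l hl
        have h1 : ∀ x, EW V' m x (fun p => |s (p l)|) = ((QQ V')^[l] (fun x => |s x|)) x := fun x =>
          EW_pos V' m x (fun x => |s x|) l ((Finset.mem_range.1 hl).le.trans hk)
        simp only [h1]
        rw [sum_QQ_iter V' _ hB]
        have := hb (2*R+1)
        push_cast at this
        rwa [show (2:ℝ)*(2*R+1)+1 = 4*R+3 by ring] at this
      refine (Finset.sum_le_sum this).trans ?_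
      simp
    have e4 : ∑ x ∈ Box d (2*R+1), η = (4*R+3)^d * η := by
      rw [Finset.sum_const, card_Box, nsmul_eq_mul]; push_cast; ring
    rw [e4]
    have e5 := mul_le_mul_of_nonneg_left e1 (show 0 ≤ lam^2/η by positivity)
    have e6 := mul_le_mul_of_nonneg_left e3 hl
    calc _ ≤ (4*(R:ℝ)+3)^d * η + lam^2/η * (2 * (k+1) * (a * (4*R+3)^d)) + lam * (k * (b * (4*R+3)^d)) := by linarith
      _ = _ := by ring


lemma av_cmul (c : ℂ) (g : Dir d → ℂ) : av (fun e => c * g e) = c * av g := by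
  simp only [av, ← Finset.mul_sum, mul_smul_comm]

lemma av_ofReal (g : Dir d → ℝ) : av (fun e => (g e : ℂ)) = ((av g : ℝ) : ℂ) := by
  simp only [av, smul_eq_mul, Complex.real_smul]; push_cast; rfl

lemma EW_cmul (V : Set (Pt d)) (m : ℕ) (x : Pt d) (c : ℂ) (F : (ℕ → Pt d) → ℂ) :
    EW V m x (fun p => c * F p) = c * EW V m x F := by
  induction m generalizing x F with
  | zero => rfl
  | succ m ih => simp only [EW_succ, ih, av_cmul]

lemma prod_lemma [NeZero d] (V : Set (Pt d)) (L : ℕ) (B κ : ℝ) (hB : 1 ≤ B) (hκ : 0 ≤ κ) (f : ℕ → Pt d → Pt d → ℂ)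
    (h1 : ∀ l x e, ‖f l x (mv V x e)‖ ≤ B)
    (h2 : ∀ l x, ‖av (fun e => f l x (mv V x e)) - 1‖ ≤ κ) (x : Pt d) :
    ‖EW V L x (fun p => ∏ l ∈ Finset.range L, f l (p l) (p (l+1))) - 1‖ ≤ L * κ * B^L := by
  induction L generalizing x f with
  | zero => simp [EW_zero]
  | succ L ih =>
    rw [EW_succ]
    have e1 : ∀ e, EW V L (mv V x e) (fun p => ∏ l ∈ Finset.range (L+1), f l (consP x p l) (consP x p (l+1)))
        = f 0 x (mv V x e) * EW V L (mv V x e) (fun p => ∏ l ∈ Finset.range L, f (l+1) (p l) (p (l+1))) := by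
      intro e
      rw [← EW_cmul]
      refine EW_congr fun p hp _ => ?_
      rw [Finset.prod_range_succ']
      rw [mul_comm]
      congr 1
      show f 0 x (p 0) = _
      rw [hp]
    simp only [e1]
    have e2 : av (fun e => f 0 x (mv V x e) * EW V L (mv V x e) (fun p => ∏ l ∈ Finset.range L, f (l+1) (p l) (p (l+1)))) - 1
        = av (fun e => f 0 x (mv V x e) * (EW V L (mv V x e) (fun p => ∏ l ∈ Finset.range L, f (l+1) (p l) (p (l+1))) - 1))
          + (av (fun e => f 0 x (mv V x e)) - 1) := by
      simp only [mul_sub, mul_one, av_sub]; ring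
    rw [e2]
    have e3 : ‖av (fun e => f 0 x (mv V x e) * (EW V L (mv V x e) (fun p => ∏ l ∈ Finset.range L, f (l+1) (p l) (p (l+1))) - 1))‖
        ≤ B * (L * κ * B^L) := by
      refine (norm_av_le _).trans ?_
      rw [← av_const (d := d) (B * (L * κ * B^L))]
      refine av_mono fun e => ?_
      rw [norm_mul]
      exact mul_le_mul (h1 0 x e) (ih (fun l => f (l+1)) (fun l => h1 (l+1)) (fun l => h2 (l+1)) _) (norm_nonneg _) (by linarith)
    refine (norm_add_le _ _).trans ((add_le_add e3 (h2 0 x)).trans ?_)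
    have e4 : κ ≤ κ * B^(L+1) := le_mul_of_one_le_right hκ (one_le_pow₀ hB)
    push_cast
    calc _ ≤ B * (L * κ * B^L) + κ * B^(L+1) := by linarith
      _ = _ := by ring

/-- one step estimate -/
lemma one_step [NeZero d] (ξ : Dir d → ℝ) (K : ℝ) (hK : 1 ≤ K) (hξ : ∀ e, |ξ e| ≤ K) (h0 : av ξ = 0) (n : ℝ) (hn : K^2 ≤ n) :
    ‖av (fun e => Complex.exp (Complex.I * ((ξ e / Real.sqrt n : ℝ) : ℂ) + ((av (fun e => ξ e^2) / (2*n) : ℝ) : ℂ))) - 1‖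
      ≤ 4 * K^4 / (n * Real.sqrt n) := by
  have hn1 : 1 ≤ n := le_trans (one_le_pow₀ hK) hn
  have hs1 : 1 ≤ Real.sqrt n := Real.one_le_sqrt.2 hn1
  have hss : Real.sqrt n ^ 2 = n := Real.sq_sqrt (by linarith)
  have hKs : K ≤ Real.sqrt n := Real.le_sqrt_of_sq_le hn
  set v := av (fun e => ξ e^2) with hv
  have hv0 : 0 ≤ v := av_nonneg fun e => sq_nonneg _
  have hvK : v ≤ K^2 := by
    rw [← av_const (d := d) (K^2)]
    exact av_mono fun e => sq_le_sq' (by linarith [abs_le.1 (hξ e)]) (abs_le.1 (hξ e)).2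
  set w := v/(2*n) with hw
  have hw0 : 0 ≤ w := by positivity
  have hw1 : w ≤ K^2/n := by
    rw [hw, div_le_div_iff₀ (by positivity) (by positivity)]; nlinarith
  have hw2 : w ≤ 1 := hw1.trans (by rw [div_le_one (by positivity)]; exact hn)
  simp only [Complex.exp_add]
  have e0 : av (fun e => Complex.exp (Complex.I * ((ξ e / Real.sqrt n : ℝ) : ℂ)) * Complex.exp (w:ℂ)) =
      Complex.exp w * av (fun e => Complex.exp (Complex.I * ((ξ e / Real.sqrt n : ℝ) : ℂ))) := by
    rw [← av_cmul]; simp only [mul_comm]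
  rw [e0]
  set r : Dir d → ℂ := fun e => Complex.exp (Complex.I * ((ξ e / Real.sqrt n : ℝ) : ℂ)) -
    (1 + Complex.I * ((ξ e / Real.sqrt n : ℝ) : ℂ) - (((ξ e / Real.sqrt n)^2/2 : ℝ) : ℂ)) with hr
  have hrb : ∀ e, ‖r e‖ ≤ K^3 / (n * Real.sqrt n) := by
    intro e
    have hx : ‖Complex.I * ((ξ e / Real.sqrt n : ℝ) : ℂ)‖ = |ξ e| / Real.sqrt n := by
      rw [norm_mul, Complex.norm_I, one_mul, Complex.norm_real, Real.norm_eq_abs, abs_div, abs_of_pos (by linarith : 0 < Real.sqrt n)]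
    have hle : ‖Complex.I * ((ξ e / Real.sqrt n : ℝ) : ℂ)‖ ≤ 1 := by
      rw [hx, div_le_one (by linarith)]; exact (hξ e).trans hKs
    have h3 := Complex.exp_bound hle (n := 3) (by norm_num)
    have h4 : ∑ m ∈ Finset.range 3, (Complex.I * ((ξ e / Real.sqrt n : ℝ) : ℂ))^m / (m.factorial : ℂ) =
        1 + Complex.I * ((ξ e / Real.sqrt n : ℝ) : ℂ) - (((ξ e / Real.sqrt n)^2/2 : ℝ) : ℂ) := by
      simp only [Finset.sum_range_succ, Finset.sum_range_zero, Nat.factorial]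
      rw [mul_pow Complex.I _ 2, Complex.I_sq]; push_cast; norm_num; ring
    rw [h4] at h3
    refine h3.trans ?_
    rw [hx]
    have : n * Real.sqrt n = Real.sqrt n ^ 3 := by rw [← hss]; rw [Real.sqrt_sq (by linarith)]; ring
    rw [this, div_pow]
    have h5 : |ξ e|^3 ≤ K^3 := pow_le_pow_left₀ (abs_nonneg _) (hξ e) 3
    have h6 : (((3:ℕ).succ : ℝ) * (((3:ℕ).factorial : ℝ) * (3:ℕ))⁻¹) ≤ 1 := by norm_num [Nat.factorial]
    calc _ ≤ |ξ e|^3 / Real.sqrt n ^3 * 1 := by gcongr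
      _ ≤ _ := by rw [mul_one]; gcongr
  have e1 : av (fun e => Complex.exp (Complex.I * ((ξ e / Real.sqrt n : ℝ) : ℂ))) = (((1 - w : ℝ)) : ℂ) + av r := by
    have h5 : (fun e => Complex.exp (Complex.I * ((ξ e / Real.sqrt n : ℝ) : ℂ))) = fun e =>
      ((1 + Complex.I * ((ξ e / Real.sqrt n : ℝ) : ℂ)) - (((ξ e / Real.sqrt n)^2/2 : ℝ) : ℂ)) + r e := by
      ext e; simp only [hr]; ring
    have h6 : av (fun e => ξ e / Real.sqrt n) = 0 := by
      simp only [div_eq_inv_mul, av_mul, h0, mul_zero]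
    have h7 : av (fun e => (ξ e / Real.sqrt n)^2/2) = w := by
      have : ∀ e, (ξ e / Real.sqrt n)^2/2 = (1/(2*n)) * ξ e^2 := by intro e; rw [div_pow, hss]; field_simp
      simp only [this, av_mul]; rw [hw]; ring
    rw [h5, av_add, av_sub, av_add, av_const, av_cmul, av_ofReal, av_ofReal, h6, h7]
    push_cast; ring
  rw [e1]
  have hrav : ‖av r‖ ≤ K^3 / (n * Real.sqrt n) := by
    refine (norm_av_le _).trans ?_
    rw [← av_const (d := d) (K^3 / (n * Real.sqrt n))]
    exact av_mono hrb
  have e2 : Complex.exp w * ((((1 - w : ℝ)) : ℂ) + av r) - 1 = ((Real.exp w * (1-w) - 1 : ℝ) : ℂ) + Complex.exp w * av r := by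
    push_cast; ring
  rw [e2]
  have hew : Real.exp w ≤ 3 := by
    have := Real.exp_le_exp.2 hw2
    linarith [Real.exp_one_lt_d9]
  have e3 : |Real.exp w * (1-w) - 1| ≤ w^2 := by
    have h8 := Real.add_one_le_exp w
    have h9 := Real.add_one_le_exp (-w)
    have h10 : Real.exp w * Real.exp (-w) = 1 := by rw [← Real.exp_add]; simp
    have hp := Real.exp_pos w
    rw [abs_le]; constructor
    · nlinarith
    · nlinarith
  refine (norm_add_le _ _).trans ?_
  rw [Complex.norm_real, Real.norm_eq_abs, norm_mul, Complex.norm_exp, Complex.ofReal_re]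
  have e4 : w^2 ≤ K^4/(n*Real.sqrt n) := by
    calc w^2 ≤ (K^2/n)^2 := by gcongr
      _ = K^4/(n*n) := by rw [div_pow]; ring
      _ ≤ _ := by
        gcongr
        rw [Real.sqrt_le_iff]; constructor <;> nlinarith
  have e5 : Real.exp w * ‖av r‖ ≤ 3 * (K^4/(n*Real.sqrt n)) := by
    have : K^3 / (n * Real.sqrt n) ≤ K^4 / (n * Real.sqrt n) := by
      gcongr; norm_num
    exact mul_le_mul hew (hrav.trans this) (norm_nonneg _) (by norm_num)
  calc _ ≤ K^4/(n*Real.sqrt n) + 3 * (K^4/(n*Real.sqrt n)) := add_le_add (e3.trans e4) e5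
    _ = _ := by ring

/-- conditional covariance -/
noncomputable def cv (V : Set (Pt d)) (D D' : Pt d → Pt d → ℝ) (x : Pt d) : ℝ :=
  av fun e => (D x (mv V x e) - drift V D x) * (D' x (mv V x e) - drift V D' x)

lemma sum_ind_range {m k : ℕ} (h : k ≤ m) (g : ℕ → ℝ) :
    ∑ l ∈ Finset.range m, (if l < k then g l else 0) = ∑ l ∈ Finset.range k, g l := by
  rw [← Finset.sum_filter]
  congr 1
  ext l; simp only [Finset.mem_filter, Finset.mem_range]; omega

lemma mart_cf [NeZero d] {ι : Type*} [Fintype ι] (V : Set (Pt d)) (D : ι → Pt d → Pt d → ℝ) (K0 : ℝ)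
    (hD : ∀ a x e, |D a x (mv V x e)| ≤ K0) (T : ℕ) :
    ∃ K1 : ℝ, ∃ n0 : ℕ, ∀ n : ℕ, n0 ≤ n → ∀ m : ℕ, m ≤ T * n → ∀ k : ι → ℕ, (∀ a, k a ≤ m) → ∀ x,
      ‖EW V m x (fun p => Complex.exp (Complex.I * (((∑ a, (SF (D a) (k a) p - ∑ l ∈ Finset.range (k a), drift V (D a) (p l)))
          / Real.sqrt n : ℝ) : ℂ)
        + (((∑ a, ∑ a', ∑ l ∈ Finset.range (min (k a) (k a')), cv V (D a) (D a') (p l)) / (2*n) : ℝ) : ℂ))) - 1‖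
      ≤ K1 / Real.sqrt n := by
  classical
  set K : ℝ := (Fintype.card ι) * (2 * |K0|) + 1 with hK
  have hK1 : 1 ≤ K := by have : 0 ≤ (Fintype.card ι) * (2 * |K0|) := by positivity
                         linarith
  refine ⟨T * (4*K^4) * Real.exp (K^2 * T / 2), max 1 ⌈K^2⌉₊, fun n hn m hm k hk x => ?_⟩
  have hnK : K^2 ≤ n := Nat.ceil_le.1 ((le_max_right _ _).trans hn)
  have hn1 : (1:ℝ) ≤ n := le_trans (one_le_pow₀ hK1) hnK
  set ξ : ℕ → Pt d → Pt d → ℝ := fun l x y => ∑ a, if l < k a then D a x y - drift V (D a) x else 0 with hξ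
  set v : ℕ → Pt d → ℝ := fun l x => av fun e => ξ l x (mv V x e) ^ 2 with hv
  set f : ℕ → Pt d → Pt d → ℂ := fun l x y => Complex.exp (Complex.I * ((ξ l x y / Real.sqrt n : ℝ) : ℂ) + ((v l x / (2*n) : ℝ) : ℂ)) with hf
  have hdr : ∀ a x, |drift V (D a) x| ≤ |K0| := by
    intro a x
    refine (abs_av_le _).trans ?_
    rw [← av_const (d := d) |K0|]
    exact av_mono fun e => (hD a x e).trans (le_abs_self _)
  have hξb : ∀ l x e, |ξ l x (mv V x e)| ≤ K := by
    intro l x e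
    refine (Finset.abs_sum_le_sum_abs _ _).trans ?_
    refine (Finset.sum_le_sum (g := fun _ => 2 * |K0|) fun a _ => ?_).trans ?_
    · split_ifs
      · have h1 := hD a x e
        have h2 := hdr a x
        have := abs_sub (D a x (mv V x e)) (drift V (D a) x)
        linarith [le_abs_self K0]
      · simp
    · rw [Finset.sum_const, Finset.card_univ, nsmul_eq_mul]; linarith
  have hξ0 : ∀ l x, av (fun e => ξ l x (mv V x e)) = 0 := by
    intro l x
    simp only [hξ]
    rw [av_sum]
    refine Finset.sum_eq_zero fun a _ => ?_
    split_ifs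
    · rw [av_sub, av_const]; exact sub_self _
    · exact av_zero
  have hvK : ∀ l x, v l x ≤ K^2 := by
    intro l x
    rw [← av_const (d := d) (K^2)]
    exact av_mono fun e => sq_le_sq' (by linarith [abs_le.1 (hξb l x e)]) (abs_le.1 (hξb l x e)).2
  have hB1 : 1 ≤ Real.exp (K^2/(2*n)) := Real.one_le_exp (by positivity)
  have hnorm : ∀ l x e, ‖f l x (mv V x e)‖ ≤ Real.exp (K^2/(2*n)) := by
    intro l x e
    rw [Complex.norm_exp]
    apply Real.exp_le_exp.2
    simp only [Complex.add_re, Complex.mul_re, Complex.I_re, Complex.I_im, Complex.ofReal_re, Complex.ofReal_im]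
    have := hvK l x
    ring_nf
    have h3 : v l x * (n:ℝ)⁻¹ ≤ K^2 * (n:ℝ)⁻¹ := by gcongr
    linarith
  have hone : ∀ l x, ‖av (fun e => f l x (mv V x e)) - 1‖ ≤ 4 * K^4 / (n * Real.sqrt n) := fun l x =>
    one_step (fun e => ξ l x (mv V x e)) K hK1 (hξb l x) (hξ0 l x) n hnK
  have hmain := prod_lemma V m _ _ hB1 (by positivity) f hnorm hone x
  have hprod : ∀ p : ℕ → Pt d, ∏ l ∈ Finset.range m, f l (p l) (p (l+1)) =
      Complex.exp (Complex.I * (((∑ a, (SF (D a) (k a) p - ∑ l ∈ Finset.range (k a), drift V (D a) (p l)))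
          / Real.sqrt n : ℝ) : ℂ)
        + (((∑ a, ∑ a', ∑ l ∈ Finset.range (min (k a) (k a')), cv V (D a) (D a') (p l)) / (2*n) : ℝ) : ℂ)) := by
    intro p
    rw [← Complex.exp_sum, Finset.sum_add_distrib, ← Finset.mul_sum, ← Complex.ofReal_sum, ← Complex.ofReal_sum,
      ← Finset.sum_div, ← Finset.sum_div]
    have h1 : ∑ l ∈ Finset.range m, ξ l (p l) (p (l+1)) = ∑ a, (SF (D a) (k a) p - ∑ l ∈ Finset.range (k a), drift V (D a) (p l)) := by
      simp only [hξ]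
      rw [Finset.sum_comm]
      refine Finset.sum_congr rfl fun a _ => ?_
      rw [sum_ind_range (hk a), Finset.sum_sub_distrib]; rfl
    have h2 : ∑ l ∈ Finset.range m, v l (p l) = ∑ a, ∑ a', ∑ l ∈ Finset.range (min (k a) (k a')), cv V (D a) (D a') (p l) := by
      have h3 : ∀ l x, v l x = ∑ a, ∑ a', if l < min (k a) (k a') then cv V (D a) (D a') x else 0 := by
        intro l x
        simp only [hv, hξ, sq, Finset.sum_mul_sum]
        rw [av_sum]
        refine Finset.sum_congr rfl fun a _ => ?_
        rw [av_sum]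
        refine Finset.sum_congr rfl fun a' _ => ?_
        by_cases ha : l < k a
        · by_cases ha' : l < k a'
          · simp only [ha, ha', if_true, lt_min_iff, and_self]; rfl
          · simp [ha', av_zero]
        · simp [ha, av_zero]
      simp only [h3]
      rw [Finset.sum_comm]
      refine Finset.sum_congr rfl fun a _ => ?_
      rw [Finset.sum_comm]
      refine Finset.sum_congr rfl fun a' _ => ?_
      rw [sum_ind_range ((min_le_left _ _).trans (hk a))]
    rw [h1, h2]
  simp only [hprod] at hmain
  refine hmain.trans ?_
  have hmT : (m:ℝ) ≤ T * n := by exact_mod_cast hm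
  have hBm : Real.exp (K^2/(2*n)) ^ m ≤ Real.exp (K^2 * T / 2) := by
    rw [← Real.exp_nat_mul]
    apply Real.exp_le_exp.2
    calc (m:ℝ) * (K^2/(2*n)) ≤ (T*n) * (K^2/(2*n)) := by gcongr
      _ = _ := by field_simp
  have hs : 0 < Real.sqrt n := Real.sqrt_pos.2 (by linarith)
  calc (m:ℝ) * (4 * K^4 / (n * Real.sqrt n)) * Real.exp (K^2/(2*n)) ^ m
      ≤ (T*n) * (4 * K^4 / (n * Real.sqrt n)) * Real.exp (K^2 * T / 2) := by gcongr
    _ = _ := by field_simp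


lemma path_mem {V : Set (Pt d)} {m : ℕ} {p : ℕ → Pt d} (h : IsPath V m p) (h0 : p 0 ∈ V) (k : ℕ) : p k ∈ V := by
  have hk : ∀ k ≤ m, p k ∈ V := by
    intro k hk
    induction k with
    | zero => exact h0
    | succ k ih =>
      obtain ⟨e, he⟩ := h.1 k hk
      rw [he]
      unfold mv
      split_ifs with hc
      · exact hc.2
      · exact ih (by omega)
  rcases le_or_gt k m with h1 | h1
  · exact hk k h1
  · rw [h.2 k h1.le]; exact hk m le_rfl

lemma cexp_lip (a b : ℝ) : ‖Complex.exp (Complex.I * (a:ℂ)) - Complex.exp (Complex.I * (b:ℂ))‖ ≤ |a - b| := by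
  have h := Real.norm_exp_I_mul_ofReal_sub_one_le (x := a - b)
  have : Complex.exp (Complex.I * (a:ℂ)) - Complex.exp (Complex.I * (b:ℂ)) =
      Complex.exp (Complex.I * (b:ℂ)) * (Complex.exp (Complex.I * ((a - b : ℝ) : ℂ)) - 1) := by
    rw [mul_sub, ← Complex.exp_add, mul_one]; congr 2; push_cast; ring
  rw [this, norm_mul, Complex.norm_exp_I_mul_ofReal, one_mul]
  simpa using h

lemma cexp_two (a b : ℝ) : ‖Complex.exp (Complex.I * (a:ℂ)) - Complex.exp (Complex.I * (b:ℂ))‖ ≤ 2 := by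
  refine (norm_sub_le _ _).trans ?_
  rw [Complex.norm_exp_I_mul_ofReal, Complex.norm_exp_I_mul_ofReal]; norm_num

lemma exp_lip {a b A : ℝ} (ha : a ≤ A) (hb : b ≤ A) : |Real.exp a - Real.exp b| ≤ Real.exp A * |a - b| := by
  have key : ∀ a b : ℝ, a ≤ A → Real.exp a - Real.exp b ≤ Real.exp A * |a - b| := by
    intro a b ha
    have h1 := Real.add_one_le_exp (b - a)
    have h2 : Real.exp a * Real.exp (b - a) = Real.exp b := by rw [← Real.exp_add]; congr 1; ring
    have h3 := Real.exp_le_exp.2 ha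
    have h4 := Real.exp_pos a
    have h5 := le_abs_self (a - b)
    calc Real.exp a - Real.exp b ≤ Real.exp a * (a - b) := by nlinarith
      _ ≤ Real.exp a * |a-b| := by gcongr
      _ ≤ _ := by gcongr
  rw [abs_le]; constructor
  · have := key b a hb; rw [abs_sub_comm] at this; linarith
  · exact key a b ha

lemma cv_abs_le [NeZero d] {V : Set (Pt d)} {D D' : Pt d → Pt d → ℝ} {K0 : ℝ} (hD : ∀ x e, |D x (mv V x e)| ≤ K0)
    (hD' : ∀ x e, |D' x (mv V x e)| ≤ K0) (x : Pt d) : |cv V D D' x| ≤ (2*K0)^2 := by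
  have hdr : ∀ D : Pt d → Pt d → ℝ, (∀ x e, |D x (mv V x e)| ≤ K0) → |drift V D x| ≤ K0 := by
    intro D hD
    refine (abs_av_le _).trans ?_
    rw [← av_const (d := d) K0]
    exact av_mono fun e => hD x e
  refine (abs_av_le _).trans ?_
  rw [← av_const (d := d) ((2*K0)^2)]
  refine av_mono fun e => ?_
  rw [abs_mul, sq]
  have h1 := abs_sub (D x (mv V x e)) (drift V D x)
  have h2 := abs_sub (D' x (mv V x e)) (drift V D' x)
  have h3 := hdr D hD
  have h4 := hdr D' hD'
  have h5 := hD x e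
  have h6 := hD' x e
  exact mul_le_mul (by linarith) (by linarith) (abs_nonneg _) (by have := abs_nonneg (drift V D x); linarith)

lemma cf_point [NeZero d] {ι : Type*} [Fintype ι] (V : Set (Pt d)) (D : ι → Pt d → Pt d → ℝ) (K0 : ℝ)
    (hD : ∀ a x e, |D a x (mv V x e)| ≤ K0) (T : ℕ) (W : ι → ι → ℝ) (u : ι → ι → Pt d → ℝ)
    (hu : ∀ a a' x, x ∈ V → cv V (D a) (D a') x = W a a' + u a a' x) (H0 : ℝ) (hH0 : 0 ≤ H0) :
    ∃ KA KB : ℝ, 0 ≤ KB ∧ ∃ n0 : ℕ, ∀ n : ℕ, n0 ≤ n → ∀ m : ℕ, m ≤ T * n → ∀ k : ι → ℕ, (∀ a, k a ≤ m) → ∀ x ∈ V,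
      ∀ Z : (ℕ → Pt d) → ℝ, (∀ p, p 0 = x → |Z p - ∑ a, SF (D a) (k a) p| ≤ H0) →
      ‖EW V m x (fun p => Complex.exp (Complex.I * ((Z p / Real.sqrt n : ℝ) : ℂ))) -
        ((Real.exp (-((∑ a, ∑ a', (min (k a) (k a') : ℕ) * W a a') / (2*n))) : ℝ) : ℂ)‖
      ≤ KA / Real.sqrt n
        + KB * EW V m x (fun p => min 1 (∑ a, ∑ a', (1/n:ℝ) * |∑ l ∈ Finset.range (min (k a) (k a')), u a a' (p l)|))
        + 2 * EW V m x (fun p => min 1 (∑ a, (1/Real.sqrt n) * |∑ l ∈ Finset.range (k a), drift V (D a) (p l)|)) := by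
  obtain ⟨K1, n0, hcf⟩ := mart_cf V D K0 hD T
  set N : ℝ := ((Fintype.card ι : ℕ) : ℝ) with hN
  set w0 : ℝ := (2*K0)^2 + ∑ a, ∑ a', |W a a'| with hw0
  have hw0' : 0 ≤ w0 := by positivity
  set A0 : ℝ := N * (N * (T * w0)) with hA0
  have hA0' : 0 ≤ A0 := by positivity
  refine ⟨Real.exp A0 * |K1| + H0, Real.exp A0 * (Real.exp A0 * (2*A0+1)), by positivity, max 1 n0, ?_⟩
  intro n hn m hm k hk x hx Z hZ
  have hn1 : 1 ≤ n := (le_max_left _ _).trans hn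
  have hn1' : (1:ℝ) ≤ n := by exact_mod_cast hn1
  have hs : 0 < Real.sqrt n := Real.sqrt_pos.2 (by linarith)
  have hcf' := hcf n ((le_max_right _ _).trans hn) m hm k hk x
  set Y : (ℕ → Pt d) → ℝ := fun p => (∑ a, (SF (D a) (k a) p - ∑ l ∈ Finset.range (k a), drift V (D a) (p l))) / Real.sqrt n with hY
  set A : (ℕ → Pt d) → ℝ := fun p => (∑ a, ∑ a', ∑ l ∈ Finset.range (min (k a) (k a')), cv V (D a) (D a') (p l)) / (2*n) with hA
  set Ab : ℝ := (∑ a, ∑ a', (min (k a) (k a') : ℕ) * W a a') / (2*n) with hAb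
  set g2 : (ℕ → Pt d) → ℝ := fun p => ∑ a, ∑ a', (1/n:ℝ) * |∑ l ∈ Finset.range (min (k a) (k a')), u a a' (p l)| with hg2
  set g1 : (ℕ → Pt d) → ℝ := fun p => ∑ a, (1/Real.sqrt n) * |∑ l ∈ Finset.range (k a), drift V (D a) (p l)| with hg1
  -- bounds on exponents
  have hkm : ∀ a a', ((min (k a) (k a') : ℕ) : ℝ) ≤ T * n := fun a a' => by
    exact_mod_cast (min_le_left _ _).trans ((hk a).trans hm)
  have hdouble : ∀ f : ι → ι → ℝ, (∀ a a', |f a a'| ≤ T * n * w0) → |(∑ a, ∑ a', f a a') / (2*n)| ≤ A0 := by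
    intro f hf
    rw [abs_div, abs_of_pos (show (0:ℝ) < 2*n by positivity), div_le_iff₀ (by positivity)]
    have h1 : |∑ a, ∑ a', f a a'| ≤ ∑ a : ι, ∑ a' : ι, (T * n * w0) :=
      (Finset.abs_sum_le_sum_abs _ _).trans (Finset.sum_le_sum fun a _ =>
        (Finset.abs_sum_le_sum_abs _ _).trans (Finset.sum_le_sum fun a' _ => hf a a'))
    refine h1.trans ?_
    simp only [Finset.sum_const, Finset.card_univ, nsmul_eq_mul]
    have : N * (N * (T * n * w0)) = A0 * n := by rw [hA0]; ring
    rw [← hN, this]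
    nlinarith
  have hAA : ∀ p, |A p| ≤ A0 := by
    intro p
    refine hdouble _ fun a a' => ?_
    refine (Finset.abs_sum_le_sum_abs _ _).trans ?_
    refine (Finset.sum_le_sum (g := fun _ => w0) fun l _ => ?_).trans ?_
    · refine (cv_abs_le (hD a) (hD a') _).trans ?_
      have : 0 ≤ ∑ a, ∑ a', |W a a'| := by positivity
      linarith
    · rw [Finset.sum_const, Finset.card_range, nsmul_eq_mul]
      exact mul_le_mul_of_nonneg_right (hkm a a') hw0'
  have hAbA : |Ab| ≤ A0 := by
    refine hdouble _ fun a a' => ?_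
    rw [abs_mul, abs_of_nonneg (by positivity)]
    refine mul_le_mul (hkm a a') ?_ (abs_nonneg _) (by positivity)
    have h1 : |W a a'| ≤ ∑ a', |W a a'| := Finset.single_le_sum (f := fun a' => |W a a'|) (fun _ _ => abs_nonneg _) (Finset.mem_univ a')
    have h2 : ∑ a', |W a a'| ≤ ∑ a, ∑ a', |W a a'| :=
      Finset.single_le_sum (f := fun a => ∑ a', |W a a'|) (fun _ _ => Finset.sum_nonneg fun _ _ => abs_nonneg _) (Finset.mem_univ a)
    have : 0 ≤ (2*K0)^2 := by positivity
    linarith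
  have hdiff : ∀ p, p 0 = x → IsPath V m p → |A p - Ab| ≤ g2 p := by
    intro p hp0 hp
    have h1 : A p - Ab = (∑ a, ∑ a', ∑ l ∈ Finset.range (min (k a) (k a')), u a a' (p l)) / (2*n) := by
      rw [hA, hAb, ← sub_div, ← Finset.sum_sub_distrib]
      congr 1
      refine Finset.sum_congr rfl fun a _ => ?_
      rw [← Finset.sum_sub_distrib]
      refine Finset.sum_congr rfl fun a' _ => ?_
      rw [sub_eq_iff_eq_add]
      have : ((min (k a) (k a') : ℕ) : ℝ) * W a a' = ∑ l ∈ Finset.range (min (k a) (k a')), W a a' := by simp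
      rw [this, ← Finset.sum_add_distrib]
      refine Finset.sum_congr rfl fun l _ => ?_
      rw [hu a a' _ (path_mem hp (hp0 ▸ hx) l)]; ring
    rw [h1, abs_div, abs_of_pos (show (0:ℝ) < 2*n by positivity)]
    have h2 : |∑ a, ∑ a', ∑ l ∈ Finset.range (min (k a) (k a')), u a a' (p l)| ≤
        ∑ a, ∑ a', |∑ l ∈ Finset.range (min (k a) (k a')), u a a' (p l)| :=
      (Finset.abs_sum_le_sum_abs _ _).trans (Finset.sum_le_sum fun a _ => Finset.abs_sum_le_sum_abs _ _)
    simp only [hg2, ← Finset.mul_sum]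
    rw [div_eq_inv_mul]
    refine mul_le_mul ?_ h2 (abs_nonneg _) (by positivity)
    rw [one_div]
    exact inv_anti₀ (by positivity) (by linarith)
  have hg10 : ∀ p, 0 ≤ g1 p := fun p => by positivity
  have hg20 : ∀ p, 0 ≤ g2 p := fun p => by positivity
  -- term 1
  have t1 : ‖EW V m x (fun p => Complex.exp (Complex.I * ((Z p / Real.sqrt n : ℝ) : ℂ))) -
      EW V m x (fun p => Complex.exp (Complex.I * ((Y p : ℝ) : ℂ)))‖ ≤ H0 / Real.sqrt n + 2 * EW V m x (fun p => min 1 (g1 p)) := by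
    rw [← EW_sub, ← EW_mul]
    refine (norm_EW_le _ _ _ _).trans ?_
    rw [← EW_const V m x (H0 / Real.sqrt n), ← EW_add]
    refine EW_mono' fun p hp0 hp => ?_
    have h0 : 0 ≤ H0 / Real.sqrt n := by positivity
    rcases le_or_gt (g1 p) 1 with h | h
    · rw [min_eq_right h]
      refine (cexp_lip _ _).trans ?_
      have h1 : Z p / Real.sqrt n - Y p = (Z p - ∑ a, SF (D a) (k a) p) / Real.sqrt n +
          ∑ a, (1/Real.sqrt n) * ∑ l ∈ Finset.range (k a), drift V (D a) (p l) := by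
        simp only [hY]; rw [Finset.sum_sub_distrib, ← Finset.mul_sum]; ring
      rw [h1]
      refine (abs_add_le _ _).trans ?_
      have h2 : |(Z p - ∑ a, SF (D a) (k a) p) / Real.sqrt n| ≤ H0 / Real.sqrt n := by
        rw [abs_div, abs_of_pos hs]; gcongr; exact hZ p hp0
      have h3 : |∑ a, (1/Real.sqrt n) * ∑ l ∈ Finset.range (k a), drift V (D a) (p l)| ≤ g1 p := by
        refine (Finset.abs_sum_le_sum_abs _ _).trans (Finset.sum_le_sum fun a _ => ?_)
        rw [abs_mul, abs_of_nonneg (by positivity)]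
      linarith [hg10 p]
    · rw [min_eq_left h.le]
      have := cexp_two (Z p / Real.sqrt n) (Y p)
      linarith
  -- term 2
  have t2 : ‖EW V m x (fun p => Complex.exp (Complex.I * ((Y p : ℝ) : ℂ))) - ((Real.exp (-Ab) : ℝ) : ℂ)‖ ≤
      Real.exp A0 * (|K1| / Real.sqrt n + Real.exp A0 * (2*A0+1) * EW V m x (fun p => min 1 (g2 p))) := by
    have e1 : EW V m x (fun p => Complex.exp (Complex.I * ((Y p : ℝ) : ℂ))) - ((Real.exp (-Ab) : ℝ) : ℂ) =
        ((Real.exp (-Ab) : ℝ) : ℂ) * ((EW V m x (fun p => Complex.exp (Complex.I * ((Y p : ℝ) : ℂ) + ((A p : ℝ) : ℂ))) - 1) +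
          EW V m x (fun p => Complex.exp (Complex.I * ((Y p : ℝ) : ℂ)) * ((Real.exp Ab - Real.exp (A p) : ℝ) : ℂ))) := by
      rw [sub_add_eq_add_sub, ← EW_add, mul_sub, mul_one]
      congr 1
      rw [← EW_cmul]
      congr 1; ext p
      rw [Complex.exp_add]
      have h1 : ((Real.exp (-Ab) : ℝ) : ℂ) * ((Real.exp Ab : ℝ) : ℂ) = 1 := by
        rw [← Complex.ofReal_mul, ← Real.exp_add]; simp
      have h2 : Complex.exp ((A p : ℝ) : ℂ) = ((Real.exp (A p) : ℝ) : ℂ) := by push_cast; rfl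
      rw [h2, Complex.ofReal_sub]
      linear_combination -(Complex.exp (Complex.I * ((Y p : ℝ) : ℂ))) * h1
    rw [e1, norm_mul, Complex.norm_real, Real.norm_eq_abs, abs_of_pos (Real.exp_pos _)]
    refine mul_le_mul (Real.exp_le_exp.2 (by linarith [abs_le.1 hAbA])) ?_ (norm_nonneg _) (Real.exp_pos _).le
    refine (norm_add_le _ _).trans (add_le_add ?_ ?_)
    · refine hcf'.trans ?_
      gcongr; exact le_abs_self _
    · refine (norm_EW_le _ _ _ _).trans ?_
      rw [← EW_mul]
      refine EW_mono' fun p hp0 hp => ?_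
      rw [norm_mul, Complex.norm_exp_I_mul_ofReal, one_mul, Complex.norm_real, Real.norm_eq_abs]
      have h1 := hAA p
      refine (exp_lip (A := A0) (by linarith [abs_le.1 hAbA]) (by linarith [abs_le.1 h1])).trans ?_
      rw [mul_assoc]
      refine mul_le_mul_of_nonneg_left ?_ (Real.exp_pos _).le
      have h3 := hdiff p hp0 hp
      rw [abs_sub_comm] at h3
      rcases le_or_gt (g2 p) 1 with h | h
      · rw [min_eq_right h]
        have := hg20 p
        nlinarith
      · rw [min_eq_left h.le]
        have := abs_sub Ab (A p)
        linarith
  have e3 : EW V m x (fun p => Complex.exp (Complex.I * ((Z p / Real.sqrt n : ℝ) : ℂ))) - ((Real.exp (-Ab) : ℝ) : ℂ) =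
    (EW V m x (fun p => Complex.exp (Complex.I * ((Z p / Real.sqrt n : ℝ) : ℂ))) -
      EW V m x (fun p => Complex.exp (Complex.I * ((Y p : ℝ) : ℂ)))) +
    (EW V m x (fun p => Complex.exp (Complex.I * ((Y p : ℝ) : ℂ))) - ((Real.exp (-Ab) : ℝ) : ℂ)) := by ring
  rw [e3]
  refine (norm_add_le _ _).trans ((add_le_add t1 t2).trans (le_of_eq ?_))
  ring


lemma small [NeZero d] {V : Set (Pt d)} {C : ℝ} (hV : HKB V C) (T : ℕ) (hT : 1 ≤ T) (δ ε : ℝ)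
    (hδ : 0 < δ) (hε : 0 < ε) (β : Type) [Fintype β] :
    ∃ q0 : ℝ, 0 < q0 ∧ ∀ n t m : ℕ, 1 ≤ n → 1 ≤ t → δ * n ≤ t → t ≤ T * n → 1 ≤ m → m ≤ T * n →
      ∀ (lam : ℝ) (F : β → Pt d → Pt d → ℝ) (u s : β → Pt d → ℝ) (a b : β → ℝ) (k : β → ℕ), 0 ≤ lam →
      (∀ i x y, F i x y = - F i y x) → (∀ i x, u i x = drift V (F i) x + s i x) →
      (∀ i, ∀ R : ℕ, ∑ x ∈ Box d R, av (fun e => F i x (mv V x e) ^ 2) ≤ a i * (2*R+1)^d) →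
      (∀ i, ∀ R : ℕ, ∑ x ∈ Box d R, |s i x| ≤ b i * (2*R+1)^d) →
      (∀ i, k i ≤ m) → (∀ i, lam^2 * (2 * (k i + 1) * a i) ≤ q0) → (∀ i, lam * (k i * b i) ≤ q0) →
      EW V (t+m) 0 (fun p => min 1 (∑ i, lam * |∑ l ∈ Finset.range (k i), u i (p (t+l))|)) ≤ ε := by
  obtain ⟨M, K, hK, h⟩ := transfer hV T hT δ (ε/2) hδ (by positivity)
  set q1 : ℝ := (ε/(2*(K+1)))^2 with hq1
  have hq1p : 0 < q1 := by positivity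
  set N : ℝ := ((Fintype.card β : ℕ) : ℝ) with hN
  have hN0 : 0 ≤ N := by positivity
  set r : ℝ := q1 / (3*(N+1)) with hr
  have hrp : 0 < r := by positivity
  refine ⟨min (r^2) r, by positivity, ?_⟩
  intro n t m hn ht hδt htT hm hmT lam F u s a b k hl hF hu ha hb hk h1 h2
  choose G' hG0 hGG hGs using fun i => af_bound V (hF i) (u i) (s i) (hu i) (a i) (b i) (ha i) (hb i) (k i) m
    (M*(Nat.sqrt n+1)) (hk i) lam r hl hrp
  have := h n t m hn ht hδt htT hm hmT (fun p => min 1 (∑ i, lam * |∑ l ∈ Finset.range (k i), u i (p l)|))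
    (fun p => ∑ i, G' i p) q1 hq1p.le (fun p => le_min zero_le_one (Finset.sum_nonneg fun i _ => by positivity))
    (fun p => min_le_left _ _) (fun p => Finset.sum_nonneg fun i _ => hG0 i p)
    (fun p hp => (min_le_right _ _).trans (Finset.sum_le_sum fun i _ => hGG i p hp)) ?_
  · refine this.trans ?_
    rw [hq1, Real.sqrt_sq (by positivity)]
    have : K * (ε / (2*(K+1))) ≤ ε/2 := by
      rw [mul_div_assoc', div_le_div_iff₀ (by positivity) (by positivity)]
      nlinarith
    linarith
  · simp only [EW_sum]
    rw [Finset.sum_comm]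
    refine (Finset.sum_le_sum (g := fun _ => (4*((M*(Nat.sqrt n+1) : ℕ):ℝ)+3)^d * (3*r)) fun i _ => (hGs i).trans ?_).trans ?_
    · gcongr
      have e1 : lam^2/r * (2*(k i+1)*a i) ≤ r := by
        rw [div_mul_eq_mul_div, div_le_iff₀ hrp, ← sq]
        exact (h1 i).trans (min_le_left _ _)
      have e2 := (h2 i).trans (min_le_right _ _)
      linarith
    · rw [Finset.sum_const, Finset.card_univ, nsmul_eq_mul, ← hN, mul_left_comm]
      gcongr
      rw [hr]
      have : N * (3 * (q1 / (3*(N+1)))) = q1 * (N/(N+1)) := by field_simp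
      rw [this]
      have : N/(N+1) ≤ 1 := by rw [div_le_one (by positivity)]; linarith
      nlinarith

/-- corrected increments -/
def DDf (φ : Fin d → Pt d → ℝ) (i : Fin d) (x y : Pt d) : ℝ := ((y i : ℝ) - (x i : ℝ)) + (φ i y - φ i x)

/-- homogenization data -/
def Hom (V : Set (Pt d)) (Cov : Fin d → Fin d → ℝ) : Prop :=
  ∀ ε : ℝ, 0 < ε → ∃ (φ : Fin d → Pt d → ℝ) (H : ℝ), (∀ i x, |φ i x| ≤ H) ∧
    (∀ i, ∃ F : Pt d → Pt d → ℝ, (∀ x y, F x y = - F y x) ∧ (∀ x, drift V (DDf φ i) x = drift V F x) ∧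
      ∀ R : ℕ, ∑ x ∈ Box d R, av (fun e => F x (mv V x e) ^ 2) ≤ ε * (2*R+1)^d) ∧
    ∃ Cov' : Fin d → Fin d → ℝ, (∀ i i', |Cov' i i' - Cov i i'| ≤ ε) ∧
      ∀ i i', ∀ ε' : ℝ, 0 < ε' → ∃ (h : Pt d → ℝ) (H' : ℝ) (s : Pt d → ℝ), (∀ x, |h x| ≤ H') ∧
        (∀ x, cv V (DDf φ i) (DDf φ i') x - Cov' i i' * ind (x ∈ V) = drift V (fun x y => h y - h x) x + s x) ∧
        ∀ R : ℕ, ∑ x ∈ Box d R, |s x| ≤ ε' * (2*R+1)^d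

lemma SF_DDf (φ : Fin d → Pt d → ℝ) (i : Fin d) (c : ℝ) (k : ℕ) (p : ℕ → Pt d) :
    SF (fun x y => c * DDf φ i x y) k p = c * (((p k i : ℝ) - (p 0 i:ℝ)) + (φ i (p k) - φ i (p 0))) := by
  unfold SF DDf
  rw [← Finset.mul_sum, Finset.sum_add_distrib, Finset.sum_range_sub (fun l => ((p l i : ℤ):ℝ)),
    Finset.sum_range_sub (fun l => φ i (p l))]

lemma drift_cmul (V : Set (Pt d)) (D : Pt d → Pt d → ℝ) (c : ℝ) (x : Pt d) :
    drift V (fun x y => c * D x y) x = c * drift V D x := by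
  unfold drift; rw [av_mul]

lemma cv_cmul (V : Set (Pt d)) (D D' : Pt d → Pt d → ℝ) (c c' : ℝ) (x : Pt d) :
    cv V (fun x y => c * D x y) (fun x y => c' * D' x y) x = c * c' * cv V D D' x := by
  unfold cv; rw [← av_mul]; congr 1; ext e
  rw [drift_cmul, drift_cmul]; ring

lemma DDf_bound {φ : Fin d → Pt d → ℝ} {H : ℝ} (hφ : ∀ i x, |φ i x| ≤ H) (V : Set (Pt d)) (i : Fin d) (x : Pt d) (e : Dir d) :
    |DDf φ i x (mv V x e)| ≤ 1 + 2*H := by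
  unfold DDf
  have h1 : |((mv V x e) i : ℝ) - x i| ≤ 1 := mv_coord V x e i
  have h2 := abs_sub (φ i (mv V x e)) (φ i x)
  have h3 := abs_add_le (((mv V x e) i : ℝ) - x i) (φ i (mv V x e) - φ i x)
  have := hφ i x
  have := hφ i (mv V x e)
  linarith


set_option maxHeartbeats 1000000 in
lemma CF1 [NeZero d] {V : Set (Pt d)} {C : ℝ} (hV : HKB V C) (h0 : (0:Pt d) ∈ V) {Cov : Fin d → Fin d → ℝ} (hH : Hom V Cov)
    (T : ℕ) (hT : 1 ≤ T) (ι : Type) [Fintype ι] (th : ι → ℝ) (c : ι → Fin d) (δ ε : ℝ) (hδ : 0 < δ) (hε : 0 < ε) :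
    ∃ n0 : ℕ, ∀ n t : ℕ, n0 ≤ n → 1 ≤ t → δ * n ≤ t → t ≤ T * n → ∀ k : ι → ℕ, (∀ a, k a ≤ T * n) →
      ‖EW V (t + T * n) 0 (fun p => Complex.exp (Complex.I * (((∑ a, th a * ((p (t + k a) (c a) : ℝ) - (p t (c a) : ℝ)))
        / Real.sqrt n : ℝ) : ℂ))) -
        ((Real.exp (-((∑ a, ∑ a', (min (k a) (k a') : ℕ) * (th a * th a' * Cov (c a) (c a'))) / (2*n))) : ℝ) : ℂ)‖ ≤ ε := by
  have hT' : (1:ℝ) ≤ T := by exact_mod_cast hT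
  set N : ℝ := ((Fintype.card ι : ℕ) : ℝ) with hN
  have hN0 : 0 ≤ N := by positivity
  set Θ : ℝ := 1 + ∑ a, |th a| with hΘ
  have hΘ1 : 1 ≤ Θ := by
    have : 0 ≤ ∑ a, |th a| := by positivity
    linarith
  have hthΘ : ∀ a, |th a| ≤ Θ := fun a => by
    have : |th a| ≤ ∑ a, |th a| := Finset.single_le_sum (f := fun a => |th a|) (fun _ _ => abs_nonneg _) (Finset.mem_univ a)
    linarith
  have hthΘ2 : ∀ a a', |th a * th a'| ≤ Θ^2 := fun a a' => by
    rw [abs_mul, sq]; exact mul_le_mul (hthΘ a) (hthΘ a') (abs_nonneg _) (by linarith)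
  set Cm : ℝ := ∑ i, ∑ i', |Cov i i'| with hCm
  have hCmi : ∀ i i', |Cov i i'| ≤ Cm := fun i i' => by
    have h1 : |Cov i i'| ≤ ∑ i', |Cov i i'| := Finset.single_le_sum (f := fun i' => |Cov i i'|) (fun _ _ => abs_nonneg _) (Finset.mem_univ i')
    have h2 : ∑ i', |Cov i i'| ≤ Cm :=
      Finset.single_le_sum (f := fun i => ∑ i', |Cov i i'|) (fun _ _ => Finset.sum_nonneg fun _ _ => abs_nonneg _) (Finset.mem_univ i)
    linarith
  have hCm0 : 0 ≤ Cm := by positivity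
  set B : ℝ := N * (N * (T * Θ^2)) with hB
  have hB0 : 0 ≤ B := by positivity
  set A0 : ℝ := B * Cm with hA0
  have hA00 : 0 ≤ A0 := by positivity
  obtain ⟨q1, hq1, hsm1⟩ := small hV T hT δ (ε/8) hδ (by positivity) ι
  -- choose homogenization accuracy
  obtain ⟨ε0, hε0, hε0a, hε0b, hε0c⟩ : ∃ ε0 : ℝ, 0 < ε0 ∧ 4 * T * (Θ^2 * ε0) ≤ q1 ∧ B * ε0 ≤ 1 ∧ Real.exp (A0+1) * (B * ε0) ≤ ε/4 := by
    refine ⟨min (q1/(4*T*Θ^2)) (min (1/(B+1)) (ε/4/(Real.exp (A0+1) * (B+1)))), by positivity, ?_, ?_, ?_⟩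
    · calc 4 * T * (Θ^2 * min (q1/(4*T*Θ^2)) (min (1/(B+1)) (ε/4/(Real.exp (A0+1) * (B+1))))) ≤ 4 * T * (Θ^2 * (q1/(4*T*Θ^2))) := by
            gcongr; exact min_le_left _ _
        _ = q1 := by field_simp
    · calc B * min (q1/(4*T*Θ^2)) (min (1/(B+1)) (ε/4/(Real.exp (A0+1) * (B+1)))) ≤ (B+1) * (1/(B+1)) := by
            gcongr
            · linarith
            · exact (min_le_right _ _).trans (min_le_left _ _)
        _ = 1 := by field_simp
    · calc Real.exp (A0+1) * (B * min (q1/(4*T*Θ^2)) (min (1/(B+1)) (ε/4/(Real.exp (A0+1) * (B+1)))))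
          ≤ Real.exp (A0+1) * ((B+1) * (ε/4/(Real.exp (A0+1) * (B+1)))) := by
            gcongr
            · linarith
            · exact (min_le_right _ _).trans (min_le_right _ _)
        _ = ε/4 := by have := Real.exp_pos (A0+1); field_simp
  obtain ⟨φ, H, hφ, hF, Cov', hCov', hs⟩ := hH ε0 hε0
  choose F hFa hFd hFs using hF
  have hHn : 0 ≤ H := (abs_nonneg _).trans (hφ ⟨0, Nat.pos_of_ne_zero (NeZero.ne d)⟩ 0)
  set D : ι → Pt d → Pt d → ℝ := fun a x y => th a * DDf φ (c a) x y with hD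
  set W : ι → ι → ℝ := fun a a' => th a * th a' * Cov' (c a) (c a') with hW
  set u : ι → ι → Pt d → ℝ := fun a a' x => th a * th a' * (cv V (DDf φ (c a)) (DDf φ (c a')) x - Cov' (c a) (c a') * ind (x ∈ V)) with hu
  set H0 : ℝ := ∑ a, |th a| * (2*H) with hH0
  have hH00 : 0 ≤ H0 := by positivity
  obtain ⟨KA, KB, hKB, n1, hcp⟩ := cf_point V D (Θ * (1+2*H)) (fun a x e => by
      simp only [hD]; rw [abs_mul]
      exact mul_le_mul (hthΘ a) (DDf_bound hφ V (c a) x e) (abs_nonneg _) (by linarith)) T W u (fun a a' x hx => by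
      simp only [hD, hW, hu]; rw [cv_cmul, ind_pos hx]; ring) H0 hH00
  obtain ⟨q2, hq2, hsm2⟩ := small hV T hT δ (ε/(8*(KB+1))) hδ (by positivity) (ι × ι)
  set ε' : ℝ := q2 / (T * Θ^2) with hε'
  have hε'0 : 0 < ε' := by positivity
  choose h H' s hh hcv hsR using fun i i' => hs i i' ε' hε'0
  set Hm : ℝ := ∑ i, ∑ i', |H' i i'| with hHm
  have hHmi : ∀ i i', |H' i i'| ≤ Hm := fun i i' => by
    have h1 : |H' i i'| ≤ ∑ i', |H' i i'| := Finset.single_le_sum (f := fun i' => |H' i i'|) (fun _ _ => abs_nonneg _) (Finset.mem_univ i')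
    have h2 : ∑ i', |H' i i'| ≤ Hm :=
      Finset.single_le_sum (f := fun i => ∑ i', |H' i i'|) (fun _ _ => Finset.sum_nonneg fun _ _ => abs_nonneg _) (Finset.mem_univ i)
    linarith
  have hHm0 : 0 ≤ Hm := by positivity
  set aa : ℝ := (Θ^2 * (2*Hm))^2 with haa
  obtain ⟨n2, hn2⟩ := exists_nat_gt (4 * T * aa / q2)
  obtain ⟨n3, hn3⟩ := exists_nat_gt ((4 * |KA| / ε)^2)
  refine ⟨max (max n1 n2) (max n3 1), ?_⟩
  intro n t hn ht hδt htT k hk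
  have hn1 : n1 ≤ n := (le_max_left _ _).trans ((le_max_left _ _).trans hn)
  have hn2' : n2 ≤ n := (le_max_right _ _).trans ((le_max_left _ _).trans hn)
  have hn3' : n3 ≤ n := (le_max_left _ _).trans ((le_max_right _ _).trans hn)
  have hn4 : 1 ≤ n := (le_max_right _ _).trans ((le_max_right _ _).trans hn)
  have hnr : (1:ℝ) ≤ n := by exact_mod_cast hn4
  have hsq : 0 < Real.sqrt n := Real.sqrt_pos.2 (by linarith)
  have hm1 : 1 ≤ T * n := Nat.one_le_iff_ne_zero.2 (by positivity)
  have hTn : ((T * n : ℕ) : ℝ) = T * n := by push_cast; ring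
  have hTn1 : (1:ℝ) ≤ T * n := by rw [← hTn]; exact_mod_cast hm1
  have hkr : ∀ a, (k a : ℝ) ≤ T * n := fun a => by rw [← hTn]; exact_mod_cast hk a
  set Eb' : ℝ := (∑ a, ∑ a', (min (k a) (k a') : ℕ) * W a a') / (2*n) with hEb'
  set Eb : ℝ := (∑ a, ∑ a', (min (k a) (k a') : ℕ) * (th a * th a' * Cov (c a) (c a'))) / (2*n) with hEb
  set g1 : (ℕ → Pt d) → ℝ := fun p => min 1 (∑ a, (1/Real.sqrt n) * |∑ l ∈ Finset.range (k a), drift V (D a) (p l)|) with hg1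
  set g2 : (ℕ → Pt d) → ℝ := fun p => min 1 (∑ a, ∑ a', (1/n:ℝ) * |∑ l ∈ Finset.range (min (k a) (k a')), u a a' (p l)|) with hg2
  have hdouble : ∀ (f : ι → ι → ℝ) (w : ℝ), 0 ≤ w → (∀ a a', |f a a'| ≤ T * n * (Θ^2 * w)) → |(∑ a, ∑ a', f a a') / (2*n)| ≤ B * w := by
    intro f w hw hf
    rw [abs_div, abs_of_pos (show (0:ℝ) < 2*n by positivity), div_le_iff₀ (by positivity)]
    have h1 : |∑ a, ∑ a', f a a'| ≤ ∑ a : ι, ∑ a' : ι, (T * n * (Θ^2 * w)) :=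
      (Finset.abs_sum_le_sum_abs _ _).trans (Finset.sum_le_sum fun a _ =>
        (Finset.abs_sum_le_sum_abs _ _).trans (Finset.sum_le_sum fun a' _ => hf a a'))
    refine h1.trans ?_
    simp only [Finset.sum_const, Finset.card_univ, nsmul_eq_mul]
    have e : N * (N * (T * n * (Θ^2 * w))) = B * w * n := by rw [hB]; ring
    rw [← hN, e]
    have : 0 ≤ B * w * n := by positivity
    linarith
  have hkm : ∀ a a', ((min (k a) (k a') : ℕ) : ℝ) ≤ T * n := fun a a' =>
    le_trans (by exact_mod_cast min_le_left _ _) (hkr a)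
  have hEbA : |Eb| ≤ A0 := hdouble _ Cm hCm0 fun a a' => by
    rw [abs_mul, abs_of_nonneg (by positivity), abs_mul]
    exact mul_le_mul (hkm a a') (mul_le_mul (hthΘ2 a a') (hCmi _ _) (abs_nonneg _) (by positivity)) (by positivity) (by positivity)
  have hEbd : |Eb' - Eb| ≤ B * ε0 := by
    rw [hEb', hEb, ← sub_div, ← Finset.sum_sub_distrib]
    simp only [← Finset.sum_sub_distrib]
    refine hdouble _ ε0 hε0.le fun a a' => ?_
    rw [← mul_sub, abs_mul, abs_of_nonneg (by positivity)]
    simp only [hW]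
    rw [← mul_sub, abs_mul]
    exact mul_le_mul (hkm a a') (mul_le_mul (hthΘ2 a a') (hCov' _ _) (abs_nonneg _) (by positivity)) (by positivity) (by positivity)
  have hexp : |Real.exp (-Eb') - Real.exp (-Eb)| ≤ ε/4 := by
    have h1 := abs_le.1 hEbA
    have h2 := abs_le.1 hEbd
    refine (exp_lip (A := A0+1) (by linarith) (by linarith)).trans ?_
    have : |-Eb' - -Eb| = |Eb' - Eb| := by rw [← abs_neg]; congr 1; ring
    rw [this]
    refine le_trans ?_ hε0c
    gcongr
  -- the two error terms
  have hT1 : EW V (t + T*n) 0 (fun p => g1 (fun l => p (t+l))) ≤ ε/8 := by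
    refine hsm1 n t (T*n) hn4 ht hδt htT hm1 le_rfl (1/Real.sqrt n) (fun a x y => th a * F (c a) x y)
      (fun a => drift V (D a)) (fun _ _ => 0) (fun _ => Θ^2 * ε0) (fun _ => 0) k (by positivity)
      (fun a x y => by rw [hFa]; ring) (fun a x => ?_) (fun a R => ?_) (fun a R => by simp) hk (fun a => ?_) (fun a => by simpa using hq1.le)
    · show drift V (fun x y => th a * DDf φ (c a) x y) x = drift V (fun x y => th a * F (c a) x y) x + 0
      rw [drift_cmul, add_zero, drift_cmul, hFd]
    · have e : ∀ x, av (fun e => (th a * F (c a) x (mv V x e))^2) = th a^2 * av (fun e => F (c a) x (mv V x e)^2) := by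
        intro x; rw [← av_mul]; congr 1; ext e; ring
      simp only [e]
      rw [← Finset.mul_sum, mul_assoc]
      refine mul_le_mul ?_ (hFs (c a) R) (Finset.sum_nonneg fun x _ => av_nonneg fun e => sq_nonneg _) (by positivity)
      rw [← sq_abs (th a)]; exact pow_le_pow_left₀ (abs_nonneg _) (hthΘ a) 2
    · rw [div_pow, one_pow, Real.sq_sqrt (by positivity), div_mul_eq_mul_div, one_mul, div_le_iff₀ (by positivity)]
      have h1 := hkr a
      have h2 : 2 * ((k a:ℝ) + 1) ≤ 4 * (T * n) := by linarith
      calc 2 * ((k a:ℝ)+1) * (Θ^2*ε0) ≤ 4 * (T * n) * (Θ^2*ε0) := by gcongr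
        _ = 4 * T * (Θ^2*ε0) * n := by ring
        _ ≤ q1 * n := by gcongr
  have hT2 : EW V (t + T*n) 0 (fun p => g2 (fun l => p (t+l))) ≤ ε/(8*(KB+1)) := by
    have key := hsm2 n t (T*n) hn4 ht hδt htT hm1 le_rfl (1/n)
      (fun b x y => th b.1 * th b.2 * (h (c b.1) (c b.2) y - h (c b.1) (c b.2) x))
      (fun b => u b.1 b.2) (fun b x => th b.1 * th b.2 * s (c b.1) (c b.2) x) (fun _ => aa) (fun _ => Θ^2 * ε')
      (fun b => min (k b.1) (k b.2)) (by positivity) (fun b x y => by ring) (fun b x => ?_) (fun b R => ?_) (fun b R => ?_)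
      (fun b => (min_le_left _ _).trans (hk _)) (fun b => ?_) (fun b => ?_)
    · simpa only [hg2, Fintype.sum_prod_type] using key
    · rw [drift_cmul]; show th b.1 * th b.2 * (cv V (DDf φ (c b.1)) (DDf φ (c b.2)) x - Cov' (c b.1) (c b.2) * ind (x ∈ V)) = _; rw [hcv]; ring
    · have e : ∀ x ∈ Box d R, av (fun e => (th b.1 * th b.2 * (h (c b.1) (c b.2) (mv V x e) - h (c b.1) (c b.2) x))^2) ≤ aa := by
        intro x _
        rw [← av_const (d := d) aa]
        refine av_mono fun e => ?_
        rw [haa, ← sq_abs, abs_mul]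
        refine pow_le_pow_left₀ (by positivity) (mul_le_mul (hthΘ2 _ _) ?_ (abs_nonneg _) (by positivity)) 2
        refine (abs_sub _ _).trans ?_
        have e1 := hh (c b.1) (c b.2) (mv V x e)
        have e2 := hh (c b.1) (c b.2) x
        have e3 := hHmi (c b.1) (c b.2)
        have e4 := le_abs_self (H' (c b.1) (c b.2))
        linarith
      refine (Finset.sum_le_sum e).trans ?_
      rw [Finset.sum_const, card_Box, nsmul_eq_mul, mul_comm]; push_cast; rfl
    · simp only [abs_mul (th b.1 * th b.2)]
      rw [← Finset.mul_sum, mul_assoc]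
      exact mul_le_mul (hthΘ2 _ _) (hsR _ _ R) (by positivity) (by positivity)
    · have h1 := hkm b.1 b.2
      have h2 : 2 * (((min (k b.1) (k b.2) : ℕ):ℝ) + 1) ≤ 4 * (T * n) := by linarith
      have h3 : 4 * T * aa ≤ q2 * n := by
        have : (n2:ℝ) ≤ n := by exact_mod_cast hn2'
        rw [div_lt_iff₀ hq2] at hn2
        have := mul_le_mul_of_nonneg_left this hq2.le
        linarith only [this, hn2]
      have haa0 : 0 ≤ aa := by positivity
      calc (1/(n:ℝ))^2 * (2 * (((min (k b.1) (k b.2) : ℕ):ℝ) + 1) * aa) ≤ (1/(n:ℝ))^2 * (4 * (T * n) * aa) := by gcongr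
        _ = (4 * T * aa) / n := by field_simp
        _ ≤ q2 := by rw [div_le_iff₀ (by positivity)]; exact h3
    · have h1 := hkm b.1 b.2
      calc (1/(n:ℝ)) * (((min (k b.1) (k b.2) : ℕ):ℝ) * (Θ^2 * ε')) ≤ (1/(n:ℝ)) * ((T*n) * (Θ^2 * ε')) := by gcongr
        _ = q2 := by rw [hε']; field_simp
  -- pointwise bound
  have hpt : ‖EW V (t + T * n) 0 (fun p => Complex.exp (Complex.I * (((∑ a, th a * ((p (t + k a) (c a) : ℝ) - (p t (c a) : ℝ)))
        / Real.sqrt n : ℝ) : ℂ))) - ((Real.exp (-Eb') : ℝ) : ℂ)‖ ≤ KA / Real.sqrt n + KB * (ε/(8*(KB+1))) + 2 * (ε/8) := by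
    rw [EW_markov, ← EW_const V t 0 ((Real.exp (-Eb') : ℝ) : ℂ), ← EW_sub]
    refine (norm_EW_le _ _ _ _).trans ?_
    have hle : ∀ p : ℕ → Pt d, p 0 = 0 → IsPath V t p →
        ‖EW V (T*n) (p t) (fun q => Complex.exp (Complex.I * (((∑ a, th a * ((glue t p q (t + k a) (c a) : ℝ) - (glue t p q t (c a) : ℝ)))
        / Real.sqrt n : ℝ) : ℂ))) - ((Real.exp (-Eb') : ℝ) : ℂ)‖ ≤ KA / Real.sqrt n + KB * EW V (T*n) (p t) g2 + 2 * EW V (T*n) (p t) g1 := by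
      intro p hp0 hp
      have hpV : p t ∈ V := path_mem hp (hp0 ▸ h0) t
      have e := hcp n hn1 (T*n) le_rfl k hk (p t) hpV (fun q => ∑ a, th a * ((q (k a) (c a) : ℝ) - (q 0 (c a) : ℝ))) (fun q hq => ?_)
      · have g0 : ∀ (q : ℕ → Pt d) (j : ℕ), glue t p q (t + j) = q j := fun q j => by
          unfold glue; rw [if_neg (by omega)]; congr 1; omega
        have g1' : ∀ (q : ℕ → Pt d), glue t p q t = q 0 := fun q => g0 q 0
        simp only [g0, g1']
        exact e
      · rw [← Finset.sum_sub_distrib, hH0]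
        refine (Finset.abs_sum_le_sum_abs _ _).trans (Finset.sum_le_sum fun a _ => ?_)
        simp only [hD]; rw [SF_DDf, ← mul_sub, abs_mul]
        gcongr
        have e1 := abs_le.1 (hφ (c a) (q (k a)))
        have e2 := abs_le.1 (hφ (c a) (q 0))
        refine abs_le.2 ⟨?_, ?_⟩ <;> linarith only [e1.1, e1.2, e2.1, e2.2]
    refine (EW_mono' hle).trans ?_
    rw [EW_add, EW_add, EW_const, EW_mul, EW_mul]
    have c1 : EW V t 0 (fun p => EW V (T*n) (p t) g1) = EW V (t+T*n) 0 (fun p => g1 (fun l => p (t+l))) := by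
      rw [EW_markov]; simp [glue]
    have c2 : EW V t 0 (fun p => EW V (T*n) (p t) g2) = EW V (t+T*n) 0 (fun p => g2 (fun l => p (t+l))) := by
      rw [EW_markov]; simp [glue]
    rw [c1, c2]
    gcongr
  have hKA : KA / Real.sqrt n ≤ ε/4 := by
    rw [div_le_iff₀ hsq]
    have h1 : 4 * |KA| / ε ≤ Real.sqrt n := by
      refine Real.le_sqrt_of_sq_le ?_
      have : (n3:ℝ) ≤ n := by exact_mod_cast hn3'
      linarith
    rw [div_le_iff₀ hε] at h1
    have := le_abs_self KA
    linarith
  have hKB' : KB * (ε/(8*(KB+1))) ≤ ε/8 := by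
    rw [mul_div_assoc', div_le_div_iff₀ (by positivity) (by positivity)]
    linarith only [hε]
  have hfin := norm_sub_le_norm_sub_add_norm_sub (EW V (t + T * n) 0 (fun p => Complex.exp (Complex.I * (((∑ a, th a * ((p (t + k a) (c a) : ℝ) - (p t (c a) : ℝ)))
        / Real.sqrt n : ℝ) : ℂ)))) ((Real.exp (-Eb') : ℝ) : ℂ) ((Real.exp (-Eb) : ℝ) : ℂ)
  have hexp' : ‖((Real.exp (-Eb') : ℝ) : ℂ) - ((Real.exp (-Eb) : ℝ) : ℂ)‖ ≤ ε/4 := by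
    rw [← Complex.ofReal_sub, Complex.norm_real]; exact hexp
  linarith


set_option maxHeartbeats 1000000 in
lemma CF2 [NeZero d] {V : Set (Pt d)} {C : ℝ} (hV : HKB V C) (h0 : (0:Pt d) ∈ V) {Cov : Fin d → Fin d → ℝ} (hH : Hom V Cov)
    (T : ℕ) (hT : 1 ≤ T) (ι : Type) [Fintype ι] (th : ι → ℝ) (c : ι → Fin d) (tt : ι → ℝ) (ht0 : ∀ a, 0 ≤ tt a)
    (htT : ∀ a, tt a ≤ T) :
    Tendsto (fun n : ℕ => EW V (T * n) 0 (fun p => Complex.exp (Complex.I * (((∑ a, th a * (p ⌊tt a * n⌋₊ (c a) : ℝ))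
        / Real.sqrt n : ℝ) : ℂ)))) atTop
      (nhds ((Real.exp (-((∑ a, ∑ a', min (tt a) (tt a') * (th a * th a' * Cov (c a) (c a'))) / 2)) : ℝ) : ℂ)) := by
  rw [Metric.tendsto_atTop]
  intro ε hε
  have hT' : (1:ℝ) ≤ T := by exact_mod_cast hT
  set B : ℝ := ∑ a, ∑ a', |th a * th a' * Cov (c a) (c a')| with hB
  have hB0 : 0 ≤ B := by positivity
  set S : ℝ := ∑ a, |th a| with hS
  have hS0 : 0 ≤ S := by positivity
  obtain ⟨M, hM1, hM⟩ := diffusive hV (ε/16) (by positivity)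
  have hM1' : (1:ℝ) ≤ M := by exact_mod_cast hM1
  set A0 : ℝ := (T+3) * B with hA0
  obtain ⟨δ, hδ, hδ1, hδ2, hδ3⟩ : ∃ δ : ℝ, 0 < δ ∧ δ ≤ 1/2 ∧ S * (M * Real.sqrt (2*δ)) ≤ ε/8 ∧ Real.exp A0 * (3*δ*B) ≤ ε/8 := by
    have c1 : Tendsto (fun δ : ℝ => S * (M * Real.sqrt (2*δ))) (nhdsWithin 0 (Set.Ioi 0)) (nhds 0) := by
      have : Continuous fun δ : ℝ => S * (M * Real.sqrt (2*δ)) := by fun_prop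
      have := (this.tendsto 0).mono_left (nhdsWithin_le_nhds (s := Set.Ioi 0))
      simpa using this
    have c2 : Tendsto (fun δ : ℝ => Real.exp A0 * (3*δ*B)) (nhdsWithin 0 (Set.Ioi 0)) (nhds 0) := by
      have : Continuous fun δ : ℝ => Real.exp A0 * (3*δ*B) := by fun_prop
      have := (this.tendsto 0).mono_left (nhdsWithin_le_nhds (s := Set.Ioi 0))
      simpa using this
    have c3 : ∀ᶠ δ : ℝ in nhdsWithin 0 (Set.Ioi 0), δ < 1/2 :=
      nhdsWithin_le_nhds (Iio_mem_nhds (by norm_num))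
    have c4 : ∀ᶠ δ : ℝ in nhdsWithin 0 (Set.Ioi 0), 0 < δ := self_mem_nhdsWithin
    obtain ⟨δ, e1, e2, e3, e4⟩ := ((c1.eventually (Iio_mem_nhds (show (0:ℝ) < ε/8 by positivity))).and
      ((c2.eventually (Iio_mem_nhds (show (0:ℝ) < ε/8 by positivity))).and (c3.and c4))).exists
    exact ⟨δ, e4, e3.le, le_of_lt e1, le_of_lt e2⟩
  obtain ⟨n1, hcf⟩ := CF1 hV h0 hH T hT ι th c δ (ε/4) hδ (by positivity)
  obtain ⟨n2, hn2⟩ := exists_nat_gt (1/δ)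
  refine ⟨max n1 (max n2 1), fun n hn => ?_⟩
  have hn1 : n1 ≤ n := (le_max_left _ _).trans hn
  have hn2' : n2 ≤ n := (le_max_left _ _).trans ((le_max_right _ _).trans hn)
  have hn3 : 1 ≤ n := (le_max_right _ _).trans ((le_max_right _ _).trans hn)
  have hnr : (1:ℝ) ≤ n := by exact_mod_cast hn3
  have hsq : 0 < Real.sqrt n := Real.sqrt_pos.2 (by linarith)
  have hδn : 1 ≤ δ * n := by
    have : (n2:ℝ) ≤ n := by exact_mod_cast hn2'
    rw [div_lt_iff₀ hδ] at hn2
    have := mul_le_mul_of_nonneg_left this hδ.le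
    linarith
  set t : ℕ := ⌈δ * n⌉₊ with ht
  have htlo : δ * n ≤ t := Nat.le_ceil _
  have hthi : (t:ℝ) ≤ 2 * δ * n := by
    have := Nat.ceil_lt_add_one (a := δ * n) (by linarith)
    linarith
  have ht1 : 1 ≤ t := by
    have : (1:ℝ) ≤ t := by linarith
    exact_mod_cast this
  have htn : (t:ℝ) ≤ n := by
    have : 2 * δ * n ≤ 1 * n := by gcongr; linarith
    linarith
  have htTn : t ≤ T * n := by
    have h1 : t ≤ n := by exact_mod_cast htn
    exact h1.trans (Nat.le_mul_of_pos_left _ (by omega))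
  set m : ι → ℕ := fun a => ⌊tt a * n⌋₊ with hm
  have hmT : ∀ a, m a ≤ T * n := fun a => by
    refine Nat.floor_le_of_le ?_
    push_cast
    exact mul_le_mul_of_nonneg_right (htT a) (by linarith)
  set k : ι → ℕ := fun a => m a - t with hk
  have hkT : ∀ a, k a ≤ T * n := fun a => (Nat.sub_le _ _).trans (hmT a)
  have key := hcf n t hn1 ht1 htlo htTn k hkT
  set Z : (ℕ → Pt d) → ℝ := fun p => (∑ a, th a * (p (m a) (c a) : ℝ)) / Real.sqrt n with hZ
  set Z1 : (ℕ → Pt d) → ℝ := fun p => (∑ a, th a * ((p (t + k a) (c a) : ℝ) - (p t (c a) : ℝ))) / Real.sqrt n with hZ1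
  set Eb : ℝ := (∑ a, ∑ a', (min (k a) (k a') : ℕ) * (th a * th a' * Cov (c a) (c a'))) / (2*n) with hEb
  set Ef : ℝ := (∑ a, ∑ a', min (tt a) (tt a') * (th a * th a' * Cov (c a) (c a'))) / 2 with hEf
  have hext : EW V (T * n) 0 (fun p => Complex.exp (Complex.I * ((Z p : ℝ) : ℂ))) =
      EW V (t + T * n) 0 (fun p => Complex.exp (Complex.I * ((Z p : ℝ) : ℂ))) := by
    refine (EW_restrict' V (by omega) 0 _ ?_).symm
    intro p q hpq
    have : Z p = Z q := by
      simp only [hZ]; congr 1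
      refine Finset.sum_congr rfl fun a _ => ?_
      rw [hpq _ (hmT a)]
    rw [this]
  have hcomp : ‖EW V (t + T * n) 0 (fun p => Complex.exp (Complex.I * ((Z p : ℝ) : ℂ))) -
      EW V (t + T * n) 0 (fun p => Complex.exp (Complex.I * ((Z1 p : ℝ) : ℂ)))‖ ≤ ε/8 + 2 * (ε/16) := by
    rw [← EW_sub]
    refine (norm_EW_le _ _ _ _).trans ?_
    set I : (ℕ → Pt d) → ℝ := fun p => ind (∃ k ≤ t, ∃ a, (M:ℝ) * Real.sqrt t ≤ |(p k a:ℝ)|) with hI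
    have hI1 : EW V (t + T * n) 0 I ≤ ε/16 := by
      rw [EW_restrict' V (Nat.le_add_right t (T*n)) 0 I ?_]
      · exact hM t ht1
      · intro p q hpq
        simp only [hI]
        congr 1
        refine propext (exists_congr fun k => and_congr_right fun hk => ?_)
        rw [hpq k hk]
    have : EW V (t + T * n) 0 (fun p => ‖Complex.exp (Complex.I * ((Z p : ℝ) : ℂ)) - Complex.exp (Complex.I * ((Z1 p : ℝ) : ℂ))‖) ≤
        EW V (t + T * n) 0 (fun p => ε/8 + 2 * I p) := by
      refine EW_mono fun p => ?_
      by_cases hp : ∃ k ≤ t, ∃ a, (M:ℝ) * Real.sqrt t ≤ |(p k a:ℝ)|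
      · simp only [hI]; rw [ind_pos hp]
        have := cexp_two (Z p) (Z1 p)
        linarith
      · simp only [hI]; rw [ind_neg hp]
        refine (cexp_lip _ _).trans ?_
        push Not at hp
        have e : Z p - Z1 p = (∑ a, th a * ((p (m a) (c a) : ℝ) - ((p (t + k a) (c a) : ℝ) - (p t (c a) : ℝ)))) / Real.sqrt n := by
          simp only [hZ, hZ1]; rw [← sub_div, ← Finset.sum_sub_distrib]; congr 1
          refine Finset.sum_congr rfl fun a _ => ?_
          ring
        have hb : ∀ a, |(p (m a) (c a) : ℝ) - ((p (t + k a) (c a) : ℝ) - (p t (c a) : ℝ))| ≤ M * Real.sqrt t := by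
          intro a
          rcases le_or_gt t (m a) with h | h
          · have : t + k a = m a := by simp only [hk]; omega
            rw [this, sub_sub_cancel]
            exact (hp t le_rfl (c a)).le
          · have : t + k a = t := by simp only [hk]; omega
            rw [this, sub_self, sub_zero]
            exact (hp _ h.le (c a)).le
        rw [e, abs_div, abs_of_pos hsq, div_le_iff₀ hsq]
        have h3 : Real.sqrt t ≤ Real.sqrt (2*δ) * Real.sqrt n := by
          rw [← Real.sqrt_mul (by positivity)]; exact Real.sqrt_le_sqrt hthi
        calc |∑ a, th a * ((p (m a) (c a) : ℝ) - ((p (t + k a) (c a) : ℝ) - (p t (c a) : ℝ)))| ≤ ∑ a, |th a| * (M * Real.sqrt t) := by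
              refine (Finset.abs_sum_le_sum_abs _ _).trans (Finset.sum_le_sum fun a _ => ?_)
              rw [abs_mul]; gcongr; exact hb a
          _ = S * (M * Real.sqrt t) := by rw [← Finset.sum_mul]
          _ ≤ S * (M * (Real.sqrt (2*δ) * Real.sqrt n)) := by gcongr
          _ = S * (M * Real.sqrt (2*δ)) * Real.sqrt n := by ring
          _ ≤ ε/8 * Real.sqrt n := by gcongr
          _ = _ := by ring
    refine this.trans ?_
    rw [EW_add, EW_const, EW_mul]
    linarith
  -- exponents
  have hdb : ∀ (f : ι → ι → ℝ) (w : ℝ), (∀ a a', |f a a'| ≤ w) → |(∑ a, ∑ a', f a a' * (th a * th a' * Cov (c a) (c a'))) / 2| ≤ w * B := by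
    intro f w hf
    rw [abs_div, abs_of_pos (show (0:ℝ) < 2 by norm_num)]
    have h1 : |∑ a, ∑ a', f a a' * (th a * th a' * Cov (c a) (c a'))| ≤ w * B := by
      rw [hB, Finset.mul_sum]
      refine (Finset.abs_sum_le_sum_abs _ _).trans (Finset.sum_le_sum fun a _ => ?_)
      rw [Finset.mul_sum]
      refine (Finset.abs_sum_le_sum_abs _ _).trans (Finset.sum_le_sum fun a' _ => ?_)
      rw [abs_mul]; gcongr; exact hf a a'
    have h2 := abs_nonneg (∑ a, ∑ a', f a a' * (th a * th a' * Cov (c a) (c a')))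
    linarith
  have hEfA : |Ef| ≤ T * B := hdb _ _ fun a a' => by
    rw [abs_of_nonneg (le_min (ht0 a) (ht0 a'))]; exact (min_le_left _ _).trans (htT a)
  have hkk : ∀ a, |(k a : ℝ)/n - tt a| ≤ 3 * δ := by
    intro a
    have h1 : (m a : ℝ) ≤ tt a * n := Nat.floor_le (mul_nonneg (ht0 a) (by linarith))
    have h2 : tt a * n < m a + 1 := Nat.lt_floor_add_one _
    have h3 : (k a : ℝ) ≤ m a := by exact_mod_cast Nat.sub_le _ _
    have h4 : (m a : ℝ) ≤ k a + t := by
      have : m a ≤ k a + t := by simp only [hk]; omega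
      exact_mod_cast this
    have hn0 : (0:ℝ) < n := by linarith
    rw [abs_le]
    constructor
    · rw [neg_le_sub_iff_le_add, ← sub_le_iff_le_add, le_div_iff₀ hn0]
      have e1 : (tt a - 3*δ) * n = tt a * n - 3 * δ * n := by ring
      linarith
    · rw [sub_le_iff_le_add, div_le_iff₀ hn0]
      have e1 : (3*δ + tt a) * n = tt a * n + 3 * (δ * n) := by ring
      linarith
  have hEd : |Eb - Ef| ≤ 3 * δ * B := by
    have e : Eb - Ef = (∑ a, ∑ a', ((min (k a) (k a') : ℕ) / n - min (tt a) (tt a')) * (th a * th a' * Cov (c a) (c a'))) / 2 := by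
      simp only [hEb, hEf, sub_mul, Finset.sum_sub_distrib, sub_div]
      congr 1
      rw [mul_comm 2, ← div_div]
      congr 1
      rw [Finset.sum_div]
      refine Finset.sum_congr rfl fun a _ => ?_
      rw [Finset.sum_div]
      refine Finset.sum_congr rfl fun a' _ => ?_
      ring
    rw [e]
    refine hdb _ _ fun a a' => ?_
    have h1 : ((min (k a) (k a') : ℕ) : ℝ) / n = min ((k a : ℝ)/n) ((k a' : ℝ)/n) := by
      rw [Nat.cast_min, min_div_div_right (by linarith)]
    rw [h1]
    refine (abs_min_sub_min_le_max _ _ _ _).trans (max_le (hkk a) (hkk a'))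
  have hexp : ‖((Real.exp (-Eb) : ℝ) : ℂ) - ((Real.exp (-Ef) : ℝ) : ℂ)‖ ≤ ε/8 := by
    rw [← Complex.ofReal_sub, Complex.norm_real, Real.norm_eq_abs]
    have h1 := abs_le.1 hEfA
    have h2 := abs_le.1 hEd
    have h3 : 3 * δ * B ≤ 3 * B := by gcongr; linarith
    refine (exp_lip (A := A0) (by rw [hA0]; linarith) (by rw [hA0]; linarith)).trans ?_
    have : |-Eb - -Ef| = |Eb - Ef| := by rw [← abs_neg]; congr 1; ring
    rw [this]
    refine le_trans ?_ hδ3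
    gcongr
  rw [dist_eq_norm, hext]
  have f1 := norm_sub_le_norm_sub_add_norm_sub (EW V (t + T * n) 0 (fun p => Complex.exp (Complex.I * ((Z p : ℝ) : ℂ))))
    (EW V (t + T * n) 0 (fun p => Complex.exp (Complex.I * ((Z1 p : ℝ) : ℂ)))) ((Real.exp (-Ef) : ℝ) : ℂ)
  have f2 := norm_sub_le_norm_sub_add_norm_sub (EW V (t + T * n) 0 (fun p => Complex.exp (Complex.I * ((Z1 p : ℝ) : ℂ))))
    ((Real.exp (-Eb) : ℝ) : ℂ) ((Real.exp (-Ef) : ℝ) : ℂ)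
  linarith


/-- indicator of open edge at the origin -/
noncomputable def ce (ω : Config d) (e : Dir d) : ℝ := ind ((0:Pt d) ∈ Sinf ω ∧ vec e ∈ Sinf ω)

/-- environment times direction measure -/
noncomputable def muD (P : Measure (Config d)) : Measure (Config d × Dir d) := P.prod Measure.count

/-- the flip -/
def JJ (z : Config d × Dir d) : Config d × Dir d := (shift (vec z.2) z.1, opp z.2)

/-- gradient -/
noncomputable def gr (h : Config d → ℝ) (z : Config d × Dir d) : ℝ := ce z.1 z.2 * (h (shift (vec z.2) z.1) - h z.1)

/-- position gradient -/
noncomputable def Uf (i : Fin d) (z : Config d × Dir d) : ℝ := ce z.1 z.2 * (vec z.2 i : ℝ)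

/-- bounded measurable -/
def Bm {α : Type*} [MeasurableSpace α] (h : α → ℝ) : Prop := Measurable h ∧ ∃ B, ∀ ω, |h ω| ≤ B

lemma opp_shift (ω : Config d) (e : Dir d) : shift (vec (opp e)) (shift (vec e) ω) = ω := by
  rw [shift_shift, vec_opp, add_neg_cancel, shift_zero]

lemma JJ_JJ (z : Config d × Dir d) : JJ (JJ z) = z := by
  rcases z with ⟨ω, e⟩
  simp [JJ, opp_shift, opp_opp]

lemma ce_JJ (z : Config d × Dir d) : ce (JJ z).1 (JJ z).2 = ce z.1 z.2 := by
  rcases z with ⟨ω, e⟩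
  simp only [JJ, ce]
  congr 1
  rw [Sinf_shift, Sinf_shift, vec_opp, add_neg_cancel, add_zero]
  exact propext and_comm

lemma gr_JJ (h : Config d → ℝ) (z : Config d × Dir d) : gr h (JJ z) = - gr h z := by
  unfold gr
  rw [ce_JJ]
  rcases z with ⟨ω, e⟩
  simp only [JJ, opp_shift]; ring

lemma Uf_JJ (i : Fin d) (z : Config d × Dir d) : Uf i (JJ z) = - Uf i z := by
  unfold Uf
  rw [ce_JJ]
  rcases z with ⟨ω, e⟩
  simp only [JJ, vec_opp]; simp

lemma ce_shift (x : Pt d) (ω : Config d) (e : Dir d) : ce (shift x ω) e = ind (x ∈ Sinf ω ∧ x + vec e ∈ Sinf ω) := by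
  unfold ce; rw [Sinf_shift, Sinf_shift, add_zero]

lemma ce_abs (ω : Config d) (e : Dir d) : |ce ω e| ≤ 1 := by
  unfold ce
  rw [abs_of_nonneg (ind_nonneg _)]; exact ind_le_one _

lemma ce_sq (ω : Config d) (e : Dir d) : ce ω e * ce ω e = ce ω e := by
  unfold ce ind; split_ifs <;> norm_num

lemma meas_ce (e : Dir d) : Measurable fun ω : Config d => ce ω e := by
  unfold ce ind
  exact Measurable.ite ((meas_Sinf 0).inter (meas_Sinf (vec e))) measurable_const measurable_const

lemma measD {γ : Type*} [MeasurableSpace γ] {f : Config d × Dir d → γ} (hf : ∀ e, Measurable fun ω => f (ω, e)) : Measurable f :=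
  measurable_from_prod_countable_left hf

lemma Bm_gr {h : Config d → ℝ} (hh : Bm h) : Bm (gr h) := by
  obtain ⟨hm, B, hB⟩ := hh
  have hmm : ∀ e, Measurable fun ω : Config d => gr h (ω, e) := fun e =>
    (meas_ce e).mul ((hm.comp (measurable_shift (vec e))).sub hm)
  refine ⟨measD hmm, 2*B, fun z => ?_⟩
  unfold gr
  rw [abs_mul]
  have h1 := ce_abs z.1 z.2
  have h2 := abs_sub (h (shift (vec z.2) z.1)) (h z.1)
  have h3 := hB (shift (vec z.2) z.1)
  have h4 := hB z.1
  calc |ce z.1 z.2| * |h (shift (vec z.2) z.1) - h z.1| ≤ 1 * (2*B) := by gcongr; linarith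
    _ = _ := one_mul _

lemma Bm_Uf (i : Fin d) : Bm (Uf (d := d) i) := by
  have hmm : ∀ e, Measurable fun ω : Config d => Uf i (ω, e) := fun e => by
    simp only [Uf]
    exact (meas_ce e).mul measurable_const
  refine ⟨measD hmm, 1, fun z => ?_⟩
  unfold Uf
  rw [abs_mul]
  have h1 := ce_abs z.1 z.2
  have h2 : |((vec z.2 i : ℤ) : ℝ)| ≤ 1 := by exact_mod_cast vec_abs_le z.2 i
  calc _ ≤ (1:ℝ) * 1 := by gcongr
    _ = 1 := one_mul _

section
variable {α : Type*} [MeasurableSpace α]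
lemma Bm.add {f g : α → ℝ} (hf : Bm f) (hg : Bm g) : Bm (fun x => f x + g x) := by
  obtain ⟨h1, A, h2⟩ := hf
  obtain ⟨h3, B, h4⟩ := hg
  exact ⟨h1.add h3, A + B, fun x => (abs_add_le _ _).trans (add_le_add (h2 x) (h4 x))⟩

lemma Bm.mul {f g : α → ℝ} (hf : Bm f) (hg : Bm g) : Bm (fun x => f x * g x) := by
  obtain ⟨h1, A, h2⟩ := hf
  obtain ⟨h3, B, h4⟩ := hg
  exact ⟨h1.mul h3, A * B, fun x => by
    rw [abs_mul]; exact mul_le_mul (h2 x) (h4 x) (abs_nonneg _) ((abs_nonneg _).trans (h2 x))⟩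

lemma Bm.const (c : ℝ) : Bm (fun _ : α => c) := ⟨measurable_const, |c|, fun _ => le_rfl⟩

lemma Bm.neg {f : α → ℝ} (hf : Bm f) : Bm (fun x => - f x) := by
  simpa using (Bm.const (-1)).mul hf

lemma Bm.sub {f g : α → ℝ} (hf : Bm f) (hg : Bm g) : Bm (fun x => f x - g x) := by
  simpa [sub_eq_add_neg] using hf.add hg.neg

lemma Bm.sum {ι : Type*} (s : Finset ι) {f : ι → α → ℝ} (hf : ∀ i, Bm (f i)) : Bm (fun x => ∑ i ∈ s, f i x) := by
  classical
  induction s using Finset.induction_on with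
  | empty => simpa using Bm.const 0
  | insert i s hi ih => simpa [Finset.sum_insert hi] using (hf i).add ih

lemma Bm.memLp {f : α → ℝ} (hf : Bm f) (μ : Measure α) [IsFiniteMeasure μ] (p : ℝ≥0∞) : MemLp f p μ := by
  obtain ⟨h1, B, hB⟩ := hf
  exact MemLp.of_bound h1.aestronglyMeasurable B (Eventually.of_forall hB)

lemma Bm.integrable {f : α → ℝ} (hf : Bm f) (μ : Measure α) [IsFiniteMeasure μ] : Integrable f μ :=
  memLp_one_iff_integrable.1 (hf.memLp μ 1)
end

lemma Bm.sec {f : Config d × Dir d → ℝ} (hf : Bm f) (e : Dir d) : Bm (fun ω => f (ω, e)) := by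
  obtain ⟨h1, B, hB⟩ := hf
  exact ⟨h1.comp (measurable_id.prodMk measurable_const), B, fun ω => hB _⟩

lemma Bm.av {f : Config d × Dir d → ℝ} (hf : Bm f) : Bm (fun ω => av fun e => f (ω, e)) := by
  simpa [Perco.av] using (Bm.const ((2*d:ℝ)⁻¹)).mul (Bm.sum Finset.univ hf.sec)

instance (P : Measure (Config d)) [IsProbabilityMeasure P] : IsFiniteMeasure (muD P) := by
  unfold muD; infer_instance

lemma JJ_mp {P : Measure (Config d)} [IsProbabilityMeasure P] (hA1 : ∀ e : Pt d, dist1 (0 : Pt d) e = 1 → Ergodic (shift e) P) :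
    MeasurePreserving (JJ (d := d)) (muD P) (muD P) := by
  have hmm : ∀ e, Measurable fun ω : Config d => JJ (ω, e) := fun e => by
    simp only [JJ]
    exact (measurable_shift (vec e)).prodMk measurable_const
  have hm : Measurable (JJ (d := d)) := measD hmm
  refine ⟨hm, ?_⟩
  ext s hs
  rw [Measure.map_apply hm hs]
  unfold muD
  rw [Measure.prod_apply_symm (hm hs), Measure.prod_apply_symm hs, lintegral_count, lintegral_count, tsum_fintype, tsum_fintype]
  have hinv : Function.Involutive (opp : Dir d → Dir d) := opp_opp
  rw [← Equiv.sum_comp hinv.toPerm (fun e => P ((fun ω => (ω, e)) ⁻¹' s))]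
  refine Finset.sum_congr rfl fun e _ => ?_
  have h1 : (fun ω : Config d => (ω, e)) ⁻¹' (JJ ⁻¹' s) = shift (vec e) ⁻¹' ((fun ω : Config d => (ω, opp e)) ⁻¹' s) := rfl
  rw [h1, (shift_mp hA1 (vec e)).measure_preimage]
  · rfl
  · exact (measurable_id.prodMk measurable_const hs).nullMeasurableSet

lemma int_muD {P : Measure (Config d)} [IsProbabilityMeasure P] {f : Config d × Dir d → ℝ} (hf : Integrable f (muD P)) :
    ∫ z, f z ∂(muD P) = ∫ ω, ∑ e, f (ω, e) ∂P := by
  unfold muD at *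
  rw [integral_prod _ hf]
  congr 1; ext ω
  rw [integral_fintype]
  · simp
  · exact Integrable.of_finite

lemma lint_muD {P : Measure (Config d)} [IsProbabilityMeasure P] {f : Config d × Dir d → ℝ≥0∞} (hf : Measurable f) :
    ∫⁻ z, f z ∂(muD P) = ∫⁻ ω, ∑ e, f (ω, e) ∂P := by
  unfold muD
  rw [lintegral_prod _ hf.aemeasurable]
  congr 1; ext ω
  rw [lintegral_count, tsum_fintype]

lemma ae_muD {P : Measure (Config d)} [IsProbabilityMeasure P] {p : Config d × Dir d → Prop} (h : ∀ᵐ z ∂(muD P), p z) :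
    ∀ᵐ ω ∂P, ∀ e, p (ω, e) := by
  unfold muD at h
  filter_upwards [Measure.ae_ae_of_ae_prod h] with ω hω
  exact fun e => (Measure.ae_count_iff.1 hω) e


lemma erg_const [NeZero d] {P : Measure (Config d)} [IsProbabilityMeasure P]
    (hA1 : ∀ e : Pt d, dist1 (0 : Pt d) e = 1 → Ergodic (shift e) P)
    (hA2 : ∀ᵐ ω ∂P, (Sinf ω).Nonempty ∧ ∀ x ∈ Sinf ω, ∀ y ∈ Sinf ω, connIn (SS ω) x y)
    (f : Config d → ℝ) (hf : Measurable f)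
    (h : ∀ᵐ ω ∂P, ∀ e, ce ω e = 0 ∨ f (shift (vec e) ω) = f ω) :
    ∃ c, ∀ᵐ ω ∂P, (0:Pt d) ∈ Sinf ω → f ω = c := by
  classical
  have key : ∀ᵐ ω ∂P, ∀ x ∈ Sinf ω, (0:Pt d) ∈ Sinf ω → f (shift x ω) = f ω := by
    filter_upwards [hA2, ae_shift hA1 h] with ω h2 h3 x hx h0
    have hc := (h2.2 0 h0 x hx).2.2
    have : ∀ z, Relation.ReflTransGen (stepRel (SS ω)) 0 z → z ∈ Sinf ω ∧ f (shift z ω) = f ω := by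
      intro z hz
      induction hz with
      | refl => exact ⟨h0, by rw [shift_zero]⟩
      | tail _ hst ih =>
        rename_i b c hb
        obtain ⟨hbi, hbf⟩ := ih
        have hci : c ∈ Sinf ω := Sinf_of_conn hbi ⟨hst.2.1, hst.2.2, Relation.ReflTransGen.single hst⟩
        refine ⟨hci, ?_⟩
        obtain ⟨e, rfl⟩ := adj_iff.1 hst.1
        rcases h3 b e with h4 | h4
        · exfalso
          rw [ce_shift, ind_pos ⟨hbi, hci⟩] at h4
          norm_num at h4
        · rw [shift_shift] at h4
          rw [h4, hbf]
    exact (this x hc).2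
  set Φ : Config d → ℝ := fun ω => ⨆ x : Pt d, (if x ∈ Sinf ω then Real.arctan (f (shift x ω)) else -2) with hΦ
  have hΦm : Measurable Φ := by
    refine Measurable.iSup fun x => ?_
    exact Measurable.ite (meas_Sinf x) (Real.measurable_arctan.comp (hf.comp (measurable_shift x))) measurable_const
  have hΦs : Φ ∘ shift (vec ((0, true) : Dir d)) = Φ := by
    ext ω
    simp only [hΦ, Function.comp]
    refine Equiv.iSup_congr (Equiv.addLeft (vec ((0, true) : Dir d))) fun x => ?_
    show (if vec ((0, true) : Dir d) + x ∈ Sinf ω then Real.arctan (f (shift (vec ((0, true) : Dir d) + x) ω)) else -2) = _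
    rw [shift_shift]
    by_cases hxx : vec ((0, true) : Dir d) + x ∈ Sinf ω
    · rw [if_pos hxx, if_pos (Sinf_shift.2 hxx)]
    · rw [if_neg hxx, if_neg (fun h => hxx (Sinf_shift.1 h))]
  obtain ⟨c, hc⟩ := (hA1 _ (vec_dist ((0, true) : Dir d))).toPreErgodic.ae_eq_const_of_ae_eq_comp hΦm hΦs
  refine ⟨Real.tan c, ?_⟩
  filter_upwards [hc, key] with ω h1 h2 h0
  have hpi : (-2:ℝ) ≤ Real.arctan (f ω) := by
    have := Real.neg_pi_div_two_lt_arctan (f ω)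
    have := Real.pi_lt_four
    linarith
  have hle : ∀ x : Pt d, (if x ∈ Sinf ω then Real.arctan (f (shift x ω)) else -2) ≤ Real.arctan (f ω) := by
    intro x
    split_ifs with hx
    · rw [h2 x hx h0]
    · exact hpi
  have h3 : Φ ω = Real.arctan (f ω) := by
    apply le_antisymm
    · exact ciSup_le hle
    · have := le_ciSup (f := fun x : Pt d => (if x ∈ Sinf ω then Real.arctan (f (shift x ω)) else -2)) ⟨_, by rintro _ ⟨x, rfl⟩; exact hle x⟩ (0 : Pt d)
      simpa [h0, shift_zero] using this
  rw [h3] at h1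
  simp only [Function.const] at h1
  rw [← h1, Real.tan_arctan]

section hilb
variable {α : Type*} [MeasurableSpace α] {μ : Measure α}

lemma Lp_inner (u v : Lp ℝ 2 μ) : inner ℝ u v = ∫ z, u z * v z ∂μ := by
  rw [L2.inner_def]
  congr 1; ext z
  simp [mul_comm]

lemma Lp_norm_sq (u : Lp ℝ 2 μ) : ‖u‖^2 = ∫ z, (u z)^2 ∂μ := by
  rw [← real_inner_self_eq_norm_sq, Lp_inner]
  simp_rw [pow_two]

/-- submodule of images of bounded functions -/
def KA (μ : Measure α) (A : (Config d → ℝ) → α → ℝ) (hadd : ∀ h h' z, A (fun ω => h ω + h' ω) z = A h z + A h' z)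
    (hsm : ∀ (c : ℝ) h z, A (fun ω => c * h ω) z = c * A h z) : Submodule ℝ (Lp ℝ 2 μ) where
  carrier := {u | ∃ h, Bm h ∧ u =ᵐ[μ] A h}
  add_mem' := by
    rintro u v ⟨h, hh, hu⟩ ⟨h', hh', hv⟩
    refine ⟨_, hh.add hh', ?_⟩
    filter_upwards [hu, hv, Lp.coeFn_add u v] with z h1 h2 h3
    rw [h3, hadd, Pi.add_apply, h1, h2]
  zero_mem' := by
    refine ⟨fun _ => 0, Bm.const 0, ?_⟩
    filter_upwards [Lp.coeFn_zero ℝ 2 μ] with z h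
    have := hsm 0 (fun _ => 0) z
    simp only [zero_mul] at this
    rw [h, this]; rfl
  smul_mem' := by
    rintro c u ⟨h, hh, hu⟩
    refine ⟨_, (Bm.const c).mul hh, ?_⟩
    filter_upwards [hu, Lp.coeFn_smul c u] with z h1 h2
    rw [h2, hsm, Pi.smul_apply, h1]; rfl

lemma hilb_closure {H : Type*} [NormedAddCommGroup H] [InnerProductSpace ℝ H] [CompleteSpace H] (K : Submodule ℝ H) (g : H)
    (h : ∀ f, (∀ k ∈ K, inner ℝ k f = 0) → inner ℝ f g = 0) (ε : ℝ) (hε : 0 < ε) : ∃ k ∈ K, ‖g - k‖ < ε := by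
  have h1 : g ∈ Kᗮᗮ := by
    rw [Submodule.mem_orthogonal]
    intro f hf
    exact h f ((Submodule.mem_orthogonal K f).1 hf)
  rw [Submodule.orthogonal_orthogonal_eq_closure] at h1
  obtain ⟨k, hk, hd⟩ := Metric.mem_closure_iff.1 h1 ε hε
  exact ⟨k, hk, by rwa [dist_eq_norm] at hd⟩
end hilb

/-- generator -/
noncomputable def Lop (h : Config d → ℝ) (ω : Config d) : ℝ := av fun e => gr h (ω, e)

lemma gr_add (h h' : Config d → ℝ) (z) : gr (fun ω => h ω + h' ω) z = gr h z + gr h' z := by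
  unfold gr; ring
lemma gr_mul (c : ℝ) (h : Config d → ℝ) (z) : gr (fun ω => c * h ω) z = c * gr h z := by
  unfold gr; ring
lemma Lop_add (h h' : Config d → ℝ) (z) : Lop (fun ω => h ω + h' ω) z = Lop h z + Lop h' z := by
  unfold Lop; simp_rw [gr_add]; rw [← av_add]
lemma Lop_mul (c : ℝ) (h : Config d → ℝ) (z) : Lop (fun ω => c * h ω) z = c * Lop h z := by
  unfold Lop; simp_rw [gr_mul]; rw [← av_mul]
lemma Bm_Lop {h : Config d → ℝ} (hh : Bm h) : Bm (Lop h) := (Bm_gr hh).av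

lemma orth_const [NeZero d] {P : Measure (Config d)} [IsProbabilityMeasure P]
    (hA1 : ∀ e : Pt d, dist1 (0 : Pt d) e = 1 → Ergodic (shift e) P)
    (hA2 : ∀ᵐ ω ∂P, (Sinf ω).Nonempty ∧ ∀ x ∈ Sinf ω, ∀ y ∈ Sinf ω, connIn (SS ω) x y)
    (f : Config d → ℝ) (hf : Measurable f) (hfi : Integrable f P)
    (h : ∀ h, Bm h → ∫ ω, Lop h ω * f ω ∂P = 0) : ∃ c, ∀ᵐ ω ∂P, (0:Pt d) ∈ Sinf ω → f ω = c := by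
  set h0 : Config d → ℝ := fun ω => Real.arctan (f ω) with hh0
  have hb : Bm h0 := by
    refine ⟨Real.measurable_arctan.comp hf, 2, fun ω => ?_⟩
    have h1 := Real.neg_pi_div_two_lt_arctan (f ω)
    have h2 := Real.arctan_lt_pi_div_two (f ω)
    have := Real.pi_lt_four
    rw [abs_le]; constructor <;> simp only [hh0] <;> linarith
  set G : Config d × Dir d → ℝ := fun z => gr h0 z * f z.1 with hG
  have hfi2 : Integrable (fun z : Config d × Dir d => f z.1) (muD P) := by
    unfold muD; exact hfi.comp_fst _
  have hGi : Integrable G (muD P) := by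
    obtain ⟨h1, B, h2⟩ := Bm_gr hb
    exact hfi2.bdd_mul h1.aestronglyMeasurable (Eventually.of_forall h2)
  have hG0 : ∫ z, G z ∂(muD P) = 0 := by
    rw [int_muD hGi]
    have h1 := h h0 hb
    have h2 : ∀ ω, ∑ e, G (ω, e) = (2*d) * (Lop h0 ω * f ω) := by
      intro ω
      have hd : (d:ℝ) ≠ 0 := Nat.cast_ne_zero.2 (NeZero.ne d)
      simp only [hG, Lop, av, smul_eq_mul]
      rw [← Finset.sum_mul]
      field_simp
    simp_rw [h2]
    rw [integral_const_mul, h1, mul_zero]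
  have hJ := JJ_mp (P := P) hA1
  have hGJ : ∫ z, G (JJ z) ∂(muD P) = 0 := by
    rw [← hG0]
    have := integral_map (μ := muD P) hJ.measurable.aemeasurable (f := G) (by rw [hJ.map_eq]; exact hGi.aestronglyMeasurable)
    rw [hJ.map_eq] at this
    exact this.symm
  have hGJi : Integrable (fun z => G (JJ z)) (muD P) := hJ.integrable_comp_of_integrable hGi
  have hsum : ∫ z, (-(G z + G (JJ z))) ∂(muD P) = 0 := by
    rw [integral_neg, integral_add hGi hGJi, hG0, hGJ]; norm_num
  have hform : ∀ z : Config d × Dir d, -(G z + G (JJ z)) = ce z.1 z.2 * ((h0 (shift (vec z.2) z.1) - h0 z.1) * (f (shift (vec z.2) z.1) - f z.1)) := by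
    intro z
    simp only [hG]
    rw [gr_JJ]
    simp only [JJ, gr]; ring
  have hnn : ∀ z : Config d × Dir d, 0 ≤ -(G z + G (JJ z)) := by
    intro z
    rw [hform]
    refine mul_nonneg (ind_nonneg _) ?_
    rcases le_total (f (shift (vec z.2) z.1)) (f z.1) with h1 | h1
    · exact mul_nonneg_of_nonpos_of_nonpos (sub_nonpos.2 (Real.arctan_mono h1)) (sub_nonpos.2 h1)
    · exact mul_nonneg (sub_nonneg.2 (Real.arctan_mono h1)) (sub_nonneg.2 h1)
  have hz := (integral_eq_zero_iff_of_nonneg hnn (hGi.add hGJi).neg).1 hsum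
  refine erg_const hA1 hA2 f hf ?_
  filter_upwards [ae_muD hz] with ω hω e
  have h1 := hω e
  rw [hform] at h1
  rcases mul_eq_zero.1 h1 with h2 | h2
  · exact Or.inl h2
  · right
    rcases mul_eq_zero.1 h2 with h3 | h3
    · exact Real.arctan_injective (sub_eq_zero.1 h3)
    · exact sub_eq_zero.1 h3

/-- mean zero functions are approximated by generators -/
lemma erg_approx [NeZero d] {P : Measure (Config d)} [IsProbabilityMeasure P]
    (hA1 : ∀ e : Pt d, dist1 (0 : Pt d) e = 1 → Ergodic (shift e) P)
    (hA2 : ∀ᵐ ω ∂P, (Sinf ω).Nonempty ∧ ∀ x ∈ Sinf ω, ∀ y ∈ Sinf ω, connIn (SS ω) x y)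
    (g : Config d → ℝ) (hg : Bm g) (hg0 : ∀ ω, (0:Pt d) ∉ Sinf ω → g ω = 0) (hgi : ∫ ω, g ω ∂P = 0)
    (ε : ℝ) (hε : 0 < ε) : ∃ h, Bm h ∧ ∫ ω, |g ω - Lop h ω| ∂P ≤ ε := by
  set K := KA P (Lop (d := d)) Lop_add Lop_mul with hK
  have hgL := (hg.memLp P 2).coeFn_toLp
  obtain ⟨k, ⟨h, hb, hk⟩, hlt⟩ := hilb_closure K ((hg.memLp P 2).toLp g) (by
    intro f hf
    obtain ⟨c, hc⟩ := orth_const hA1 hA2 f (Lp.stronglyMeasurable f).measurable ((Lp.memLp f).integrable (by norm_num)) (by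
      intro h hb
      have hm := ((Bm_Lop hb).memLp P 2)
      have h1 := hf (hm.toLp _) ⟨h, hb, hm.coeFn_toLp⟩
      rw [Lp_inner] at h1
      rw [← h1]
      refine integral_congr_ae ?_
      filter_upwards [hm.coeFn_toLp] with ω h2
      rw [h2])
    rw [Lp_inner]
    have : ∫ ω, c * g ω ∂P = 0 := by rw [integral_const_mul, hgi, mul_zero]
    rw [← this]
    refine integral_congr_ae ?_
    filter_upwards [hgL, hc] with ω h1 h2
    rw [h1]
    by_cases h3 : (0:Pt d) ∈ Sinf ω
    · rw [h2 h3]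
    · rw [hg0 ω h3]; ring) ε hε
  refine ⟨h, hb, ?_⟩
  have hu : Bm (fun ω => g ω - Lop h ω) := hg.sub (Bm_Lop hb)
  have hsq : ∫ ω, (g ω - Lop h ω)^2 ∂P ≤ ε^2 := by
    have h1 := Lp_norm_sq ((hg.memLp P 2).toLp g - k)
    have h2 : ∫ ω, (g ω - Lop h ω)^2 ∂P = ‖(hg.memLp P 2).toLp g - k‖^2 := by
      rw [h1]
      refine integral_congr_ae ?_
      filter_upwards [hgL, hk, Lp.coeFn_sub ((hg.memLp P 2).toLp g) k] with ω h3 h4 h5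
      rw [h5, Pi.sub_apply, h3, h4]
    rw [h2]
    gcongr
  have hui : Integrable (fun ω => (g ω - Lop h ω)^2) P := by simpa [pow_two] using (hu.mul hu).integrable P
  calc ∫ ω, |g ω - Lop h ω| ∂P ≤ ∫ ω, (ε/2 + (g ω - Lop h ω)^2/(2*ε)) ∂P := by
        refine integral_mono (hu.integrable P).abs ((integrable_const _).add (hui.div_const _)) fun ω => ?_
        simp only
        rw [← sq_abs]
        generalize |g ω - Lop h ω| = t
        have h7 : ε/2 + t^2/(2*ε) - t = (t-ε)^2/(2*ε) := by field_simp; ring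
        have h8 : 0 ≤ (t-ε)^2/(2*ε) := by positivity
        linarith only [h7, h8]
    _ ≤ ε := by
        rw [integral_add (integrable_const _) (hui.div_const _), integral_const, probReal_univ, one_smul, integral_div]
        have h9 : (∫ ω, (g ω - Lop h ω)^2 ∂P)/(2*ε) ≤ ε^2/(2*ε) := by gcongr
        have h3 : ε^2/(2*ε) = ε/2 := by field_simp
        linarith only [h9, h3]


lemma corrector [NeZero d] {P : Measure (Config d)} [IsProbabilityMeasure P]
    (hA1 : ∀ e : Pt d, dist1 (0 : Pt d) e = 1 → Ergodic (shift e) P) (i : Fin d) :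
    ∃ Pi0 : Lp ℝ 2 (muD P), (∀ᵐ z ∂(muD P), Pi0 (JJ z) = - Pi0 z) ∧ (∀ᵐ ω ∂P, ∑ e, ce ω e * Pi0 (ω, e) = 0) ∧
      ∀ ε : ℝ, 0 < ε → ∃ h, Bm h ∧ ∫ z, (Uf i z + gr h z - Pi0 z)^2 ∂(muD P) ≤ ε := by
  set K := KA (muD P) (gr (d := d)) gr_add gr_mul with hK
  have hJ := JJ_mp (P := P) hA1
  have hU := (Bm_Uf (d := d) i).memLp (muD P) 2
  obtain ⟨y, hy, Pi0, hPi0, hsum⟩ := Submodule.exists_add_mem_mem_orthogonal (K := K.topologicalClosure) (hU.toLp _)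
  have hPi0e : Pi0 = hU.toLp _ - y := by rw [hsum]; abel
  have hyJ : Lp.compMeasurePreserving JJ hJ y = - y := by
    have hcl : IsClosed {w : Lp ℝ 2 (muD P) | Lp.compMeasurePreserving JJ hJ w = - w} :=
      isClosed_eq (Lp.isometry_compMeasurePreserving hJ).continuous continuous_neg
    have : (K : Set (Lp ℝ 2 (muD P))) ⊆ {w : Lp ℝ 2 (muD P) | Lp.compMeasurePreserving JJ hJ w = - w} := by
      rintro w ⟨h, hb, hw⟩
      apply Lp.ext
      filter_upwards [Lp.coeFn_compMeasurePreserving w hJ, Lp.coeFn_neg w, hw, hJ.quasiMeasurePreserving.ae hw] with z h1 h2 h3 h4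
      rw [h1, h2, Pi.neg_apply, Function.comp, h3, h4, gr_JJ]
    exact closure_minimal this hcl hy
  have hJPi0 : ∀ᵐ z ∂(muD P), Pi0 (JJ z) = - Pi0 z := by
    have h1 : Lp.compMeasurePreserving JJ hJ Pi0 = - Pi0 := by
      rw [hPi0e, map_sub, hyJ, Lp.toLp_compMeasurePreserving, neg_sub]
      have : (hU.comp_measurePreserving hJ).toLp _ = - hU.toLp _ := by
        apply Lp.ext
        filter_upwards [(hU.comp_measurePreserving hJ).coeFn_toLp, Lp.coeFn_neg (hU.toLp _), hU.coeFn_toLp] with z h1 h2 h3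
        rw [h1, h2, Pi.neg_apply, h3, Function.comp, Uf_JJ]
      rw [this]; abel
    filter_upwards [Lp.coeFn_compMeasurePreserving Pi0 hJ, Lp.coeFn_neg Pi0] with z h2 h3
    rw [h1, h3] at h2
    exact h2.symm
  have hPi0m : Measurable Pi0 := (Lp.stronglyMeasurable Pi0).measurable
  have hPi0i : Integrable Pi0 (muD P) := (Lp.memLp Pi0).integrable (by norm_num)
  refine ⟨Pi0, hJPi0, ?_, ?_⟩
  · have key : ∀ h, Bm h → ∫ ω, h ω * ∑ e, ce ω e * Pi0 (ω, e) ∂P = 0 := by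
      intro h hb
      set G : Config d × Dir d → ℝ := fun z => (ce z.1 z.2 * h z.1) * Pi0 z with hG
      have hcm : Measurable fun z : Config d × Dir d => ce z.1 z.2 := measD meas_ce
      have hcb : Bm (fun z : Config d × Dir d => ce z.1 z.2 * h z.1) :=
        Bm.mul ⟨hcm, 1, fun z => ce_abs _ _⟩ ⟨hb.1.comp measurable_fst, hb.2.choose, fun z => hb.2.choose_spec _⟩
      have hGi : Integrable G (muD P) := hPi0i.bdd_mul hcb.1.aestronglyMeasurable (Eventually.of_forall hcb.2.choose_spec)
      have hGJi : Integrable (fun z => G (JJ z)) (muD P) := hJ.integrable_comp_of_integrable hGi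
      have hGJ : ∫ z, G (JJ z) ∂(muD P) = ∫ z, G z ∂(muD P) := by
        have := integral_map (μ := muD P) hJ.measurable.aemeasurable (f := G) (by rw [hJ.map_eq]; exact hGi.aestronglyMeasurable)
        rw [hJ.map_eq] at this
        exact this.symm
      have horth : ∫ z, gr h z * Pi0 z ∂(muD P) = 0 := by
        have hm := (Bm_gr hb).memLp (muD P) 2
        have h1 := (Submodule.mem_orthogonal _ _).1 hPi0 (hm.toLp _) (Submodule.le_topologicalClosure K ⟨h, hb, hm.coeFn_toLp⟩)
        rw [Lp_inner] at h1
        rw [← h1]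
        refine integral_congr_ae ?_
        filter_upwards [hm.coeFn_toLp] with z h2
        rw [h2]
      have h3 : ∫ z, gr h z * Pi0 z ∂(muD P) = ∫ z, (- (G (JJ z)) - G z) ∂(muD P) := by
        refine integral_congr_ae ?_
        filter_upwards [hJPi0] with z hz
        simp only [hG]
        rw [hz, ce_JJ]
        simp only [gr, JJ]; ring
      have h4 : ∫ z, G z ∂(muD P) = 0 := by
        rw [integral_sub (f := fun z => -(G (JJ z))) hGJi.neg hGi, integral_neg, hGJ, horth] at h3
        linarith only [h3]
      rw [int_muD hGi] at h4
      rw [← h4]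
      congr 1; ext ω
      simp only [hG]
      rw [Finset.mul_sum]
      exact Finset.sum_congr rfl fun e _ => by ring
    set s : Config d → ℝ := fun ω => ∑ e, ce ω e * Pi0 (ω, e) with hs
    have hsm : Measurable s := Finset.measurable_sum _ fun e _ => (meas_ce e).mul (hPi0m.comp (measurable_id.prodMk measurable_const))
    have hsi : Integrable s P := by
      have h1 : Integrable (fun z : Config d × Dir d => ce z.1 z.2 * Pi0 z) (muD P) :=
        hPi0i.bdd_mul (c := 1) (measD meas_ce).aestronglyMeasurable (Eventually.of_forall fun z => ce_abs _ _)
      unfold muD at h1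
      have h2 := h1.integral_prod_left
      refine h2.congr (Eventually.of_forall fun ω => ?_)
      simp only
      rw [integral_fintype Integrable.of_finite]
      simp [hs]
      rfl
    have hat : Bm (fun ω => Real.arctan (s ω)) := by
      refine ⟨Real.measurable_arctan.comp hsm, 2, fun ω => ?_⟩
      have h1 := Real.neg_pi_div_two_lt_arctan (s ω)
      have h2 := Real.arctan_lt_pi_div_two (s ω)
      have := Real.pi_lt_four
      rw [abs_le]; constructor <;> linarith
    have h5 := key _ hat
    have hnn : ∀ ω, 0 ≤ Real.arctan (s ω) * s ω := by
      intro ω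
      rcases le_total 0 (s ω) with h | h
      · exact mul_nonneg (Real.arctan_nonneg.2 h) h
      · exact mul_nonneg_of_nonpos_of_nonpos (by rw [← Real.arctan_zero]; exact Real.arctan_mono h) h
    have h6 := (integral_eq_zero_iff_of_nonneg hnn (hsi.bdd_mul hat.1.aestronglyMeasurable (Eventually.of_forall hat.2.choose_spec))).1 h5
    filter_upwards [h6] with ω hω
    rcases mul_eq_zero.1 hω with h | h
    · exact Real.arctan_eq_zero_iff.1 h
    · exact h
  · intro ε hε
    obtain ⟨k, ⟨h, hb, hk⟩, hlt⟩ := Metric.mem_closure_iff.1 hy (Real.sqrt ε) (Real.sqrt_pos.2 hε)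
    refine ⟨fun ω => (-1) * h ω, (Bm.const (-1)).mul hb, ?_⟩
    have h1 : ∫ z, (Uf i z + gr (fun ω => (-1) * h ω) z - Pi0 z)^2 ∂(muD P) = ‖y - k‖^2 := by
      rw [Lp_norm_sq]
      refine integral_congr_ae ?_
      filter_upwards [hk, Lp.coeFn_sub y k, Lp.coeFn_sub (hU.toLp _) y, hU.coeFn_toLp] with z h1 h2 h3 h4
      rw [h2, Pi.sub_apply, h1, hPi0e, h3, Pi.sub_apply, h4, gr_mul]; ring
    rw [h1, ← Real.sq_sqrt hε.le]
    rw [dist_eq_norm] at hlt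
    gcongr


/-- gradient of corrected coordinate -/
noncomputable def Dm (i : Fin d) (h : Config d → ℝ) (z : Config d × Dir d) : ℝ := Uf i z + gr h z

lemma Bm_Dm (i : Fin d) {h : Config d → ℝ} (hh : Bm h) : Bm (Dm i h) := (Bm_Uf i).add (Bm_gr hh)

lemma ce_Dm (i : Fin d) (h : Config d → ℝ) (z) : ce z.1 z.2 * Dm i h z = Dm i h z := by
  unfold Dm Uf gr
  have := ce_sq z.1 z.2
  linear_combination ((vec z.2 i : ℝ) + (h (shift (vec z.2) z.1) - h z.1)) * this

lemma Dm_off (i : Fin d) (h : Config d → ℝ) (ω e) (h0 : (0:Pt d) ∉ Sinf ω) : Dm i h (ω, e) = 0 := by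
  rw [← ce_Dm]; simp only
  unfold ce; rw [ind_neg (fun hh => h0 hh.1), zero_mul]

lemma mv_gr (h : Config d → ℝ) (ω : Config d) (x : Pt d) (e : Dir d) :
    h (shift (mv (Sinf ω) x e) ω) - h (shift x ω) = gr h (shift x ω, e) := by
  unfold gr
  simp only [ce_shift, shift_shift]
  unfold mv
  split_ifs with hh
  · rw [ind_pos hh, one_mul]
  · rw [ind_neg hh, sub_self, zero_mul]

lemma mv_Uf (i : Fin d) (ω : Config d) (x : Pt d) (e : Dir d) :
    ((mv (Sinf ω) x e i : ℤ) : ℝ) - (x i : ℝ) = Uf i (shift x ω, e) := by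
  unfold Uf
  simp only [ce_shift]
  unfold mv
  split_ifs with hh
  · rw [ind_pos hh, one_mul]; simp
  · rw [ind_neg hh, sub_self, zero_mul]

lemma mv_DDf (h : Fin d → Config d → ℝ) (i : Fin d) (ω : Config d) (x : Pt d) (e : Dir d) :
    DDf (fun i x => h i (shift x ω)) i x (mv (Sinf ω) x e) = Dm i (h i) (shift x ω, e) := by
  unfold DDf Dm
  rw [mv_Uf, mv_gr]

/-- local covariance -/
noncomputable def gf (h : Fin d → Config d → ℝ) (i i' : Fin d) (ω : Config d) : ℝ :=
  (av fun e => Dm i (h i) (ω, e) * Dm i' (h i') (ω, e)) - (av fun e => Dm i (h i) (ω, e)) * (av fun e => Dm i' (h i') (ω, e))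

lemma Bm_gf {h : Fin d → Config d → ℝ} (hh : ∀ i, Bm (h i)) (i i' : Fin d) : Bm (gf h i i') :=
  (Bm.av ((Bm_Dm i (hh i)).mul (Bm_Dm i' (hh i')))).sub ((Bm.av (Bm_Dm i (hh i))).mul (Bm.av (Bm_Dm i' (hh i'))))

lemma gf_off (h : Fin d → Config d → ℝ) (i i' : Fin d) (ω) (h0 : (0:Pt d) ∉ Sinf ω) : gf h i i' ω = 0 := by
  unfold gf
  simp only [Dm_off _ _ _ _ h0, mul_zero, av_zero, sub_zero]

lemma cv_gf [NeZero d] (h : Fin d → Config d → ℝ) (i i' : Fin d) (ω : Config d) (x : Pt d) :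
    cv (Sinf ω) (DDf (fun i x => h i (shift x ω)) i) (DDf (fun i x => h i (shift x ω)) i') x = gf h i i' (shift x ω) := by
  unfold cv drift gf
  simp only [mv_DDf]
  set a := av fun e => Dm i (h i) (shift x ω, e) with ha
  set b := av fun e => Dm i' (h i') (shift x ω, e) with hb
  have : ∀ e, (Dm i (h i) (shift x ω, e) - a) * (Dm i' (h i') (shift x ω, e) - b) =
      ((Dm i (h i) (shift x ω, e) * Dm i' (h i') (shift x ω, e) - b * Dm i (h i) (shift x ω, e)) - a * Dm i' (h i') (shift x ω, e)) + a * b := by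
    intro e; ring
  simp_rw [this]
  rw [av_add, av_sub, av_sub, av_mul, av_mul, av_const, ← ha, ← hb]
  ring

lemma vec_inj {e e' : Dir d} (h : vec e = vec e') : e = e' := by
  rcases e with ⟨i, b⟩
  rcases e' with ⟨i', b'⟩
  have h1 := congrFun h i
  simp only [vec, Pi.single_eq_same] at h1
  by_cases hi : i = i'
  · subst hi
    rw [Pi.single_eq_same] at h1
    cases b <;> cases b' <;> simp at h1 ⊢
  · rw [Pi.single_eq_of_ne hi] at h1
    cases b <;> simp at h1

/-- antisymmetric pair field -/
noncomputable def pF (G : Config d × Dir d → ℝ) (ω : Config d) (x y : Pt d) : ℝ :=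
  ∑ e, ind (y = x + vec e) * G (shift x ω, e)

lemma pF_anti (G : Config d × Dir d → ℝ) (ω : Config d) (hG : ∀ x e, G (JJ (shift x ω, e)) = - G (shift x ω, e)) (x y : Pt d) :
    pF G ω x y = - pF G ω y x := by
  unfold pF
  have hinv : Function.Involutive (opp : Dir d → Dir d) := opp_opp
  rw [← Equiv.sum_comp hinv.toPerm (fun e => ind (x = y + vec e) * G (shift y ω, e)), ← Finset.sum_neg_distrib]
  refine Finset.sum_congr rfl fun e _ => ?_
  simp only [Function.Involutive.coe_toPerm]
  by_cases h : y = x + vec e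
  · have h1 := hG x e
    simp only [JJ, shift_shift] at h1
    rw [ind_pos h, ind_pos (by rw [h, vec_opp]; abel), h, h1]; ring
  · rw [ind_neg h, ind_neg (fun hh => h (by rw [hh, vec_opp]; abel))]; ring

lemma pF_mv (G : Config d × Dir d → ℝ) (ω : Config d) (hG : ∀ x e, G (JJ (shift x ω, e)) = - G (shift x ω, e))
    (hc : ∀ x e, ce (shift x ω) e = 0 → G (shift x ω, e) = 0) (x : Pt d) (e : Dir d) :
    pF G ω x (mv (Sinf ω) x e) = G (shift x ω, e) := by
  by_cases hh : x ∈ Sinf ω ∧ x + vec e ∈ Sinf ω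
  · have : mv (Sinf ω) x e = x + vec e := by unfold mv; rw [if_pos hh]
    rw [this]
    unfold pF
    rw [Finset.sum_eq_single e]
    · rw [ind_pos rfl, one_mul]
    · intro e' _ hne
      rw [ind_neg (fun h => hne (vec_inj (add_left_cancel h)).symm), zero_mul]
    · intro h; exact absurd (Finset.mem_univ _) h
  · have : mv (Sinf ω) x e = x := by unfold mv; rw [if_neg hh]
    rw [this, hc x e (by rw [ce_shift, ind_neg hh])]
    have := pF_anti G ω hG x x
    linarith only [this]

lemma p0_pos {P : Measure (Config d)} [IsProbabilityMeasure P]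
    (hA1 : ∀ e : Pt d, dist1 (0 : Pt d) e = 1 → Ergodic (shift e) P)
    (hA2 : ∀ᵐ ω ∂P, (Sinf ω).Nonempty ∧ ∀ x ∈ Sinf ω, ∀ y ∈ Sinf ω, connIn (SS ω) x y) :
    P {ω | (0:Pt d) ∈ Sinf ω} ≠ 0 := by
  intro h
  have h1 : ∀ᵐ ω ∂P, (0:Pt d) ∉ Sinf ω := by rw [ae_iff]; simpa using h
  have h2 : ∀ᵐ ω ∂P, False := by
    filter_upwards [ae_shift hA1 h1, hA2] with ω h3 h4
    obtain ⟨x, hx⟩ := h4.1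
    exact h3 x (Sinf_shift.2 (by simpa using hx))
  simp at h2
  exact IsProbabilityMeasure.ne_zero P h2


lemma int_sec {P : Measure (Config d)} [IsProbabilityMeasure P] {f : Config d × Dir d → ℝ} (hf : Integrable f (muD P)) :
    Integrable (fun ω => av fun e => f (ω, e)) P := by
  unfold muD at hf
  have h2 := hf.integral_prod_left.const_mul ((2*d:ℝ)⁻¹)
  refine h2.congr (Eventually.of_forall fun ω => ?_)
  simp only
  rw [integral_fintype Integrable.of_finite]
  simp [av]

lemma int_av {P : Measure (Config d)} [IsProbabilityMeasure P] {f : Config d × Dir d → ℝ} (hf : Integrable f (muD P)) :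
    ∫ ω, av (fun e => f (ω, e)) ∂P = (2*d:ℝ)⁻¹ * ∫ z, f z ∂(muD P) := by
  rw [int_muD hf, ← integral_const_mul]
  rfl

lemma lint_q {P : Measure (Config d)} [IsProbabilityMeasure P] {f : Config d → ℝ} (hf : Integrable f P) (h0 : ∀ ω, 0 ≤ f ω) (j : ℕ)
    (h : ∫ ω, f ω ∂P ≤ (1/4:ℝ)^j) : ∫⁻ ω, ENNReal.ofReal (f ω) ∂P ≤ (1/4 : ℝ≥0∞)^j := by
  rw [← ofReal_integral_eq_lintegral_ofReal hf (Eventually.of_forall h0)]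
  refine (ENNReal.ofReal_le_ofReal h).trans (le_of_eq ?_)
  rw [ENNReal.ofReal_pow (by norm_num), ENNReal.ofReal_div_of_pos (by norm_num)]
  simp

lemma Hom_ae [NeZero d] {P : Measure (Config d)} [IsProbabilityMeasure P]
    (hA1 : ∀ e : Pt d, dist1 (0 : Pt d) e = 1 → Ergodic (shift e) P)
    (hA2 : ∀ᵐ ω ∂P, (Sinf ω).Nonempty ∧ ∀ x ∈ Sinf ω, ∀ y ∈ Sinf ω, connIn (SS ω) x y) :
    ∃ Cov : Fin d → Fin d → ℝ, (∀ i i', Cov i i' = Cov i' i) ∧ ∀ᵐ ω ∂P, Hom (Sinf ω) Cov := by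
  choose Pi hJ hD happ using fun i => corrector (P := P) hA1 i
  choose h hb hh using fun (j : ℕ) (i : Fin d) => happ i ((1/4:ℝ)^j) (by positivity)
  set p0 : ℝ := (P {ω | (0:Pt d) ∈ Sinf ω}).toReal with hp0
  have hp0pos : 0 < p0 := ENNReal.toReal_pos (p0_pos hA1 hA2) (measure_ne_top _ _)
  have hdpos : (0:ℝ) < d := Nat.cast_pos.2 (NeZero.pos d)
  have hd1 : (1:ℝ) ≤ d := Nat.one_le_cast.2 (NeZero.pos d)
  set Cov : Fin d → Fin d → ℝ := fun i i' => ((2*d:ℝ)⁻¹ * inner ℝ (Pi i) (Pi i')) / p0 with hCov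
  set Cov' : ℕ → Fin d → Fin d → ℝ := fun j i i' => (∫ ω, gf (h j) i i' ω ∂P) / p0 with hCov'
  set G : ℕ → Fin d → Config d × Dir d → ℝ := fun j i z => ce z.1 z.2 * (Dm i (h j i) z - Pi i z) with hG
  have hPm : ∀ i, Measurable (Pi i) := fun i => (Lp.stronglyMeasurable (Pi i)).measurable
  have hDm : ∀ j i, MemLp (Dm i (h j i)) 2 (muD P) := fun j i => (Bm_Dm i (hb j i)).memLp _ _
  have hsub : ∀ j i, Integrable (fun z => (Dm i (h j i) z - Pi i z)^2) (muD P) := fun j i =>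
    ((hDm j i).sub (Lp.memLp (Pi i))).integrable_sq
  have hGm : ∀ j i, Measurable (G j i) := fun j i => (measD meas_ce).mul ((Bm_Dm i (hb j i)).1.sub (hPm i))
  have hGle : ∀ j i z, (G j i z)^2 ≤ (Dm i (h j i) z - Pi i z)^2 := by
    intro j i z
    simp only [hG]
    rw [mul_pow]
    have h1 := ce_sq z.1 z.2
    have h2 : ce z.1 z.2 ≤ 1 := ind_le_one _
    rw [pow_two (ce z.1 z.2), h1]
    exact mul_le_of_le_one_left (sq_nonneg _) h2
  have hGi : ∀ j i, Integrable (fun z => (G j i z)^2) (muD P) := fun j i =>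
    (hsub j i).mono' ((hGm j i).pow_const 2).aestronglyMeasurable (Eventually.of_forall fun z => by
      rw [Real.norm_of_nonneg (sq_nonneg _)]; exact hGle j i z)
  have hGint : ∀ j i, ∫ ω, av (fun e => (G j i (ω, e))^2) ∂P ≤ (1/4:ℝ)^j := by
    intro j i
    rw [int_av (hGi j i)]
    have h1 : ∫ z, (G j i z)^2 ∂(muD P) ≤ (1/4:ℝ)^j :=
      (integral_mono (hGi j i) (hsub j i) (hGle j i)).trans (hh j i)
    have h2 : (2*d:ℝ)⁻¹ ≤ 1 := by
      rw [inv_le_one₀ (by positivity)]; linarith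
    have h3 : 0 ≤ ∫ z, (G j i z)^2 ∂(muD P) := integral_nonneg fun z => sq_nonneg _
    calc _ ≤ 1 * ∫ z, (G j i z)^2 ∂(muD P) := by gcongr
      _ ≤ _ := by rw [one_mul]; exact h1
  have hGav : ∀ j i, ∀ᵐ ω ∂P, av (fun e => Dm i (h j i) (ω, e)) = av (fun e => G j i (ω, e)) := by
    intro j i
    filter_upwards [hD i] with ω hω
    simp only [hG]
    have : ∀ e, ce ω e * (Dm i (h j i) (ω, e) - Pi i (ω, e)) = Dm i (h j i) (ω, e) - ce ω e * Pi i (ω, e) := by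
      intro e; have := ce_Dm i (h j i) (ω, e); simp only at this; rw [mul_sub, this]
    simp_rw [this]
    rw [av_sub]
    have h0 : av (fun e => ce ω e * Pi i (ω, e)) = 0 := by unfold av; rw [hω, smul_zero]
    rw [h0, sub_zero]
  have hconv : ∀ i i', Tendsto (fun j => Cov' j i i') atTop (nhds (Cov i i')) := by
    intro i i'
    refine Tendsto.div_const ?_ p0
    have hu : ∀ i, Tendsto (fun j => (hDm j i).toLp _) atTop (nhds (Pi i)) := by
      intro i
      rw [tendsto_iff_norm_sub_tendsto_zero]
      have h1 : ∀ j, ‖(hDm j i).toLp _ - Pi i‖ ≤ (1/2:ℝ)^j := by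
        intro j
        refine abs_le_of_sq_le_sq' ?_ (by positivity) |>.2
        rw [Lp_norm_sq]
        refine le_trans (le_of_eq ?_) ((hh j i).trans (le_of_eq ?_))
        · refine integral_congr_ae ?_
          filter_upwards [Lp.coeFn_sub ((hDm j i).toLp _) (Pi i), (hDm j i).coeFn_toLp] with z h3 h4
          rw [h3, _root_.Pi.sub_apply, h4]; rfl
        · rw [← pow_mul, mul_comm, pow_mul]; norm_num
      exact squeeze_zero (fun _ => norm_nonneg _) h1 (tendsto_pow_atTop_nhds_zero_of_lt_one (by norm_num) (by norm_num))
    have h2 : Tendsto (fun j => ∫ ω, (av fun e => Dm i (h j i) (ω, e)) * (av fun e => Dm i' (h j i') (ω, e)) ∂P) atTop (nhds 0) := by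
      have h3 : ∀ j, |∫ ω, (av fun e => Dm i (h j i) (ω, e)) * (av fun e => Dm i' (h j i') (ω, e)) ∂P| ≤ (1/4:ℝ)^j := by
        intro j
        have hi1 := int_sec (hGi j i)
        have hi2 := int_sec (hGi j i')
        calc _ ≤ ∫ ω, |(av fun e => Dm i (h j i) (ω, e)) * (av fun e => Dm i' (h j i') (ω, e))| ∂P := abs_integral_le_integral_abs
          _ ≤ ∫ ω, (2⁻¹ * av (fun e => (G j i (ω, e))^2) + 2⁻¹ * av (fun e => (G j i' (ω, e))^2)) ∂P := by
            refine integral_mono_of_nonneg (Eventually.of_forall fun ω => abs_nonneg _) ((hi1.const_mul _).add (hi2.const_mul _)) ?_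
            filter_upwards [hGav j i, hGav j i'] with ω h4 h5
            rw [h4, h5, abs_mul]
            have h6 := av_sq_le (fun e => G j i (ω, e))
            have h7 := av_sq_le (fun e => G j i' (ω, e))
            have h8 := two_mul_le_add_sq |av fun e => G j i (ω, e)| |av fun e => G j i' (ω, e)|
            rw [sq_abs, sq_abs] at h8
            linarith only [h6, h7, h8]
          _ ≤ _ := by
            rw [integral_add (hi1.const_mul _) (hi2.const_mul _), integral_const_mul, integral_const_mul]
            linarith only [hGint j i, hGint j i']
      rw [tendsto_zero_iff_abs_tendsto_zero]
      exact squeeze_zero (fun _ => abs_nonneg _) h3 (tendsto_pow_atTop_nhds_zero_of_lt_one (by norm_num) (by norm_num))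
    have h5 : ∀ j, ∫ ω, gf (h j) i i' ω ∂P = (2*d:ℝ)⁻¹ * inner ℝ ((hDm j i).toLp _) ((hDm j i').toLp _) -
        ∫ ω, (av fun e => Dm i (h j i) (ω, e)) * (av fun e => Dm i' (h j i') (ω, e)) ∂P := by
      intro j
      have hbm := (Bm_Dm i (hb j i)).mul (Bm_Dm i' (hb j i'))
      unfold gf
      rw [integral_sub (hbm.av.integrable P) (((Bm_Dm i (hb j i)).av.mul (Bm_Dm i' (hb j i')).av).integrable P),
        int_av (hbm.integrable _)]
      congr 2
      rw [Lp_inner]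
      refine integral_congr_ae ?_
      filter_upwards [(hDm j i).coeFn_toLp, (hDm j i').coeFn_toLp] with z h3 h4
      rw [h3, h4]
    simp_rw [h5]
    have := (((hu i).inner (𝕜 := ℝ) (hu i')).const_mul ((2*d:ℝ)⁻¹)).sub h2
    simpa using this
  have hz0 : ∀ ω : Config d, ind ((0:Pt d) ∈ Sinf ω) = Set.indicator {ω | (0:Pt d) ∈ Sinf ω} (fun _ => (1:ℝ)) ω := by
    intro ω; unfold ind Set.indicator; rfl
  have hindB : Bm (fun ω : Config d => ind ((0:Pt d) ∈ Sinf ω)) := by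
    refine ⟨?_, 1, fun ω => by rw [abs_of_nonneg (ind_nonneg _)]; exact ind_le_one _⟩
    simp_rw [hz0]
    exact measurable_const.indicator (meas_Sinf 0)
  have hindI : ∫ ω, ind ((0:Pt d) ∈ Sinf ω) ∂P = p0 := by
    simp_rw [hz0]
    rw [integral_indicator_const _ (meas_Sinf 0)]
    simp [hp0, Measure.real]
  have hgB : ∀ j i i', Bm (fun ω => gf (h j) i i' ω - Cov' j i i' * ind ((0:Pt d) ∈ Sinf ω)) := fun j i i' =>
    (Bm_gf (hb j) i i').sub ((Bm.const _).mul hindB)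
  choose k hkB hk using fun (j : ℕ) (i i' : Fin d) (j' : ℕ) =>
    erg_approx hA1 hA2 (fun ω => gf (h j) i i' ω - Cov' j i i' * ind ((0:Pt d) ∈ Sinf ω)) (hgB j i i')
      (fun ω h0 => by rw [gf_off _ _ _ _ h0, ind_neg h0]; ring)
      (by rw [integral_sub ((Bm_gf (hb j) i i').integrable P) (((Bm.const _).mul hindB).integrable P), integral_const_mul, hindI]
          simp only [hCov']; field_simp; ring) ((1/4:ℝ)^j') (by positivity)
  refine ⟨Cov, fun i i' => by simp only [hCov]; rw [real_inner_comm], ?_⟩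
  have hA : ∀ᵐ ω ∂P, ∀ i, ∀ᶠ j in atTop, ∀ R : ℕ, ∑ y ∈ Box d R, av (fun e => (G j i (shift y ω, e))^2) ≤ (1/2:ℝ) ^ j * (2*R+1)^d := by
    rw [ae_all_iff]
    intro i
    refine max_ae hA1 (fun j ω => av (fun e => (G j i (ω, e))^2)) (fun j => ?_) (fun j ω => av_nonneg fun e => sq_nonneg _)
      (fun j => lint_q (int_sec (hGi j i)) (fun ω => av_nonneg fun e => sq_nonneg _) j (hGint j i))
    have hms : ∀ e : Dir d, Measurable fun ω : Config d => (G j i (ω, e))^2 := fun e =>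
      ((hGm j i).comp (measurable_id.prodMk measurable_const)).pow_const 2
    have := (Finset.measurable_sum Finset.univ fun e (_ : e ∈ Finset.univ) => hms e).const_mul ((2*d:ℝ)⁻¹)
    simpa [av] using this
  have hB : ∀ᵐ ω ∂P, ∀ j i i', ∀ᶠ j' in atTop, ∀ R : ℕ, ∑ y ∈ Box d R,
      |(gf (h j) i i' (shift y ω) - Cov' j i i' * ind ((0:Pt d) ∈ Sinf (shift y ω))) - Lop (k j i i' j') (shift y ω)| ≤ (1/2:ℝ) ^ j' * (2*R+1)^d := by
    rw [ae_all_iff]; intro j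
    rw [ae_all_iff]; intro i
    rw [ae_all_iff]; intro i'
    have hBB : ∀ j', Bm (fun ω => (gf (h j) i i' ω - Cov' j i i' * ind ((0:Pt d) ∈ Sinf ω)) - Lop (k j i i' j') ω) := fun j' =>
      (hgB j i i').sub (Bm_Lop (hkB j i i' j'))
    refine max_ae hA1 (fun j' ω => |(gf (h j) i i' ω - Cov' j i i' * ind ((0:Pt d) ∈ Sinf ω)) - Lop (k j i i' j') ω|)
      (fun j' => (hBB j').1.abs) (fun j' ω => abs_nonneg _)
      (fun j' => lint_q ((hBB j').integrable P).abs (fun ω => abs_nonneg _) j' (hk j i i' j'))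
  have hC : ∀ᵐ ω ∂P, ∀ i x e, Pi i (JJ (shift x ω, e)) = - Pi i (shift x ω, e) := by
    rw [ae_all_iff]; intro i
    exact ae_shift hA1 (ae_muD (hJ i))
  have hDD : ∀ᵐ ω ∂P, ∀ j i x, av (fun e => Dm i (h j i) (shift x ω, e)) = av (fun e => G j i (shift x ω, e)) := by
    rw [ae_all_iff]; intro j
    rw [ae_all_iff]; intro i
    exact ae_shift hA1 (hGav j i)
  have hpow : Tendsto (fun j : ℕ => (1/2:ℝ)^j) atTop (nhds 0) := tendsto_pow_atTop_nhds_zero_of_lt_one (by norm_num) (by norm_num)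
  filter_upwards [hA, hB, hC, hDD] with ω h1 h2 h3 h4 ε hε
  have hev1 : ∀ᶠ j in atTop, ∀ i, ∀ R : ℕ, ∑ y ∈ Box d R, av (fun e => (G j i (shift y ω, e))^2) ≤ (1/2:ℝ) ^ j * (2*R+1)^d :=
    eventually_all.2 h1
  have hev2 : ∀ᶠ j in atTop, ∀ i i', |Cov' j i i' - Cov i i'| ≤ ε := by
    refine eventually_all.2 fun i => eventually_all.2 fun i' => ?_
    filter_upwards [(Metric.tendsto_atTop'.1 (hconv i i') ε hε |> fun ⟨N, hN⟩ => (eventually_gt_atTop N).mono hN)] with j hj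
    rw [Real.dist_eq] at hj; exact hj.le
  have hev3 : ∀ᶠ j : ℕ in atTop, (1/2:ℝ)^j < ε := hpow.eventually_lt_const hε
  obtain ⟨j, hj1, hj2, hj3⟩ := (hev1.and (hev2.and hev3)).exists
  choose Bh hBh using fun i => (hb j i).2
  refine ⟨fun i x => h j i (shift x ω), ∑ i, |Bh i|, fun i x => ?_, fun i => ?_, Cov' j, hj2, fun i i' ε' hε' => ?_⟩
  · exact ((hBh i _).trans (le_abs_self _)).trans (Finset.single_le_sum (f := fun i => |Bh i|) (fun i _ => abs_nonneg _) (Finset.mem_univ i))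
  · have hanti : ∀ x e, G j i (JJ (shift x ω, e)) = - G j i (shift x ω, e) := by
      intro x e
      simp only [hG]
      rw [ce_JJ, h3 i x e]
      unfold Dm
      rw [Uf_JJ, gr_JJ]; ring
    have hoff : ∀ x e, ce (shift x ω) e = 0 → G j i (shift x ω, e) = 0 := by
      intro x e hx
      simp only [hG]; rw [hx, zero_mul]
    refine ⟨pF (G j i) ω, pF_anti _ ω hanti, fun x => ?_, fun R => ?_⟩
    · unfold drift
      simp only [pF_mv _ ω hanti hoff]
      rw [← h4 j i x]
      congr 1; ext e
      exact mv_DDf (h j) i ω x e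
    · simp only [pF_mv _ ω hanti hoff]
      refine (hj1 i R).trans ?_
      gcongr
  · obtain ⟨j', hj'1, hj'2⟩ := ((h2 j i i').and (hpow.eventually_lt_const hε')).exists
    obtain ⟨Bk, hBk⟩ := (hkB j i i' j').2
    refine ⟨fun x => k j i i' j' (shift x ω), Bk,
      fun x => (gf (h j) i i' (shift x ω) - Cov' j i i' * ind ((0:Pt d) ∈ Sinf (shift x ω))) - Lop (k j i i' j') (shift x ω),
      fun x => hBk _, fun x => ?_, fun R => ?_⟩
    · rw [cv_gf]
      unfold drift Lop
      simp only [mv_gr, Sinf_shift, add_zero]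
      ring
    · refine (hj'1 R).trans ?_
      gcongr


lemma EW_re (V : Set (Pt d)) (m : ℕ) (x : Pt d) (F : (ℕ → Pt d) → ℂ) :
    (EW V m x F).re = EW V m x (fun p => (F p).re) := by
  induction m generalizing x F with
  | zero => rfl
  | succ m ih =>
    simp only [EW_succ, av, ← ih]
    rw [Complex.real_smul, Complex.re_ofReal_mul, Complex.re_sum, smul_eq_mul]

lemma slab_card [NeZero d] (θ : Fin d → ℝ) (i : Fin d) (R N : ℕ) (r : ℝ) (hN : 2 * r < (N+1) * |θ i|) :
    ((Box d R).filter (fun x => |∑ j, θ j * (x j : ℝ)| ≤ r)).card ≤ (2*R+1)^(d-1) * (2*N+1) := by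
  classical
  set A := (Box d R).filter (fun x => |∑ j, θ j * (x j : ℝ)| ≤ r) with hA
  set f : Pt d → Pt d := fun x => Function.update x i 0 with hf
  have hfib : ∀ b ∈ A.image f, (A.filter (fun a => f a = b)).card ≤ 2*N+1 := by
    intro b hb
    obtain ⟨x0, hx0, hb⟩ := Finset.mem_image.1 hb
    have hinj : Set.InjOn (fun x : Pt d => x i) (A.filter (fun a => f a = b)) := by
      intro x hx y hy hxy
      have hx := (Finset.mem_filter.1 hx).2
      have hy := (Finset.mem_filter.1 hy).2
      funext j
      by_cases hj : j = i
      · rw [hj]; exact hxy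
      · have h := congrFun (hx.trans hy.symm) j
        simpa [hf, hj] using h
    have hsub : (A.filter (fun a => f a = b)).image (fun x : Pt d => x i) ⊆ Finset.Icc (x0 i - N) (x0 i + N) := by
      intro v hv
      obtain ⟨x, hx, rfl⟩ := Finset.mem_image.1 hv
      obtain ⟨hxA, hxb⟩ := Finset.mem_filter.1 hx
      have h1 := (Finset.mem_filter.1 hxA).2
      have h2 := (Finset.mem_filter.1 hx0).2
      have h3 : ∑ j, θ j * (x j : ℝ) - ∑ j, θ j * (x0 j : ℝ) = θ i * ((x i : ℝ) - x0 i) := by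
        rw [← Finset.sum_sub_distrib, Finset.sum_eq_single i]
        · ring
        · intro j _ hj
          have h := congrFun (hxb.trans hb.symm) j
          have h' : x j = x0 j := by simpa [hf, hj] using h
          rw [h']; ring
        · simp
      have h4 : |θ i| * |(x i : ℝ) - x0 i| ≤ 2 * r := by
        rw [← abs_mul, ← h3]
        exact (abs_sub _ _).trans (by linarith)
      have hθ : 0 ≤ |θ i| := abs_nonneg _
      have h5 : |(x i : ℝ) - x0 i| < N + 1 := by
        by_contra hcon
        rw [not_lt] at hcon
        nlinarith
      have h6 : |x i - x0 i| < N + 1 := by exact_mod_cast h5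
      rw [Finset.mem_Icc]
      rw [abs_lt] at h6
      constructor <;> linarith [h6.1, h6.2]
    rw [← Finset.card_image_of_injOn hinj]
    refine (Finset.card_le_card hsub).trans ?_
    rw [Int.card_Icc]; omega
  have h1 := Finset.card_le_mul_card_image A (2*N+1) hfib
  have h2 : (A.image f).card ≤ (2*R+1)^(d-1) := by
    have hsub : A.image f ⊆ Fintype.piFinset (fun j => if j = i then ({0} : Finset ℤ) else Finset.Icc (-(R:ℤ)) R) := by
      intro v hv
      obtain ⟨x, hx, rfl⟩ := Finset.mem_image.1 hv
      have hx1 := Fintype.mem_piFinset.1 (Finset.mem_filter.1 hx).1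
      rw [Fintype.mem_piFinset]
      intro j
      by_cases hj : j = i
      · subst hj; simp [hf]
      · simpa [hf, hj] using hx1 j
    refine (Finset.card_le_card hsub).trans ?_
    rw [Fintype.card_piFinset, ← Finset.mul_prod_erase _ _ (Finset.mem_univ i)]
    have : ∀ j ∈ Finset.univ.erase i, (if j = i then ({0} : Finset ℤ) else Finset.Icc (-(R:ℤ)) R).card = 2*R+1 := by
      intro j hj
      rw [if_neg (Finset.ne_of_mem_erase hj), Int.card_Icc]; omega
    rw [Finset.prod_congr rfl this]
    simp
  calc A.card ≤ (2*N+1) * (A.image f).card := h1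
    _ ≤ (2*N+1) * (2*R+1)^(d-1) := Nat.mul_le_mul_left _ h2
    _ = _ := by ring

lemma slab_prob [NeZero d] {V : Set (Pt d)} {C : ℝ} (hV : HKB V C) (θ : Fin d → ℝ) (i : Fin d) (hi : θ i ≠ 0) (M : ℕ) (hM : 1 ≤ M) :
    ∃ δ > (0:ℝ), ∃ n0 : ℕ, ∀ n ≥ n0, EW V n 0 (fun p => ind ((∀ a, |(p n a:ℝ)| < M * Real.sqrt n) ∧
      |∑ j, θ j * (p n j : ℝ)| ≤ δ * Real.sqrt n)) ≤ 1/4 := by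
  have hC := hV.1
  have hM' : (1:ℝ) ≤ M := by exact_mod_cast hM
  have hθ : 0 < |θ i| := abs_pos.2 hi
  set K : ℝ := (3*M)^(d-1) * (5/|θ i|) with hK
  have hK0 : 0 < K := by positivity
  set δ : ℝ := 1/(16*C^2*K) with hδ
  have hδ0 : 0 < δ := by positivity
  obtain ⟨n1, hn1⟩ := exists_nat_gt ((|θ i|/δ)^2)
  refine ⟨δ, hδ0, n1 + 1, fun n hn => ?_⟩
  have hn0 : 1 ≤ n := by omega
  have hn' : (1:ℝ) ≤ n := by exact_mod_cast hn0
  set q := Real.sqrt n with hq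
  have hq1 : 1 ≤ q := Real.one_le_sqrt.2 hn'
  have hqb : |θ i|/δ ≤ q := by
    apply Real.le_sqrt_of_sq_le
    have : (n1:ℝ) ≤ n := by exact_mod_cast (by omega : n1 ≤ n)
    linarith
  have hqb2 : 1 ≤ δ * q / |θ i| := by
    rw [le_div_iff₀ hθ, one_mul]
    rwa [div_le_iff₀ hδ0, mul_comm] at hqb
  set R := ⌊M * q⌋₊ with hR
  set N := ⌊2 * (δ * q) / |θ i|⌋₊ with hN
  set A := (Box d R).filter (fun x => |∑ j, θ j * (x j : ℝ)| ≤ δ * q) with hA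
  have hcard : A.card ≤ (2*R+1)^(d-1) * (2*N+1) := by
    apply slab_card θ i
    rw [← div_lt_iff₀ hθ]
    exact Nat.lt_floor_add_one _
  have hRb : (2*R+1 : ℝ) ≤ 3*M*q := by
    have h1 : (R:ℝ) ≤ M*q := Nat.floor_le (by positivity)
    have h2 : 1 ≤ M*q := by nlinarith
    linarith
  have hNb : (2*N+1 : ℝ) ≤ 5/|θ i| * δ * q := by
    have h1 : (N:ℝ) ≤ 2*(δ*q)/|θ i| := Nat.floor_le (by positivity)
    have h2 : 5/|θ i| * δ * q = 2 * (2*(δ*q)/|θ i|) + δ * q/|θ i| := by ring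
    linarith
  have hcard2 : (A.card : ℝ) ≤ K * δ * q^d := by
    have h1 : (A.card : ℝ) ≤ (2*R+1)^(d-1) * (2*N+1) := by exact_mod_cast hcard
    refine h1.trans ?_
    calc ((2*R+1:ℝ))^(d-1) * (2*N+1) ≤ (3*M*q)^(d-1) * (5/|θ i| * δ * q) := by gcongr
      _ = K * δ * (q^(d-1) * q) := by rw [hK, mul_pow]; ring
      _ = _ := by rw [← pow_succ, Nat.sub_add_cancel (NeZero.one_le)]
  set w : Pt d → ℝ := fun x => ind (x ∈ A) with hw
  have h1 := hV.2 n hn0 A w (fun x hx => ind_neg hx)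
  rw [← EW_pos V n 0 w n le_rfl] at h1
  have hsum : ∑ x ∈ A, w x ^ 2 = A.card := by
    have : ∀ x ∈ A, w x ^ 2 = 1 := fun x hx => by
      show ind (x ∈ A) ^ 2 = 1
      rw [ind_pos hx, one_pow]
    rw [Finset.sum_congr rfl this]; simp
  rw [hsum] at h1
  have h2 : EW V n 0 (fun p => ind ((∀ a, |(p n a:ℝ)| < M * q) ∧ |∑ j, θ j * (p n j : ℝ)| ≤ δ * q))
      ≤ EW V n 0 (fun p => w (p n)) := by
    apply EW_mono
    intro p
    apply ind_mono
    rintro ⟨ha, hb⟩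
    refine Finset.mem_filter.2 ⟨mem_Box.2 fun a => ?_, hb⟩
    have h := (ha a).le
    have h' : (p n a).natAbs ≤ R := by
      apply Nat.le_floor
      rw [Nat.cast_natAbs, Int.cast_abs]; exact h
    rw [Int.abs_eq_natAbs]; exact_mod_cast h'
  refine h2.trans (h1.trans ?_)
  have h3 : Real.sqrt A.card ≤ Real.sqrt (K*δ) * (n:ℝ)^((d:ℝ)/4) := by
    have e : q^d = ((n:ℝ)^((d:ℝ)/4))^2 := by
      rw [hq, Real.sqrt_eq_rpow, ← Real.rpow_natCast, ← Real.rpow_natCast, ← Real.rpow_mul (by positivity), ← Real.rpow_mul (by positivity)]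
      congr 1; push_cast; ring
    refine (Real.sqrt_le_sqrt hcard2).trans ?_
    rw [e, Real.sqrt_mul (by positivity), Real.sqrt_sq (by positivity)]
  have h4 : Real.sqrt (K*δ) = 1/(4*C) := by
    rw [show K*δ = (1/(4*C))^2 by rw [hδ]; field_simp; norm_num]
    exact Real.sqrt_sq (by positivity)
  have h5 : (n:ℝ)^(-(d:ℝ)/4) * (n:ℝ)^((d:ℝ)/4) = 1 := by
    rw [← Real.rpow_add (by positivity)]
    rw [show -(d:ℝ)/4 + d/4 = 0 by ring, Real.rpow_zero]
  calc C * (n:ℝ)^(-(d:ℝ)/4) * Real.sqrt A.card ≤ C * (n:ℝ)^(-(d:ℝ)/4) * (1/(4*C) * (n:ℝ)^((d:ℝ)/4)) := by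
        rw [← h4]; gcongr
    _ = (C * (1/(4*C))) * ((n:ℝ)^(-(d:ℝ)/4) * (n:ℝ)^((d:ℝ)/4)) := by ring
    _ = 1/4 := by rw [h5]; field_simp

/-- one-time characteristic function -/
lemma CF1t [NeZero d] {V : Set (Pt d)} {C : ℝ} (hV : HKB V C) (h0 : (0:Pt d) ∈ V) {Cov : Fin d → Fin d → ℝ} (hH : Hom V Cov)
    (θ : Fin d → ℝ) :
    Tendsto (fun n : ℕ => EW V n 0 (fun p => Real.cos ((∑ j, θ j * (p n j : ℝ)) / Real.sqrt n))) atTop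
      (nhds (Real.exp (-((∑ i, ∑ i', θ i * θ i' * Cov i i') / 2)))) := by
  have h := CF2 hV h0 hH 1 le_rfl (Fin d) θ id (fun _ => 1) (by simp) (by simp)
  have h2 := (Complex.continuous_re.tendsto _).comp h
  simp only [id, min_self, one_mul, Nat.floor_natCast, Complex.ofReal_re] at h2
  refine h2.congr fun n => ?_
  simp only [Function.comp]
  rw [EW_re]
  refine EW_congr fun p _ _ => ?_
  rw [mul_comm Complex.I, Complex.exp_ofReal_mul_I_re]

lemma nondeg [NeZero d] {V : Set (Pt d)} {C : ℝ} (hV : HKB V C) (h0 : (0:Pt d) ∈ V) {Cov : Fin d → Fin d → ℝ} (hH : Hom V Cov)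
    (θ : Fin d → ℝ) (hθ : θ ≠ 0) : 0 < ∑ i, ∑ i', θ i * θ i' * Cov i i' := by
  by_contra hcon
  rw [not_lt] at hcon
  obtain ⟨i, hi⟩ := Function.ne_iff.1 hθ
  obtain ⟨M, hM1, hM⟩ := diffusive hV (1/8) (by norm_num)
  have hM1' : (1:ℝ) ≤ M := by exact_mod_cast hM1
  obtain ⟨δ, hδ, n0, hn0⟩ := slab_prob hV θ i hi M hM1
  set L : ℝ := ∑ j, |θ j| * M with hL
  have hL0 : 0 ≤ L := by positivity
  set s : ℝ := 1/(L+1) with hs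
  have hs0 : 0 < s := by positivity
  have hlim := CF1t hV h0 hH (fun j => s * θ j)
  have hge : 1 ≤ Real.exp (-((∑ i, ∑ i', s * θ i * (s * θ i') * Cov i i') / 2)) := by
    apply Real.one_le_exp
    have : ∑ i, ∑ i', s * θ i * (s * θ i') * Cov i i' = s^2 * ∑ i, ∑ i', θ i * θ i' * Cov i i' := by
      rw [Finset.mul_sum]; refine Finset.sum_congr rfl fun a _ => ?_
      rw [Finset.mul_sum]; refine Finset.sum_congr rfl fun b _ => ?_
      ring
    rw [this]
    nlinarith [sq_nonneg s]
  set η : ℝ := s^2 * δ^2/32 with hη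
  have hη0 : 0 < η := by positivity
  have hev := hlim.eventually (lt_mem_nhds (show 1 - η < Real.exp (-((∑ i, ∑ i', s * θ i * (s * θ i') * Cov i i') / 2)) by linarith))
  obtain ⟨n, hn, hnge⟩ := (hev.and (eventually_ge_atTop (n0+1))).exists
  have hn1 : 1 ≤ n := by omega
  have h1 := hM n hn1
  have h2 := hn0 n (by omega)
  set q := Real.sqrt n with hq
  have hq1 : 1 ≤ q := Real.one_le_sqrt.2 (by exact_mod_cast hn1)
  have hmain : (1:ℝ) ≤ EW V n 0 (fun p => ind (∃ k ≤ n, ∃ a, (M:ℝ) * q ≤ |(p k a:ℝ)|))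
      + EW V n 0 (fun p => ind ((∀ a, |(p n a:ℝ)| < M * q) ∧ |∑ j, θ j * (p n j : ℝ)| ≤ δ * q))
      + (8/(s^2*δ^2)) * (1 - EW V n 0 (fun p => Real.cos ((∑ j, s * θ j * (p n j : ℝ)) / q))) := by
    have e1 : (1:ℝ) - EW V n 0 (fun p => Real.cos ((∑ j, s * θ j * (p n j : ℝ)) / q))
        = EW V n 0 (fun p => 1 - Real.cos ((∑ j, s * θ j * (p n j : ℝ)) / q)) := by
      rw [EW_sub, EW_const]
    rw [e1, ← EW_mul, ← EW_add, ← EW_add]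
    refine (EW_const V n 0 (1:ℝ)).symm.le.trans ?_
    apply EW_mono
    intro p
    have hcos : ∀ z, 0 ≤ 1 - Real.cos z := fun z => by linarith [Real.cos_le_one z]
    have hcc : 0 ≤ 8/(s^2*δ^2) * (1 - Real.cos ((∑ j, s * θ j * (p n j : ℝ)) / q)) := mul_nonneg (by positivity) (hcos _)
    by_cases hA : ∃ k ≤ n, ∃ a, (M:ℝ) * q ≤ |(p k a:ℝ)|
    · rw [ind_pos hA]
      linarith [ind_nonneg ((∀ a, |(p n a:ℝ)| < M * q) ∧ |∑ j, θ j * (p n j : ℝ)| ≤ δ * q)]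
    push Not at hA
    have hA' := hA n le_rfl
    by_cases hB : |∑ j, θ j * (p n j : ℝ)| ≤ δ * q
    · rw [ind_pos (⟨hA', hB⟩ : (∀ a, |(p n a:ℝ)| < M * q) ∧ _)]
      linarith [ind_nonneg (∃ k ≤ n, ∃ a, (M:ℝ) * q ≤ |(p k a:ℝ)|)]
    rw [not_le] at hB
    set z : ℝ := (∑ j, s * θ j * (p n j : ℝ)) / q with hz
    have hzq : z = s * (∑ j, θ j * (p n j : ℝ)) / q := by
      rw [hz, Finset.mul_sum]; congr 1; refine Finset.sum_congr rfl fun a _ => by ring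
    have hzl : s * δ ≤ |z| := by
      rw [hzq, abs_div, abs_mul, abs_of_pos hs0, abs_of_pos (by linarith : 0 < q), le_div_iff₀ (by linarith)]
      nlinarith
    have hzu : |z| ≤ 1 := by
      rw [hzq, abs_div, abs_mul, abs_of_pos hs0, abs_of_pos (by linarith : 0 < q), div_le_iff₀ (by linarith)]
      have : |∑ j, θ j * (p n j : ℝ)| ≤ L * q := by
        rw [hL, Finset.sum_mul]
        refine (Finset.abs_sum_le_sum_abs _ _).trans (Finset.sum_le_sum fun j _ => ?_)
        rw [abs_mul, mul_assoc]
        exact mul_le_mul_of_nonneg_left (hA' j).le (abs_nonneg _)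
      calc s * |∑ j, θ j * (p n j : ℝ)| ≤ s * (L * q) := by gcongr
        _ ≤ 1 * q := by
          rw [← mul_assoc]
          apply mul_le_mul_of_nonneg_right _ (by linarith)
          rw [hs, one_div, inv_mul_le_iff₀ (by linarith)]; linarith
    have hcb := Real.cos_le_one_sub_mul_cos_sq (x := z) (by linarith [Real.pi_gt_three])
    have hpi : (1:ℝ)/8 ≤ 2/Real.pi^2 := by
      rw [div_le_div_iff₀ (by norm_num) (by positivity)]
      nlinarith [Real.pi_le_four, Real.pi_gt_three]
    have hz2 : (s*δ)^2 ≤ z^2 := by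
      rw [← sq_abs z]; gcongr
    have : 1 ≤ 8/(s^2*δ^2) * (1 - Real.cos z) := by
      rw [div_mul_eq_mul_div, le_div_iff₀ (by positivity)]
      nlinarith [sq_nonneg z]
    linarith [ind_nonneg (∃ k ≤ n, ∃ a, (M:ℝ) * q ≤ |(p k a:ℝ)|), ind_nonneg ((∀ a, |(p n a:ℝ)| < M * q) ∧ |∑ j, θ j * (p n j : ℝ)| ≤ δ * q)]
  have h3 : (8/(s^2*δ^2)) * (1 - EW V n 0 (fun p => Real.cos ((∑ j, s * θ j * (p n j : ℝ)) / q))) ≤ 1/4 := by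
    calc _ ≤ (8/(s^2*δ^2)) * η := by
          apply mul_le_mul_of_nonneg_left _ (by positivity)
          linarith
      _ = 1/4 := by rw [hη]; field_simp; norm_num
  linarith


/-- signed permutation as an equivalence -/
def sE (π : Equiv.Perm (Fin d)) (ε : Fin d → Bool) : Pt d ≃ Pt d where
  toFun := signedPerm π ε
  invFun y := fun j => if ε (π.symm j) then - y (π.symm j) else y (π.symm j)
  left_inv x := by
    funext j
    simp only [signedPerm, Equiv.apply_symm_apply]
    split_ifs <;> simp
  right_inv x := by
    funext j
    simp only [signedPerm, Equiv.symm_apply_apply]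
    split_ifs <;> simp

/-- induced map on directions -/
def sD (π : Equiv.Perm (Fin d)) (ε : Fin d → Bool) : Dir d ≃ Dir d where
  toFun e := (π.symm e.1, xor e.2 (ε (π.symm e.1)))
  invFun e := (π e.1, xor e.2 (ε e.1))
  left_inv e := by
    ext <;> simp
  right_inv e := by
    ext <;> simp

lemma sE_add (π : Equiv.Perm (Fin d)) (ε : Fin d → Bool) (x y : Pt d) : sE π ε (x + y) = sE π ε x + sE π ε y := by
  funext j
  simp only [sE, Equiv.coe_fn_mk, signedPerm, Pi.add_apply]
  split_ifs <;> ring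

lemma sE_zero (π : Equiv.Perm (Fin d)) (ε : Fin d → Bool) : sE π ε 0 = 0 := by
  funext j
  simp [sE, signedPerm]

lemma sE_vec (π : Equiv.Perm (Fin d)) (ε : Fin d → Bool) (e : Dir d) : sE π ε (vec e) = vec (sD π ε e) := by
  funext j
  obtain ⟨a, b⟩ := e
  simp only [sE, sD, Equiv.coe_fn_mk, signedPerm, vec, Pi.single_apply]
  by_cases hj : π j = a
  · subst hj
    simp only [Equiv.symm_apply_apply, if_true]
    cases b <;> cases ε j <;> simp
  · have : j ≠ π.symm a := fun h => hj (by rw [h]; simp)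
    simp [hj, this]

lemma sE_dist (π : Equiv.Perm (Fin d)) (ε : Fin d → Bool) (x y : Pt d) : dist1 (sE π ε x) (sE π ε y) = dist1 x y := by
  unfold dist1
  rw [← Equiv.sum_comp π (fun i => (x i - y i).natAbs)]
  refine Finset.sum_congr rfl fun i _ => ?_
  simp only [sE, Equiv.coe_fn_mk, signedPerm]
  split_ifs <;> omega

/-- transformed configuration -/
def sC (π : Equiv.Perm (Fin d)) (ε : Fin d → Bool) (ω : Config d) : Config d := fun x => ω (signedPerm π ε x)

lemma mem_SS_sC (π : Equiv.Perm (Fin d)) (ε : Fin d → Bool) (ω : Config d) (x : Pt d) :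
    x ∈ SS (sC π ε ω) ↔ sE π ε x ∈ SS ω := Iff.rfl

lemma conn_sC (π : Equiv.Perm (Fin d)) (ε : Fin d → Bool) (ω : Config d) (x y : Pt d) :
    connIn (SS (sC π ε ω)) x y ↔ connIn (SS ω) (sE π ε x) (sE π ε y) := by
  have hstep : ∀ u v, stepRel (SS (sC π ε ω)) u v ↔ stepRel (SS ω) (sE π ε u) (sE π ε v) := by
    intro u v
    unfold stepRel adj
    rw [sE_dist, mem_SS_sC, mem_SS_sC]
  unfold connIn
  rw [mem_SS_sC, mem_SS_sC]
  refine and_congr_right fun _ => and_congr_right fun _ => ⟨fun h => ?_, fun h => ?_⟩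
  · exact h.lift (sE π ε) fun u v huv => (hstep u v).1 huv
  · have := h.lift (p := stepRel (SS (sC π ε ω))) (sE π ε).symm (fun u v huv => (hstep _ _).2 (by simpa using huv))
    simpa [Function.onFun] using this

lemma Sinf_sC (π : Equiv.Perm (Fin d)) (ε : Fin d → Bool) (ω : Config d) (x : Pt d) :
    x ∈ Sinf (sC π ε ω) ↔ sE π ε x ∈ Sinf ω := by
  have hc : cluster (SS (sC π ε ω)) x = (sE π ε) ⁻¹' (cluster (SS ω) (sE π ε x)) := by
    ext y; exact conn_sC π ε ω x y
  show (_ ∧ _) ↔ (_ ∧ _)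
  refine and_congr Iff.rfl ?_
  rw [hc]
  refine not_congr ⟨fun h => ?_, fun h => h.preimage (sE π ε).injective.injOn⟩
  have := h.image (sE π ε)
  rwa [Set.image_preimage_eq _ (sE π ε).surjective] at this

lemma sE_mv {V V' : Set (Pt d)} (π : Equiv.Perm (Fin d)) (ε : Fin d → Bool) (hV : ∀ x, x ∈ V' ↔ sE π ε x ∈ V) (x : Pt d) (e : Dir d) :
    sE π ε (mv V' x e) = mv V (sE π ε x) (sD π ε e) := by
  unfold mv
  rw [← sE_vec, ← sE_add]
  by_cases h : x ∈ V' ∧ x + vec e ∈ V'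
  · rw [if_pos h, if_pos ⟨(hV _).1 h.1, (hV _).1 h.2⟩]
  · rw [if_neg h, if_neg fun h' => h ⟨(hV _).2 h'.1, (hV _).2 h'.2⟩]

lemma EW_sE {V V' : Set (Pt d)} (π : Equiv.Perm (Fin d)) (ε : Fin d → Bool) (hV : ∀ x, x ∈ V' ↔ sE π ε x ∈ V) (m : ℕ)
    (x : Pt d) (F : (ℕ → Pt d) → ℝ) :
    EW V' m x (fun p => F (fun k => sE π ε (p k))) = EW V m (sE π ε x) F := by
  induction m generalizing x F with
  | zero => rfl
  | succ m ih =>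
    simp only [EW_succ, av]
    congr 1
    rw [← Equiv.sum_comp (sD π ε) (fun e => EW V m (mv V (sE π ε x) e) (fun p => F (consP (sE π ε x) p)))]
    refine Finset.sum_congr rfl fun e _ => ?_
    rw [← sE_mv π ε hV, ← ih]
    refine EW_congr fun p _ _ => ?_
    congr 1
    funext k
    cases k <;> rfl

lemma quad_inv [NeZero d] {V V' : Set (Pt d)} {C C' : ℝ} (hV : HKB V C) (hV' : HKB V' C') (h0 : (0:Pt d) ∈ V)
    {Cov : Fin d → Fin d → ℝ} (hH : Hom V Cov) (hH' : Hom V' Cov)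
    (π : Equiv.Perm (Fin d)) (ε : Fin d → Bool) (hs : ∀ x, x ∈ V' ↔ sE π ε x ∈ V) (θ θ' : Fin d → ℝ)
    (hθ : ∀ j, θ (π j) = if ε j then - θ' j else θ' j) :
    ∑ i, ∑ i', θ i * θ i' * Cov i i' = ∑ i, ∑ i', θ' i * θ' i' * Cov i i' := by
  have h0' : (0:Pt d) ∈ V' := (hs 0).2 (by rwa [sE_zero])
  have h1 := CF1t hV h0 hH θ'
  have h2 := CF1t hV' h0' hH' θ
  have h3 : (fun n : ℕ => EW V n 0 (fun p => Real.cos ((∑ j, θ' j * (p n j : ℝ)) / Real.sqrt n)))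
      = (fun n : ℕ => EW V' n 0 (fun p => Real.cos ((∑ j, θ j * (p n j : ℝ)) / Real.sqrt n))) := by
    funext n
    have := EW_sE π ε hs n 0 (fun p => Real.cos ((∑ j, θ' j * (p n j : ℝ)) / Real.sqrt n))
    rw [sE_zero] at this
    rw [← this]
    refine EW_congr fun p _ _ => ?_
    congr 2
    rw [← Equiv.sum_comp π (fun j => θ j * (p n j : ℝ))]
    refine Finset.sum_congr rfl fun j _ => ?_
    rw [hθ]
    simp only [sE, Equiv.coe_fn_mk, signedPerm]
    split_ifs
    · push_cast; ring
    · rfl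
  rw [h3] at h1
  have h4 := tendsto_nhds_unique h1 h2
  have h5 := Real.exp_injective h4
  linarith

lemma isotropic [NeZero d] {Cov : Fin d → Fin d → ℝ} (hsym : ∀ i i', Cov i i' = Cov i' i)
    (h : ∀ (π : Equiv.Perm (Fin d)) (ε : Fin d → Bool) (θ θ' : Fin d → ℝ),
      (∀ j, θ (π j) = if ε j then - θ' j else θ' j) →
      ∑ i, ∑ i', θ i * θ i' * Cov i i' = ∑ i, ∑ i', θ' i * θ' i' * Cov i i') (i i' : Fin d) :
    Cov i i' = if i = i' then Cov 0 0 else 0 := by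
  classical
  have hsingle : ∀ a, ∑ i, ∑ i', (Pi.single a (1:ℝ) : Fin d → ℝ) i * (Pi.single a (1:ℝ) : Fin d → ℝ) i' * Cov i i' = Cov a a := by
    intro a
    simp [Pi.single_apply]
  have hdiag : ∀ a b, Cov a a = Cov b b := by
    intro a b
    have := h (Equiv.swap a b) (fun _ => false) (Pi.single b 1) (Pi.single a 1) (by
      intro j
      simp only [Pi.single_apply]
      by_cases hj : j = a
      · subst hj; simp
      · have : Equiv.swap a b j ≠ b := fun h' => hj (by
          have := congrArg (Equiv.swap a b) h'
          simpa using this)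
        simp [hj, this])
    rw [hsingle, hsingle] at this
    exact this.symm
  have hoff : ∀ a b, a ≠ b → Cov a b = 0 := by
    intro a b hab
    have key : ∀ s : ℝ, ∑ i, ∑ i', ((Pi.single b (1:ℝ) : Fin d → ℝ) i + (Pi.single a s : Fin d → ℝ) i) * ((Pi.single b (1:ℝ) : Fin d → ℝ) i' + (Pi.single a s : Fin d → ℝ) i') * Cov i i'
        = Cov b b + 2 * s * Cov a b + s^2 * Cov a a := by
      intro s
      simp only [add_mul, mul_add, Finset.sum_add_distrib, Pi.single_apply]
      simp
      rw [hsym b a]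
      ring
    have := h 1 (fun j => decide (j = a)) (fun i => (Pi.single b (1:ℝ) : Fin d → ℝ) i + (Pi.single a (-1) : Fin d → ℝ) i)
      (fun i => (Pi.single b (1:ℝ) : Fin d → ℝ) i + (Pi.single a 1 : Fin d → ℝ) i) (by
      intro j
      by_cases hj : j = a
      · subst hj; simp [hab]
      · simp [hj])
    rw [key, key] at this
    linarith
  split_ifs with hii
  · subst hii; exact hdiag _ _
  · exact hoff _ _ hii


lemma stepP_eq [NeZero d] (ω : Config d) (x z : Pt d) (hx : x ∈ Sinf ω) :
    stepP d ω x z = av (fun e => ind (z = mv (Sinf ω) x e)) := by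
  classical
  have hd : (0:ℝ) < 2*d := by have := NeZero.pos d; positivity
  have hmem : ∀ e, x + vec e ∈ Sinf ω ↔ x + vec e ∈ SS ω := fun e =>
    ⟨fun h => h.1, fun h => Sinf_nbr hx (adj_iff.2 ⟨e, rfl⟩) h⟩
  have hmv : ∀ e, mv (Sinf ω) x e = if x + vec e ∈ SS ω then x + vec e else x := by
    intro e
    unfold mv
    by_cases h : x + vec e ∈ SS ω
    · rw [if_pos h, if_pos ⟨hx, (hmem e).2 h⟩]
    · rw [if_neg h, if_neg fun h' => h ((hmem e).1 h'.2)]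
  have hne : ∀ e, x + vec e ≠ x := fun e h => by
    have h1 : adj x (x + vec e) := adj_iff.2 ⟨e, rfl⟩
    rw [h] at h1
    simp [adj, dist1] at h1
  have hinj : ∀ e e', x + vec e = x + vec e' → e = e' := fun e e' h => vec_inj (add_left_cancel h)
  unfold stepP av
  by_cases h1 : adj x z ∧ z ∈ SS ω
  · rw [if_pos h1]
    obtain ⟨e0, he0⟩ := adj_iff.1 h1.1
    rw [Finset.sum_eq_single e0]
    · rw [hmv, if_pos (he0 ▸ h1.2), ind_pos he0]; simp
    · intro e _ he
      apply ind_neg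
      rw [hmv]
      split_ifs
      · rw [he0]; exact fun h => he (hinj _ _ h).symm
      · rw [he0]; exact hne e0
    · simp
  · rw [if_neg h1]
    by_cases h2 : z = x
    · subst h2
      rw [if_pos rfl]
      have hdeg : degS ω z = (Finset.univ.filter (fun e : Dir d => z + vec e ∈ SS ω)).card := by
        unfold degS
        have : {y | adj z y ∧ y ∈ SS ω} = ((Finset.univ.filter (fun e : Dir d => z + vec e ∈ SS ω)).image (fun e => z + vec e) : Finset (Pt d)) := by
          ext y
          simp only [Set.mem_setOf_eq, Finset.coe_image, Finset.coe_filter, Finset.mem_univ, true_and, Set.mem_image]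
          constructor
          · rintro ⟨ha, hb⟩
            obtain ⟨e, he⟩ := adj_iff.1 ha
            exact ⟨e, he ▸ hb, he.symm⟩
          · rintro ⟨e, he, rfl⟩
            exact ⟨adj_iff.2 ⟨e, rfl⟩, he⟩
        rw [this, Set.ncard_coe_finset, Finset.card_image_of_injective _ (fun e e' h => hinj e e' h)]
      have hsum : ∑ e, ind (z = mv (Sinf ω) z e) = 2*d - degS ω z := by
        have : ∀ e : Dir d, ind (z = mv (Sinf ω) z e) = 1 - (if z + vec e ∈ SS ω then (1:ℝ) else 0) := by
          intro e
          rw [hmv]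
          by_cases h : z + vec e ∈ SS ω
          · rw [if_pos h, if_pos h, ind_neg (fun h' => hne e h'.symm)]; simp
          · rw [if_neg h, if_neg h, ind_pos rfl]; simp
        rw [Finset.sum_congr rfl (fun e _ => this e), Finset.sum_sub_distrib, Finset.sum_boole, hdeg]
        simp [Dir]
        ring
      rw [hsum, smul_eq_mul, mul_sub, inv_mul_cancel₀ hd.ne']
      ring
    · rw [if_neg h2, Finset.sum_eq_zero]
      · simp
      · intro e _
        apply ind_neg
        rw [hmv]
        split_ifs with h
        · rintro rfl; exact h1 ⟨adj_iff.2 ⟨e, rfl⟩, h⟩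
        · exact h2

lemma path_sum [NeZero d] (ω : Config d) (m : ℕ) : ∀ x ∈ Sinf ω, ∀ G : (Fin (m+1) → Pt d) → ℝ,
    HasSum (fun p : Fin (m+1) → Pt d => (ind (p 0 = x) * ∏ k : Fin m, stepP d ω (p k.castSucc) (p k.succ)) * G p)
      (EW (Sinf ω) m x (fun q => G (fun k => q k))) := by
  induction m with
  | zero =>
    intro x hx G
    have : EW (Sinf ω) 0 x (fun q => G (fun k => q k)) = (ind ((fun _ => x : Fin 1 → Pt d) 0 = x) * ∏ k : Fin 0, stepP d ω ((fun _ => x : Fin 1 → Pt d) k.castSucc) ((fun _ => x : Fin 1 → Pt d) k.succ)) * G (fun _ => x) := by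
      rw [ind_pos rfl, EW_zero]; simp
    rw [this]
    refine hasSum_single (fun _ => x) fun p hp => ?_
    rw [ind_neg, zero_mul, zero_mul]
    intro h
    apply hp
    funext k
    rw [show k = 0 from Fin.fin_one_eq_zero k, h]
  | succ m ih =>
    intro x hx G
    have hinj : Function.Injective (fun p : Fin (m+1) → Pt d => (Fin.cons x p : Fin (m+2) → Pt d)) := by
      intro p q h
      exact Fin.cons_right_injective (α := fun _ => Pt d) x h
    rw [← hinj.hasSum_iff]
    · have h1 : HasSum (fun p : Fin (m+1) → Pt d => (2*d:ℝ)⁻¹ * ∑ e, (ind (p 0 = mv (Sinf ω) x e) * ∏ k : Fin m, stepP d ω (p k.castSucc) (p k.succ)) * G (Fin.cons x p))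
        ((2*d:ℝ)⁻¹ * ∑ e, EW (Sinf ω) m (mv (Sinf ω) x e) (fun q => G (Fin.cons x (fun k : Fin (m+1) => q k)))) := by
        refine HasSum.mul_left _ (hasSum_sum fun e _ => ?_)
        refine ih _ ?_ (fun p => G (Fin.cons x p))
        unfold mv
        split_ifs with h
        · exact h.2
        · exact hx
      rw [EW_succ]
      convert h1 using 1
      · funext p
        simp only [Function.comp]
        rw [Fin.prod_univ_succ, Fin.cons_zero, ind_pos rfl]
        simp only [Fin.castSucc_zero, Fin.cons_zero, Fin.cons_succ, ← Fin.succ_castSucc]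
        rw [stepP_eq ω x _ hx, av, smul_eq_mul]
        rw [← Finset.sum_mul, ← Finset.sum_mul]
        ring
      · rw [av, smul_eq_mul]
        congr 1
        refine Finset.sum_congr rfl fun e _ => ?_
        refine EW_congr fun q _ _ => ?_
        congr 1
        funext k
        refine Fin.cases ?_ (fun k => ?_) k
        · rfl
        · simp
    · intro p hp
      rw [ind_neg, zero_mul, zero_mul]
      intro h
      apply hp
      refine ⟨fun k => p k.succ, ?_⟩
      funext k
      refine Fin.cases ?_ (fun k => ?_) k
      · simp [h]
      · simp

lemma walkExpct_eq [NeZero d] (ω : Config d) (h0 : (0:Pt d) ∈ Sinf ω) (T : ℝ) (n : ℕ) (F : PathSp d T → ℝ) :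
    walkExpct d ω T n F = EW (Sinf ω) (⌊T * n⌋.toNat + 1) 0
      (fun q => F (interpPath d T n (⌊T * n⌋.toNat + 1) (fun k => q k))) := by
  unfold walkExpct
  rw [← (path_sum ω (⌊T * n⌋.toNat + 1) 0 h0 (fun p => F (interpPath d T n (⌊T * n⌋.toNat + 1) p))).tsum_eq]
  refine tsum_congr fun p => ?_
  unfold pathProb ind
  congr


/-- linear interpolation of a sequence -/
noncomputable def li (a : ℕ → ℝ) (s : ℝ) : ℝ := a ⌊s⌋₊ + (s - ⌊s⌋₊) * (a (⌊s⌋₊ + 1) - a ⌊s⌋₊)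

/-- clamp to the unit interval -/
noncomputable def clp (u : ℝ) : ℝ := max 0 (min 1 u)

lemma clp_mono {u v : ℝ} (h : u ≤ v) : clp u ≤ clp v := max_le_max le_rfl (min_le_min le_rfl h)

lemma li_sum (a : ℕ → ℝ) (s : ℝ) (hs : 0 ≤ s) (K : ℕ) (hK : s < K) :
    li a s = a 0 + ∑ k ∈ Finset.range K, clp (s - k) * (a (k+1) - a k) := by
  set j := ⌊s⌋₊ with hj
  have h1 : (j:ℝ) ≤ s := Nat.floor_le hs
  have h2 : s < j + 1 := Nat.lt_floor_add_one s
  have hjK : j + 1 ≤ K := by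
    have : (j:ℝ) < K := by linarith
    have : j < K := by exact_mod_cast this
    omega
  have h3 : ∑ k ∈ Finset.range K, clp (s - k) * (a (k+1) - a k) = ∑ k ∈ Finset.range (j+1), clp (s - k) * (a (k+1) - a k) := by
    symm
    apply Finset.sum_subset (Finset.range_mono hjK)
    intro k _ hk
    have hk' : j + 1 ≤ k := by simpa using hk
    have : (j:ℝ) + 1 ≤ k := by exact_mod_cast hk'
    have : clp (s - k) = 0 := by
      unfold clp
      apply max_eq_left
      exact (min_le_right _ _).trans (by linarith)
    rw [this, zero_mul]
  rw [h3, Finset.sum_range_succ]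
  have h4 : ∑ k ∈ Finset.range j, clp (s - k) * (a (k+1) - a k) = ∑ k ∈ Finset.range j, (a (k+1) - a k) := by
    refine Finset.sum_congr rfl fun k hk => ?_
    have hk' : k + 1 ≤ j := Finset.mem_range.1 hk
    have : (k:ℝ) + 1 ≤ j := by exact_mod_cast hk'
    have : clp (s - k) = 1 := by
      unfold clp
      rw [min_eq_left (by linarith), max_eq_right (by norm_num)]
    rw [this, one_mul]
  have h5 : clp (s - j) = s - j := by
    unfold clp
    rw [min_eq_right (by linarith), max_eq_right (by linarith)]
  rw [h4, h5, Finset.sum_range_sub]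
  unfold li
  rw [← hj]; ring

lemma li_lip (a : ℕ → ℝ) (ha : ∀ k, |a (k+1) - a k| ≤ 1) (s s' : ℝ) (hs : 0 ≤ s) (hss : s ≤ s') :
    |li a s' - li a s| ≤ s' - s := by
  obtain ⟨K, hK⟩ := exists_nat_gt s'
  have hid : ∀ u : ℝ, li (fun k => (k:ℝ)) u = u := by
    intro u; unfold li; push_cast; ring
  have h1 := hid s'
  have h2 := hid s
  rw [li_sum _ _ (hs.trans hss) K hK] at h1
  rw [li_sum _ _ hs K (by linarith)] at h2
  rw [li_sum a _ (hs.trans hss) K hK, li_sum a _ hs K (by linarith)]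
  rw [add_sub_add_left_eq_sub, ← Finset.sum_sub_distrib]
  calc _ ≤ ∑ k ∈ Finset.range K, |clp (s' - k) * (a (k+1) - a k) - clp (s - k) * (a (k+1) - a k)| := Finset.abs_sum_le_sum_abs _ _
    _ ≤ ∑ k ∈ Finset.range K, (clp (s' - k) - clp (s - k)) := by
        refine Finset.sum_le_sum fun k _ => ?_
        have h := clp_mono (show s - k ≤ s' - k by linarith)
        rw [← sub_mul, abs_mul, abs_of_nonneg (by linarith)]
        exact mul_le_of_le_one_right (by linarith) (ha k)
    _ = s' - s := by
        rw [Finset.sum_sub_distrib]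
        simp only [Nat.cast_add, Nat.cast_one, add_sub_cancel_left, mul_one, Nat.cast_zero, zero_add] at h1 h2
        rw [h1, h2]

lemma conv_abs {x y c B u : ℝ} (hu : 0 ≤ u) (hu1 : u ≤ 1) (hx : |x - c| ≤ B) (hy : |y - c| ≤ B) :
    |x + u * (y - x) - c| ≤ B := by
  have : x + u * (y - x) - c = (1 - u) * (x - c) + u * (y - c) := by ring
  rw [this]
  calc _ ≤ |(1 - u) * (x - c)| + |u * (y - c)| := abs_add_le _ _
    _ = (1 - u) * |x - c| + u * |y - c| := by rw [abs_mul, abs_mul, abs_of_nonneg hu, abs_of_nonneg (by linarith : 0 ≤ 1 - u)]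
    _ ≤ (1 - u) * B + u * B := by
        gcongr
    _ = B := by ring

lemma li_mod (a : ℕ → ℝ) (s s' B : ℝ) (hs : 0 ≤ s) (hss : s ≤ s')
    (h : ∀ k l : ℕ, k ≤ l → l ≤ ⌊s'⌋₊ + 1 → (l:ℝ) - k ≤ s' - s + 2 → |a l - a k| ≤ B) :
    |li a s' - li a s| ≤ B := by
  have h1 : (⌊s⌋₊:ℝ) ≤ s := Nat.floor_le hs
  have h2 : s < ⌊s⌋₊ + 1 := Nat.lt_floor_add_one s
  have h3 : (⌊s'⌋₊:ℝ) ≤ s' := Nat.floor_le (hs.trans hss)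
  have h4 : s' < ⌊s'⌋₊ + 1 := Nat.lt_floor_add_one s'
  have h5 : ⌊s⌋₊ ≤ ⌊s'⌋₊ := Nat.floor_mono hss
  have hk : ∀ k l : ℕ, (k = ⌊s⌋₊ ∨ k = ⌊s⌋₊ + 1) → (l = ⌊s'⌋₊ ∨ l = ⌊s'⌋₊ + 1) → |a l - a k| ≤ B := by
    intro k l hk hl
    rcases le_total k l with hkl | hkl
    · apply h k l hkl (by omega)
      have : (⌊s⌋₊:ℝ) ≤ k := by exact_mod_cast (by omega : ⌊s⌋₊ ≤ k)
      have : (l:ℝ) ≤ ⌊s'⌋₊ + 1 := by exact_mod_cast (by omega : l ≤ ⌊s'⌋₊ + 1)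
      linarith
    · rw [abs_sub_comm]
      apply h l k hkl (by omega)
      have : (⌊s'⌋₊:ℝ) ≤ l := by exact_mod_cast (by omega : ⌊s'⌋₊ ≤ l)
      have : (k:ℝ) ≤ ⌊s⌋₊ + 1 := by exact_mod_cast (by omega : k ≤ ⌊s⌋₊ + 1)
      linarith
  unfold li
  refine conv_abs (by linarith) (by linarith) ?_ ?_
  · rw [abs_sub_comm]
    refine conv_abs (by linarith) (by linarith) ?_ ?_ <;> rw [abs_sub_comm] <;> apply hk <;> simp
  · rw [abs_sub_comm]
    refine conv_abs (by linarith) (by linarith) ?_ ?_ <;> rw [abs_sub_comm] <;> apply hk <;> simp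

lemma li_near (a : ℕ → ℝ) (ha : ∀ k, |a (k+1) - a k| ≤ 1) (s : ℝ) (hs : 0 ≤ s) : |li a s - a ⌊s⌋₊| ≤ 1 := by
  have h1 : (⌊s⌋₊:ℝ) ≤ s := Nat.floor_le hs
  have h2 : s < ⌊s⌋₊ + 1 := Nat.lt_floor_add_one s
  unfold li
  rw [add_sub_cancel_left, abs_mul, abs_of_nonneg (by linarith)]
  calc _ ≤ (1:ℝ) * 1 := mul_le_mul (by linarith) (ha _) (abs_nonneg _) zero_le_one
    _ = 1 := one_mul 1

/-- the space of continuous paths -/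
abbrev CP (d : ℕ) (T : ℝ) := C(Set.Icc (0:ℝ) T, Fin d → ℝ)

/-- rescaled interpolation as a continuous map -/
noncomputable def ip (T : ℝ) (n : ℕ) (p : ℕ → Pt d) : CP d T where
  toFun t := fun i => (Real.sqrt n)⁻¹ * li (fun k => (p k i : ℝ)) (t.1 * n)
  continuous_toFun := by
    refine continuous_pi fun i => continuous_const.mul ?_
    obtain ⟨K, hK⟩ := exists_nat_gt (T * n)
    have : (fun t : Set.Icc (0:ℝ) T => li (fun k => (p k i : ℝ)) (t.1 * n)) = fun t =>
        (p 0 i : ℝ) + ∑ k ∈ Finset.range K, clp (t.1 * n - k) * ((p (k+1) i : ℝ) - p k i) := by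
      funext t
      have h1 : 0 ≤ t.1 := t.2.1
      have h2 : t.1 ≤ T := t.2.2
      rw [li_sum _ _ (by positivity) K (lt_of_le_of_lt (by gcongr) hK)]
    rw [this]
    unfold clp
    fun_prop

lemma ip_apply (T : ℝ) (n : ℕ) (p : ℕ → Pt d) (t : Set.Icc (0:ℝ) T) (i : Fin d) :
    ip T n p t i = (Real.sqrt n)⁻¹ * li (fun k => (p k i : ℝ)) (t.1 * n) := rfl

lemma interp_eq (T : ℝ) (n : ℕ) (q : ℕ → Pt d) :
    interpPath d T n (⌊T * n⌋.toNat + 1) (fun k => q k) = UniformFun.ofFun (ip T n q) := by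
  unfold interpPath
  congr 1
  funext t i
  have h1 : 0 ≤ t.1 := t.2.1
  have h2 : t.1 ≤ T := t.2.2
  have h0 : 0 ≤ t.1 * n := by positivity
  rw [ip_apply]
  unfold li extPath
  have h3 : ⌊t.1 * n⌋.toNat ≤ ⌊T * n⌋.toNat := Int.toNat_le_toNat (Int.floor_mono (by gcongr))
  have e1 : min ⌊t.1 * n⌋.toNat (⌊T * n⌋.toNat + 1) = ⌊t.1 * n⌋.toNat := min_eq_left (by omega)
  have e2 : min (⌊t.1 * n⌋.toNat + 1) (⌊T * n⌋.toNat + 1) = ⌊t.1 * n⌋.toNat + 1 := min_eq_left (by omega)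
  rw [Int.floor_toNat, Int.floor_toNat] at e1 e2
  simp only [Int.floor_toNat, e1, e2]
  rw [natCast_floor_eq_intCast_floor h0]

lemma isPath_inc {V : Set (Pt d)} {m : ℕ} {p : ℕ → Pt d} (hp : IsPath V m p) (i : Fin d) (k : ℕ) :
    |((p (k+1) i : ℤ) : ℝ) - p k i| ≤ 1 := by
  by_cases hk : k < m
  · obtain ⟨e, he⟩ := hp.1 k hk
    rw [he]
    exact_mod_cast mv_coord V (p k) e i
  · rw [hp.2 k (by omega), hp.2 (k+1) (by omega)]; simp


/-- law of a functional of the walk -/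
noncomputable def EWm {E : Type*} [MeasurableSpace E] (V : Set (Pt d)) : ℕ → Pt d → ((ℕ → Pt d) → E) → Measure E
  | 0, x, F => Measure.dirac (F (fun _ => x))
  | m+1, x, F => ((2*d : ℝ≥0∞)⁻¹) • ∑ e : Dir d, EWm V m (mv V x e) (fun p => F (consP x p))

lemma EWm_int [NeZero d] {E : Type*} [MeasurableSpace E] {G : Type*} [NormedAddCommGroup G] [NormedSpace ℝ G] [CompleteSpace G]
    (V : Set (Pt d)) (m : ℕ) (x : Pt d) (F : (ℕ → Pt d) → E)
    (g : E → G) (hg : StronglyMeasurable g) :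
    Integrable g (EWm V m x F) ∧ ∫ y, g y ∂(EWm V m x F) = EW V m x (fun p => g (F p)) := by
  have hd : (d:ℝ≥0∞) ≠ 0 := by exact_mod_cast NeZero.ne d
  induction m generalizing x F with
  | zero =>
    unfold EWm
    refine ⟨?_, integral_dirac' _ _ hg⟩
    exact (integrable_dirac' hg (by simp))
  | succ m ih =>
    unfold EWm
    have hI : Integrable g (∑ e : Dir d, EWm V m (mv V x e) (fun p => F (consP x p))) :=
      integrable_finsetSum_measure.2 fun e _ => (ih _ _).1
    refine ⟨hI.smul_measure (ENNReal.inv_ne_top.2 (mul_ne_zero two_ne_zero hd)), ?_⟩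
    rw [integral_smul_measure, integral_finsetSum_measure fun e _ => (ih _ _).1, EW_succ, av]
    congr 1
    · simp
    · exact Finset.sum_congr rfl fun e _ => (ih _ _).2

instance EWm_prob [NeZero d] {E : Type*} [MeasurableSpace E] (V : Set (Pt d)) (m : ℕ) (x : Pt d) (F : (ℕ → Pt d) → E) :
    IsProbabilityMeasure (EWm V m x F) := by
  obtain ⟨-, h2⟩ := EWm_int V m x F (fun _ => (1:ℝ)) stronglyMeasurable_const
  rw [EW_const] at h2
  apply isProbabilityMeasure_iff_real.2
  simpa using h2

lemma EWm_set [NeZero d] {E : Type*} [MeasurableSpace E] (V : Set (Pt d)) (m : ℕ) (x : Pt d) (F : (ℕ → Pt d) → E)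
    (A : Set E) (hA : MeasurableSet A) :
    EWm V m x F A = ENNReal.ofReal (EW V m x (fun p => ind (F p ∈ A))) := by
  obtain ⟨-, h2⟩ := EWm_int V m x F (A.indicator (fun _ => (1:ℝ))) (stronglyMeasurable_const.indicator hA)
  rw [integral_indicator_const _ hA, smul_eq_mul, mul_one] at h2
  have : EW V m x (fun p => ind (F p ∈ A)) = EW V m x (fun p => A.indicator (fun _ => (1:ℝ)) (F p)) := by
    refine EW_congr fun p _ _ => ?_
    by_cases h : F p ∈ A
    · rw [ind_pos h, Set.indicator_of_mem h]
    · rw [ind_neg h, Set.indicator_of_notMem h]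
  rw [this, ← h2, ofReal_measureReal]

/-- modulus set -/
def KM (d : ℕ) (T : ℝ) (δ ρ : ℝ) : Set (CP d T) :=
  {f | ∀ t t' : Set.Icc (0:ℝ) T, |t.1 - t'.1| ≤ δ → ‖f t - f t'‖ ≤ ρ}

/-- paths started at zero -/
def K0 (d : ℕ) (T : ℝ) : Set (CP d T) := {f | ∀ t : Set.Icc (0:ℝ) T, t.1 = 0 → f t = 0}

lemma KM_closed (T δ ρ : ℝ) : IsClosed (KM d T δ ρ) := by
  simp only [KM, Set.setOf_forall]
  refine isClosed_iInter fun t => isClosed_iInter fun t' => isClosed_iInter fun _ => ?_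
  exact isClosed_le (by fun_prop) continuous_const

lemma K0_closed (T : ℝ) : IsClosed (K0 d T) := by
  simp only [K0, Set.setOf_forall]
  refine isClosed_iInter fun t => isClosed_iInter fun _ => ?_
  exact isClosed_eq (by fun_prop) continuous_const

lemma K_compact (T : ℝ) (hT : 0 < T) (δ : ℕ → ℝ) (ρ : ℕ → ℝ) (hδ : ∀ j, 0 < δ j) (hρ : Tendsto ρ atTop (nhds 0)) (hρ0 : ∀ j, 0 ≤ ρ j) :
    IsCompact (K0 d T ∩ ⋂ j, KM d T (δ j) (ρ j)) := by
  set S := K0 d T ∩ ⋂ j, KM d T (δ j) (ρ j) with hS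
  have hsm : ∀ ε > 0, ∃ j, ρ j < ε := fun ε hε => ((hρ.eventually (gt_mem_nhds hε)).exists)
  have himg : ContinuousMap.toFun '' S = {g : Set.Icc (0:ℝ) T → Fin d → ℝ | (∀ t : Set.Icc (0:ℝ) T, t.1 = 0 → g t = 0) ∧
      ∀ j, ∀ t t' : Set.Icc (0:ℝ) T, |t.1 - t'.1| ≤ δ j → ‖g t - g t'‖ ≤ ρ j} := by
    ext g
    constructor
    · rintro ⟨f, ⟨hf0, hf⟩, rfl⟩
      exact ⟨hf0, fun j => Set.mem_iInter.1 hf j⟩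
    · rintro ⟨hg0, hg⟩
      refine ⟨⟨g, ?_⟩, ⟨hg0, Set.mem_iInter.2 hg⟩, rfl⟩
      rw [Metric.continuous_iff]
      intro b ε hε
      obtain ⟨j, hj⟩ := hsm ε hε
      refine ⟨δ j, hδ j, fun a hab => ?_⟩
      rw [dist_eq_norm]
      exact (hg j a b hab.le).trans_lt hj
  apply ArzelaAscoli.isCompact_of_equicontinuous
  · rw [himg]
    obtain ⟨m, hm⟩ := exists_nat_gt (T / δ 0)
    have hbd : ∀ g : Set.Icc (0:ℝ) T → Fin d → ℝ, (∀ t : Set.Icc (0:ℝ) T, t.1 = 0 → g t = 0) →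
        (∀ t t' : Set.Icc (0:ℝ) T, |t.1 - t'.1| ≤ δ 0 → ‖g t - g t'‖ ≤ ρ 0) →
        ∀ k : ℕ, ∀ t : Set.Icc (0:ℝ) T, t.1 ≤ k * δ 0 → ‖g t‖ ≤ k * ρ 0 := by
      intro g hg0 hg k
      induction k with
      | zero =>
        intro t ht
        rw [hg0 t (le_antisymm (by simpa using ht) t.2.1)]; simp
      | succ k ih =>
        intro t ht
        push_cast at ht ⊢
        have ht0 := t.2.1
        have htT := t.2.2
        have hδ0 := hδ 0
        set t' : Set.Icc (0:ℝ) T := ⟨max (t.1 - δ 0) 0, le_max_right _ _, max_le (by linarith) (by linarith)⟩ with ht'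
        have e : t'.1 = max (t.1 - δ 0) 0 := rfl
        have h1 := ih t' (by
          rw [e]; apply max_le
          · linarith
          · positivity)
        have h2 := hg t t' (by
          rw [e, abs_le]
          constructor
          · have := max_le (show t.1 - δ 0 ≤ t.1 + δ 0 by linarith) (show 0 ≤ t.1 + δ 0 by linarith)
            linarith
          · linarith [le_max_left (t.1 - δ 0) 0])
        have h3 : g t = g t' + (g t - g t') := by abel
        rw [h3]
        refine (norm_add_le _ _).trans ?_
        linarith
    have hcp : IsCompact (Set.univ.pi fun _ : Set.Icc (0:ℝ) T => Metric.closedBall (0 : Fin d → ℝ) (m * ρ 0)) :=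
      isCompact_univ_pi fun _ => isCompact_closedBall _ _
    refine hcp.of_isClosed_subset ?_ ?_
    · simp only [Set.setOf_and, Set.setOf_forall]
      refine IsClosed.inter ?_ ?_
      · refine isClosed_iInter fun t => isClosed_iInter fun _ => ?_
        exact isClosed_eq (by fun_prop) continuous_const
      · refine isClosed_iInter fun j => isClosed_iInter fun t => isClosed_iInter fun t' => isClosed_iInter fun _ => ?_
        exact isClosed_le (by fun_prop) continuous_const
    · rintro g ⟨hg0, hg⟩ t _
      rw [mem_closedBall_zero_iff]
      apply hbd g hg0 (hg 0) m t
      rw [div_lt_iff₀ (hδ 0)] at hm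
      exact t.2.2.trans hm.le
  · intro b
    rw [Metric.equicontinuousAt_iff]
    intro ε hε
    obtain ⟨j, hj⟩ := hsm ε hε
    refine ⟨δ j, hδ j, fun a hab f => ?_⟩
    rw [dist_eq_norm]
    exact (Set.mem_iInter.1 f.2.2 j b a (by rw [abs_sub_comm]; exact hab.le)).trans_lt hj


noncomputable instance (T : ℝ) : MeasurableSpace (CP d T) := borel _
instance (T : ℝ) : BorelSpace (CP d T) := ⟨rfl⟩
instance (T : ℝ) : BorelSpace (PathSp d T) := ⟨rfl⟩

lemma ip_dep (T : ℝ) (n : ℕ) (p q : ℕ → Pt d) (h : ∀ i ≤ ⌊T * n⌋.toNat + 1, p i = q i) : ip T n p = ip T n q := by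
  ext t i
  rw [ip_apply, ip_apply]
  have h2 : t.1 ≤ T := t.2.2
  have h3 : ⌊t.1 * n⌋₊ ≤ ⌊T * n⌋.toNat := by
    rw [Int.floor_toNat]
    exact Nat.floor_mono (by gcongr)
  unfold li
  beta_reduce
  rw [h _ (by omega), h _ (by omega)]

lemma ip_mem_KM {T δ ρ B : ℝ} {n : ℕ} {p : ℕ → Pt d} (hρ : 0 ≤ ρ) (hB : (Real.sqrt n)⁻¹ * B ≤ ρ)
    (h : ∀ i : Fin d, ∀ s s' : ℝ, 0 ≤ s → s ≤ s' → s' ≤ T * n → s' - s ≤ δ * n →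
      |li (fun k => (p k i : ℝ)) s' - li (fun k => (p k i : ℝ)) s| ≤ B) :
    ip T n p ∈ KM d T δ ρ := by
  have key : ∀ t t' : Set.Icc (0:ℝ) T, t.1 ≤ t'.1 → |t.1 - t'.1| ≤ δ → ‖ip T n p t - ip T n p t'‖ ≤ ρ := by
    intro t t' htt hδ
    rw [pi_norm_le_iff_of_nonneg hρ]
    intro i
    rw [Pi.sub_apply, ip_apply, ip_apply, ← mul_sub, Real.norm_eq_abs, abs_mul, abs_sub_comm, abs_of_nonneg (by positivity)]
    refine le_trans ?_ hB
    gcongr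
    have h1 := t.2.1
    have h2 := t'.2.2
    apply h i _ _ (by positivity) (by gcongr) (by gcongr)
    rw [← sub_mul]
    rw [abs_sub_comm] at hδ
    gcongr
    exact (le_abs_self _).trans hδ
  intro t t' hδ
  rcases le_total t.1 t'.1 with h1 | h1
  · exact key t t' h1 hδ
  · rw [norm_sub_rev]; rw [abs_sub_comm] at hδ; exact key t' t h1 hδ

lemma hor_le (T : ℝ) (n : ℕ) (hn : 1 ≤ n) : ⌊T * n⌋.toNat + 1 ≤ (⌈T⌉₊ + 1) * n := by
  rw [Int.floor_toNat]
  have : ⌊T * n⌋₊ ≤ ⌈T⌉₊ * n := by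
    apply Nat.floor_le_of_le
    push_cast
    gcongr
    exact Nat.le_ceil _
  nlinarith

lemma mod1 [NeZero d] {V : Set (Pt d)} {C : ℝ} (hV : HKB V C) (T : ℝ) (ρ ε : ℝ) (hρ : 0 < ρ) (hε : 0 < ε) :
    ∃ δ > 0, ∀ n : ℕ, EW V (⌊T * n⌋.toNat + 1) 0 (fun p => ind (ip T n p ∉ KM d T δ ρ)) ≤ ε := by
  set T' := ⌈T⌉₊ + 1 with hT'
  obtain ⟨y, hy, n0, h0⟩ := modulus hV T' (by omega) ρ ε hρ hε
  set N := max n0 (4*y^2) + 1 with hN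
  have hNpos : (0:ℝ) < N := by rw [hN]; positivity
  have hypos : (0:ℝ) < y := by exact_mod_cast hy
  refine ⟨min (1/(2*(y:ℝ)^2)) (ρ / Real.sqrt N), lt_min (by positivity) (by positivity), fun n => ?_⟩
  set δ := min (1/(2*(y:ℝ)^2)) (ρ / Real.sqrt N) with hδ
  have hδ0 : 0 < δ := lt_min (by positivity) (by positivity)
  by_cases hn : N ≤ n
  · have hn1 : 1 ≤ n := by omega
    have hnpos : (0:ℝ) < n := by exact_mod_cast hn1
    have hor := hor_le T n hn1
    rw [← EW_restrict' V (k := ⌊T * n⌋.toNat + 1) (m := (T'+1)*n) (by nlinarith) 0 _ (by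
      intro p q hpq
      simp only [ip_dep T n p q hpq])]
    refine le_trans (EW_mono' fun p _ hp => ind_mono ?_) (h0 n (by omega))
    contrapose!
    intro hne
    refine ip_mem_KM (B := ρ * Real.sqrt n) hρ.le (by
      have : 0 < Real.sqrt n := Real.sqrt_pos.2 hnpos
      rw [mul_comm, mul_assoc, mul_inv_cancel₀ this.ne', mul_one]) ?_
    intro i s s' hs hss hsT hsd
    refine li_mod _ s s' _ hs hss ?_
    intro k l hkl hl hlk
    refine (hne k l hkl ?_ ?_ i).le
    · rw [Int.floor_toNat] at hor
      have : ⌊s'⌋₊ ≤ ⌊T * n⌋₊ := Nat.floor_mono hsT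
      exact le_trans (by omega) hor
    · have h1 : δ ≤ 1/(2*(y:ℝ)^2) := min_le_left _ _
      have h2 : (4*y^2 : ℝ) ≤ n := by exact_mod_cast (by omega : 4*y^2 ≤ n)
      have h3 : ((l:ℝ) - k) * y^2 ≤ n := by
        have : (l:ℝ) - k ≤ 1/(2*(y:ℝ)^2) * n + 2 := by
          have : δ * n ≤ 1/(2*(y:ℝ)^2) * n := by gcongr
          linarith
        calc ((l:ℝ) - k) * (y:ℝ)^2 ≤ (1/(2*(y:ℝ)^2) * n + 2) * (y:ℝ)^2 := by gcongr
          _ = (n:ℝ)/2 + 2*(y:ℝ)^2 := by field_simp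
          _ ≤ n := by linarith
      rw [← Nat.cast_sub hkl] at h3
      exact_mod_cast h3
  · refine le_trans (EW_mono' (G := fun _ => 0) fun p _ hp => ?_) (by rw [EW_const]; exact hε.le)
    apply le_of_eq
    apply ind_neg
    rw [not_not]
    refine ip_mem_KM (B := δ * n) hρ.le ?_ ?_
    · have h1 : Real.sqrt n ≤ Real.sqrt N := Real.sqrt_le_sqrt (by exact_mod_cast (by omega : n ≤ N))
      have h2 : (Real.sqrt n)⁻¹ * (δ * n) = δ * Real.sqrt n := by
        rcases Nat.eq_zero_or_pos n with h | h
        · subst h; simp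
        · have : (0:ℝ) < n := by exact_mod_cast h
          have h3 : 0 < Real.sqrt n := Real.sqrt_pos.2 this
          have h4 : Real.sqrt n * Real.sqrt n = n := Real.mul_self_sqrt this.le
          field_simp
          linarith
      rw [h2]
      calc δ * Real.sqrt n ≤ (ρ / Real.sqrt N) * Real.sqrt N := by gcongr; exact min_le_right _ _
        _ = ρ := by
          have : 0 < Real.sqrt N := Real.sqrt_pos.2 hNpos
          field_simp
    · intro i s s' hs hss _ hsd
      exact (li_lip _ (fun k => isPath_inc hp i k) s s' hs hss).trans hsd

/-- law of the rescaled walk -/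
noncomputable def mun [NeZero d] (V : Set (Pt d)) (T : ℝ) (n : ℕ) : ProbabilityMeasure (CP d T) :=
  ⟨EWm V (⌊T * n⌋.toNat + 1) 0 (ip T n), EWm_prob _ _ _ _⟩

lemma tight [NeZero d] {V : Set (Pt d)} {C : ℝ} (hV : HKB V C) (T : ℝ) (hT : 0 < T) :
    IsTightMeasureSet {((μ : ProbabilityMeasure (CP d T)) : Measure (CP d T)) | μ ∈ Set.range (mun V T)} := by
  rw [isTightMeasureSet_iff_exists_isCompact_measure_compl_le]
  intro ε hε
  obtain ⟨ε', hε', hsum⟩ := ENNReal.exists_pos_sum_of_countable hε.ne' ℕ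
  have hρ : ∀ j : ℕ, (0:ℝ) < 1 / (j+1) := fun j => by positivity
  choose δ hδ hE using fun j : ℕ => mod1 hV T (1/((j:ℝ)+1)) (ε' j) (hρ j) (by exact_mod_cast hε' j)
  refine ⟨_, K_compact T hT δ (fun j => 1/((j:ℝ)+1)) hδ tendsto_one_div_add_atTop_nhds_zero_nat fun j => (hρ j).le, ?_⟩
  rintro _ ⟨_, ⟨n, rfl⟩, rfl⟩
  change EWm V (⌊T * n⌋.toNat + 1) 0 (ip T n) _ ≤ ε
  rw [Set.compl_inter, Set.compl_iInter]
  refine (measure_union_le _ _).trans ?_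
  have h1 : EWm V (⌊T * n⌋.toNat + 1) 0 (ip T n) (K0 d T)ᶜ = 0 := by
    rw [EWm_set _ _ _ _ _ (K0_closed T).measurableSet.compl]
    rw [ENNReal.ofReal_eq_zero]
    refine le_trans (EW_mono' (G := fun _ => 0) fun p hp0 _ => ?_) (by rw [EW_const])
    apply le_of_eq
    apply ind_neg
    rw [Set.mem_compl_iff, not_not]
    intro t ht
    ext i
    rw [ip_apply, ht]
    simp [li, hp0]
  rw [h1, zero_add]
  refine (measure_iUnion_le _).trans ?_
  refine le_trans (ENNReal.tsum_le_tsum fun j => ?_) hsum.le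
  rw [EWm_set _ _ _ _ _ (KM_closed T _ _).measurableSet.compl]
  refine (ENNReal.ofReal_le_ofReal (hE j n)).trans ?_
  simp


/-- the characters of the path space -/
noncomputable def cB {T : ℝ} {ι : Type} [Fintype ι] (th : ι → ℝ) (c : ι → Fin d) (tt : ι → Set.Icc (0:ℝ) T) :
    BoundedContinuousFunction (CP d T) ℂ :=
  BoundedContinuousFunction.ofNormedAddCommGroup
    (fun f => Complex.exp (Complex.I * ((∑ a, th a * f (tt a) (c a) : ℝ) : ℂ)))
    (by fun_prop) 1 (fun f => by rw [mul_comm, Complex.norm_exp_ofReal_mul_I])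

lemma cB_apply {T : ℝ} {ι : Type} [Fintype ι] (th : ι → ℝ) (c : ι → Fin d) (tt : ι → Set.Icc (0:ℝ) T) (f : CP d T) :
    cB th c tt f = Complex.exp (Complex.I * ((∑ a, th a * f (tt a) (c a) : ℝ) : ℂ)) := rfl

lemma CFmu [NeZero d] {V : Set (Pt d)} {C : ℝ} (hV : HKB V C) (h0 : (0:Pt d) ∈ V) {Cov : Fin d → Fin d → ℝ} (hH : Hom V Cov)
    (T : ℝ) (ι : Type) [Fintype ι] (th : ι → ℝ) (c : ι → Fin d) (tt : ι → Set.Icc (0:ℝ) T) :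
    Tendsto (fun n : ℕ => ∫ f, cB th c tt f ∂(mun V T n : Measure (CP d T))) atTop
      (nhds ((Real.exp (-((∑ a, ∑ a', min (tt a).1 (tt a').1 * (th a * th a' * Cov (c a) (c a'))) / 2)) : ℝ) : ℂ)) := by
  set T' := ⌈T⌉₊ + 1 with hT'
  have hTT : T ≤ T' := by
    rw [hT']; push_cast
    linarith [Nat.le_ceil T]
  have h1 := CF2 hV h0 hH T' (by omega) ι th c (fun a => (tt a).1) (fun a => (tt a).2.1) (fun a => (tt a).2.2.trans hTT)
  set A : ℕ → ℂ := fun n : ℕ => EW V (T' * n) 0 (fun p => Complex.exp (Complex.I * (((∑ a, th a * (p ⌊(tt a).1 * n⌋₊ (c a) : ℝ))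
        / Real.sqrt n : ℝ) : ℂ))) with hA
  have h2 : Tendsto (fun n : ℕ => (∑ a, |th a|) / Real.sqrt n) atTop (nhds 0) := by
    apply Tendsto.div_atTop tendsto_const_nhds
    exact Real.tendsto_sqrt_atTop.comp tendsto_natCast_atTop_atTop
  have h3 : ∀ n : ℕ, 1 ≤ n → ‖(∫ f, cB th c tt f ∂(mun V T n : Measure (CP d T))) - A n‖ ≤ (∑ a, |th a|) / Real.sqrt n := by
    intro n hn
    have e1 : ∫ f, cB th c tt f ∂(mun V T n : Measure (CP d T)) = EW V (⌊T * n⌋.toNat + 1) 0 (fun p => cB th c tt (ip T n p)) :=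
      (EWm_int V (⌊T * n⌋.toNat + 1) 0 (ip T n) (cB th c tt) (cB th c tt).continuous.stronglyMeasurable).2
    rw [e1, ← EW_restrict' V (k := ⌊T * n⌋.toNat + 1) (m := T'*n) (hor_le T n hn) 0 _ (by
      intro p q hpq
      rw [ip_dep T n p q hpq]), hA]
    rw [← EW_sub]
    refine (norm_EW_le _ _ _ _).trans ?_
    refine le_trans (EW_mono' (G := fun _ => (∑ a, |th a|) / Real.sqrt n) fun p _ hp => ?_) (by rw [EW_const])
    rw [cB_apply]
    refine (cexp_lip _ _).trans ?_
    rw [Finset.sum_div, ← Finset.sum_sub_distrib, Finset.sum_div]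
    refine (Finset.abs_sum_le_sum_abs _ _).trans (Finset.sum_le_sum fun a _ => ?_)
    rw [ip_apply]
    have h4 := li_near (fun k => (p k (c a) : ℝ)) (fun k => isPath_inc hp (c a) k) ((tt a).1 * n) (by have := (tt a).2.1; positivity)
    have : th a * ((Real.sqrt n)⁻¹ * li (fun k => (p k (c a) : ℝ)) ((tt a).1 * n)) - th a * (p ⌊(tt a).1 * n⌋₊ (c a) : ℝ) / Real.sqrt n
        = th a * (li (fun k => (p k (c a) : ℝ)) ((tt a).1 * n) - (p ⌊(tt a).1 * n⌋₊ (c a) : ℝ)) / Real.sqrt n := by ring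
    rw [this, abs_div, abs_mul, abs_of_nonneg (Real.sqrt_nonneg _)]
    gcongr
    exact mul_le_of_le_one_right (abs_nonneg _) h4
  have h5 : Tendsto (fun n : ℕ => (∫ f, cB th c tt f ∂(mun V T n : Measure (CP d T))) - A n) atTop (nhds 0) :=
    squeeze_zero_norm' (eventually_atTop.2 ⟨1, h3⟩) h2
  have h6 := h5.add h1
  simpa using h6

/-- the pairing with finitely supported test measures -/
noncomputable def Lp (d : ℕ) (T : ℝ) : CP d T →ₗ[ℝ] ((Set.Icc (0:ℝ) T × Fin d) →₀ ℝ) →ₗ[ℝ] ℝ where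
  toFun f := Finsupp.lsum ℝ fun a => (f a.1 a.2) • LinearMap.id
  map_add' f g := by ext; simp
  map_smul' r f := by ext; simp

lemma Lp_apply (T : ℝ) (f : CP d T) (w : (Set.Icc (0:ℝ) T × Fin d) →₀ ℝ) :
    Lp d T f w = ∑ a : w.support, w a * f a.1.1 a.1.2 := by
  simp only [Lp, LinearMap.coe_mk, AddHom.coe_mk, Finsupp.lsum_apply, Finsupp.sum]
  rw [← Finset.sum_coe_sort]
  refine Finset.sum_congr rfl fun a _ => ?_
  simp [mul_comm]

lemma weak_conv (T : ℝ) (μ : ℕ → ProbabilityMeasure (CP d T)) (ν : ProbabilityMeasure (CP d T))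
    (ht : IsTightMeasureSet {((m : ProbabilityMeasure (CP d T)) : Measure (CP d T)) | m ∈ Set.range μ})
    (h : ∀ (ι : Type) [Fintype ι] (th : ι → ℝ) (c : ι → Fin d) (tt : ι → Set.Icc (0:ℝ) T),
      Tendsto (fun n => ∫ f, cB th c tt f ∂(μ n : Measure (CP d T))) atTop (nhds (∫ f, cB th c tt f ∂(ν : Measure (CP d T))))) :
    Tendsto μ atTop (nhds ν) := by
  letI : TopologicalSpace ((Set.Icc (0:ℝ) T × Fin d) →₀ ℝ) := ⊥
  haveI : DiscreteTopology ((Set.Icc (0:ℝ) T × Fin d) →₀ ℝ) := ⟨rfl⟩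
  have hL : Continuous fun p : CP d T × ((Set.Icc (0:ℝ) T × Fin d) →₀ ℝ) => Lp d T p.1 p.2 := by
    rw [continuous_prod_of_discrete_right]
    intro w
    simp only [Lp_apply]
    fun_prop
  have ht' : IsTightMeasureSet {((μ n : ProbabilityMeasure (CP d T)) : Measure (CP d T)) | n} := by
    convert ht using 2
    ext m
    simp
  refine ProbabilityMeasure.tendsto_of_tight_of_separatesPoints ℂ ht'
    (A := BoundedContinuousFunction.charPoly Real.continuous_probChar hL) ?_ ?_
  · refine BoundedContinuousFunction.separatesPoints_charPoly Real.continuous_probChar Real.probChar_ne_one _ ?_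
    intro v hv hz
    apply hv
    ext t i
    have := congrArg (fun g => g (Finsupp.single (t, i) 1)) hz
    simpa [Lp] using this
  · intro g hg
    rw [BoundedContinuousFunction.mem_charPoly] at hg
    obtain ⟨w, hw⟩ := hg
    have hc : ∀ (a : (Set.Icc (0:ℝ) T × Fin d) →₀ ℝ) (x : CP d T), ((Real.probChar (Lp d T x a) : Circle) : ℂ) =
        cB (fun b : a.support => a b) (fun b => b.1.2) (fun b => b.1.1) x := by
      intro a x
      rw [cB_apply, Real.probChar_apply, Lp_apply, mul_comm]
    have h_eq : ∀ m : ProbabilityMeasure (CP d T), ∫ x, g x ∂(m : Measure (CP d T)) = w.coeff.sum (fun a z =>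
        z * ∫ x, cB (fun b : a.support => a b) (fun b => b.1.2) (fun b => b.1.1) x ∂(m : Measure (CP d T))) := by
      intro m
      simp_rw [hw, Finsupp.sum, hc]
      rw [integral_finsetSum]
      · refine Finset.sum_congr rfl fun y _ => ?_
        rw [integral_const_mul]
      · refine fun i hi => Integrable.const_mul ?_ _
        exact BoundedContinuousFunction.integrable _ _
    simp_rw [h_eq]
    refine tendsto_finsetSum _ fun y hy => Tendsto.const_mul _ ?_
    exact h _ _ _ _

lemma lim_exists [NeZero d] {V : Set (Pt d)} {C : ℝ} (hV : HKB V C) (h0 : (0:Pt d) ∈ V) {Cov : Fin d → Fin d → ℝ} (hH : Hom V Cov)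
    (T : ℝ) (hT : 0 < T) : ∃ ν : ProbabilityMeasure (CP d T),
      ∀ (ι : Type) [Fintype ι] (th : ι → ℝ) (c : ι → Fin d) (tt : ι → Set.Icc (0:ℝ) T),
        ∫ f, cB th c tt f ∂(ν : Measure (CP d T)) =
          ((Real.exp (-((∑ a, ∑ a', min (tt a).1 (tt a').1 * (th a * th a' * Cov (c a) (c a'))) / 2)) : ℝ) : ℂ) := by
  have hcpt := isCompact_closure_of_isTightMeasureSet (tight hV T hT)
  set U : Ultrafilter ℕ := Ultrafilter.of atTop
  obtain ⟨ν, -, hν⟩ := hcpt.ultrafilter_le_nhds (U.map (mun V T))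
    (by
      rw [le_principal_iff, Ultrafilter.mem_coe, Ultrafilter.mem_map]
      refine Filter.univ_mem' fun n => subset_closure ⟨n, rfl⟩)
  have hν' : Tendsto (mun V T) U (nhds ν) := hν
  refine ⟨ν, fun ι _ th c tt => ?_⟩
  rw [ProbabilityMeasure.tendsto_iff_forall_integral_rclike_tendsto ℂ] at hν'
  exact tendsto_nhds_unique (hν' (cB th c tt)) ((CFmu hV h0 hH T ι th c tt).mono_left (Ultrafilter.of_le atTop))


/-- inclusion of the continuous paths in the path space -/
def incl (d : ℕ) (T : ℝ) (f : CP d T) : PathSp d T := UniformFun.ofFun f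

lemma incl_cont (T : ℝ) : Continuous (incl d T) := by
  rw [continuous_iff_continuousAt]
  intro f
  unfold ContinuousAt
  rw [UniformFun.tendsto_iff_tendstoUniformly]
  exact ContinuousMap.tendsto_iff_tendstoUniformly.1 tendsto_id

lemma bm_law (T : ℝ) (Cov : Fin d → Fin d → ℝ) (ν : ProbabilityMeasure (CP d T))
    (hν : ∀ (ι : Type) [Fintype ι] (th : ι → ℝ) (c : ι → Fin d) (tt : ι → Set.Icc (0:ℝ) T),
        ∫ f, cB th c tt f ∂(ν : Measure (CP d T)) =
          ((Real.exp (-((∑ a, ∑ a', min (tt a).1 (tt a').1 * (th a * th a' * Cov (c a) (c a'))) / 2)) : ℝ) : ℂ)) :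
    IsBMLaw d T (Matrix.of Cov) ((ν : Measure (CP d T)).map (incl d T)) := by
  have hm : Measurable (incl d T) := (incl_cont T).measurable
  refine ⟨Measure.isProbabilityMeasure_map hm.aemeasurable, ?_, ?_⟩
  · rw [ae_map_iff hm.aemeasurable (UniformFun.isClosed_setOfPred_continuous _).measurableSet]
    exact ae_of_all _ fun f => f.continuous
  · intro n t θ
    have hev : ∀ k, Continuous fun f : PathSp d T => UniformFun.toFun f (t k) := fun k =>
      (UniformFun.uniformContinuous_eval (Fin d → ℝ) (t k)).continuous
    rw [integral_map hm.aemeasurable]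
    · have h1 := hν (Fin n × Fin d) (fun a => θ a.1 a.2) (fun a => a.2) (fun a => t a.1)
      have h2 : ∀ f : CP d T, Complex.exp (Complex.I *
        ((∑ k, ∑ i, θ k i * (UniformFun.toFun (incl d T f) (t k) i) : ℝ) : ℂ)) =
          cB (fun a : Fin n × Fin d => θ a.1 a.2) (fun a => a.2) (fun a => t a.1) f := by
        intro f
        rw [cB_apply, Fintype.sum_prod_type]
        rfl
      simp_rw [h2]
      rw [h1, Complex.ofReal_exp]
      congr 1
      have h3 : ∑ a : Fin n × Fin d, ∑ a' : Fin n × Fin d, min (t a.1).1 (t a'.1).1 * (θ a.1 a.2 * θ a'.1 a'.2 * Cov a.2 a'.2)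
          = ∑ k, ∑ k', min (t k).1 (t k').1 * ∑ i, ∑ i', θ k i * Matrix.of Cov i i' * θ k' i' := by
        simp only [Fintype.sum_prod_type]
        refine Finset.sum_congr rfl fun k _ => ?_
        rw [Finset.sum_comm]
        refine Finset.sum_congr rfl fun k' _ => ?_
        simp only [Finset.mul_sum]
        refine Finset.sum_congr rfl fun i _ => Finset.sum_congr rfl fun i' _ => ?_
        simp only [Matrix.of_apply]
        ring
      rw [h3]
      push_cast
      ring
    · apply Continuous.aestronglyMeasurable
      have hev' : ∀ k i, Continuous fun f : PathSp d T => UniformFun.toFun f (t k) i := fun k i =>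
        (continuous_apply i).comp (hev k)
      refine Complex.continuous_exp.comp (continuous_const.mul (Complex.continuous_ofReal.comp ?_))
      exact continuous_finsetSum _ fun k _ => continuous_finsetSum _ fun i _ => continuous_const.mul (hev' k i)

lemma conv_good [NeZero d] {ω : Config d} {C : ℝ} (hV : HKB (Sinf ω) C) (h0 : (0:Pt d) ∈ Sinf ω) {Cov : Fin d → Fin d → ℝ}
    (hH : Hom (Sinf ω) Cov) (T : ℝ) (hT : 0 < T) (ν : ProbabilityMeasure (CP d T))
    (hν : ∀ (ι : Type) [Fintype ι] (th : ι → ℝ) (c : ι → Fin d) (tt : ι → Set.Icc (0:ℝ) T),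
        ∫ f, cB th c tt f ∂(ν : Measure (CP d T)) =
          ((Real.exp (-((∑ a, ∑ a', min (tt a).1 (tt a').1 * (th a * th a' * Cov (c a) (c a'))) / 2)) : ℝ) : ℂ))
    (F : BoundedContinuousFunction (PathSp d T) ℝ) :
    Tendsto (fun n => walkExpct d ω T n (fun f => F f)) atTop
      (nhds (∫ f, F f ∂((ν : Measure (CP d T)).map (incl d T)))) := by
  have hm : Measurable (incl d T) := (incl_cont T).measurable
  have h1 : Tendsto (mun (Sinf ω) T) atTop (nhds ν) := by
    refine weak_conv T _ ν (tight hV T hT) fun ι _ th c tt => ?_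
    rw [hν]
    exact CFmu hV h0 hH T ι th c tt
  rw [ProbabilityMeasure.tendsto_iff_forall_integral_tendsto] at h1
  have h2 := h1 (F.compContinuous ⟨incl d T, incl_cont T⟩)
  rw [integral_map hm.aemeasurable F.continuous.measurable.aestronglyMeasurable]
  refine h2.congr fun n => ?_
  rw [walkExpct_eq ω h0]
  simp only [interp_eq]
  exact (EWm_int (Sinf ω) (⌊T * n⌋.toNat + 1) 0 (ip T n) (F.compContinuous ⟨incl d T, incl_cont T⟩)
    (F.compContinuous ⟨incl d T, incl_cont T⟩).continuous.stronglyMeasurable).2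

theorem final (d : ℕ) (hd : 2 ≤ d) (P : Measure (Config d)) (hP : IsProbabilityMeasure P)
    (hA1 : ∀ e : Pt d, dist1 (0 : Pt d) e = 1 → Ergodic (shift e) P)
    (hA2 : ∀ᵐ ω ∂P, (Sinf ω).Nonempty ∧ ∀ x ∈ Sinf ω, ∀ y ∈ Sinf ω, connIn (SS ω) x y)
    (hA5 : ∀ᵐ ω ∂(ProbabilityTheory.cond P {ω | (0 : Pt d) ∈ Sinf ω}),
      ∃ ι > (0:ℝ), ∀ k : ℕ, 1 ≤ k →
        ∀ A : Set (Pt d), A ⊆ Sinf ω ∩ chemBall ω (0 : Pt d) (2*k) →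
          (k : ℝ) ^ ((1:ℝ)/3) ≤ (A.ncard : ℝ) →
          ι * (A.ncard : ℝ) ^ (((d:ℝ) - 1)/d) ≤ ((edgeBd (SS ω) A).ncard : ℝ)) :
    ∃ Cov : Matrix (Fin d) (Fin d) ℝ, Cov.PosDef ∧
      ((∀ (π : Equiv.Perm (Fin d)) (ε : Fin d → Bool),
          MeasurePreserving (fun ω : Config d => fun x => ω (signedPerm π ε x)) P P) →
        ∃ σ > (0:ℝ), Cov = σ • (1 : Matrix (Fin d) (Fin d) ℝ)) ∧
      ∀ T : ℝ, 0 < T →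
        ∃ W : Measure (PathSp d T), IsBMLaw d T Cov W ∧
          ∀ᵐ ω ∂(ProbabilityTheory.cond P {ω | (0 : Pt d) ∈ Sinf ω}),
            ∀ F : BoundedContinuousFunction (PathSp d T) ℝ,
              Filter.Tendsto (fun n => walkExpct d ω T n (fun f => F f))
                Filter.atTop (nhds (∫ f, F f ∂W)) := by
  have hNZ : NeZero d := ⟨by omega⟩
  obtain ⟨Cov, hsym, hHom⟩ := Hom_ae hA1 hA2
  have hp0 := p0_pos hA1 hA2
  have hms : MeasurableSet {ω : Config d | (0 : Pt d) ∈ Sinf ω} := meas_Sinf 0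
  -- translate between the conditional measure and the base measure
  have hcond : ∀ Q : Config d → Prop, (∀ᵐ ω ∂(ProbabilityTheory.cond P {ω | (0 : Pt d) ∈ Sinf ω}), Q ω) ↔
      ∀ᵐ ω ∂P, (0 : Pt d) ∈ Sinf ω → Q ω := by
    intro Q
    unfold ProbabilityTheory.cond
    rw [Measure.ae_ennreal_smul_measure_iff (ENNReal.inv_ne_zero.2 (measure_ne_top _ _)), ae_restrict_iff' hms]
    rfl
  have hgood : ∀ᵐ ω ∂P, (0 : Pt d) ∈ Sinf ω → (∃ C, HKB (Sinf ω) C) ∧ Hom (Sinf ω) Cov := by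
    rw [hcond] at hA5
    filter_upwards [hA5, hHom] with ω h1 h2 h0
    exact ⟨HK_main hd ω h0 (h1 h0), h2⟩
  have hfreq : ∃ᵐ ω ∂P, (0 : Pt d) ∈ Sinf ω := frequently_ae_iff.2 hp0
  obtain ⟨ω0, h00, hg0⟩ := (hfreq.and_eventually hgood).exists
  obtain ⟨⟨C0, hV0⟩, hH0⟩ := hg0 h00
  have hnd : ∀ θ : Fin d → ℝ, θ ≠ 0 → 0 < ∑ i, ∑ i', θ i * θ i' * Cov i i' := fun θ hθ => nondeg hV0 h00 hH0 θ hθ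
  refine ⟨Matrix.of Cov, ?_, ?_, ?_⟩
  · apply Matrix.PosDef.of_dotProduct_mulVec_pos
    · ext i j
      simp [hsym j i]
    · intro x hx
      have := hnd x hx
      simp only [dotProduct, Matrix.mulVec, Matrix.of_apply, Finset.mul_sum, Pi.star_apply, star_trivial]
      refine this.trans_eq ?_
      refine Finset.sum_congr rfl fun i _ => Finset.sum_congr rfl fun j _ => ?_
      ring
  · intro hmp
    refine ⟨Cov 0 0, ?_, ?_⟩
    · have := hnd (Pi.single 0 1) (by simp)
      simpa [Pi.single_apply] using this
    · have hiso := isotropic hsym (fun π ε θ θ' hθ => by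
        have hpull : ∀ᵐ ω ∂P, (0 : Pt d) ∈ Sinf (sC π ε ω) → (∃ C, HKB (Sinf (sC π ε ω)) C) ∧ Hom (Sinf (sC π ε ω)) Cov :=
          (hmp π ε).quasiMeasurePreserving.ae hgood
        obtain ⟨ω, h0, h1, h2⟩ := (hfreq.and_eventually (hgood.and hpull)).exists
        obtain ⟨⟨C, hV⟩, hH⟩ := h1 h0
        obtain ⟨⟨C', hV'⟩, hH'⟩ := h2 ((Sinf_sC π ε ω 0).2 (by rwa [sE_zero]))
        exact quad_inv hV hV' h0 hH hH' π ε (Sinf_sC π ε ω) θ θ' hθ)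
      ext i j
      rw [Matrix.of_apply, hiso i j]
      simp [Matrix.one_apply]
  · intro T hT
    obtain ⟨ν, hν⟩ := lim_exists hV0 h00 hH0 T hT
    refine ⟨_, bm_law T Cov ν hν, ?_⟩
    rw [hcond]
    filter_upwards [hgood] with ω h1 h0
    obtain ⟨⟨C, hV⟩, hH⟩ := h1 h0
    exact conv_good hV h0 hH T hT ν hν

/-- Theorem 4.1. Let `d ≥ 2` and let `P` satisfy A1–A5. Then for all `T > 0`
and `P₀`-a.e. `ω`, the law on `C[0,T]` of the rescaled interpolation of the lazy simple random
walk on `S` started at `0` converges weakly to the law of a Brownian motion with zero drift and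
non-degenerate covariance matrix; if reflections and rotations of `ℤ^d` by `π/2` preserve `P`,
the limit is isotropic with positive diffusion constant. -/
theorem stmt2 (d : ℕ) (hd : 2 ≤ d) (P : Measure (Config d)) (hP : IsProbabilityMeasure P)
    -- A1
    (hA1 : ∀ e : Pt d, dist1 (0 : Pt d) e = 1 → Ergodic (shift e) P)
    -- A2
    (hA2 : ∀ᵐ ω ∂P, (Sinf ω).Nonempty ∧ ∀ x ∈ Sinf ω, ∀ y ∈ Sinf ω, connIn (SS ω) x y)
    -- A3
    (hA3 : ∃ c > (0:ℝ), ∃ C > (0:ℝ), ∃ Δ₃ > (0:ℝ), ∀ R : ℕ, 1 ≤ R →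
      ∀ e : Pt d, dist1 (0 : Pt d) e = 1 →
        1 - C * Real.exp (-c * (Real.log R) ^ (1 + Δ₃)) ≤
          (P {ω | ∃ k : ℕ, k ≤ R ∧ ((k : ℤ) • e) ∈ Sinf ω}).toReal)
    -- A4
    (hA4 : ∃ c > (0:ℝ), ∃ C > (0:ℝ), ∃ Δ₄ > (0:ℝ), ∀ R : ℕ, 1 ≤ R →
      1 - C * Real.exp (-c * (Real.log R) ^ (1 + Δ₄)) ≤
        (P {ω | ∀ x ∈ Sinf ω ∩ ballZ (0 : Pt d) R, ∀ y ∈ Sinf ω ∩ ballZ (0 : Pt d) R,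
            chemDist (SS ω) x y ≤ ((⌊C * (R : ℝ)⌋₊ : ℕ) : ℕ∞)}).toReal)
    -- A5
    (hA5 : ∀ᵐ ω ∂(ProbabilityTheory.cond P {ω | (0 : Pt d) ∈ Sinf ω}),
      ∃ ι > (0:ℝ), ∀ k : ℕ, 1 ≤ k →
        ∀ A : Set (Pt d), A ⊆ Sinf ω ∩ chemBall ω (0 : Pt d) (2*k) →
          (k : ℝ) ^ ((1:ℝ)/3) ≤ (A.ncard : ℝ) →
          ι * (A.ncard : ℝ) ^ (((d:ℝ) - 1)/d) ≤ ((edgeBd (SS ω) A).ncard : ℝ)) :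
    ∃ Cov : Matrix (Fin d) (Fin d) ℝ, Cov.PosDef ∧
      ((∀ (π : Equiv.Perm (Fin d)) (ε : Fin d → Bool),
          MeasurePreserving (fun ω : Config d => fun x => ω (signedPerm π ε x)) P P) →
        ∃ σ > (0:ℝ), Cov = σ • (1 : Matrix (Fin d) (Fin d) ℝ)) ∧
      ∀ T : ℝ, 0 < T →
        ∃ W : Measure (PathSp d T), IsBMLaw d T Cov W ∧
          ∀ᵐ ω ∂(ProbabilityTheory.cond P {ω | (0 : Pt d) ∈ Sinf ω}),
            ∀ F : BoundedContinuousFunction (PathSp d T) ℝ,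
              Filter.Tendsto (fun n => walkExpct d ω T n (fun f => F f))
                Filter.atTop (nhds (∫ f, F f ∂W)) := by
  exact final d hd P hP hA1 hA2 hA5

end Perco
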